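/- There exists η > 0 with the following property: for every ε > 0 and all nonzero integers a, b, c, d there is a constant C = C(ε, a, b, c, d) such that for all real P ≥ 2 and all R with 2 ≤ R ≤ P^η one has I(a,b,c,d) ≤ C · P^{13 + Δ₁₀/2 + ε}. -/

import Mathlib

open scoped Real
open Filter MeasureTheory

noncomputable section

/-- `e(z) = exp(2πiz)`. -/
def e (z : ℝ) : ℂ := Complex.exp (2 * Real.pi * Complex.I * z)

/-- The set `𝒜(P,R)` of `R`-smooth positive integers not exceeding `P`. -/
def smoothA (P R : ℝ) : Finset ℕ :=
  (Finset.Icc 1 ⌊P⌋₊).filter (fun n => ∀ p ∈ n.primeFactors, (p : ℝ) ≤ R)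

/-- The smooth Weyl sum `h(α; P, R)`. -/
def h (P R α : ℝ) : ℂ := ∑ x ∈ smoothA P R, e (α * (x : ℝ) ^ 4)

/-- `Δ₇ = 0.849408`. -/
def Δ₇ : ℝ := 0.849408

/-- `Δ₁₀ = 0.213431`. -/
def Δ₁₀ : ℝ := 0.213431

/-- The correlation integral `I(a,b,c,d) = ∫₀¹∫₀¹ |h(aα)h(bβ)h(cα+dβ)|⁷ dα dβ`. -/
def Icorr (P R : ℝ) (a b c d : ℤ) : ℝ :=
  ∫ α in (0:ℝ)..1, ∫ β in (0:ℝ)..1,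
    ‖h P R ((a : ℝ) * α) * h P R ((b : ℝ) * β) * h P R ((c : ℝ) * α + (d : ℝ) * β)‖ ^ 7

lemma e_add (x y : ℝ) : e (x + y) = e x * e y := by
  unfold e; rw [← Complex.exp_add]; push_cast; ring_nf

lemma e_zero : e 0 = 1 := by simp [e]

lemma norm_e (x : ℝ) : ‖e x‖ = 1 := by
  unfold e
  rw [Complex.norm_exp]; simp

lemma e_int (n : ℤ) : e n = 1 := by
  unfold e
  rw [Complex.exp_eq_one_iff]
  exact ⟨n, by push_cast; ring⟩

lemma e_add_int (x : ℝ) (n : ℤ) : e (x + n) = e x := by rw [e_add, e_int, mul_one]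

lemma conj_e (x : ℝ) : (starRingEnd ℂ) (e x) = e (-x) := by
  unfold e
  rw [← Complex.exp_conj]; congr 1
  simp only [map_mul, Complex.conj_I, Complex.conj_ofReal, map_ofNat]
  push_cast; ring

lemma e_sub (x y : ℝ) : e (x - y) = e x * (starRingEnd ℂ) (e y) := by
  rw [conj_e, ← e_add, sub_eq_add_neg]

lemma continuous_e : Continuous e := by unfold e; fun_prop

@[fun_prop] lemma continuous_e_comp {f : ℝ → ℝ} (hf : Continuous f) : Continuous fun x => e (f x) :=
  continuous_e.comp hf

lemma integral_e (k : ℤ) : ∫ α in (0:ℝ)..1, e (k * α) = if k = 0 then 1 else 0 := by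
  split_ifs with hk
  · subst hk; simp [e_zero]
  · have hc : (2 * Real.pi * Complex.I * k : ℂ) ≠ 0 := by
      simp [hk]
    have := integral_exp_mul_complex (a := 0) (b := 1) hc
    have h2 : ∀ α : ℝ, e (k * α) = Complex.exp (2 * Real.pi * Complex.I * k * α) := by
      intro α; unfold e; push_cast; ring_nf
    simp_rw [h2, this]
    have h3 : Complex.exp (2 * Real.pi * Complex.I * k * (1:ℝ)) = 1 := by
      have := e_int k; unfold e at this; simpa using this
    rw [h3]; simp

/-- `Dom f g`: `f` is a trigonometric polynomial whose coefficients are bounded by the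
nonnegative coefficients of the trigonometric polynomial `g`. -/
def Dom (f g : ℝ → ℂ) : Prop :=
  ∃ (ι : Type) (s : Finset ι) (k : ι → ℤ) (a : ι → ℂ) (b : ι → ℝ),
    (∀ i ∈ s, ‖a i‖ ≤ b i) ∧ (∀ α, f α = ∑ i ∈ s, a i * e (k i * α)) ∧
    (∀ α, g α = ∑ i ∈ s, (b i : ℂ) * e (k i * α))

lemma Dom.single (k : ℤ) {a : ℂ} {b : ℝ} (h : ‖a‖ ≤ b) :
    Dom (fun α => a * e (k * α)) (fun α => (b : ℂ) * e (k * α)) :=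
  ⟨Unit, {()}, fun _ => k, fun _ => a, fun _ => b, by simpa using h, by simp, by simp⟩

lemma Dom.zero : Dom (fun _ => 0) (fun _ => 0) :=
  ⟨Unit, ∅, fun _ => 0, fun _ => 0, fun _ => 0, by simp, by simp, by simp⟩

lemma Dom.one : Dom (fun _ => 1) (fun _ => 1) := by
  simpa [e_zero] using Dom.single 0 (a := 1) (b := 1) (by simp)

lemma Dom.add {f g f' g' : ℝ → ℂ} (H : Dom f g) (H' : Dom f' g') :
    Dom (fun α => f α + f' α) (fun α => g α + g' α) := by
  obtain ⟨ι, s, k, a, b, h1, h2, h3⟩ := H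
  obtain ⟨ι', s', k', a', b', h1', h2', h3'⟩ := H'
  refine ⟨ι ⊕ ι', s.disjSum s', Sum.elim k k', Sum.elim a a', Sum.elim b b', ?_, ?_, ?_⟩
  · rintro (i | i) hi
    · exact h1 i (by simpa using hi)
    · exact h1' i (by simpa using hi)
  · intro α; simp [Finset.sum_disjSum, h2, h2']
  · intro α; simp [Finset.sum_disjSum, h3, h3']

lemma Dom.mul {f g f' g' : ℝ → ℂ} (H : Dom f g) (H' : Dom f' g') :
    Dom (fun α => f α * f' α) (fun α => g α * g' α) := by
  obtain ⟨ι, s, k, a, b, h1, h2, h3⟩ := H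
  obtain ⟨ι', s', k', a', b', h1', h2', h3'⟩ := H'
  refine ⟨ι × ι', s ×ˢ s', fun p => k p.1 + k' p.2, fun p => a p.1 * a' p.2,
    fun p => b p.1 * b' p.2, ?_, ?_, ?_⟩
  · rintro ⟨i, j⟩ hi
    rw [Finset.mem_product] at hi
    rw [norm_mul]
    exact mul_le_mul (h1 i hi.1) (h1' j hi.2) (norm_nonneg _) ((norm_nonneg _).trans (h1 i hi.1))
  · intro α
    dsimp only
    rw [h2, h2', Finset.sum_mul_sum, Finset.sum_product]
    refine Finset.sum_congr rfl fun i _ => Finset.sum_congr rfl fun j _ => ?_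
    push_cast; rw [add_mul, e_add]; ring
  · intro α
    dsimp only
    rw [h3, h3', Finset.sum_mul_sum, Finset.sum_product]
    refine Finset.sum_congr rfl fun i _ => Finset.sum_congr rfl fun j _ => ?_
    push_cast; rw [add_mul, e_add]; ring

lemma Dom.conj {f g : ℝ → ℂ} (H : Dom f g) :
    Dom (fun α => (starRingEnd ℂ) (f α)) (fun α => (starRingEnd ℂ) (g α)) := by
  obtain ⟨ι, s, k, a, b, h1, h2, h3⟩ := H
  refine ⟨ι, s, fun i => -k i, fun i => (starRingEnd ℂ) (a i), b, ?_, ?_, ?_⟩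
  · intro i hi; simpa using h1 i hi
  · intro α; dsimp only; rw [h2, map_sum]; simp [conj_e]
  · intro α; dsimp only; rw [h3, map_sum]; simp [conj_e]

lemma Dom.pow {f g : ℝ → ℂ} (H : Dom f g) (n : ℕ) :
    Dom (fun α => f α ^ n) (fun α => g α ^ n) := by
  induction n with
  | zero => simpa using Dom.one
  | succ n ih => simpa only [pow_succ] using ih.mul H

lemma Dom.sum {κ : Type*} (S : Finset κ) {f g : κ → ℝ → ℂ} (H : ∀ i ∈ S, Dom (f i) (g i)) :
    Dom (fun α => ∑ i ∈ S, f i α) (fun α => ∑ i ∈ S, g i α) := by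
  classical
  induction S using Finset.induction_on with
  | empty => simpa using Dom.zero
  | insert i S hi ih =>
    simp only [Finset.sum_insert hi]
    exact (H i (by simp)).add (ih fun j hj => H j (by simp [hj]))

lemma Dom.trig {κ : Type*} (S : Finset κ) (k : κ → ℤ) {a : κ → ℂ} {b : κ → ℝ}
    (h : ∀ i ∈ S, ‖a i‖ ≤ b i) :
    Dom (fun α => ∑ i ∈ S, a i * e (k i * α)) (fun α => ∑ i ∈ S, (b i : ℂ) * e (k i * α)) :=
  Dom.sum S fun i hi => Dom.single (k i) (h i hi)

/-- weights bounded by `1` -/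
lemma Dom.trig_one {κ : Type*} (S : Finset κ) (k : κ → ℤ) {a : κ → ℂ}
    (h : ∀ i ∈ S, ‖a i‖ ≤ 1) :
    Dom (fun α => ∑ i ∈ S, a i * e (k i * α)) (fun α => ∑ i ∈ S, e (k i * α)) := by
  simpa using Dom.trig S k (b := fun _ => 1) h

/-- subset of an index set, with injection-free form -/
lemma Dom.trig_subset {κ : Type*} {S S' : Finset κ} (hS : S ⊆ S') (k : κ → ℤ) {a : κ → ℂ}
    (h : ∀ i ∈ S, ‖a i‖ ≤ 1) :
    Dom (fun α => ∑ i ∈ S, a i * e (k i * α)) (fun α => ∑ i ∈ S', e (k i * α)) := by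
  classical
  have := Dom.trig_one S' k (a := fun i => if i ∈ S then a i else 0) (by
    intro i _; split_ifs with hi
    · exact h i hi
    · simp)
  convert this using 2 with α
  simp only [ite_mul, zero_mul]
  rw [← Finset.sum_filter]
  congr 1
  ext i; simp only [Finset.mem_filter]
  exact ⟨fun hi => ⟨hS hi, hi⟩, fun hi => hi.2⟩

lemma Dom.integral {f g : ℝ → ℂ} (H : Dom f g) :
    ‖∫ α in (0:ℝ)..1, f α‖ ≤ (∫ α in (0:ℝ)..1, g α).re := by
  obtain ⟨ι, s, k, a, b, h1, h2, h3⟩ := H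
  simp_rw [h2, h3]
  rw [intervalIntegral.integral_finsetSum, intervalIntegral.integral_finsetSum]
  · simp only [intervalIntegral.integral_const_mul, integral_e]
    rw [Complex.re_sum]
    refine (norm_sum_le _ _).trans (Finset.sum_le_sum fun i hi => ?_)
    split_ifs
    · simpa using h1 i hi
    · simp
  all_goals
    intro i _
    exact Continuous.intervalIntegrable (by fun_prop) _ _

lemma normSq_eq (z : ℂ) : ((‖z‖ ^ 2 : ℝ) : ℂ) = z * (starRingEnd ℂ) z := by
  rw [Complex.mul_conj, Complex.normSq_eq_norm_sq]

lemma Dom.sq {f g : ℝ → ℂ} (H : Dom f g) :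
    ∫ α in (0:ℝ)..1, ‖f α‖ ^ 2 ≤ ∫ α in (0:ℝ)..1, ‖g α‖ ^ 2 := by
  have h1 := (H.mul H.conj).integral
  simp_rw [← normSq_eq] at h1
  rw [intervalIntegral.integral_ofReal, intervalIntegral.integral_ofReal] at h1
  rw [Complex.ofReal_re, Complex.norm_real] at h1
  exact (le_abs_self _).trans h1

/-- mean value of products -/
lemma Dom.sq_mul_pow {f g f' g' : ℝ → ℂ} (H : Dom f g) (H' : Dom f' g') (n : ℕ) :
    ∫ α in (0:ℝ)..1, ‖f α‖ ^ 2 * ‖f' α‖ ^ (2 * n) ≤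
      ∫ α in (0:ℝ)..1, ‖g α‖ ^ 2 * ‖g' α‖ ^ (2 * n) := by
  have := (H.mul (H'.pow n)).sq
  simpa only [norm_mul, norm_pow, mul_pow, ← pow_mul, mul_comm n 2] using this

lemma Dom.pow_even {f g : ℝ → ℂ} (H : Dom f g) (n : ℕ) :
    ∫ α in (0:ℝ)..1, ‖f α‖ ^ (2 * n) ≤ ∫ α in (0:ℝ)..1, ‖g α‖ ^ (2 * n) := by
  have := (H.pow n).sq
  simpa only [norm_pow, ← pow_mul, mul_comm n 2] using this

lemma Dom.mul_pow {f g f' g' : ℝ → ℂ} (H : Dom f g) (H' : Dom f' g') (n : ℕ) :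
    ‖∫ α in (0:ℝ)..1, f α * ((‖f' α‖ ^ (2 * n) : ℝ) : ℂ)‖ ≤
      (∫ α in (0:ℝ)..1, g α * ((‖g' α‖ ^ (2 * n) : ℝ) : ℂ)).re := by
  have := (H.mul ((H'.mul H'.conj).pow n)).integral
  simp_rw [← normSq_eq] at this
  simpa only [← Complex.ofReal_pow, ← pow_mul] using this

lemma integral_normSq_trig {κ : Type*} [DecidableEq κ] (S : Finset κ) (k : κ → ℤ) :
    ∫ α in (0:ℝ)..1, ‖∑ i ∈ S, e (k i * α)‖ ^ 2 =
      (((S ×ˢ S).filter fun p => k p.1 = k p.2).card : ℝ) := by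
  have h1 : ∀ α : ℝ, ((‖∑ i ∈ S, e (k i * α)‖ ^ 2 : ℝ) : ℂ) =
      ∑ p ∈ S ×ˢ S, e (((k p.1 - k p.2 : ℤ) : ℝ) * α) := by
    intro α
    rw [normSq_eq, map_sum, Finset.sum_mul_sum, Finset.sum_product]
    refine Finset.sum_congr rfl fun i _ => Finset.sum_congr rfl fun j _ => ?_
    rw [← e_sub]; congr 1; push_cast; ring
  have h2 : ((∫ α in (0:ℝ)..1, ‖∑ i ∈ S, e (k i * α)‖ ^ 2 : ℝ) : ℂ) =
      (((S ×ˢ S).filter fun p => k p.1 = k p.2).card : ℂ) := by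
    rw [← intervalIntegral.integral_ofReal]
    simp_rw [h1]
    rw [intervalIntegral.integral_finsetSum]
    · simp only [integral_e, sub_eq_zero]
      rw [Finset.card_filter]; push_cast; rfl
    · intro i _
      exact Continuous.intervalIntegrable (by fun_prop) _ _
  exact_mod_cast h2

/-- `L²` bound from bounded multiplicity of frequencies. -/
lemma integral_normSq_le {κ : Type*} (S : Finset κ) (k : κ → ℤ) (B : ℝ)
    (hB : ∀ i ∈ S, ((S.filter fun j => k i = k j).card : ℝ) ≤ B) :
    ∫ α in (0:ℝ)..1, ‖∑ i ∈ S, e (k i * α)‖ ^ 2 ≤ S.card * B := by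
  classical
  rw [integral_normSq_trig, Finset.card_filter, Finset.sum_product]
  push_cast
  rw [← nsmul_eq_mul]
  refine Finset.sum_le_card_nsmul _ _ _ fun i hi => ?_
  have := hB i hi
  rw [Finset.card_filter] at this
  push_cast at this
  exact this

lemma ii {f : ℝ → ℝ} (hf : Continuous f) (a b : ℝ) : IntervalIntegrable f volume a b :=
  hf.intervalIntegrable _ _

lemma integral01_mono {f g : ℝ → ℝ} (hf : Continuous f) (hg : Continuous g) (h : ∀ x, f x ≤ g x) :
    ∫ x in (0:ℝ)..1, f x ≤ ∫ x in (0:ℝ)..1, g x :=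
  intervalIntegral.integral_mono (by norm_num) (ii hf _ _) (ii hg _ _) h

lemma integral01_nonneg {f : ℝ → ℝ} (h : ∀ x, 0 ≤ f x) : 0 ≤ ∫ x in (0:ℝ)..1, f x :=
  intervalIntegral.integral_nonneg (by norm_num) fun x _ => h x

/-- Hölder's inequality in the weighted geometric mean form. -/
lemma holder01 {f g : ℝ → ℝ} (hf : Continuous f) (hg : Continuous g) (hf0 : ∀ x, 0 ≤ f x)
    (hg0 : ∀ x, 0 ≤ g x) {a b : ℝ} (ha : 0 ≤ a) (hb : 0 ≤ b) (hab : a + b = 1) :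
    ∫ x in (0:ℝ)..1, f x ^ a * g x ^ b ≤
      (∫ x in (0:ℝ)..1, f x) ^ a * (∫ x in (0:ℝ)..1, g x) ^ b := by
  set F := ∫ x in (0:ℝ)..1, f x with hF
  set G := ∫ x in (0:ℝ)..1, g x with hG
  have hF0 : 0 ≤ F := integral01_nonneg hf0
  have hG0 : 0 ≤ G := integral01_nonneg hg0
  have key : ∀ δ > 0, ∫ x in (0:ℝ)..1, f x ^ a * g x ^ b ≤ (F + δ) ^ a * (G + δ) ^ b := by
    intro δ hδ
    have hFd : 0 < F + δ := by linarith
    have hGd : 0 < G + δ := by linarith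
    have h1 : ∀ x, f x ^ a * g x ^ b ≤
        ((F + δ) ^ a * (G + δ) ^ b) * (a / (F + δ) * f x + b / (G + δ) * g x) := by
      intro x
      have h2 := Real.geom_mean_le_arith_mean2_weighted ha hb
        (div_nonneg (hf0 x) hFd.le) (div_nonneg (hg0 x) hGd.le) hab
      rw [Real.div_rpow (hf0 x) hFd.le, Real.div_rpow (hg0 x) hGd.le, div_mul_div_comm,
        div_le_iff₀ (by positivity)] at h2
      refine h2.trans (le_of_eq ?_)
      field_simp
    refine (integral01_mono ?_ ?_ h1).trans ?_
    · exact (hf.rpow_const fun x => Or.inr ha).mul (hg.rpow_const fun x => Or.inr hb)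
    · fun_prop
    · rw [intervalIntegral.integral_const_mul, intervalIntegral.integral_add
        (ii (by fun_prop) _ _) (ii (by fun_prop) _ _), intervalIntegral.integral_const_mul,
        intervalIntegral.integral_const_mul, ← hF, ← hG]
      refine mul_le_of_le_one_right (by positivity) ?_
      have h3 : a / (F + δ) * F ≤ a := by
        rw [div_mul_eq_mul_div, div_le_iff₀ hFd]; nlinarith
      have h4 : b / (G + δ) * G ≤ b := by
        rw [div_mul_eq_mul_div, div_le_iff₀ hGd]; nlinarith
      linarith
  have hlim : Tendsto (fun δ : ℝ => (F + δ) ^ a * (G + δ) ^ b) (nhdsWithin 0 (Set.Ioi 0))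
      (nhds ((F + 0) ^ a * (G + 0) ^ b)) := by
    refine Tendsto.mono_left ?_ nhdsWithin_le_nhds
    refine Continuous.tendsto (f := fun δ : ℝ => (F + δ) ^ a * (G + δ) ^ b) ?_ 0
    exact ((continuous_const.add continuous_id).rpow_const fun x => Or.inr ha).mul
      ((continuous_const.add continuous_id).rpow_const fun x => Or.inr hb)
  simp only [add_zero] at hlim
  refine ge_of_tendsto hlim ?_
  filter_upwards [self_mem_nhdsWithin] with δ hδ using key δ hδ

lemma cauchy01 {f g : ℝ → ℝ} (hf : Continuous f) (hg : Continuous g) (hf0 : ∀ x, 0 ≤ f x)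
    (hg0 : ∀ x, 0 ≤ g x) :
    ∫ x in (0:ℝ)..1, f x * g x ≤
      (∫ x in (0:ℝ)..1, f x ^ 2) ^ (1 / 2 : ℝ) * (∫ x in (0:ℝ)..1, g x ^ 2) ^ (1 / 2 : ℝ) := by
  have := holder01 (f := fun x => f x ^ 2) (g := fun x => g x ^ 2) (by fun_prop) (by fun_prop)
    (fun x => by positivity) (fun x => by positivity) (a := 1 / 2) (b := 1 / 2) (by norm_num) (by norm_num) (by norm_num)
  convert this using 2
  funext x
  rw [← Real.sqrt_eq_rpow, ← Real.sqrt_eq_rpow, Real.sqrt_sq (hf0 x),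
    Real.sqrt_sq (hg0 x)]

lemma cauchy01_sq {f g : ℝ → ℝ} (hf : Continuous f) (hg : Continuous g) (hf0 : ∀ x, 0 ≤ f x)
    (hg0 : ∀ x, 0 ≤ g x) :
    (∫ x in (0:ℝ)..1, f x * g x) ^ 2 ≤
      (∫ x in (0:ℝ)..1, f x ^ 2) * (∫ x in (0:ℝ)..1, g x ^ 2) := by
  have h1 := cauchy01 hf hg hf0 hg0
  have h0 : 0 ≤ ∫ x in (0:ℝ)..1, f x * g x := integral01_nonneg fun x => mul_nonneg (hf0 x) (hg0 x)
  have hA : 0 ≤ ∫ x in (0:ℝ)..1, f x ^ 2 := integral01_nonneg fun x => by positivity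
  have hB : 0 ≤ ∫ x in (0:ℝ)..1, g x ^ 2 := integral01_nonneg fun x => by positivity
  calc _ ≤ _ := pow_le_pow_left₀ h0 h1 2
    _ = _ := by
      rw [mul_pow, ← Real.sqrt_eq_rpow, ← Real.sqrt_eq_rpow, Real.sq_sqrt hA, Real.sq_sqrt hB]

/-- translation invariance of the mean over a period -/
lemma integral01_shift {E : Type*} [NormedAddCommGroup E] [NormedSpace ℝ E] {f : ℝ → E}
    (hf : ∀ x, f (x + 1) = f x) (t : ℝ) :
    ∫ x in (0:ℝ)..1, f (x + t) = ∫ x in (0:ℝ)..1, f x := by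
  have hp : Function.Periodic f 1 := hf
  rw [intervalIntegral.integral_comp_add_right (fun x => f x) t, zero_add, add_comm 1 t]
  simpa using hp.intervalIntegral_add_eq t 0

/-- invariance of the mean under integer dilation -/
lemma integral01_dil {f : ℝ → ℝ} (hc : Continuous f) (hf : ∀ x, f (x + 1) = f x)
    (n : ℕ) (hn : n ≠ 0) :
    ∫ x in (0:ℝ)..1, f (n * x) = ∫ x in (0:ℝ)..1, f x := by
  have hp : Function.Periodic f 1 := hf
  have hn' : (n : ℝ) ≠ 0 := by exact_mod_cast hn
  rw [intervalIntegral.integral_comp_mul_left (fun x => f x) hn']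
  have := hp.intervalIntegral_add_zsmul_eq (n : ℤ) 0 (fun _ _ => ii hc _ _)
  simp only [zsmul_eq_mul, mul_one, zero_add, Int.cast_natCast] at this
  simp only [mul_zero, mul_one]
  rw [this]
  rw [smul_eq_mul, ← mul_assoc, inv_mul_cancel₀ hn', one_mul]

lemma dil_period {E : Type*} {f : ℝ → E} (hf : ∀ x, f (x + 1) = f x) (n : ℕ) (x : ℝ) :
    f (x + n) = f x := by
  induction n with
  | zero => simp
  | succ n ih => push_cast; rw [← add_assoc, hf, ih]

lemma e_eq_one_iff (x : ℝ) : e x = 1 ↔ ∃ m : ℤ, x = m := by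
  unfold e
  rw [Complex.exp_eq_one_iff]
  constructor
  · rintro ⟨m, hm⟩
    refine ⟨m, ?_⟩
    have h2 : (2 * Real.pi * Complex.I : ℂ) ≠ 0 := by simp
    have : (x : ℂ) = m := by
      apply mul_left_cancel₀ h2; rw [hm]; ring
    exact_mod_cast this
  · rintro ⟨m, rfl⟩
    exact ⟨m, by push_cast; ring⟩

/-- a frequency not divisible by `n` is orthogonal to functions of `n x` -/
lemma integral01_e_mul_dil {f : ℝ → ℂ} (hf : ∀ x, f (x + 1) = f x)
    (n : ℕ) (j : ℤ) (hj : ¬ (n : ℤ) ∣ j) :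
    ∫ x in (0:ℝ)..1, e (j * x) * f (n * x) = 0 := by
  rcases Nat.eq_zero_or_pos n with rfl | hn
  · simp only [Nat.cast_zero, zero_mul]
    rw [intervalIntegral.integral_mul_const, integral_e, if_neg, zero_mul]
    rintro rfl; simp at hj
  have hn' : (n : ℝ) ≠ 0 := by positivity
  set F : ℝ → ℂ := fun x => e (j * x) * f (n * x) with hF
  have hper : ∀ x, F (x + 1) = F x := by
    intro x
    simp only [hF]
    rw [mul_add, mul_one, e_add_int, mul_add, mul_one, dil_period hf]
  have h1 : ∀ x, F (x + 1 / n) = e (j / n) * F x := by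
    intro x
    simp only [hF]
    rw [mul_add, e_add, mul_add, mul_one_div_cancel hn', hf]
    rw [mul_one_div]; ring
  have h2 := integral01_shift hper (1 / n)
  simp_rw [h1] at h2
  rw [intervalIntegral.integral_const_mul] at h2
  have h3 : e (j / n) ≠ 1 := by
    rw [Ne, e_eq_one_iff]
    rintro ⟨m, hm⟩
    rw [div_eq_iff hn'] at hm
    apply hj
    refine ⟨m, ?_⟩
    have : (j : ℝ) = ((n : ℤ) * m : ℤ) := by rw [hm]; push_cast; ring
    exact_mod_cast this
  have h4 : (e (j / n) - 1) * ∫ x in (0:ℝ)..1, F x = 0 := by rw [sub_mul, h2]; ring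
  rcases mul_eq_zero.1 h4 with h5 | h5
  · exact absurd (sub_eq_zero.1 h5) h3
  · exact h5

lemma divisor_bound (ε : ℝ) (hε : 0 < ε) :
    ∃ C : ℝ, ∀ n : ℕ, n ≠ 0 → (n.divisors.card : ℝ) ≤ C * (n : ℝ) ^ ε := by
  set C₀ : ℝ := 1 + 1 / (ε * Real.log 2) with hC₀
  have hl2 : 0 < Real.log 2 := Real.log_pos (by norm_num)
  have hC1 : 1 ≤ C₀ := by rw [hC₀]; linarith [show 0 < 1 / (ε * Real.log 2) by positivity]
  set B : ℕ := ⌈(2 : ℝ) ^ (1 / ε)⌉₊ with hB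
  refine ⟨C₀ ^ B, fun n hn => ?_⟩
  have hsmall : ∀ p : ℕ, 2 ≤ p → ∀ a : ℕ, (a + 1 : ℝ) ≤ C₀ * ((p : ℝ) ^ a) ^ ε := by
    intro p hp a
    have h1 : (2 : ℝ) ^ (a * ε) ≤ ((p : ℝ) ^ a) ^ ε := by
      rw [← Real.rpow_natCast, ← Real.rpow_mul (by positivity)]
      exact Real.rpow_le_rpow (by norm_num) (by exact_mod_cast hp) (by positivity)
    have h2 : 1 + a * ε * Real.log 2 ≤ (2 : ℝ) ^ (a * ε) := by
      rw [Real.rpow_def_of_pos (by norm_num)]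
      have := Real.add_one_le_exp (Real.log 2 * (a * ε))
      linarith
    have h3 : (a + 1 : ℝ) ≤ C₀ * (1 + a * ε * Real.log 2) := by
      rw [hC₀]
      have : (1 + 1 / (ε * Real.log 2)) * (1 + a * ε * Real.log 2) =
        1 + a * ε * Real.log 2 + 1 / (ε * Real.log 2) + a := by field_simp; ring
      rw [this]
      have : 0 ≤ a * ε * Real.log 2 := by positivity
      have : 0 ≤ 1 / (ε * Real.log 2) := by positivity
      linarith
    exact h3.trans (mul_le_mul_of_nonneg_left (h2.trans h1) (by linarith))
  have hlarge : ∀ p : ℕ, B ≤ p → ∀ a : ℕ, (a + 1 : ℝ) ≤ ((p : ℝ) ^ a) ^ ε := by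
    intro p hp a
    have h0 : (2 : ℝ) ^ (1 / ε) ≤ p := (Nat.le_ceil _).trans (by exact_mod_cast hp)
    have h1 : (2 : ℝ) ≤ (p : ℝ) ^ ε := by
      calc (2 : ℝ) = ((2 : ℝ) ^ (1 / ε)) ^ ε := by
            rw [← Real.rpow_mul (by norm_num), one_div_mul_cancel hε.ne', Real.rpow_one]
        _ ≤ _ := Real.rpow_le_rpow (by positivity) h0 hε.le
    have h2 : ((p : ℝ) ^ a) ^ ε = ((p : ℝ) ^ ε) ^ a := by
      rw [← Real.rpow_natCast, ← Real.rpow_natCast, ← Real.rpow_mul (by positivity),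
        ← Real.rpow_mul (by positivity), mul_comm]
    rw [h2]
    have h3 : (a + 1 : ℝ) ≤ 2 ^ a := by
      have := Nat.lt_two_pow_self (n := a)
      exact_mod_cast this
    exact h3.trans (pow_le_pow_left₀ (by norm_num) h1 a)
  rw [Nat.card_divisors hn]
  have hprod : (n : ℝ) ^ ε = ∏ p ∈ n.primeFactors, ((p : ℝ) ^ n.factorization p) ^ ε := by
    rw [Real.finsetProd_rpow _ _ (fun p _ => by positivity)]
    congr 1
    conv_lhs => rw [← Nat.prod_factorization_pow_eq_self hn]
    rw [Finsupp.prod]; push_cast; rfl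
  push_cast
  rw [hprod]
  have h1 : ∏ p ∈ n.primeFactors, ((n.factorization p : ℝ) + 1) ≤
      ∏ p ∈ n.primeFactors, ((if p < B then C₀ else 1) * ((p : ℝ) ^ n.factorization p) ^ ε) := by
    refine Finset.prod_le_prod (fun p _ => by positivity) fun p hp => ?_
    split_ifs with hpB
    · exact hsmall p (Nat.prime_of_mem_primeFactors hp).two_le _
    · rw [one_mul]; exact hlarge p (not_lt.1 hpB) _
  refine h1.trans ?_
  rw [Finset.prod_mul_distrib]
  refine mul_le_mul_of_nonneg_right ?_ (Finset.prod_nonneg fun p _ => by positivity)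
  rw [Finset.prod_ite, Finset.prod_const, Finset.prod_const_one, mul_one]
  refine pow_le_pow_right₀ hC1 ?_
  calc _ ≤ (Finset.range B).card := Finset.card_le_card fun p hp => by
        rw [Finset.mem_filter] at hp; simpa using hp.2
    _ = B := Finset.card_range B

lemma dvd_of_eq_sub {n x y z : ℤ} (h1 : n ∣ x) (h2 : n ∣ y) (h : z = x - y) : n ∣ z :=
  h ▸ dvd_sub h1 h2

/-- Square roots modulo `n`. -/
lemma card_sqrt_mod_le (n g : ℕ) (hn : n ≠ 0) (a : ℤ) (S : Finset ℕ) (hlt : ∀ c ∈ S, c < n)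
    (hroot : ∀ c ∈ S, (n : ℤ) ∣ (c : ℤ) ^ 2 - a) (hg : ∀ c ∈ S, Nat.gcd c n ≤ g) :
    S.card ≤ 2 * g * n.divisors.card := by
  classical
  rcases S.eq_empty_or_nonempty with rfl | ⟨c₀, hc₀⟩
  · simp
  have himg : S.image (fun c : ℕ => Int.gcd ((c : ℤ) - c₀) n) ⊆ n.divisors := by
    intro d hd
    obtain ⟨c, -, rfl⟩ := Finset.mem_image.1 hd
    rw [Nat.mem_divisors]
    exact ⟨Int.natCast_dvd_natCast.1 (Int.gcd_dvd_right _ _), hn⟩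
  refine (Finset.card_le_mul_card_image (f := fun c : ℕ => Int.gcd ((c : ℤ) - c₀) n) S (2 * g) ?_).trans
    (Nat.mul_le_mul_left _ (Finset.card_le_card himg))
  intro d hd
  have hdn : d ∣ n := Nat.dvd_of_mem_divisors (himg hd)
  obtain ⟨m, rfl⟩ := hdn
  have hd0 : d ≠ 0 := left_ne_zero_of_mul hn
  have hm0 : m ≠ 0 := right_ne_zero_of_mul hn
  have hfib : ∀ c ∈ S.filter (fun c : ℕ => Int.gcd ((c : ℤ) - c₀) ((d * m : ℕ) : ℤ) = d),
      (d : ℤ) ∣ (c : ℤ) - c₀ ∧ (m : ℤ) ∣ (c : ℤ) + c₀ := by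
    intro c hc
    rw [Finset.mem_filter] at hc
    obtain ⟨hcS, hcd⟩ := hc
    have h1 : (d : ℤ) ∣ (c : ℤ) - c₀ := by
      have := Int.gcd_dvd_left ((c : ℤ) - c₀) ((d * m : ℕ) : ℤ)
      rwa [hcd] at this
    refine ⟨h1, ?_⟩
    obtain ⟨u, hu⟩ := h1
    have h2 : ((d * m : ℕ) : ℤ) ∣ ((c : ℤ) - c₀) * (c + c₀) := dvd_of_eq_sub (hroot c hcS) (hroot c₀ hc₀) (by ring)
    have hdz : (d : ℤ) ≠ 0 := by exact_mod_cast hd0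
    have h3 : (m : ℤ) ∣ u * (c + c₀) := by
      rw [hu] at h2; push_cast at h2
      rw [mul_assoc] at h2
      exact Int.dvd_of_mul_dvd_mul_left hdz h2
    have h4 : IsCoprime (m : ℤ) u := by
      rw [hu] at hcd; push_cast at hcd
      rw [Int.gcd_mul_left] at hcd
      have : Int.gcd u m = 1 := by
        have h5 : d * Int.gcd u m = d * 1 := by simpa using hcd
        exact Nat.eq_of_mul_eq_mul_left (Nat.pos_of_ne_zero hd0) h5
      exact (Int.isCoprime_iff_gcd_eq_one.2 this).symm
    exact h4.dvd_of_dvd_mul_left h3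
  rcases Finset.eq_empty_or_nonempty
    (S.filter (fun c : ℕ => Int.gcd ((c : ℤ) - c₀) ((d * m : ℕ) : ℤ) = d)) with he | ⟨c₁, hc₁⟩
  · rw [he]; simp
  have hG : Nat.gcd d m ≤ 2 * g := by
    obtain ⟨h1, h2⟩ := hfib c₁ hc₁
    have hz : ((Nat.gcd d m : ℕ) : ℤ) ∣ 2 * c₀ := by
      have h3 : ((Nat.gcd d m : ℕ) : ℤ) ∣ (c₁ : ℤ) - c₀ :=
        (Int.natCast_dvd_natCast.2 (Nat.gcd_dvd_left d m)).trans h1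
      have h4 : ((Nat.gcd d m : ℕ) : ℤ) ∣ (c₁ : ℤ) + c₀ :=
        (Int.natCast_dvd_natCast.2 (Nat.gcd_dvd_right d m)).trans h2
      exact dvd_of_eq_sub h4 h3 (by ring)
    have hz' : Nat.gcd d m ∣ 2 * c₀ := by exact_mod_cast hz
    have hz2 : Nat.gcd d m ∣ Nat.gcd (2 * c₀) (2 * (d * m)) :=
      Nat.dvd_gcd hz' (((Nat.gcd_dvd_left d m).mul_right m).mul_left 2)
    rw [Nat.gcd_mul_left] at hz2
    have hpos : 0 < Nat.gcd c₀ (d * m) := Nat.gcd_pos_of_pos_right _ (Nat.pos_of_ne_zero hn)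
    exact (Nat.le_of_dvd (by omega) hz2).trans (Nat.mul_le_mul_left _ (hg c₀ hc₀))
  set L := Nat.lcm d m with hL
  have hLpos : 0 < L := Nat.lcm_pos (Nat.pos_of_ne_zero hd0) (Nat.pos_of_ne_zero hm0)
  have hLg : Nat.gcd d m * L = d * m := Nat.gcd_mul_lcm d m
  calc _ ≤ (Finset.range (2 * g)).card := by
        refine Finset.card_le_card_of_injOn (fun c => c / L) ?_ ?_
        · intro c hc
          have hcl := hlt c (Finset.mem_filter.1 hc).1
          simp only [Finset.coe_range, Set.mem_Iio]
          rw [Nat.div_lt_iff_lt_mul hLpos]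
          calc c < d * m := hcl
            _ = Nat.gcd d m * L := hLg.symm
            _ ≤ _ := Nat.mul_le_mul_right _ hG
        · intro c hc c' hc' hcc
          obtain ⟨h1, h2⟩ := hfib c hc
          obtain ⟨h1', h2'⟩ := hfib c' hc'
          have e1 : (d : ℤ) ∣ (c : ℤ) - c' := dvd_of_eq_sub h1 h1' (by ring)
          have e2 : (m : ℤ) ∣ (c : ℤ) - c' := dvd_of_eq_sub h2 h2' (by ring)
          have e3 : (L : ℤ) ∣ (c : ℤ) - c' := by
            rw [hL]
            have := Int.coe_lcm_dvd e1 e2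
            simpa [Int.lcm] using this
          have e4 : c ≡ c' [MOD L] := by
            rw [Nat.ModEq.comm]
            exact (Nat.modEq_iff_dvd).2 e3
          have e5 : c / L = c' / L := hcc
          have := Nat.div_add_mod c L
          have h6 := Nat.div_add_mod c' L
          unfold Nat.ModEq at e4
          rw [e5, e4] at this
          omega
    _ = 2 * g := Finset.card_range _

/-- Fourth roots modulo `n`. -/
lemma card_fourth_root_mod_le (n : ℕ) (hn : n ≠ 0) (a : ℤ) (S : Finset ℕ) (hlt : ∀ c ∈ S, c < n)
    (hroot : ∀ c ∈ S, (n : ℤ) ∣ (c : ℤ) ^ 4 - a) (hg : ∀ c ∈ S, Nat.gcd c n = 1) :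
    S.card ≤ (2 * n.divisors.card) * (2 * n.divisors.card) := by
  classical
  have h1 : (S.image (fun c => c ^ 2 % n)).card ≤ 2 * 1 * n.divisors.card := by
    apply card_sqrt_mod_le n 1 hn a
    · intro c hc
      obtain ⟨x, -, rfl⟩ := Finset.mem_image.1 hc
      exact Nat.mod_lt _ (Nat.pos_of_ne_zero hn)
    · intro c hc
      obtain ⟨x, hx, rfl⟩ := Finset.mem_image.1 hc
      have h2 : (((x ^ 2 % n : ℕ) : ℤ)) ≡ (x : ℤ) ^ 2 [ZMOD n] := by
        push_cast; exact Int.mod_modEq _ _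
      have h3 : (x : ℤ) ^ 4 ≡ a [ZMOD n] := ((Int.modEq_iff_dvd).2 (hroot x hx)).symm
      have h4 := (h2.pow 2)
      rw [← pow_mul] at h4
      exact (Int.modEq_iff_dvd).1 (h4.trans h3).symm
    · intro c hc
      obtain ⟨x, hx, rfl⟩ := Finset.mem_image.1 hc
      have : Nat.gcd (x ^ 2 % n) n = 1 := by
        rw [← Nat.gcd_rec, Nat.gcd_comm]
        exact Nat.Coprime.pow_left 2 (hg x hx)
      exact this.le
  refine (Finset.card_le_mul_card_image (f := fun c => c ^ 2 % n) S (2 * n.divisors.card) ?_).trans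
    (Nat.mul_le_mul_left _ (by simpa using h1))
  intro b hb
  have := card_sqrt_mod_le n 1 hn b (S.filter fun c => c ^ 2 % n = b)
    (fun c hc => hlt c (Finset.mem_filter.1 hc).1) ?_
    (fun c hc => (hg c (Finset.mem_filter.1 hc).1).le)
  · simpa using this
  · intro c hc
    have h2 := (Finset.mem_filter.1 hc).2
    rw [← h2]; push_cast
    exact Int.dvd_self_sub_emod

lemma prim_rep_unique (N x y x' y' t : ℕ) (hN : 0 < N) (hx : 0 < x) (hx' : 0 < x')
    (h : 3 * x ^ 2 + y ^ 2 = N) (h' : 3 * x' ^ 2 + y' ^ 2 = N)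
    (hc : Nat.gcd x y = 1) (hc' : Nat.gcd x' y' = 1)
    (ht : t * x ≡ y [MOD N]) (ht' : t * x' ≡ y' [MOD N]) : x = x' ∧ y = y' := by
  have h1 : (N : ℤ) ∣ (x : ℤ) * y' - x' * y := by
    have e1 : x * y' ≡ x' * y [MOD N] := by
      have a1 := (ht'.symm.mul_left x)
      have a2 := (ht.mul_left x')
      have : x * (t * x') = x' * (t * x) := by ring
      rw [this] at a1
      exact a1.trans a2
    have := (Nat.modEq_iff_dvd).1 e1.symm
    push_cast at this; exact this
  have h2 : (3 * (x : ℤ) * x' + y * y') ^ 2 + 3 * ((x : ℤ) * y' - x' * y) ^ 2 = (N : ℤ) ^ 2 := by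
    have a1 : (N : ℤ) = 3 * x ^ 2 + y ^ 2 := by rw [← h]; push_cast; ring
    have a2 : (N : ℤ) = 3 * x' ^ 2 + y' ^ 2 := by rw [← h']; push_cast; ring
    rw [sq (N : ℤ)]; nth_rewrite 1 [a1]; rw [a2]; ring
  have h3 : (x : ℤ) * y' - x' * y = 0 := by
    obtain ⟨k, hk⟩ := h1
    by_contra hne
    have hk0 : k ≠ 0 := by rintro rfl; simp at hk; exact hne (by linarith)
    rw [hk] at h2
    have hk1 : 1 ≤ k ^ 2 := by have := sq_pos_of_ne_zero (a := k) hk0; omega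
    have hN2 : 0 < (N : ℤ) ^ 2 := by positivity
    nlinarith [sq_nonneg (3 * (x : ℤ) * x' + y * y')]
  have h4 : x * y' = x' * y := by
    have : (x : ℤ) * y' = x' * y := by linarith
    exact_mod_cast this
  have d1 : x ∣ x' := (Nat.Coprime.dvd_of_dvd_mul_right hc ⟨y', by rw [h4]⟩)
  have d2 : x' ∣ x := (Nat.Coprime.dvd_of_dvd_mul_right hc' ⟨y, by rw [h4]⟩)
  have hxx : x = x' := Nat.dvd_antisymm d1 d2
  refine ⟨hxx, ?_⟩
  rw [← hxx] at h4
  exact (Nat.eq_of_mul_eq_mul_left hx h4).symm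

/-- Representations by `3 X ^ 2 + Y ^ 2`. -/
lemma card_three_sq_add_sq_le (n : ℕ) (hn : n ≠ 0) (S : Finset (ℕ × ℕ))
    (hS : ∀ p ∈ S, 0 < p.1 ∧ 3 * p.1 ^ 2 + p.2 ^ 2 = n) :
    S.card ≤ 6 * n.divisors.card * n.divisors.card := by
  classical
  have himg : S.image (fun p => Nat.gcd p.1 p.2) ⊆ n.divisors := by
    intro d hd
    obtain ⟨p, hp, rfl⟩ := Finset.mem_image.1 hd
    rw [Nat.mem_divisors]
    refine ⟨?_, hn⟩
    rw [← (hS p hp).2]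
    exact dvd_add (((Nat.gcd_dvd_left p.1 p.2).trans (dvd_pow_self _ two_ne_zero)).mul_left 3)
      ((Nat.gcd_dvd_right p.1 p.2).trans (dvd_pow_self _ two_ne_zero))
  refine (Finset.card_le_mul_card_image (f := fun p : ℕ × ℕ => Nat.gcd p.1 p.2) S
    (6 * n.divisors.card) ?_).trans (Nat.mul_le_mul_left _ (Finset.card_le_card himg))
  intro g hg
  set F := S.filter (fun p : ℕ × ℕ => Nat.gcd p.1 p.2 = g) with hF
  rcases F.eq_empty_or_nonempty with he | ⟨p₀, hp₀⟩
  · rw [he]; simp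
  have hgpos : 0 < g := by
    have h1 := (Finset.mem_filter.1 hp₀)
    rw [← h1.2]; exact Nat.gcd_pos_of_pos_left _ (hS _ h1.1).1
  have hdata : ∀ p ∈ F, 0 < p.1 / g ∧ Nat.gcd (p.1 / g) (p.2 / g) = 1 ∧
      g * (p.1 / g) = p.1 ∧ g * (p.2 / g) = p.2 ∧
      g ^ 2 * (3 * (p.1 / g) ^ 2 + (p.2 / g) ^ 2) = n := by
    intro p hp
    have h1 := (Finset.mem_filter.1 hp)
    have hd1 : g ∣ p.1 := h1.2 ▸ Nat.gcd_dvd_left _ _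
    have hd2 : g ∣ p.2 := h1.2 ▸ Nat.gcd_dvd_right _ _
    have e1 := Nat.mul_div_cancel' hd1
    have e2 := Nat.mul_div_cancel' hd2
    refine ⟨Nat.div_pos (Nat.le_of_dvd (hS _ h1.1).1 hd1) hgpos, ?_, e1, e2, ?_⟩
    · rw [Nat.gcd_div hd1 hd2, h1.2, Nat.div_self hgpos]
    · rw [← (hS p h1.1).2]
      calc _ = 3 * (g * (p.1 / g)) ^ 2 + (g * (p.2 / g)) ^ 2 := by ring
        _ = _ := by rw [e1, e2]
  obtain ⟨-, -, -, -, hN⟩ := hdata p₀ hp₀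
  set N := 3 * (p₀.1 / g) ^ 2 + (p₀.2 / g) ^ 2 with hNdef
  have hN0 : N ≠ 0 := by rintro h0; rw [h0] at hN; simp at hN; exact hn hN.symm
  have hdata2 : ∀ p ∈ F, 3 * (p.1 / g) ^ 2 + (p.2 / g) ^ 2 = N := by
    intro p hp
    obtain ⟨-, -, -, -, h5⟩ := hdata p hp
    rw [← hN] at h5
    exact Nat.eq_of_mul_eq_mul_left (by positivity) h5
  have hcop : ∀ p ∈ F, Nat.Coprime (p.1 / g) N := by
    intro p hp
    obtain ⟨-, h2, -⟩ := hdata p hp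
    rw [← hdata2 p hp]
    have : Nat.Coprime (p.1 / g) ((p.2 / g) ^ 2) := Nat.Coprime.pow_right 2 h2
    rw [Nat.Coprime, show 3 * (p.1 / g) ^ 2 + (p.2 / g) ^ 2 =
      (p.2 / g) ^ 2 + (p.1 / g) * (3 * (p.1 / g)) by ring, Nat.gcd_add_mul_left_right]
    exact this
  have hex : ∀ p ∈ F, ∃ t < N, t * (p.1 / g) ≡ p.2 / g [MOD N] := by
    intro p hp
    obtain ⟨u, hu⟩ := Int.mod_coprime (hcop p hp)
    refine ⟨((u * ((p.2 / g : ℕ) : ℤ)) % N).toNat, ?_, ?_⟩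
    · have h1 := Int.emod_lt_of_pos (u * ((p.2 / g : ℕ) : ℤ)) (b := N) (by positivity)
      have h2 := Int.emod_nonneg (u * ((p.2 / g : ℕ) : ℤ)) (b := (N : ℤ)) (by positivity)
      omega
    · rw [← Int.natCast_modEq_iff]
      have h2 := Int.emod_nonneg (u * ((p.2 / g : ℕ) : ℤ)) (b := (N : ℤ)) (by positivity)
      rw [Nat.cast_mul, Int.toNat_of_nonneg h2]
      have h3 : (u * ((p.2 / g : ℕ) : ℤ)) % N ≡ u * ((p.2 / g : ℕ) : ℤ) [ZMOD N] := Int.mod_modEq _ _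
      have h4 := h3.mul_right ((p.1 / g : ℕ) : ℤ)
      refine h4.trans ?_
      have h5 := hu.mul_right ((p.2 / g : ℕ) : ℤ)
      rw [one_mul] at h5
      convert h5 using 1; ring
  choose! t ht using hex
  have hinj : Set.InjOn t F := by
    intro p hp p' hp' htt
    obtain ⟨a1, a2, a3, a4, -⟩ := hdata p hp
    obtain ⟨b1, b2, b3, b4, -⟩ := hdata p' hp'
    obtain ⟨u1, u2⟩ := prim_rep_unique N _ _ _ _ (t p) (Nat.pos_of_ne_zero hN0) a1 b1
      (hdata2 p hp) (hdata2 p' hp') a2 b2 (ht p hp).2 (htt ▸ (ht p' hp').2)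
    ext
    · rw [← a3, ← b3, u1]
    · rw [← a4, ← b4, u2]
  have hsq : ∀ p ∈ F, (N : ℤ) ∣ (t p : ℤ) ^ 2 - (-3) := by
    intro p hp
    have h1 := (Nat.modEq_iff_dvd).1 (ht p hp).2.symm
    have hcop' : IsCoprime (N : ℤ) (((p.1 / g : ℕ) : ℤ) ^ 2) :=
      ((Nat.isCoprime_iff_coprime.2 (hcop p hp)).symm).pow_right
    have h3 := hdata2 p hp
    generalize p.1 / g = x at h1 hcop' h3
    generalize p.2 / g = y at h1 h3
    push_cast at h1
    apply hcop'.dvd_of_dvd_mul_right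
    have h4 : (N : ℤ) = 3 * (x : ℤ) ^ 2 + (y : ℤ) ^ 2 := by rw [← h3]; push_cast; ring
    obtain ⟨w, hw⟩ := h1
    refine ⟨w * ((t p : ℤ) * x + y) + 1, ?_⟩
    linear_combination ((t p : ℤ) * x + y) * hw - h4
  have hgcd : ∀ p ∈ F, Nat.gcd (t p) N ≤ 3 := by
    intro p hp
    have h1 : ((Nat.gcd (t p) N : ℕ) : ℤ) ∣ 3 := by
      have a1 : ((Nat.gcd (t p) N : ℕ) : ℤ) ∣ (t p : ℤ) ^ 2 - (-3) :=
        (Int.natCast_dvd_natCast.2 (Nat.gcd_dvd_right _ _)).trans (hsq p hp)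
      have a2 : ((Nat.gcd (t p) N : ℕ) : ℤ) ∣ (t p : ℤ) ^ 2 :=
        (Int.natCast_dvd_natCast.2 (Nat.gcd_dvd_left _ _)).trans (dvd_pow_self _ two_ne_zero)
      exact dvd_of_eq_sub a1 a2 (by ring)
    exact Nat.le_of_dvd (by norm_num) (by exact_mod_cast h1)
  have hfin := card_sqrt_mod_le N 3 hN0 (-3) (F.image t)
    (by intro c hc; obtain ⟨p, hp, rfl⟩ := Finset.mem_image.1 hc; exact (ht p hp).1)
    (by intro c hc; obtain ⟨p, hp, rfl⟩ := Finset.mem_image.1 hc; exact hsq p hp)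
    (by intro c hc; obtain ⟨p, hp, rfl⟩ := Finset.mem_image.1 hc; exact hgcd p hp)
  rw [Finset.card_image_of_injOn hinj] at hfin
  refine hfin.trans ?_
  have : N.divisors.card ≤ n.divisors.card :=
    Finset.card_le_card (Nat.divisors_subset_of_dvd hn ⟨g ^ 2, by rw [← hN]; ring⟩)
  calc 2 * 3 * N.divisors.card ≤ 2 * 3 * n.divisors.card := Nat.mul_le_mul_left _ this
    _ = _ := by ring

/-- distance to the nearest integer -/
def nd (x : ℝ) : ℝ := |x - round x|

lemma nd_nonneg (x : ℝ) : 0 ≤ nd x := abs_nonneg _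

lemma nd_le (x : ℝ) (m : ℤ) : nd x ≤ |x - m| := round_le x m

lemma four_nd_le (x : ℝ) : 4 * nd x ≤ ‖e x - 1‖ := by
  set δ := x - round x with hδ
  have h1 : e x = e δ := by
    have : x = δ + (round x : ℤ) := by rw [hδ]; ring
    conv_lhs => rw [this]
    rw [e_add_int]
  have h2 : |δ| ≤ 1 / 2 := abs_sub_round x
  have h3 : ‖e δ - 1‖ = 2 * |Real.sin (π * δ)| := by
    unfold e
    have : (2 * π * Complex.I * δ : ℂ) = Complex.I * ((2 * π * δ : ℝ) : ℂ) := by push_cast; ring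
    rw [this, Complex.norm_exp_I_mul_ofReal_sub_one]
    rw [show 2 * π * δ / 2 = π * δ by ring, Real.norm_eq_abs, abs_mul]; simp
  rw [h1, h3]
  have h4 : 2 * |δ| ≤ |Real.sin (π * δ)| := by
    have h5 : |Real.sin (π * δ)| = Real.sin (π * |δ|) := by
      rcases abs_cases δ with ⟨h6, h7⟩ | ⟨h6, h7⟩
      · rw [h6, abs_of_nonneg]
        apply Real.sin_nonneg_of_nonneg_of_le_pi (by positivity)
        rw [h6] at h2; nlinarith [Real.pi_pos]
      · rw [h6, mul_neg, Real.sin_neg, ← abs_neg, abs_of_nonneg]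
        rw [← Real.sin_neg, ← mul_neg]
        apply Real.sin_nonneg_of_nonneg_of_le_pi
        · exact mul_nonneg Real.pi_pos.le (by linarith)
        · rw [h6] at h2; nlinarith [Real.pi_pos]
    rw [h5]
    have := Real.mul_le_sin (x := π * |δ|) (by positivity) (by nlinarith [Real.pi_pos])
    refine le_trans (le_of_eq ?_) this
    field_simp
  change 4 * |δ| ≤ _
  linarith

/-- linear exponential sums -/
lemma geom_sum_nd (θ : ℝ) (n : ℕ) : ‖∑ x ∈ Finset.range n, e (x * θ)‖ * nd θ ≤ 1 := by
  have h1 : (∑ x ∈ Finset.range n, e (x * θ)) * (e θ - 1) = e (n * θ) - 1 := by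
    induction n with
    | zero => simp [e_zero]
    | succ n ih =>
      rw [Finset.sum_range_succ, add_mul, ih]; push_cast; rw [add_mul, one_mul, e_add]; ring
  have h2 : ‖∑ x ∈ Finset.range n, e (x * θ)‖ * ‖e θ - 1‖ ≤ 2 := by
    rw [← norm_mul, h1]
    refine (norm_sub_le _ _).trans ?_
    rw [norm_e]; norm_num
  have h3 := mul_le_mul_of_nonneg_left (four_nd_le θ)
    (norm_nonneg (∑ x ∈ Finset.range n, e (x * θ)))
  nlinarith [norm_nonneg (∑ x ∈ Finset.range n, e (x * θ)), nd_nonneg θ]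

lemma norm_sum_e_le {κ : Type*} (S : Finset κ) (f : κ → ℝ) : ‖∑ x ∈ S, e (f x)‖ ≤ S.card := by
  refine (norm_sum_le _ _).trans ?_
  simp [norm_e]

lemma bucket_card (α t : ℝ) (a : ℤ) (q : ℕ) (hq : 0 < q) (hc : IsCoprime a (q : ℤ))
    (hα : |α - a / q| ≤ 1 / (q : ℝ) ^ 2) (j : ℤ) :
    ((Finset.range q).filter fun r : ℕ => ⌊(q : ℝ) * Int.fract (t + r * α)⌋ = j).card ≤ 3 := by
  classical
  set F := (Finset.range q).filter fun r : ℕ => ⌊(q : ℝ) * Int.fract (t + r * α)⌋ = j with hF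
  rcases F.eq_empty_or_nonempty with he | ⟨r₀, hr₀⟩
  · rw [he]; simp
  have hqR : (0 : ℝ) < q := by exact_mod_cast hq
  have hex : ∀ r ∈ F, ∃ m : ℤ, ((r : ℤ) - r₀) * a - m * q ∈ Finset.Icc (-1 : ℤ) 1 := by
    intro r hr
    rw [hF, Finset.mem_filter] at hr hr₀
    have e1 := Int.floor_le ((q : ℝ) * Int.fract (t + r * α))
    have e2 := Int.lt_floor_add_one ((q : ℝ) * Int.fract (t + r * α))
    have e3 := Int.floor_le ((q : ℝ) * Int.fract (t + r₀ * α))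
    have e4 := Int.lt_floor_add_one ((q : ℝ) * Int.fract (t + r₀ * α))
    rw [hr.2] at e1 e2
    rw [hr₀.2] at e3 e4
    unfold Int.fract at e1 e2 e3 e4
    refine ⟨⌊t + r * α⌋ - ⌊t + r₀ * α⌋, ?_⟩
    set m₁ := ⌊t + r * α⌋
    set m₂ := ⌊t + r₀ * α⌋
    have hr1 : (r : ℝ) < q := by exact_mod_cast Finset.mem_range.1 hr.1
    have hr2 : (r₀ : ℝ) < q := by exact_mod_cast Finset.mem_range.1 hr₀.1
    have hr3 : (0 : ℝ) ≤ r := by positivity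
    have hr4 : (0 : ℝ) ≤ r₀ := by positivity
    have h5 : |((r : ℝ) - r₀) * (q * α - a)| < 1 := by
      rw [abs_mul]
      have h6 : |(q : ℝ) * α - a| ≤ 1 / q := by
        have : (q : ℝ) * α - a = q * (α - a / q) := by field_simp
        rw [this, abs_mul, abs_of_pos hqR]
        calc _ ≤ (q : ℝ) * (1 / (q : ℝ) ^ 2) := mul_le_mul_of_nonneg_left hα hqR.le
          _ = 1 / q := by field_simp
      have h7 : |(r : ℝ) - r₀| < q := by rw [abs_lt]; constructor <;> linarith
      calc _ ≤ |(r : ℝ) - r₀| * (1 / q) := mul_le_mul_of_nonneg_left h6 (abs_nonneg _)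
        _ < q * (1 / q) := mul_lt_mul_of_pos_right h7 (by positivity)
        _ = 1 := by field_simp
    have h8 := abs_lt.1 h5
    have h9 : ((((r : ℤ) - r₀) * a - (m₁ - m₂) * q : ℤ) : ℝ) < 2 := by
      push_cast; nlinarith
    have h10 : (-2 : ℝ) < ((((r : ℤ) - r₀) * a - (m₁ - m₂) * q : ℤ) : ℝ) := by
      push_cast; nlinarith
    rw [Finset.mem_Icc]
    have h11 : ((r : ℤ) - r₀) * a - (m₁ - m₂) * q < 2 := by exact_mod_cast h9
    have h12 : -2 < ((r : ℤ) - r₀) * a - (m₁ - m₂) * q := by exact_mod_cast h10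
    omega
  choose! m hm using hex
  calc F.card ≤ (Finset.Icc (-1 : ℤ) 1).card := by
        refine Finset.card_le_card_of_injOn (fun r : ℕ => ((r : ℤ) - r₀) * a - m r * q)
          (fun r hr => hm r hr) ?_
        intro r hr r' hr' hrr
        dsimp only at hrr
        have h1 : (q : ℤ) ∣ ((r : ℤ) - r') * a := ⟨m r - m r', by linear_combination hrr⟩
        have h2 : (q : ℤ) ∣ (r : ℤ) - r' := hc.symm.dvd_of_dvd_mul_right h1
        have h3 : r < q := Finset.mem_range.1 (Finset.mem_filter.1 hr).1
        have h4 : r' < q := Finset.mem_range.1 (Finset.mem_filter.1 hr').1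
        have h5 := Int.eq_zero_of_abs_lt_dvd h2 (by rw [abs_lt]; constructor <;> omega)
        omega
    _ = 3 := by rfl

lemma block_sum (α t : ℝ) (a : ℤ) (q : ℕ) (hq : 0 < q) (hc : IsCoprime a (q : ℤ))
    (hα : |α - a / q| ≤ 1 / (q : ℝ) ^ 2) (P : ℝ) (φ : ℕ → ℝ)
    (h1 : ∀ r, φ r ≤ P) (h2 : ∀ r, φ r * nd (t + r * α) ≤ 1) (hP : 0 ≤ P) :
    ∑ r ∈ Finset.range q, φ r ≤ 6 * P + 6 * q * (1 + Real.log q) := by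
  classical
  have hqR : (0 : ℝ) < q := by exact_mod_cast hq
  set B : ℕ → ℤ := fun r => ⌊(q : ℝ) * Int.fract (t + r * α)⌋ with hB
  set w : ℕ → ℝ := fun j => (if j = 0 then P else (q : ℝ) / j) with hw
  have hw0 : ∀ j, 0 ≤ w j := by intro j; simp only [hw]; split_ifs <;> positivity
  have hBr : ∀ r, 0 ≤ B r ∧ B r < q := by
    intro r
    refine ⟨Int.floor_nonneg.2 (mul_nonneg hqR.le (Int.fract_nonneg _)), ?_⟩
    rw [Int.floor_lt]
    have := Int.fract_lt_one (t + r * α)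
    push_cast
    nlinarith
  have hφ : ∀ r, φ r ≤ w (B r).toNat + w (q - 1 - (B r).toNat) := by
    intro r
    obtain ⟨hb0, hb1⟩ := hBr r
    by_cases c1 : (B r).toNat = 0
    · have : w (B r).toNat = P := by simp [hw, c1]
      rw [this]; linarith [h1 r, hw0 (q - 1 - (B r).toNat)]
    by_cases c2 : q - 1 - (B r).toNat = 0
    · have : w (q - 1 - (B r).toNat) = P := by simp [hw, c2]
      rw [this]; linarith [h1 r, hw0 (B r).toNat]
    have e1 := Int.floor_le ((q : ℝ) * Int.fract (t + r * α))
    have e2 := Int.lt_floor_add_one ((q : ℝ) * Int.fract (t + r * α))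
    have hj : ((B r).toNat : ℝ) = (B r : ℝ) := by
      have := Int.toNat_of_nonneg hb0
      exact_mod_cast this
    have hj2 : ((q - 1 - (B r).toNat : ℕ) : ℝ) = q - 1 - (B r : ℝ) := by
      rw [Nat.cast_sub, Nat.cast_sub, hj]; · simp
      · omega
      · omega
    have hnd : nd (t + r * α) = min (Int.fract (t + r * α)) (1 - Int.fract (t + r * α)) := by
      unfold nd; exact abs_sub_round_eq_min _
    have hA : w (B r).toNat = q / (B r : ℝ) := by simp only [hw, if_neg c1]; rw [hj]
    have hC : w (q - 1 - (B r).toNat) = q / (q - 1 - (B r : ℝ)) := by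
      simp only [hw, if_neg c2]; rw [hj2]
    have p1 : 0 < (B r : ℝ) := by rw [← hj]; exact_mod_cast Nat.pos_of_ne_zero c1
    have p2 : 0 < (q : ℝ) - 1 - (B r : ℝ) := by rw [← hj2]; exact_mod_cast Nat.pos_of_ne_zero c2
    have h3 := h2 r
    rw [hnd] at h3
    change (B r : ℝ) ≤ _ at e1
    change _ < (B r : ℝ) + 1 at e2
    set f := Int.fract (t + r * α)
    by_cases hneg : φ r ≤ 0
    · linarith [hw0 (B r).toNat, hw0 (q - 1 - (B r).toNat)]
    push Not at hneg
    rcases min_choice f (1 - f) with hm | hm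
    · rw [hm] at h3
      have : φ r ≤ q / (B r : ℝ) := by rw [le_div_iff₀ p1]; nlinarith
      rw [hA]; linarith [hw0 (q - 1 - (B r).toNat)]
    · rw [hm] at h3
      have : φ r ≤ q / ((q : ℝ) - 1 - (B r : ℝ)) := by rw [le_div_iff₀ p2]; nlinarith
      rw [hC]; linarith [hw0 (B r).toNat]
  have hsum : ∑ r ∈ Finset.range q, φ r ≤
      ∑ j ∈ Finset.range q, 3 * (w j + w (q - 1 - j)) := by
    rw [← Finset.sum_fiberwise_of_maps_to (s := Finset.range q) (t := Finset.range q)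
      (g := fun r => (B r).toNat) (fun r _ => by
        rw [Finset.mem_range]; have := hBr r; omega) φ]
    refine Finset.sum_le_sum fun j _ => ?_
    have hcard : ((Finset.range q).filter fun r => (B r).toNat = j).card ≤ 3 := by
      refine le_trans (Finset.card_le_card ?_) (bucket_card α t a q hq hc hα j)
      intro r hr
      rw [Finset.mem_filter] at hr ⊢
      refine ⟨hr.1, ?_⟩
      have h3 := hr.2; have := (hBr r).1
      change B r = j
      omega
    calc _ ≤ ∑ r ∈ (Finset.range q).filter (fun r => (B r).toNat = j), (w j + w (q - 1 - j)) :=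
          Finset.sum_le_sum fun r hr => by
            have := hφ r
            rwa [(Finset.mem_filter.1 hr).2] at this
      _ = _ := by rw [Finset.sum_const, nsmul_eq_mul]
      _ ≤ _ := by
        refine mul_le_mul_of_nonneg_right ?_ (add_nonneg (hw0 _) (hw0 _))
        exact_mod_cast hcard
  have hws : ∑ j ∈ Finset.range q, w j ≤ P + q * (1 + Real.log q) := by
    obtain ⟨n, rfl⟩ : ∃ n, q = n + 1 := ⟨q - 1, by omega⟩
    rw [Finset.sum_range_succ']
    have hH := harmonic_le_one_add_log (n + 1)
    have hH2 : (harmonic n : ℝ) ≤ harmonic (n + 1) := by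
      rw [harmonic_succ]; push_cast; linarith [show (0:ℝ) ≤ ((n : ℝ) + 1)⁻¹ by positivity]
    have : ∑ j ∈ Finset.range n, w (j + 1) = ((n + 1 : ℕ) : ℝ) * (harmonic n : ℝ) := by
      rw [harmonic]; push_cast; rw [Finset.mul_sum]
      refine Finset.sum_congr rfl fun j _ => ?_
      simp only [hw, if_neg (Nat.succ_ne_zero j)]; push_cast; rw [div_eq_mul_inv]
    rw [this]
    have hw00 : w 0 = P := by simp [hw]
    rw [hw00]
    nlinarith
  rw [← Finset.mul_sum, Finset.sum_add_distrib, Finset.sum_range_reflect w q] at hsum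
  nlinarith

/-- The standard reciprocal sum estimate. -/
lemma recip_sum (α : ℝ) (a : ℤ) (q : ℕ) (hq : 0 < q) (hc : IsCoprime a (q : ℤ))
    (hα : |α - a / q| ≤ 1 / (q : ℝ) ^ 2) (P : ℝ) (hP : 0 ≤ P) (N : ℕ) (φ : ℕ → ℝ)
    (h0 : ∀ n, 0 ≤ φ n) (h1 : ∀ n, φ n ≤ P) (h2 : ∀ n, φ n * nd (n * α) ≤ 1)  :
    ∑ n ∈ Finset.range N, φ n ≤ (N / q + 1) * (6 * P + 6 * q * (1 + Real.log q)) := by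
  have hqR : (0 : ℝ) < q := by exact_mod_cast hq
  have hblocks : ∀ k : ℕ, ∑ n ∈ Finset.range (k * q), φ n ≤
      k * (6 * P + 6 * q * (1 + Real.log q)) := by
    intro k
    induction k with
    | zero => simp
    | succ k ih =>
      rw [Nat.succ_mul, Finset.sum_range_add]
      have := block_sum α ((k * q : ℕ) * α) a q hq hc hα P (fun r => φ (k * q + r))
        (fun r => h1 _) (fun r => by
          have := h2 (k * q + r); push_cast at this ⊢; rwa [add_mul] at this) hP
      push_cast
      linarith
  set k := N / q + 1 with hk
  have hNk : N ≤ k * q := by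
    have := Nat.div_add_mod N q
    have := Nat.mod_lt N hq
    rw [hk]; nlinarith
  calc _ ≤ ∑ n ∈ Finset.range (k * q), φ n :=
        Finset.sum_le_sum_of_subset_of_nonneg (Finset.range_mono hNk) fun n _ _ => h0 n
    _ ≤ k * (6 * P + 6 * q * (1 + Real.log q)) := hblocks k
    _ ≤ _ := by
      have : 0 ≤ 6 * P + 6 * q * (1 + Real.log q) := by
        have : 0 ≤ Real.log q := Real.log_natCast_nonneg q
        positivity
      refine mul_le_mul_of_nonneg_right ?_ this
      rw [hk]; push_cast
      have := Nat.cast_div_le (α := ℝ) (m := N) (n := q)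
      linarith

/-- `T` dominates logarithms and divisor functions up to `P ^ 50`. -/
structure Fud (P T : ℝ) : Prop where
  hundred_le : 100 ≤ T
  log_le : Real.log P + 1 ≤ T
  div_le : ∀ n : ℕ, n ≠ 0 → (n : ℝ) ≤ P ^ 50 → (n.divisors.card : ℝ) ≤ T

lemma eventually_fud (τ : ℝ) (hτ : 0 < τ) : ∃ P₀ : ℝ, 1 ≤ P₀ ∧ ∀ P ≥ P₀, Fud P (P ^ τ) := by
  obtain ⟨C, hC⟩ := divisor_bound (τ / 100) (by positivity)
  have t1 : ∀ᶠ P : ℝ in atTop, 100 ≤ P ^ τ := (tendsto_rpow_atTop hτ).eventually_ge_atTop 100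
  have t2 : ∀ᶠ P : ℝ in atTop, C ≤ P ^ (τ / 2) :=
    (tendsto_rpow_atTop (by positivity)).eventually_ge_atTop C
  have t3 : ∀ᶠ P : ℝ in atTop, Real.log P ≤ (1 / 2) * P ^ τ := by
    have := (isLittleO_log_rpow_atTop hτ).bound (show (0 : ℝ) < 1 / 2 by norm_num)
    filter_upwards [this, eventually_ge_atTop 1] with P h1 h2
    rw [Real.norm_eq_abs, Real.norm_eq_abs, abs_of_nonneg (Real.log_nonneg h2),
      abs_of_nonneg (by positivity)] at h1
    exact h1
  obtain ⟨P₀, hP₀⟩ := eventually_atTop.1 (t1.and (t2.and t3))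
  refine ⟨max P₀ 1, le_max_right _ _, fun P hP => ?_⟩
  obtain ⟨h1, h2, h3⟩ := hP₀ P ((le_max_left _ _).trans hP)
  have hP1 : 1 ≤ P := (le_max_right _ _).trans hP
  refine ⟨h1, by linarith, fun n hn hnP => ?_⟩
  refine (hC n hn).trans ?_
  calc C * (n : ℝ) ^ (τ / 100) ≤ P ^ (τ / 2) * (P ^ 50) ^ (τ / 100) := by
        refine mul_le_mul h2 ?_ (by positivity) (by positivity)
        exact Real.rpow_le_rpow (by positivity) hnP (by positivity)
    _ = P ^ τ := by
      rw [← Real.rpow_natCast, ← Real.rpow_mul (by positivity), ← Real.rpow_add (by positivity)]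
      congr 1; push_cast; ring

/-- The difference polynomial `((x + h m ^ 4) ^ 4 - x ^ 4) / m ^ 4`. -/
def Psi (h m x : ℕ) : ℕ :=
  4 * h * x ^ 3 + 6 * h ^ 2 * m ^ 4 * x ^ 2 + 4 * h ^ 3 * m ^ 8 * x + h ^ 4 * m ^ 12

lemma Psi_mul (h m x : ℕ) : m ^ 4 * Psi h m x + x ^ 4 = (x + h * m ^ 4) ^ 4 := by
  unfold Psi; ring

lemma two_mul_Psi (h m x : ℕ) :
    2 * Psi h m x = h * ((2 * x + h * m ^ 4) * ((2 * x + h * m ^ 4) ^ 2 + (h * m ^ 4) ^ 2)) := by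
  unfold Psi; ring

lemma Psi_add (h m x k : ℕ) : Psi h m (x + k) =
    Psi h m x + h * (k * (3 * (2 * x + k + h * m ^ 4) ^ 2 + (h * m ^ 4) ^ 2 + k ^ 2)) := by
  unfold Psi; ring

def boxI (H M P : ℕ) : Finset (ℕ × ℕ × ℕ) :=
  Finset.Icc 1 H ×ˢ Finset.Icc 1 M ×ˢ Finset.Icc 1 P

lemma card_boxI (H M P : ℕ) : (boxI H M P).card = H * (M * P) := by
  simp [boxI]

def F1 (H M P : ℕ) (β : ℝ) : ℂ := ∑ i ∈ boxI H M P, e (((Psi i.1 i.2.1 i.2.2 : ℕ) : ℤ) * β)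

lemma Psi_le {Y : ℝ} (hY : 2 ≤ Y) {h m x : ℕ} (hh : (h : ℝ) ≤ Y) (hm : (m : ℝ) ≤ Y)
    (hx : (x : ℝ) ≤ 2 * Y) : ((2 * Psi h m x : ℕ) : ℝ) ≤ Y ^ 30 := by
  have h1 : (h : ℝ) ≤ Y ^ 1 := by simpa using hh
  have hx2 : (x : ℝ) ≤ Y ^ 2 := by nlinarith
  unfold Psi
  push_cast
  have hY1 : 1 ≤ Y := by linarith
  have e1 : (h : ℝ) * x ^ 3 ≤ Y * (Y ^ 2) ^ 3 := by gcongr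
  have e2 : (h : ℝ) ^ 2 * m ^ 4 * x ^ 2 ≤ Y ^ 2 * Y ^ 4 * (Y ^ 2) ^ 2 := by gcongr
  have e3 : (h : ℝ) ^ 3 * m ^ 8 * x ≤ Y ^ 3 * Y ^ 8 * Y ^ 2 := by gcongr
  have e4 : (h : ℝ) ^ 4 * m ^ 12 ≤ Y ^ 4 * Y ^ 12 := by gcongr
  have f1 : Y * (Y ^ 2) ^ 3 ≤ Y ^ 16 := by
    rw [show Y * (Y ^ 2) ^ 3 = Y ^ 7 by ring]; exact pow_le_pow_right₀ hY1 (by norm_num)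
  have f2 : Y ^ 2 * Y ^ 4 * (Y ^ 2) ^ 2 ≤ Y ^ 16 := by
    rw [show Y ^ 2 * Y ^ 4 * (Y ^ 2) ^ 2 = Y ^ 10 by ring]; exact pow_le_pow_right₀ hY1 (by norm_num)
  have f3 : Y ^ 3 * Y ^ 8 * Y ^ 2 ≤ Y ^ 16 := by
    rw [show Y ^ 3 * Y ^ 8 * Y ^ 2 = Y ^ 13 by ring]; exact pow_le_pow_right₀ hY1 (by norm_num)
  have f4 : Y ^ 4 * Y ^ 12 = Y ^ 16 := by ring
  have f5 : (32 : ℝ) ≤ Y ^ 14 := by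
    calc (32 : ℝ) ≤ 2 ^ 14 := by norm_num
      _ ≤ Y ^ 14 := by gcongr
  calc _ ≤ 32 * Y ^ 16 := by nlinarith [pow_nonneg (show (0:ℝ) ≤ Y by linarith) 16]
    _ ≤ Y ^ 14 * Y ^ 16 := by gcongr
    _ = Y ^ 30 := by ring

lemma pow30_le {Y : ℝ} (hY : 2 ≤ Y) : Y ^ 30 ≤ Y ^ 50 :=
  pow_le_pow_right₀ (by linarith) (by norm_num)

lemma Psi_pos {h m x : ℕ} (hh : 0 < h) (hx : 0 < x) : 0 < Psi h m x := by
  unfold Psi; positivity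

/-- second moment of `F1` -/
lemma F1_sq {Y T : ℝ} (hF : Fud Y T) (hY : 2 ≤ Y) {H M P : ℕ} (hH : (H : ℝ) ≤ Y)
    (hM : (M : ℝ) ≤ Y) (hP : (P : ℝ) ≤ Y) :
    ∫ β in (0:ℝ)..1, ‖F1 H M P β‖ ^ 2 ≤ (H * (M * P) : ℝ) * T ^ 2 := by
  classical
  have := integral_normSq_le (boxI H M P) (fun i => ((Psi i.1 i.2.1 i.2.2 : ℕ) : ℤ)) (T ^ 2) ?_
  · rw [card_boxI] at this; push_cast at this ⊢; exact this
  rintro ⟨h, m, x⟩ hi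
  simp only [boxI, Finset.mem_product, Finset.mem_Icc] at hi
  obtain ⟨⟨hh1, hh2⟩, ⟨hm1, hm2⟩, hx1, hx2⟩ := hi
  set n := Psi h m x with hn
  have hn0 : 0 < n := Psi_pos hh1 hx1
  have hb : ((2 * n : ℕ) : ℝ) ≤ Y ^ 50 := by
    refine (Psi_le hY ?_ ?_ ?_).trans (pow30_le hY)
    · exact le_trans (by exact_mod_cast hh2) hH
    · exact le_trans (by exact_mod_cast hm2) hM
    · have : (x : ℝ) ≤ Y := le_trans (by exact_mod_cast hx2) hP
      linarith
  have hb1 : ((n : ℕ) : ℝ) ≤ Y ^ 50 := by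
    refine le_trans ?_ hb; push_cast; linarith [show (0:ℝ) ≤ n by positivity]
  have d1 := hF.div_le n hn0.ne' hb1
  have d2 := hF.div_le (2 * n) (by omega) hb
  have hT : 0 ≤ T := by linarith [hF.hundred_le]
  calc _ ≤ (((2 * n).divisors ×ˢ (2 * n).divisors).card : ℝ) := by
        norm_cast
        refine Finset.card_le_card_of_injOn
          (fun j : ℕ × ℕ × ℕ => (j.1, 2 * j.2.2 + j.1 * j.2.1 ^ 4)) ?_ ?_
        · rintro ⟨h', m', x'⟩ hj
          rw [Finset.mem_coe, Finset.mem_filter] at hj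
          have hnn : n = Psi h' m' x' := by exact_mod_cast hj.2
          simp only [Finset.coe_product, Set.mem_prod, Finset.mem_coe, Nat.mem_divisors]
          have h2 := two_mul_Psi h' m' x'
          rw [← hnn] at h2
          refine ⟨⟨⟨_, h2⟩, by omega⟩, ⟨⟨h' * ((2 * x' + h' * m' ^ 4) ^ 2 + (h' * m' ^ 4) ^ 2), ?_⟩,
            by omega⟩⟩
          rw [h2]; ring
        · rintro ⟨h', m', x'⟩ hj ⟨h'', m'', x''⟩ hj' heq
          rw [Finset.mem_coe, Finset.mem_filter] at hj hj'
          simp only [Prod.mk.injEq] at heq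
          obtain ⟨rfl, hz⟩ := heq
          have hnn : n = Psi h' m' x' := by exact_mod_cast hj.2
          have hnn' : n = Psi h' m'' x'' := by exact_mod_cast hj'.2
          have hb := hj.1
          simp only [boxI, Finset.mem_product, Finset.mem_Icc] at hb
          have h2 := two_mul_Psi h' m' x'
          have h2' := two_mul_Psi h' m'' x''
          rw [← hnn] at h2
          rw [← hnn', ← hz] at h2'
          rw [h2] at h2'
          have h3 := Nat.eq_of_mul_eq_mul_left hb.1.1 h2'
          have h4 := Nat.eq_of_mul_eq_mul_left (by omega) h3
          have h5 : (h' * m' ^ 4) ^ 2 = (h' * m'' ^ 4) ^ 2 := by omega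
          have h6 : h' * m' ^ 4 = h' * m'' ^ 4 := Nat.pow_left_injective two_ne_zero h5
          have h7 : m' ^ 4 = m'' ^ 4 := Nat.eq_of_mul_eq_mul_left hb.1.1 h6
          have h8 : m' = m'' := Nat.pow_left_injective (by norm_num) h7
          subst h8
          have : x' = x'' := by omega
          rw [this]
    _ = (2 * n).divisors.card * (2 * n).divisors.card := by rw [Finset.card_product]; push_cast; rfl
    _ ≤ T * T := mul_le_mul d2 d2 (by positivity) hT
    _ = T ^ 2 := by ring

def pairsI (n : ℕ) : Finset (ℕ × ℕ) :=
  (Finset.Icc 1 n ×ˢ Finset.Icc 1 n).filter fun p => p.1 + p.2 ≤ n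

lemma sum_sq_eq (n : ℕ) (f : ℕ → ℝ) :
    ((‖∑ x ∈ Finset.Icc 1 n, e (f x)‖ ^ 2 : ℝ) : ℂ) =
      n + (∑ p ∈ pairsI n, e (f (p.2 + p.1) - f p.2)) +
        (starRingEnd ℂ) (∑ p ∈ pairsI n, e (f (p.2 + p.1) - f p.2)) := by
  classical
  rw [normSq_eq, map_sum, Finset.sum_mul_sum, ← Finset.sum_product']
  have hsplit : ∀ p : ℕ × ℕ, e (f p.1) * (starRingEnd ℂ) (e (f p.2)) =
      (if p.1 = p.2 then 1 else 0) + (if p.2 < p.1 then e (f p.1 - f p.2) else 0) +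
      (if p.1 < p.2 then e (f p.1 - f p.2) else 0) := by
    rintro ⟨x, y⟩
    rw [← e_sub]
    rcases lt_trichotomy x y with hxy | rfl | hxy
    · simp [hxy, hxy.ne, hxy.not_gt]
    · simp [e_zero]
    · simp [hxy, hxy.ne', hxy.not_gt]
  rw [Finset.sum_congr rfl fun p _ => hsplit p, Finset.sum_add_distrib, Finset.sum_add_distrib]
  congr 1
  · congr 1
    · rw [Finset.sum_product]
      simp only [Finset.sum_ite_eq, Finset.sum_boole]
      rw [Finset.filter_true_of_mem fun x hx => hx]
      simp
    · rw [← Finset.sum_filter]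
      refine Finset.sum_nbij' (fun p => (p.1 - p.2, p.2)) (fun p => (p.2 + p.1, p.2)) ?_ ?_ ?_ ?_ ?_
      · rintro ⟨x, y⟩ hp
        simp only [pairsI, Finset.mem_filter, Finset.mem_product, Finset.mem_Icc] at hp ⊢
        omega
      · rintro ⟨x, y⟩ hp
        simp only [pairsI, Finset.mem_filter, Finset.mem_product, Finset.mem_Icc] at hp ⊢
        omega
      · rintro ⟨x, y⟩ hp
        simp only [Finset.mem_filter, Finset.mem_product, Finset.mem_Icc] at hp ⊢
        simp; omega
      · rintro ⟨x, y⟩ hp; simp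
      · rintro ⟨x, y⟩ hp
        simp only [Finset.mem_filter, Finset.mem_product, Finset.mem_Icc] at hp ⊢
        rw [show y + (x - y) = x by omega]
  · rw [← Finset.sum_filter, map_sum]
    refine Finset.sum_nbij' (fun p => (p.2 - p.1, p.1)) (fun p => (p.2, p.2 + p.1)) ?_ ?_ ?_ ?_ ?_
    · rintro ⟨x, y⟩ hp
      simp only [pairsI, Finset.mem_filter, Finset.mem_product, Finset.mem_Icc] at hp ⊢
      omega
    · rintro ⟨x, y⟩ hp
      simp only [pairsI, Finset.mem_filter, Finset.mem_product, Finset.mem_Icc] at hp ⊢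
      omega
    · rintro ⟨x, y⟩ hp
      simp only [Finset.mem_filter, Finset.mem_product, Finset.mem_Icc] at hp ⊢
      simp; omega
    · rintro ⟨x, y⟩ hp; simp
    · rintro ⟨x, y⟩ hp
      simp only [Finset.mem_filter, Finset.mem_product, Finset.mem_Icc] at hp ⊢
      rw [conj_e, show x + (y - x) = y by omega]; congr 1; ring

lemma sum_sq_eq_re (n : ℕ) (f : ℕ → ℝ) :
    ‖∑ x ∈ Finset.Icc 1 n, e (f x)‖ ^ 2 =
      n + 2 * (∑ p ∈ pairsI n, e (f (p.2 + p.1) - f p.2)).re := by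
  have h1 := congrArg Complex.re (sum_sq_eq n f)
  rw [Complex.ofReal_re] at h1
  rw [h1]; simp; ring

lemma sum_pairsI {E : Type*} [AddCommMonoid E] (n : ℕ) (f : ℕ × ℕ → E) :
    ∑ p ∈ pairsI n, f p = ∑ k ∈ Finset.Icc 1 n, ∑ x ∈ Finset.Icc 1 (n - k), f (k, x) := by
  rw [pairsI, Finset.sum_filter, Finset.sum_product]
  refine Finset.sum_congr rfl fun k hk => ?_
  rw [← Finset.sum_filter]
  refine Finset.sum_congr ?_ fun _ _ => rfl
  ext x
  simp only [Finset.mem_filter, Finset.mem_Icc] at hk ⊢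
  omega

/-- van der Corput / Weyl differencing -/
lemma weyl_diff (n : ℕ) (f : ℕ → ℝ) :
    ‖∑ x ∈ Finset.Icc 1 n, e (f x)‖ ^ 2 ≤
      n + 2 * ∑ k ∈ Finset.Icc 1 n, ‖∑ x ∈ Finset.Icc 1 (n - k), e (f (x + k) - f x)‖ := by
  rw [sum_sq_eq_re, sum_pairsI]
  have := (Complex.re_le_norm (∑ k ∈ Finset.Icc 1 n, ∑ x ∈ Finset.Icc 1 (n - k),
    e (f (x + k) - f x))).trans (norm_sum_le _ _)
  linarith

lemma card_fiber_le {α β : Type*} [DecidableEq β] (S : Finset α) (D : Finset β) (f : α → β)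
    (hf : ∀ a ∈ S, f a ∈ D) (B : ℝ) (hB : ∀ b ∈ D, ((S.filter fun a => f a = b).card : ℝ) ≤ B) :
    (S.card : ℝ) ≤ D.card * B := by
  rw [Finset.card_eq_sum_card_fiberwise hf]
  push_cast
  refine (Finset.sum_le_sum hB).trans ?_
  simp

/-- The second difference of `Psi` in `x`. -/
def Psi2 (h m k x : ℕ) : ℕ := h * (k * (3 * (2 * x + k + h * m ^ 4) ^ 2 + (h * m ^ 4) ^ 2 + k ^ 2))

def boxII (H M P : ℕ) : Finset ((ℕ × ℕ) × (ℕ × ℕ)) :=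
  (Finset.Icc 1 H ×ˢ Finset.Icc 1 M) ×ˢ pairsI P

def F2 (H M P : ℕ) (β : ℝ) : ℂ :=
  ∑ i ∈ boxII H M P, e (((Psi2 i.1.1 i.1.2 i.2.1 i.2.2 : ℕ) : ℤ) * β)

lemma continuous_F1 (H M P : ℕ) : Continuous (F1 H M P) := by
  unfold F1; fun_prop

lemma continuous_F2 (H M P : ℕ) : Continuous (F2 H M P) := by
  unfold F2; fun_prop

lemma card_pairsI_le (n : ℕ) : (pairsI n).card ≤ n * n := by
  refine (Finset.card_filter_le _ _).trans ?_
  simp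

lemma card_boxII_le (H M P : ℕ) : (boxII H M P).card ≤ H * M * (P * P) := by
  rw [boxII, Finset.card_product, Finset.card_product]
  simpa using Nat.mul_le_mul_left (H * M) (card_pairsI_le P)

def S1 (P h m : ℕ) (β : ℝ) : ℂ := ∑ x ∈ Finset.Icc 1 P, e (((Psi h m x : ℕ) : ℤ) * β)

lemma F1_eq (H M P : ℕ) (β : ℝ) :
    F1 H M P β = ∑ p ∈ Finset.Icc 1 H ×ˢ Finset.Icc 1 M, S1 P p.1 p.2 β := by
  simp only [F1, boxI, S1, Finset.sum_product]

lemma F1_normSq_le (H M P : ℕ) (β : ℝ) :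
    ‖F1 H M P β‖ ^ 2 ≤ (H * M : ℝ) * (H * M * P + 2 * ‖F2 H M P β‖) := by
  rw [F1_eq]
  have h1 : ‖∑ p ∈ Finset.Icc 1 H ×ˢ Finset.Icc 1 M, S1 P p.1 p.2 β‖ ^ 2 ≤
      (H * M : ℝ) * ∑ p ∈ Finset.Icc 1 H ×ˢ Finset.Icc 1 M, ‖S1 P p.1 p.2 β‖ ^ 2 := by
    refine (pow_le_pow_left₀ (norm_nonneg _) (norm_sum_le _ _) 2).trans ?_
    refine sq_sum_le_card_mul_sum_sq.trans (le_of_eq ?_)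
    simp
  refine h1.trans (mul_le_mul_of_nonneg_left ?_ (by positivity))
  have h2 : ∑ p ∈ Finset.Icc 1 H ×ˢ Finset.Icc 1 M, ‖S1 P p.1 p.2 β‖ ^ 2 =
      H * M * P + 2 * (F2 H M P β).re := by
    have h3 : ∀ p ∈ Finset.Icc 1 H ×ˢ Finset.Icc 1 M, ‖S1 P p.1 p.2 β‖ ^ 2 =
        P + 2 * (∑ q ∈ pairsI P, e (((Psi2 p.1 p.2 q.1 q.2 : ℕ) : ℤ) * β)).re := by
      intro p _
      rw [S1, sum_sq_eq_re]
      congr 3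
      refine Finset.sum_congr rfl fun q _ => ?_
      rw [Psi_add, Psi2]; congr 1; push_cast; ring
    rw [Finset.sum_congr rfl h3, Finset.sum_add_distrib, ← Finset.mul_sum, ← Complex.re_sum, F2, boxII]
    simp only [Finset.sum_const, Finset.card_product, Nat.card_Icc, Complex.re_sum,
      Finset.sum_product _ (pairsI P), nsmul_eq_mul, Nat.add_sub_cancel, Nat.cast_mul]
  rw [h2]
  have := Complex.re_le_norm (F2 H M P β)
  linarith

lemma F2_sq {Y T : ℝ} (hF : Fud Y T) (hY : 2 ≤ Y) {H M P : ℕ} (hH : (H : ℝ) ≤ Y)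
    (hM : (M : ℝ) ≤ Y) (hP : (P : ℝ) ≤ Y) :
    ∫ β in (0:ℝ)..1, ‖F2 H M P β‖ ^ 2 ≤ (H * M * (P * P) : ℝ) * T ^ 5 := by
  classical
  have hT : 100 ≤ T := hF.hundred_le
  have := integral_normSq_le (boxII H M P)
    (fun i => ((Psi2 i.1.1 i.1.2 i.2.1 i.2.2 : ℕ) : ℤ)) (T ^ 5) ?_
  · refine this.trans (mul_le_mul_of_nonneg_right ?_ (by positivity))
    exact_mod_cast card_boxII_le H M P
  rintro ⟨⟨h, m⟩, ⟨k, x⟩⟩ hi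
  simp only [boxII, pairsI, Finset.mem_product, Finset.mem_filter, Finset.mem_Icc] at hi
  obtain ⟨⟨⟨hh1, hh2⟩, hm1, hm2⟩, ⟨⟨hk1, hk2⟩, hx1, hx2⟩, hkx⟩ := hi
  set n := Psi2 h m k x with hn
  have hn0 : 0 < n := by rw [hn]; unfold Psi2; positivity
  have hb1 : ((n : ℕ) : ℝ) ≤ Y ^ 50 := by
    have h1 : n ≤ Psi h m (x + k) := by rw [Psi_add, hn, Psi2]; omega
    have h2 : ((2 * Psi h m (x + k) : ℕ) : ℝ) ≤ Y ^ 30 := by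
      refine Psi_le hY ?_ ?_ ?_
      · exact le_trans (by exact_mod_cast hh2) hH
      · exact le_trans (by exact_mod_cast hm2) hM
      · have : ((x + k : ℕ) : ℝ) ≤ P := by exact_mod_cast (by omega : x + k ≤ P)
        linarith
    refine le_trans ?_ (h2.trans (pow30_le hY))
    exact_mod_cast (by omega : n ≤ 2 * Psi h m (x + k))
  have d1 := hF.div_le n hn0.ne' hb1
  refine (card_fiber_le _ (n.divisors ×ˢ n.divisors) (fun i => (i.1.1, i.2.1)) ?_ (6 * T * T) ?_).trans ?_
  · rintro ⟨⟨h', m'⟩, ⟨k', x'⟩⟩ hj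
    rw [Finset.mem_filter] at hj
    have hnn : n = Psi2 h' m' k' x' := by exact_mod_cast hj.2
    simp only [Finset.mem_product, Nat.mem_divisors]
    rw [Psi2] at hnn
    refine ⟨⟨⟨_, hnn⟩, hn0.ne'⟩, ⟨h' * (3 * (2 * x' + k' + h' * m' ^ 4) ^ 2 + (h' * m' ^ 4) ^ 2 + k' ^ 2), ?_⟩, hn0.ne'⟩
    rw [hnn]; ring
  · rintro ⟨h₀, k₀⟩ hb
    simp only [Finset.mem_product, Nat.mem_divisors] at hb
    rcases Finset.eq_empty_or_nonempty ((((boxII H M P).filter fun j => ((n : ℕ) : ℤ) =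
      ((Psi2 j.1.1 j.1.2 j.2.1 j.2.2 : ℕ) : ℤ)).filter fun a => (a.1.1, a.2.1) = (h₀, k₀))) with he | hne
    · simp only [he]; simp; positivity
    obtain ⟨⟨⟨h1, m1⟩, ⟨k1, x1⟩⟩, hw⟩ := hne
    rw [Finset.mem_filter, Finset.mem_filter] at hw
    obtain ⟨⟨hw1, hw2⟩, hw3⟩ := hw
    simp only [Prod.mk.injEq] at hw3
    obtain ⟨rfl, rfl⟩ := hw3
    simp only [boxII, pairsI, Finset.mem_product, Finset.mem_filter, Finset.mem_Icc] at hw1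
    have hw2' : n = Psi2 h1 m1 k1 x1 := by exact_mod_cast hw2
    set N := 3 * (2 * x1 + k1 + h1 * m1 ^ 4) ^ 2 + (h1 * m1 ^ 4) ^ 2 with hN
    have hN0 : 0 < N := by
      have : 0 < 2 * x1 + k1 + h1 * m1 ^ 4 := by omega
      rw [hN]; positivity
    have hNn : N ≤ n := by
      rw [hw2', Psi2]
      calc N ≤ N + k1 ^ 2 := Nat.le_add_right _ _
        _ ≤ k1 * (N + k1 ^ 2) := Nat.le_mul_of_pos_left _ (by omega)
        _ ≤ _ := Nat.le_mul_of_pos_left _ (by omega)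
    have dN := hF.div_le N hN0.ne' (le_trans (by exact_mod_cast hNn) hb1)
    have key := card_three_sq_add_sq_le N hN0.ne'
      ((((boxII H M P).filter fun j => ((n : ℕ) : ℤ) =
      ((Psi2 j.1.1 j.1.2 j.2.1 j.2.2 : ℕ) : ℤ)).filter fun a => (a.1.1, a.2.1) = (h1, k1)).image
        fun a => (2 * a.2.2 + a.2.1 + a.1.1 * a.1.2 ^ 4, a.1.1 * a.1.2 ^ 4)) ?_
    · rw [Finset.card_image_of_injOn] at key
      · calc _ ≤ ((6 * N.divisors.card * N.divisors.card : ℕ) : ℝ) := by exact_mod_cast key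
          _ = 6 * N.divisors.card * N.divisors.card := by push_cast; ring
          _ ≤ 6 * T * T := by gcongr
      · rintro ⟨⟨h2, m2⟩, ⟨k2, x2⟩⟩ ha ⟨⟨h3, m3⟩, ⟨k3, x3⟩⟩ hb' hab
        rw [Finset.mem_coe, Finset.mem_filter] at ha hb'
        simp only [Prod.mk.injEq] at ha hb' hab
        obtain ⟨_, rfl, rfl⟩ := ha
        obtain ⟨_, rfl, rfl⟩ := hb'
        have h5 : m2 ^ 4 = m3 ^ 4 := Nat.eq_of_mul_eq_mul_left hw1.1.1.1 hab.2
        have h6 : m2 = m3 := Nat.pow_left_injective (by norm_num) h5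
        subst h6
        have : x2 = x3 := by omega
        rw [this]
    · intro p hp
      obtain ⟨⟨⟨h2, m2⟩, ⟨k2, x2⟩⟩, ha, rfl⟩ := Finset.mem_image.1 hp
      rw [Finset.mem_filter, Finset.mem_filter] at ha
      obtain ⟨⟨ha1, ha2⟩, ha3⟩ := ha
      simp only [Prod.mk.injEq] at ha3
      obtain ⟨rfl, rfl⟩ := ha3
      simp only [boxII, pairsI, Finset.mem_product, Finset.mem_filter, Finset.mem_Icc] at ha1
      have ha2' : n = Psi2 h2 m2 k2 x2 := by exact_mod_cast ha2
      rw [hw2', Psi2, Psi2] at ha2'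
      have h3 := Nat.eq_of_mul_eq_mul_left (by omega) (Nat.eq_of_mul_eq_mul_left (by omega) ha2')
      refine ⟨by dsimp only; omega, ?_⟩
      dsimp only; omega
  · rw [Finset.card_product]; push_cast
    calc (n.divisors.card : ℝ) * n.divisors.card * (6 * T * T) ≤ T * T * (6 * T * T) := by gcongr
      _ = 6 * T ^ 4 := by ring
      _ ≤ T * T ^ 4 := by gcongr; linarith
      _ = T ^ 5 := by ring

lemma F1_sq_mul {H M P : ℕ} {w : ℝ → ℝ} (hw : Continuous w) (hw0 : ∀ x, 0 ≤ w x) :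
    ∫ β in (0:ℝ)..1, ‖F1 H M P β‖ ^ 2 * w β ≤
      (H * M : ℝ) * (H * M * P * (∫ β in (0:ℝ)..1, w β) +
        2 * ((∫ β in (0:ℝ)..1, ‖F2 H M P β‖ ^ 2) ^ (1 / 2 : ℝ) *
          (∫ β in (0:ℝ)..1, w β ^ 2) ^ (1 / 2 : ℝ))) := by
  have c1 := continuous_F1 H M P
  have c2 := continuous_F2 H M P
  have h1 : ∫ β in (0:ℝ)..1, ‖F1 H M P β‖ ^ 2 * w β ≤
      ∫ β in (0:ℝ)..1, (H * M : ℝ) * (H * M * P * w β + 2 * (‖F2 H M P β‖ * w β)) := by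
    refine integral01_mono (by fun_prop) (by fun_prop) fun x => ?_
    calc _ ≤ ((H * M : ℝ) * (H * M * P + 2 * ‖F2 H M P x‖)) * w x :=
          mul_le_mul_of_nonneg_right (F1_normSq_le H M P x) (hw0 x)
      _ = _ := by ring
  refine h1.trans ?_
  rw [intervalIntegral.integral_const_mul, intervalIntegral.integral_add (ii (by fun_prop) _ _)
    (ii (by fun_prop) _ _), intervalIntegral.integral_const_mul, intervalIntegral.integral_const_mul]
  have := cauchy01 (f := fun β => ‖F2 H M P β‖) (g := w) (by fun_prop) hw (fun _ => norm_nonneg _) hw0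
  gcongr

def phi (P : ℕ) (β : ℝ) (n : ℕ) : ℝ := if nd (n * β) = 0 then P else min (P : ℝ) (1 / nd (n * β))

lemma phi_nonneg (P : ℕ) (β : ℝ) (n : ℕ) : 0 ≤ phi P β n := by
  unfold phi
  have := nd_nonneg (n * β)
  split_ifs <;> positivity

lemma phi_le (P : ℕ) (β : ℝ) (n : ℕ) : phi P β n ≤ P := by
  unfold phi
  split_ifs
  · exact le_rfl
  · exact min_le_left _ _

lemma phi_mul_nd (P : ℕ) (β : ℝ) (n : ℕ) : phi P β n * nd (n * β) ≤ 1 := by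
  unfold phi
  have h0 := nd_nonneg (n * β)
  split_ifs with h
  · rw [h]; simp
  · have h1 : 0 < nd (n * β) := lt_of_le_of_ne h0 (Ne.symm h)
    calc _ ≤ 1 / nd (n * β) * nd (n * β) := mul_le_mul_of_nonneg_right (min_le_right _ _) h0
      _ = 1 := by field_simp

lemma linear_sum_le {P N n : ℕ} (hN : N ≤ P) (β c : ℝ) :
    ‖∑ x ∈ Finset.Icc 1 N, e (x * (n * β) + c)‖ ≤ phi P β n := by
  have h1 : ‖∑ x ∈ Finset.Icc 1 N, e (x * (n * β) + c)‖ =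
      ‖∑ x ∈ Finset.range N, e (x * (n * β))‖ := by
    have : ∑ x ∈ Finset.Icc 1 N, e (x * (n * β) + c) =
        (∑ x ∈ Finset.range N, e (x * (n * β))) * e (n * β + c) := by
      have h0 := Finset.sum_Ico_add' (fun x : ℕ => e (x * (n * β) + c)) 0 N 1
      rw [Finset.sum_mul, Finset.range_eq_Ico]
      refine Eq.trans ?_ (h0.symm.trans ?_)
      · rfl
      refine Finset.sum_congr rfl fun x _ => ?_
      rw [← e_add]; congr 1; push_cast; ring
    rw [this, norm_mul, norm_e, mul_one]
  rw [h1]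
  have h2 : ‖∑ x ∈ Finset.range N, e (x * (n * β))‖ ≤ P :=
    (norm_sum_e_le _ _).trans (by simpa using hN)
  unfold phi
  split_ifs with h
  · exact h2
  · refine le_min h2 ?_
    rw [le_div_iff₀ (lt_of_le_of_ne (nd_nonneg _) (Ne.symm h))]
    exact geom_sum_nd _ _

lemma S1_pow_four_le (P h m : ℕ) (β : ℝ) :
    ‖S1 P h m β‖ ^ 4 ≤ 10 * P ^ 3 + 16 * P * ∑ k ∈ Finset.Icc 1 P, ∑ l ∈ Finset.Icc 1 P,
      phi P β (24 * h * k * l) := by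
  set D : ℕ → ℝ := fun k => ‖∑ x ∈ Finset.Icc 1 (P - k),
    e (((Psi h m (x + k) : ℕ) : ℤ) * β - ((Psi h m x : ℕ) : ℤ) * β)‖ with hD
  have h1 : ‖S1 P h m β‖ ^ 2 ≤ P + 2 * ∑ k ∈ Finset.Icc 1 P, D k :=
    weyl_diff P (fun x => ((Psi h m x : ℕ) : ℤ) * β)
  have h2 : ∀ k ∈ Finset.Icc 1 P, D k ^ 2 ≤ P + 2 * ∑ l ∈ Finset.Icc 1 P, phi P β (24 * h * k * l) := by
    intro k hk
    have h3 := weyl_diff (P - k) (fun x => ((Psi h m (x + k) : ℕ) : ℤ) * β - ((Psi h m x : ℕ) : ℤ) * β)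
    refine h3.trans (add_le_add (by exact_mod_cast Nat.sub_le _ _)
      (mul_le_mul_of_nonneg_left ?_ (by norm_num)))
    calc _ ≤ ∑ l ∈ Finset.Icc 1 (P - k), phi P β (24 * h * k * l) := by
          refine Finset.sum_le_sum fun l _ => ?_
          have h4 : ∀ x : ℕ, (((Psi h m (x + l + k) : ℕ) : ℤ) * β - ((Psi h m (x + l) : ℕ) : ℤ) * β) -
              (((Psi h m (x + k) : ℕ) : ℤ) * β - ((Psi h m x : ℕ) : ℤ) * β) =
              x * (((24 * h * k * l : ℕ) : ℝ) * β) + (12 * h * k * l * (k + l + h * m ^ 4)) * β := by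
            intro x
            rw [Psi_add h m (x + l) k, Psi_add h m x k]; push_cast; ring
          simp only [h4]
          exact linear_sum_le (by omega) _ _
      _ ≤ _ := Finset.sum_le_sum_of_subset_of_nonneg (Finset.Icc_subset_Icc le_rfl (Nat.sub_le _ _))
          fun _ _ _ => phi_nonneg _ _ _
  have h5 : (∑ k ∈ Finset.Icc 1 P, D k) ^ 2 ≤ P * ∑ k ∈ Finset.Icc 1 P, D k ^ 2 := by
    simpa using sq_sum_le_card_mul_sum_sq (s := Finset.Icc 1 P) (f := D)
  have h6 := Finset.sum_le_sum h2
  rw [Finset.sum_add_distrib, ← Finset.mul_sum] at h6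
  simp only [Finset.sum_const, Nat.card_Icc, Nat.add_sub_cancel, nsmul_eq_mul] at h6
  set W₁ := ∑ k ∈ Finset.Icc 1 P, D k
  set W₂ := ∑ k ∈ Finset.Icc 1 P, ∑ l ∈ Finset.Icc 1 P, phi P β (24 * h * k * l)
  set W₃ := ∑ k ∈ Finset.Icc 1 P, D k ^ 2
  have hP2 : (P : ℝ) ^ 2 ≤ P ^ 3 := by
    rcases Nat.eq_zero_or_pos P with rfl | hP
    · simp
    · exact pow_le_pow_right₀ (by exact_mod_cast hP) (by norm_num)
  have h8 : (P : ℝ) * W₃ ≤ P * (P * P + 2 * W₂) := mul_le_mul_of_nonneg_left h6 (by positivity)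
  calc ‖S1 P h m β‖ ^ 4 = (‖S1 P h m β‖ ^ 2) ^ 2 := by ring
    _ ≤ (P + 2 * W₁) ^ 2 := pow_le_pow_left₀ (by positivity) h1 2
    _ ≤ 2 * P ^ 2 + 8 * W₁ ^ 2 := by nlinarith [sq_nonneg ((P : ℝ) - 2 * W₁)]
    _ ≤ 2 * P ^ 3 + 8 * (P * (P * P + 2 * W₂)) := by nlinarith
    _ = _ := by ring

/-- the multiplicity of the representation `n = 24 h k l`. -/
lemma sum_phi_le {Y T : ℝ} (hF : Fud Y T) (hY : 24 ≤ Y) {H P : ℕ} (hH : (H : ℝ) ≤ Y) (hP : (P : ℝ) ≤ Y)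
    (φ : ℕ → ℝ) (hφ : ∀ n, 0 ≤ φ n) :
    ∑ h ∈ Finset.Icc 1 H, ∑ k ∈ Finset.Icc 1 P, ∑ l ∈ Finset.Icc 1 P, φ (24 * h * k * l) ≤
      T ^ 2 * ∑ n ∈ Finset.range (24 * H * P * P + 1), φ n := by
  classical
  have hT : 100 ≤ T := hF.hundred_le
  set S := Finset.Icc 1 H ×ˢ Finset.Icc 1 P ×ˢ Finset.Icc 1 P with hS
  have h1 : ∑ h ∈ Finset.Icc 1 H, ∑ k ∈ Finset.Icc 1 P, ∑ l ∈ Finset.Icc 1 P, φ (24 * h * k * l) =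
      ∑ i ∈ S, φ (24 * i.1 * i.2.1 * i.2.2) := by
    simp only [hS, Finset.sum_product]
  rw [h1, ← Finset.sum_fiberwise_of_maps_to (t := Finset.range (24 * H * P * P + 1))
    (g := fun i : ℕ × ℕ × ℕ => 24 * i.1 * i.2.1 * i.2.2), Finset.mul_sum]
  · refine Finset.sum_le_sum fun n hn => ?_
    have h2 : ∑ i ∈ S with 24 * i.1 * i.2.1 * i.2.2 = n, φ (24 * i.1 * i.2.1 * i.2.2) =
        ((S.filter fun i => 24 * i.1 * i.2.1 * i.2.2 = n).card : ℝ) * φ n := by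
      rw [Finset.sum_congr rfl (g := fun _ => φ n)]
      · simp
      · intro i hi
        rw [(Finset.mem_filter.1 hi).2]
    rw [h2]
    refine mul_le_mul_of_nonneg_right ?_ (hφ n)
    rcases Finset.eq_empty_or_nonempty (S.filter fun i => 24 * i.1 * i.2.1 * i.2.2 = n) with he | ⟨i, hi⟩
    · rw [he]; simp; positivity
    have hn0 : n ≠ 0 := by
      rw [Finset.mem_filter] at hi
      simp only [hS, Finset.mem_product, Finset.mem_Icc] at hi
      obtain ⟨⟨⟨a1, _⟩, ⟨a2, _⟩, a3, _⟩, rfl⟩ := hi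
      positivity
    have hnY : (n : ℝ) ≤ Y ^ 50 := by
      have h3 : n ≤ 24 * H * P * P := by have := Finset.mem_range.1 hn; omega
      calc (n : ℝ) ≤ ((24 * H * P * P : ℕ) : ℝ) := by exact_mod_cast h3
        _ = 24 * H * P * P := by push_cast; ring
        _ ≤ Y * Y * Y * Y := by gcongr
        _ = Y ^ 4 := by ring
        _ ≤ Y ^ 50 := pow_le_pow_right₀ (by linarith) (by norm_num)
    have hd := hF.div_le n hn0 hnY
    calc _ ≤ ((n.divisors ×ˢ n.divisors).card : ℝ) := by
          norm_cast
          refine Finset.card_le_card_of_injOn (fun i : ℕ × ℕ × ℕ => (i.1, i.2.1)) ?_ ?_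
          · intro i hi
            rw [Finset.mem_coe, Finset.mem_filter] at hi
            simp only [Finset.coe_product, Set.mem_prod, Finset.mem_coe, Nat.mem_divisors]
            exact ⟨⟨⟨24 * i.2.1 * i.2.2, by rw [← hi.2]; ring⟩, hn0⟩, ⟨24 * i.1 * i.2.2, by rw [← hi.2]; ring⟩, hn0⟩
          · rintro ⟨a, b, c⟩ hi ⟨a', b', c'⟩ hj hij
            rw [Finset.mem_coe, Finset.mem_filter] at hi hj
            simp only [hS, Finset.mem_product, Finset.mem_Icc] at hi hj
            simp only [Prod.mk.injEq] at hij
            obtain ⟨rfl, rfl⟩ := hij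
            have h4 := hi.2.trans hj.2.symm
            have h5 : c = c' := Nat.eq_of_mul_eq_mul_left
              (Nat.mul_pos (Nat.mul_pos (by norm_num) (by omega)) (by omega)) h4
            rw [h5]
      _ = n.divisors.card * n.divisors.card := by rw [Finset.card_product]; push_cast; rfl
      _ ≤ T * T := by gcongr
      _ = T ^ 2 := by ring
  · intro i hi
    simp only [hS, Finset.mem_product, Finset.mem_Icc] at hi
    rw [Finset.mem_range, Nat.lt_succ_iff]
    exact Nat.mul_le_mul (Nat.mul_le_mul (Nat.mul_le_mul le_rfl hi.1.2) hi.2.1.2) hi.2.2.2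

lemma sum_pow_four_le {ι : Type*} (s : Finset ι) (f : ι → ℝ) :
    (∑ i ∈ s, f i) ^ 4 ≤ (s.card : ℝ) ^ 3 * ∑ i ∈ s, f i ^ 4 := by
  have h1 := sq_sum_le_card_mul_sum_sq (s := s) (f := f)
  have h2 := sq_sum_le_card_mul_sum_sq (s := s) (f := fun i => f i ^ 2)
  calc (∑ i ∈ s, f i) ^ 4 = ((∑ i ∈ s, f i) ^ 2) ^ 2 := by ring
    _ ≤ (s.card * ∑ i ∈ s, f i ^ 2) ^ 2 := pow_le_pow_left₀ (by positivity) h1 2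
    _ = s.card ^ 2 * (∑ i ∈ s, f i ^ 2) ^ 2 := by ring
    _ ≤ s.card ^ 2 * (s.card * ∑ i ∈ s, (f i ^ 2) ^ 2) := by gcongr
    _ = _ := by
      rw [show ∑ i ∈ s, (f i ^ 2) ^ 2 = ∑ i ∈ s, f i ^ 4 from
        Finset.sum_congr rfl fun _ _ => by ring]
      ring

lemma F1_pow_four_le {Y T : ℝ} (hF : Fud Y T) (hY : 24 ≤ Y) {H M P : ℕ} (hH : (H : ℝ) ≤ Y)
    (hP : (P : ℝ) ≤ Y) (β : ℝ) :
    ‖F1 H M P β‖ ^ 4 ≤ (H * M : ℝ) ^ 3 * (10 * (H * M * P ^ 3) +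
      16 * P * M * (T ^ 2 * ∑ n ∈ Finset.range (24 * H * P * P + 1), phi P β n)) := by
  rw [F1_eq]
  have h1 : ‖∑ p ∈ Finset.Icc 1 H ×ˢ Finset.Icc 1 M, S1 P p.1 p.2 β‖ ^ 4 ≤
      (H * M : ℝ) ^ 3 * ∑ p ∈ Finset.Icc 1 H ×ˢ Finset.Icc 1 M, ‖S1 P p.1 p.2 β‖ ^ 4 := by
    refine (pow_le_pow_left₀ (norm_nonneg _) (norm_sum_le _ _) 4).trans ?_
    have h3 := sum_pow_four_le (Finset.Icc 1 H ×ˢ Finset.Icc 1 M) fun p => ‖S1 P p.1 p.2 β‖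
    simpa using h3
  refine h1.trans (mul_le_mul_of_nonneg_left ?_ (by positivity))
  calc _ ≤ ∑ p ∈ Finset.Icc 1 H ×ˢ Finset.Icc 1 M, (10 * (P : ℝ) ^ 3 + 16 * P * ∑ k ∈ Finset.Icc 1 P,
        ∑ l ∈ Finset.Icc 1 P, phi P β (24 * p.1 * k * l)) :=
        Finset.sum_le_sum fun p _ => S1_pow_four_le _ _ _ _
    _ = 10 * (H * M * P ^ 3) + 16 * P * M * ∑ h ∈ Finset.Icc 1 H, ∑ k ∈ Finset.Icc 1 P,
        ∑ l ∈ Finset.Icc 1 P, phi P β (24 * h * k * l) := by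
        rw [Finset.sum_add_distrib, ← Finset.mul_sum _ _ (16 * (P : ℝ)),
          Finset.sum_product _ _ (fun p : ℕ × ℕ => ∑ k ∈ Finset.Icc 1 P,
          ∑ l ∈ Finset.Icc 1 P, phi P β (24 * p.1 * k * l))]
        simp only [Finset.sum_const, Finset.card_product, Nat.card_Icc, nsmul_eq_mul,
          Nat.add_sub_cancel, Nat.cast_mul]
        rw [← Finset.mul_sum]; ring
    _ ≤ _ := by
        have := sum_phi_le hF hY hH hP (phi P β) (phi_nonneg P β)
        gcongr

set_option maxHeartbeats 800000 in
/-- Weyl's inequality for `F1`. -/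
lemma F1_weyl {Y T : ℝ} (hF : Fud Y T) (hY : 24 ≤ Y) {H M P : ℕ} (hH : (H : ℝ) ≤ Y)
    (hP : (P : ℝ) ≤ Y) {β X L : ℝ} (hX : 1 ≤ X) (hXL : X ≤ L) (hLY : L ≤ Y) (hL : L ≤ T * (H * P ^ 3))
    (hβ : ∀ q : ℕ, 0 < q → (q : ℝ) ≤ X → X / L < nd (q * β)) :
    ‖F1 H M P β‖ ^ 4 ≤ T ^ 6 * (H * M * P : ℝ) ^ 4 * (1 / X + 1 / P) := by
  have hT : 100 ≤ T := hF.hundred_le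
  have hX0 : 0 < X := by linarith
  have hL0 : 0 < L := by linarith
  have hHP : 0 < (H : ℝ) * P ^ 3 := by
    by_contra hcon
    nlinarith
  have hH1 : (1 : ℝ) ≤ H := by
    rcases Nat.eq_zero_or_pos H with rfl | h
    · simp at hHP
    · exact_mod_cast h
  have hP1 : (1 : ℝ) ≤ P := by
    rcases Nat.eq_zero_or_pos P with rfl | h
    · simp at hHP
    · exact_mod_cast h
  set N := ⌊L / X⌋₊ with hN
  have hLX : 1 ≤ L / X := by rw [le_div_iff₀ hX0]; linarith
  have hN1 : 0 < N := Nat.floor_pos.2 hLX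
  obtain ⟨r, hr1, hr2⟩ := Real.exists_rat_abs_sub_le_and_den_le β hN1
  have hq0 : (0 : ℝ) < r.den := by exact_mod_cast r.den_pos
  have hrr : (r : ℝ) = (r.num : ℝ) / (r.den : ℝ) := Rat.cast_def r
  have hN2 : L / X < N + 1 := Nat.lt_floor_add_one _
  have hN3 : (N : ℝ) ≤ L / X := Nat.floor_le (by positivity)
  have hqN : (r.den : ℝ) ≤ N := by exact_mod_cast hr2
  have hqX : X < r.den := by
    by_contra hcon
    push Not at hcon
    have h1 := hβ r.den r.den_pos hcon
    have h2 : nd (r.den * β) ≤ 1 / (N + 1) := by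
      refine (nd_le _ r.num).trans ?_
      have : (r.den : ℝ) * β - r.num = r.den * (β - r) := by
        rw [hrr]; field_simp
      rw [this, abs_mul, abs_of_pos hq0]
      calc _ ≤ (r.den : ℝ) * (1 / ((N + 1) * r.den)) := by gcongr
        _ = 1 / (N + 1) := by field_simp
    have h3 : (1 : ℝ) / (N + 1) ≤ X / L := by
      rw [show X / L = 1 / (L / X) by rw [one_div_div]]
      exact one_div_le_one_div_of_le (by positivity) hN2.le
    linarith
  have hrec := recip_sum β r.num r.den r.den_pos
    (by rw [Int.isCoprime_iff_gcd_eq_one]; simpa [Int.gcd] using r.reduced) ?_ P (by positivity)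
    (24 * H * P * P + 1) (phi P β) (phi_nonneg P β) (phi_le P β) (phi_mul_nd P β)
  swap
  · rw [← hrr]
    refine hr1.trans (one_div_le_one_div_of_le (by positivity) ?_)
    rw [sq]; gcongr; linarith
  have hqL : (r.den : ℝ) ≤ L / X := hqN.trans hN3
  have hlog : 1 + Real.log r.den ≤ T := by
    have h1 : (r.den : ℝ) ≤ Y := hqL.trans ((div_le_self hL0.le hX).trans hLY)
    have := Real.log_le_log hq0 h1
    have := hF.log_le
    linarith
  set q : ℝ := (r.den : ℝ) with hq
  have hqb : q ≤ T * (H * P ^ 3) * (1 / X) := by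
    calc q ≤ L / X := hqL
      _ ≤ T * (H * P ^ 3) / X := by gcongr
      _ = _ := by ring
  have hqinv : 1 / q ≤ 1 / X := one_div_le_one_div_of_le hX0 hqX.le
  have hsum : ∑ n ∈ Finset.range (24 * H * P * P + 1), phi P β n ≤
      7 * T ^ 2 * (H * P ^ 3) * (1 / X + 1 / P) := by
    have hHP1 : (1 : ℝ) ≤ H * P * P := by nlinarith [mul_le_mul hH1 hP1 zero_le_one (by positivity)]
    have hN' : (((24 * H * P * P + 1 : ℕ)) : ℝ) ≤ 25 * (H * P * P) := by push_cast; nlinarith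
    have hX' : 0 < 1 / X := by positivity
    have hP3 : (H : ℝ) * P * P = H * P ^ 3 * (1 / P) := by field_simp
    calc _ ≤ _ := hrec
      _ ≤ (25 * (H * P * P) / q + 1) * (6 * P + 6 * q * T) := by gcongr
      _ = 150 * (H * P ^ 3) * (1 / q) + 150 * T * (H * P * P) + 6 * P + 6 * T * q := by
        field_simp; ring
      _ ≤ 150 * (H * P ^ 3) * (1 / X) + 150 * T * (H * P * P) + 6 * (H * P * P) +
          6 * T * (T * (H * P ^ 3) * (1 / X)) := by
        have h7 : (P : ℝ) ≤ H * P * P := by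
          nlinarith [mul_le_mul hH1 hP1 zero_le_one (by positivity)]
        gcongr
      _ = (H * P ^ 3) * ((150 + 6 * T ^ 2) * (1 / X) + (150 * T + 6) * (1 / P)) := by rw [hP3]; ring
      _ ≤ (H * P ^ 3) * ((7 * T ^ 2) * (1 / X) + (7 * T ^ 2) * (1 / P)) := by
        gcongr <;> nlinarith
      _ = _ := by ring
  refine (F1_pow_four_le hF hY hH hP β).trans ?_
  calc _ ≤ (H * M : ℝ) ^ 3 * (10 * (H * M * P ^ 3) +
      16 * P * M * (T ^ 2 * (7 * T ^ 2 * (H * P ^ 3) * (1 / X + 1 / P)))) := by gcongr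
    _ = (H * M : ℝ) ^ 4 * P ^ 4 * (10 * (1 / P) + 112 * T ^ 4 * (1 / X + 1 / P)) := by
      field_simp; ring
    _ ≤ (H * M : ℝ) ^ 4 * P ^ 4 * (10 * (1 / X + 1 / P) + 112 * T ^ 4 * (1 / X + 1 / P)) := by
      gcongr; linarith [show 0 < 1 / X by positivity]
    _ = (10 + 112 * T ^ 4) * ((H * M * P : ℝ) ^ 4 * (1 / X + 1 / P)) := by ring
    _ ≤ T ^ 6 * ((H * M * P : ℝ) ^ 4 * (1 / X + 1 / P)) := by
      refine mul_le_mul_of_nonneg_right ?_ (by positivity)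
      have h4 : (1 : ℝ) ≤ T ^ 4 := one_le_pow₀ (by linarith)
      have h5 : T ^ 6 = T ^ 4 * T ^ 2 := by ring
      have h6 : 10000 ≤ T ^ 2 := by nlinarith
      rw [h5]
      nlinarith
    _ = _ := by ring

/-- Quartic exponential sum over a finite set. -/
def gs (S : Finset ℕ) (β : ℝ) : ℂ := ∑ x ∈ S, e (((x ^ 4 : ℕ) : ℤ) * β)

@[fun_prop] lemma continuous_gs (S : Finset ℕ) : Continuous (gs S) := by
  unfold gs; fun_prop

lemma h_eq (P R α : ℝ) : h P R α = gs (smoothA P R) α := by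
  unfold h gs
  refine Finset.sum_congr rfl fun x _ => ?_
  congr 1; push_cast; ring

/-- Weight detecting good rational approximations with denominator at most `X`. -/
def lsA (X K : ℕ) (β : ℝ) : ℝ :=
  4 / (K : ℝ) ^ 2 * ∑ q ∈ Finset.Icc 1 X, ‖∑ j ∈ Finset.range K, e (((q * j : ℕ) : ℤ) * β)‖ ^ 2

lemma continuous_lsA (X K : ℕ) : Continuous (lsA X K) := by
  unfold lsA; fun_prop

lemma lsA_nonneg (X K : ℕ) (β : ℝ) : 0 ≤ lsA X K β := by
  unfold lsA; positivity

lemma re_e_ge {x : ℝ} (hx : |x| ≤ 1 / 6) : 1 / 2 ≤ (e x).re := by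
  have h1 : (e x).re = Real.cos (2 * π * x) := by
    unfold e
    rw [show (2 * (π : ℂ) * Complex.I * x) = ((2 * π * x : ℝ) : ℂ) * Complex.I by push_cast; ring,
      Complex.exp_ofReal_mul_I_re]
  rw [h1, ← Real.cos_abs, ← Real.cos_pi_div_three]
  refine Real.cos_le_cos_of_nonneg_of_le_pi (abs_nonneg _) (by linarith [Real.pi_pos]) ?_
  rw [abs_mul, abs_of_pos (by positivity)]
  nlinarith [Real.pi_pos]

lemma e_nat_mul_sub_int (j : ℕ) (x : ℝ) (n : ℤ) : e (j * x) = e (j * (x - n)) := by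
  rw [show (j : ℝ) * x = j * (x - n) + ((j * n : ℤ) : ℝ) by push_cast; ring, e_add_int]

lemma one_le_lsA {X K q : ℕ} {β : ℝ} (hK : 0 < K) (hq : 0 < q) (hqX : q ≤ X)
    (hnd : K * nd (q * β) ≤ 1 / 6) : 1 ≤ lsA X K β := by
  have hK' : (0 : ℝ) < K := by exact_mod_cast hK
  have h1 : (K : ℝ) / 2 ≤ ‖∑ j ∈ Finset.range K, e (((q * j : ℕ) : ℤ) * β)‖ := by
    refine le_trans ?_ (Complex.re_le_norm _)
    rw [Complex.re_sum]
    have h2 : ∀ j ∈ Finset.range K, (1 / 2 : ℝ) ≤ (e (((q * j : ℕ) : ℤ) * β)).re := by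
      intro j hj
      have hjK : (j : ℝ) ≤ K := by exact_mod_cast (Finset.mem_range.1 hj).le
      rw [show (((q * j : ℕ) : ℤ) : ℝ) * β = j * (q * β) by push_cast; ring,
        e_nat_mul_sub_int j _ (round (q * β))]
      refine re_e_ge ?_
      rw [abs_mul, abs_of_nonneg (by positivity : (0 : ℝ) ≤ j)]
      exact (mul_le_mul_of_nonneg_right hjK (abs_nonneg _)).trans hnd
    have h3 := Finset.sum_le_sum h2
    simp only [Finset.sum_const, Finset.card_range, nsmul_eq_mul] at h3
    linarith
  have h4 : ‖∑ j ∈ Finset.range K, e (((q * j : ℕ) : ℤ) * β)‖ ^ 2 ≤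
      ∑ q ∈ Finset.Icc 1 X, ‖∑ j ∈ Finset.range K, e (((q * j : ℕ) : ℤ) * β)‖ ^ 2 :=
    Finset.single_le_sum (f := fun q => ‖∑ j ∈ Finset.range K, e (((q * j : ℕ) : ℤ) * β)‖ ^ 2)
      (fun _ _ => by positivity) (Finset.mem_Icc.2 ⟨hq, hqX⟩)
  unfold lsA
  have h5 : ((K : ℝ) / 2) ^ 2 ≤ ‖∑ j ∈ Finset.range K, e (((q * j : ℕ) : ℤ) * β)‖ ^ 2 :=
    pow_le_pow_left₀ (by positivity) h1 2
  calc (1 : ℝ) = 4 / (K : ℝ) ^ 2 * (K / 2) ^ 2 := by field_simp; norm_num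
    _ ≤ _ := by gcongr; exact h5.trans h4

/-- The large sieve type estimate. -/
lemma integral_lsA {Y T : ℝ} (hF : Fud Y T) (hY : 2 ≤ Y) {N X K : ℕ} (hN : (N : ℝ) ≤ Y)
    (hK : 0 < K) (S : Finset ℕ) (hS : S ⊆ Finset.Icc 1 N) :
    ∫ β in (0:ℝ)..1, lsA X K β * ‖gs S β‖ ^ 2 ≤ 4 / K * (X * N + T * N ^ 2) := by
  classical
  have hT : 100 ≤ T := hF.hundred_le
  have hK' : (0 : ℝ) < K := by exact_mod_cast hK
  have h1 : ∀ β, lsA X K β * ‖gs S β‖ ^ 2 = 4 / (K : ℝ) ^ 2 * ∑ q ∈ Finset.Icc 1 X,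
      ‖∑ i ∈ Finset.range K ×ˢ S, e (((q * i.1 + i.2 ^ 4 : ℕ) : ℤ) * β)‖ ^ 2 := by
    intro β
    unfold lsA
    rw [mul_assoc, Finset.sum_mul]
    congr 1
    refine Finset.sum_congr rfl fun q _ => ?_
    rw [← mul_pow, ← norm_mul, gs, Finset.sum_mul_sum, ← Finset.sum_product']
    congr 2
    refine Finset.sum_congr rfl fun i _ => ?_
    rw [← e_add]; congr 1; push_cast; ring
  simp_rw [h1]
  rw [intervalIntegral.integral_const_mul, intervalIntegral.integral_finsetSum
    (fun i _ => ii (by fun_prop) _ _)]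
  have h2 : ∀ q ∈ Finset.Icc 1 X, ∫ β in (0:ℝ)..1,
      ‖∑ i ∈ Finset.range K ×ˢ S, e (((q * i.1 + i.2 ^ 4 : ℕ) : ℤ) * β)‖ ^ 2 ≤
      K * ∑ p ∈ S ×ˢ S, if (q : ℤ) ∣ (p.1 : ℤ) ^ 4 - (p.2 : ℤ) ^ 4 then (1 : ℝ) else 0 := by
    intro q hq
    have hq1 := (Finset.mem_Icc.1 hq).1
    rw [integral_normSq_trig _ (fun i : ℕ × ℕ => ((q * i.1 + i.2 ^ 4 : ℕ) : ℤ))]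
    rw [Finset.sum_boole]
    rw [← Nat.cast_mul]
    refine Nat.cast_le.2 ?_
    rw [← Finset.card_range K, ← Finset.card_product, Finset.card_range]
    refine Finset.card_le_card_of_injOn (fun p => (p.2.1, (p.1.2, p.2.2))) ?_ ?_
    · rintro ⟨⟨j, x⟩, ⟨j', y⟩⟩ hp
      rw [Finset.mem_coe, Finset.mem_filter] at hp
      simp only [Finset.mem_product] at hp
      simp only [Finset.coe_product, Set.mem_prod, Finset.mem_coe, Finset.mem_filter, Finset.mem_product]
      refine ⟨hp.1.2.1, ⟨hp.1.1.2, hp.1.2.2⟩, (j' : ℤ) - j, ?_⟩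
      have := hp.2
      push_cast at this
      linarith
    · rintro ⟨⟨j, x⟩, ⟨j', y⟩⟩ hp ⟨⟨l, z⟩, ⟨l', w⟩⟩ hp' heq
      rw [Finset.mem_coe, Finset.mem_filter] at hp hp'
      simp only [Prod.mk.injEq] at heq
      obtain ⟨rfl, rfl, rfl⟩ := heq
      have e1 := hp.2
      have e2 := hp'.2
      have e3 : q * j = q * l := by
        dsimp only at e1 e2
        norm_cast at e1 e2
        omega
      have e4 := Nat.eq_of_mul_eq_mul_left hq1 e3
      rw [e4]
  have h3 : ∑ q ∈ Finset.Icc 1 X, ∑ p ∈ S ×ˢ S,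
      (if (q : ℤ) ∣ (p.1 : ℤ) ^ 4 - (p.2 : ℤ) ^ 4 then (1 : ℝ) else 0) ≤ X * N + T * N ^ 2 := by
    rw [Finset.sum_comm]
    have hSc : (S.card : ℝ) ≤ N := by
      have := Finset.card_le_card hS
      simp only [Nat.card_Icc, Nat.add_sub_cancel] at this
      exact_mod_cast this
    have h4 : ∀ p ∈ S ×ˢ S, ∑ q ∈ Finset.Icc 1 X,
        (if (q : ℤ) ∣ (p.1 : ℤ) ^ 4 - (p.2 : ℤ) ^ 4 then (1 : ℝ) else 0) ≤
        (if p.1 = p.2 then (X : ℝ) else 0) + T := by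
      rintro ⟨x, y⟩ hp
      rw [Finset.sum_boole]
      dsimp only
      split_ifs with hxy
      · have : ((Finset.Icc 1 X).filter fun q : ℕ => (q : ℤ) ∣ (x : ℤ) ^ 4 - (y : ℤ) ^ 4).card ≤ X := by
          simpa using Finset.card_filter_le (Finset.Icc 1 X) fun q : ℕ => (q : ℤ) ∣ (x : ℤ) ^ 4 - (y : ℤ) ^ 4
        have : (((Finset.Icc 1 X).filter fun q : ℕ => (q : ℤ) ∣ (x : ℤ) ^ 4 - (y : ℤ) ^ 4).card : ℝ) ≤ X := by
          exact_mod_cast this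
        linarith
      · rw [zero_add]
        set n := ((x : ℤ) ^ 4 - (y : ℤ) ^ 4).natAbs with hn
        have hx := Finset.mem_Icc.1 (hS (Finset.mem_product.1 hp).1)
        have hy := Finset.mem_Icc.1 (hS (Finset.mem_product.1 hp).2)
        dsimp only at hx hy
        have hn0 : n ≠ 0 := by
          rw [hn, Int.natAbs_ne_zero]
          intro h0
          apply hxy
          have : x ^ 4 = y ^ 4 := by exact_mod_cast sub_eq_zero.1 h0
          exact Nat.pow_left_injective (by norm_num) this
        have hnN : n ≤ N ^ 4 := by
          have h5 : x ^ 4 ≤ N ^ 4 := Nat.pow_le_pow_left hx.2 4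
          have h6 : y ^ 4 ≤ N ^ 4 := Nat.pow_le_pow_left hy.2 4
          zify at h5 h6 ⊢
          rw [hn, Int.natCast_natAbs, abs_le]
          constructor <;> nlinarith [pow_nonneg (Int.natCast_nonneg x) 4, pow_nonneg (Int.natCast_nonneg y) 4]
        refine le_trans ?_ (hF.div_le n hn0 ?_)
        · refine Nat.cast_le.2 (Finset.card_le_card fun q hq => ?_)
          rw [Finset.mem_filter] at hq
          rw [Nat.mem_divisors]
          exact ⟨Int.natCast_dvd.1 hq.2, hn0⟩
        · calc (n : ℝ) ≤ (N : ℝ) ^ 4 := by exact_mod_cast hnN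
            _ ≤ Y ^ 4 := by gcongr
            _ ≤ Y ^ 50 := pow_le_pow_right₀ (by linarith) (by norm_num)
    refine (Finset.sum_le_sum h4).trans ?_
    rw [Finset.sum_add_distrib, Finset.sum_product]
    simp only [Finset.sum_ite_eq, Finset.sum_const, nsmul_eq_mul, Finset.card_product, Nat.cast_mul]
    rw [Finset.sum_congr rfl (g := fun _ => (X : ℝ)) (fun x hx => by simp [hx])]
    simp only [Finset.sum_const, nsmul_eq_mul]
    have : (S.card : ℝ) * S.card ≤ N ^ 2 := by rw [sq]; gcongr
    nlinarith
  calc _ ≤ 4 / (K : ℝ) ^ 2 * ∑ q ∈ Finset.Icc 1 X, K * ∑ p ∈ S ×ˢ S,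
        (if (q : ℤ) ∣ (p.1 : ℤ) ^ 4 - (p.2 : ℤ) ^ 4 then (1 : ℝ) else 0) := by
        gcongr with q hq; exact h2 q hq
    _ = 4 / K * ∑ q ∈ Finset.Icc 1 X, ∑ p ∈ S ×ˢ S,
        (if (q : ℤ) ∣ (p.1 : ℤ) ^ 4 - (p.2 : ℤ) ^ 4 then (1 : ℝ) else 0) := by
        rw [← Finset.mul_sum]; field_simp
    _ ≤ _ := by gcongr

lemma min_one_le_rpow {A θ : ℝ} (hA : 0 ≤ A) (h0 : 0 < θ) (h1 : θ ≤ 1) : min 1 A ≤ A ^ θ := by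
  rcases le_total 1 A with h | h
  · rw [min_eq_left h]; exact Real.one_le_rpow h h0.le
  · rw [min_eq_right h]
    rcases hA.eq_or_lt with rfl | hA
    · rw [Real.zero_rpow h0.ne']
    · calc A = A ^ (1 : ℝ) := (Real.rpow_one A).symm
        _ ≤ A ^ θ := Real.rpow_le_rpow_of_exponent_ge hA h h1

/-- Hölder's inequality for the weighted integrals. -/
lemma integral_min_lsA {X K : ℕ} (S : Finset ℕ) {u v : ℕ} {θ : ℝ} (h0 : 0 < θ) (h1 : θ < 1)
    (huv : (v : ℝ) = 2 * θ + u * (1 - θ)) :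
    ∫ β in (0:ℝ)..1, min 1 (lsA X K β) * ‖gs S β‖ ^ v ≤
      (∫ β in (0:ℝ)..1, lsA X K β * ‖gs S β‖ ^ 2) ^ θ *
        (∫ β in (0:ℝ)..1, ‖gs S β‖ ^ u) ^ (1 - θ) := by
  have c1 := continuous_lsA X K
  refine le_trans ?_ (holder01 (f := fun β => lsA X K β * ‖gs S β‖ ^ 2) (g := fun β => ‖gs S β‖ ^ u)
    (by fun_prop) (by fun_prop) (fun β => mul_nonneg (lsA_nonneg _ _ _) (by positivity))
    (fun β => by positivity) h0.le (by linarith) (by ring))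
  refine integral01_mono (by fun_prop) ?_ fun β => ?_
  · refine Continuous.mul ?_ ?_
    · exact Continuous.rpow_const (by fun_prop) fun _ => Or.inr h0.le
    · exact Continuous.rpow_const (by fun_prop) fun _ => Or.inr (by linarith)
  · have hr := norm_nonneg (gs S β)
    have hA := lsA_nonneg X K β
    rw [Real.mul_rpow hA (by positivity), mul_assoc, ← Real.rpow_natCast _ 2, ← Real.rpow_natCast _ u,
      ← Real.rpow_mul hr, ← Real.rpow_mul hr, ← Real.rpow_add_of_nonneg hr (by positivity)
      (mul_nonneg (by positivity) (by linarith)), ← Real.rpow_natCast _ v, huv]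
    push_cast
    exact mul_le_mul_of_nonneg_right (min_one_le_rpow hA h0 h1.le) (by positivity)

lemma pow_le_of_pow_four_le {a b c : ℝ} (ha : 0 ≤ a) (hb : 0 ≤ b) (hc : 0 ≤ c)
    (hab : a ^ 4 ≤ b ^ 4 * c) (p : ℕ) : a ^ p ≤ b ^ p * c ^ ((p : ℝ) / 4) := by
  have h1 : (a ^ 4) ^ ((p : ℝ) / 4) ≤ (b ^ 4 * c) ^ ((p : ℝ) / 4) :=
    Real.rpow_le_rpow (by positivity) hab (by positivity)
  rw [Real.mul_rpow (by positivity) hc, ← Real.rpow_natCast a 4, ← Real.rpow_natCast b 4,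
    ← Real.rpow_mul ha, ← Real.rpow_mul hb] at h1
  rw [show ((4 : ℕ) : ℝ) * ((p : ℝ) / 4) = p by push_cast; ring, Real.rpow_natCast,
    Real.rpow_natCast] at h1
  exact h1

lemma F1_norm_le (H M P : ℕ) (β : ℝ) : ‖F1 H M P β‖ ≤ H * M * P := by
  refine (norm_sum_e_le _ _).trans (le_of_eq ?_)
  rw [card_boxI]; push_cast; ring

def lsK (L : ℝ) (j : ℕ) : ℕ := ⌊L / (6 * 2 ^ j)⌋₊

def rho (p j : ℕ) : ℝ := ((1 / 2 : ℝ) ^ j) ^ ((p : ℝ) / 4)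

lemma rho_nonneg (p j : ℕ) : 0 ≤ rho p j := by unfold rho; positivity

/-- dyadic form of Weyl's inequality. -/
lemma F1_dyadic {Y T : ℝ} (hF : Fud Y T) (hY : 24 ≤ Y) {H M P J : ℕ} (hH : (H : ℝ) ≤ Y)
    (hP : (P : ℝ) ≤ Y) {β L : ℝ} (hLY : L ≤ Y) (hL : L ≤ T * (H * P ^ 3)) (hPL : 6 * (P : ℝ) ≤ L)
    (hJ : 2 ^ J ≤ P) (p : ℕ) :
    ‖F1 H M P β‖ ^ p ≤ (T ^ 2 * (H * M * P)) ^ p *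
      (rho p J + ∑ j ∈ Finset.range (J + 1), rho p j * min 1 (lsA (2 ^ j) (lsK L j) β)) := by
  classical
  have hT : 100 ≤ T := hF.hundred_le
  have hN : (0 : ℝ) ≤ H * M * P := by positivity
  have hJ' : ∀ j ≤ J, (2 : ℝ) ^ j ≤ P := by
    intro j hj
    have : 2 ^ j ≤ P := (Nat.pow_le_pow_right (by norm_num) hj).trans hJ
    exact_mod_cast this
  have hP1 : (1 : ℝ) ≤ P := by simpa using hJ' 0 (Nat.zero_le _)
  have hL0 : 0 < L := by linarith
  have hpos : ∀ j ∈ Finset.range (J + 1), 0 ≤ rho p j * min 1 (lsA (2 ^ j) (lsK L j) β) :=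
    fun j _ => mul_nonneg (rho_nonneg _ _) (le_min zero_le_one (lsA_nonneg _ _ _))
  have hsum0 := Finset.sum_nonneg hpos
  have weyl : ∀ j ≤ J, (∀ q : ℕ, 0 < q → (q : ℝ) ≤ 2 ^ j → 2 ^ j / L < nd (q * β)) → ∀ c : ℝ,
      2 * (1 / 2 : ℝ) ^ j ≤ T * c → ‖F1 H M P β‖ ^ p ≤ (T ^ 2 * (H * M * P)) ^ p * c ^ ((p : ℝ) / 4) := by
    intro j hj hq c hc
    have hc0 : 0 ≤ c := by
      have : (0 : ℝ) < (1 / 2 : ℝ) ^ j := by positivity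
      by_contra hcon
      nlinarith
    refine pow_le_of_pow_four_le (norm_nonneg _) (by positivity) hc0 ?_ p
    have h2 : (1 : ℝ) ≤ 2 ^ j := one_le_pow₀ (by norm_num)
    refine (F1_weyl hF hY hH hP h2 (by linarith [hJ' j hj]) hLY hL hq).trans ?_
    have h3 : (1 : ℝ) / P ≤ 1 / 2 ^ j := one_div_le_one_div_of_le (by positivity) (hJ' j hj)
    have h4 : (1 : ℝ) / 2 ^ j = (1 / 2 : ℝ) ^ j := by rw [one_div_pow]
    rw [h4] at h3 ⊢
    calc T ^ 6 * (H * M * P : ℝ) ^ 4 * ((1 / 2 : ℝ) ^ j + 1 / P)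
        ≤ T ^ 6 * (H * M * P : ℝ) ^ 4 * (T * c) := by gcongr; linarith
      _ = T ^ 7 * ((H * M * P : ℝ) ^ 4 * c) := by ring
      _ ≤ T ^ 8 * ((H * M * P : ℝ) ^ 4 * c) := by
        gcongr
        · linarith
        · norm_num
      _ = _ := by ring
  by_cases hgood : ∃ j, j ≤ J ∧ ∃ q : ℕ, 0 < q ∧ (q : ℝ) ≤ 2 ^ j ∧ nd (q * β) ≤ 2 ^ j / L
  · set i := Nat.find hgood with hi
    obtain ⟨hiJ, q, hq0, hqi, hqn⟩ := Nat.find_spec hgood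
    rw [← hi] at hiJ hqi hqn
    have hK : 0 < lsK L i := by
      refine Nat.floor_pos.2 ?_
      rw [le_div_iff₀ (by positivity)]
      linarith [hJ' i hiJ]
    have hone : 1 ≤ lsA (2 ^ i) (lsK L i) β := by
      refine one_le_lsA hK hq0 (by exact_mod_cast hqi) ?_
      have h1 : (lsK L i : ℝ) ≤ L / (6 * 2 ^ i) := Nat.floor_le (by positivity)
      calc _ ≤ L / (6 * 2 ^ i) * (2 ^ i / L) := by
            refine mul_le_mul h1 hqn (nd_nonneg _) (by positivity)
        _ = 1 / 6 := by field_simp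
    have hmain : ‖F1 H M P β‖ ^ p ≤ (T ^ 2 * (H * M * P)) ^ p * rho p i := by
      rcases Nat.eq_zero_or_pos i with h0 | h0
      · rw [h0, rho]
        simp only [pow_zero, Real.one_rpow, mul_one]
        refine pow_le_pow_left₀ (norm_nonneg _) ((F1_norm_le _ _ _ _).trans ?_) p
        refine le_mul_of_one_le_left hN (one_le_pow₀ (by linarith))
      · have hnot := Nat.find_min hgood (m := i - 1) (by omega)
        refine weyl (i - 1) (by omega) ?_ _ ?_
        · intro q h1 h2
          by_contra hcon
          exact hnot ⟨by omega, q, h1, h2, not_lt.1 hcon⟩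
        · obtain ⟨i', hi'⟩ : ∃ i', i = i' + 1 := ⟨i - 1, by omega⟩
          rw [hi', Nat.add_sub_cancel, pow_succ]
          have : (0 : ℝ) < (1 / 2 : ℝ) ^ i' := by positivity
          nlinarith
    refine hmain.trans (mul_le_mul_of_nonneg_left ?_ (by positivity))
    have h5 := Finset.single_le_sum hpos (Finset.mem_range.2 (Nat.lt_succ_of_le hiJ))
    rw [min_eq_left hone, mul_one] at h5
    linarith [rho_nonneg p J]
  · push Not at hgood
    have h6 := weyl J le_rfl (hgood J le_rfl) ((1 / 2 : ℝ) ^ J) (by gcongr; linarith)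
    refine h6.trans (mul_le_mul_of_nonneg_left ?_ (by positivity))
    unfold rho at *
    linarith

/-- moments of `F1` against a power of a quartic sum. -/
lemma F1_moment {Y T : ℝ} (hF : Fud Y T) (hY : 24 ≤ Y) {H M P N : ℕ} (hH : (H : ℝ) ≤ Y)
    (hP : (P : ℝ) ≤ Y) (hP1 : 1 ≤ P) {L : ℝ} (hLY : L ≤ Y) (hL : L ≤ T * (H * P ^ 3))
    (hPL : 6 * (P : ℝ) ≤ L) (hN : (N : ℝ) ≤ Y) (S : Finset ℕ) (hS : S ⊆ Finset.Icc 1 N) {p u v : ℕ}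
    (hp : p ≤ 4) {θ G : ℝ} (h0 : 0 < θ) (h1 : θ < 1) (huv : (v : ℝ) = 2 * θ + u * (1 - θ))
    (hG : ∀ X : ℝ, 1 ≤ X → X ≤ P → (1 / X) ^ ((p : ℝ) / 4) * (X * (X * N + N ^ 2) / L) ^ θ ≤ G) :
    ∫ β in (0:ℝ)..1, ‖F1 H M P β‖ ^ p * ‖gs S β‖ ^ v ≤ (T ^ 2 * (H * M * P)) ^ p *
      (2 * (1 / P : ℝ) ^ ((p : ℝ) / 4) * (∫ β in (0:ℝ)..1, ‖gs S β‖ ^ v) +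
        T ^ 4 * G * (∫ β in (0:ℝ)..1, ‖gs S β‖ ^ u) ^ (1 - θ)) := by
  have hT : 100 ≤ T := hF.hundred_le
  have hP0 : (1 : ℝ) ≤ P := by exact_mod_cast hP1
  have hL0 : 0 < L := by linarith
  set J := Nat.log 2 P with hJ
  have hJP : 2 ^ J ≤ P := Nat.pow_log_le_self 2 (by omega)
  have hPJ : P < 2 ^ (J + 1) := Nat.lt_pow_succ_log_self (by norm_num) P
  have c1 := continuous_F1 H M P
  have c2 : ∀ j, Continuous (lsA (2 ^ j) (lsK L j)) := fun j => continuous_lsA _ _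
  have cm : ∀ j, Continuous fun β => min 1 (lsA (2 ^ j) (lsK L j) β) * ‖gs S β‖ ^ v := by
    intro j; have := c2 j; fun_prop
  have cj : ∀ j, Continuous fun β => rho p j * (min 1 (lsA (2 ^ j) (lsK L j) β) * ‖gs S β‖ ^ v) :=
    fun j => continuous_const.mul (cm j)
  have cs : Continuous fun β => ∑ j ∈ Finset.range (J + 1),
      rho p j * (min 1 (lsA (2 ^ j) (lsK L j) β) * ‖gs S β‖ ^ v) :=
    continuous_finsetSum _ fun j _ => cj j
  have cv : Continuous fun β => rho p J * ‖gs S β‖ ^ v := by fun_prop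
  set U := ∫ β in (0:ℝ)..1, ‖gs S β‖ ^ u with hU
  set V := ∫ β in (0:ℝ)..1, ‖gs S β‖ ^ v with hV
  have hU0 : 0 ≤ U := integral01_nonneg fun _ => by positivity
  have hV0 : 0 ≤ V := integral01_nonneg fun _ => by positivity
  have step1 : ∫ β in (0:ℝ)..1, ‖F1 H M P β‖ ^ p * ‖gs S β‖ ^ v ≤ (T ^ 2 * (H * M * P)) ^ p *
      (rho p J * V + ∑ j ∈ Finset.range (J + 1), rho p j *
        ∫ β in (0:ℝ)..1, min 1 (lsA (2 ^ j) (lsK L j) β) * ‖gs S β‖ ^ v) := by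
    have : ∫ β in (0:ℝ)..1, ‖F1 H M P β‖ ^ p * ‖gs S β‖ ^ v ≤ ∫ β in (0:ℝ)..1,
        (T ^ 2 * (H * M * P)) ^ p * (rho p J * ‖gs S β‖ ^ v + ∑ j ∈ Finset.range (J + 1), rho p j *
        (min 1 (lsA (2 ^ j) (lsK L j) β) * ‖gs S β‖ ^ v)) := by
      refine integral01_mono (by fun_prop) ?_ fun β => ?_
      · exact continuous_const.mul (cv.add cs)
      · have := mul_le_mul_of_nonneg_right (F1_dyadic (β := β) (M := M) hF hY hH hP hLY hL hPL hJP p)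
          (by positivity : 0 ≤ ‖gs S β‖ ^ v)
        refine this.trans (le_of_eq ?_)
        rw [mul_assoc, add_mul, Finset.sum_mul]
        simp only [mul_assoc]
    refine this.trans (le_of_eq ?_)
    rw [intervalIntegral.integral_const_mul, intervalIntegral.integral_add (ii cv _ _)
      (ii cs _ _), intervalIntegral.integral_const_mul, intervalIntegral.integral_finsetSum
      (fun j _ => ii (cj j) _ _)]
    simp only [intervalIntegral.integral_const_mul]
    rfl
  refine step1.trans (mul_le_mul_of_nonneg_left ?_ (by positivity))
  have hrhoJ : rho p J ≤ 2 * (1 / P : ℝ) ^ ((p : ℝ) / 4) := by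
    have h2 : ((1 / 2 : ℝ)) ^ J ≤ 2 * (1 / P) := by
      have : (P : ℝ) ≤ 2 ^ (J + 1) := by exact_mod_cast hPJ.le
      rw [one_div_pow, mul_one_div, div_le_div_iff₀ (by positivity) (by linarith)]
      rw [pow_succ] at this; linarith
    unfold rho
    calc _ ≤ (2 * (1 / P : ℝ)) ^ ((p : ℝ) / 4) := Real.rpow_le_rpow (by positivity) h2 (by positivity)
      _ = 2 ^ ((p : ℝ) / 4) * (1 / P : ℝ) ^ ((p : ℝ) / 4) := Real.mul_rpow (by norm_num) (by positivity)
      _ ≤ 2 ^ (1 : ℝ) * (1 / P : ℝ) ^ ((p : ℝ) / 4) := by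
        gcongr
        · norm_num
        · have : (p : ℝ) ≤ 4 := by exact_mod_cast hp
          linarith
      _ = _ := by rw [Real.rpow_one]
  have hterm : ∀ j ∈ Finset.range (J + 1), rho p j *
      (∫ β in (0:ℝ)..1, min 1 (lsA (2 ^ j) (lsK L j) β) * ‖gs S β‖ ^ v) ≤ T ^ 2 * (G * U ^ (1 - θ)) := by
    intro j hj
    set W : ℝ := 2 ^ j * (2 ^ j * N + N ^ 2) / L with hW
    have hW0 : 0 ≤ W := by positivity
    have hjJ : j ≤ J := by have := Finset.mem_range.1 hj; omega
    have h2jP : (2 : ℝ) ^ j ≤ P := by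
      have : 2 ^ j ≤ P := (Nat.pow_le_pow_right (by norm_num) hjJ).trans hJP
      exact_mod_cast this
    have hq1 : 1 ≤ L / (6 * 2 ^ j) := by
      rw [le_div_iff₀ (by positivity)]; linarith
    have hK : 0 < lsK L j := Nat.floor_pos.2 hq1
    have hK2 : L / (12 * 2 ^ j) ≤ lsK L j := by
      have h3 : L / (6 * 2 ^ j) < lsK L j + 1 := Nat.lt_floor_add_one _
      have h4 : (1 : ℝ) ≤ lsK L j := by exact_mod_cast hK
      have h5 : L / (12 * 2 ^ j) = L / (6 * 2 ^ j) / 2 := by rw [div_div]; congr 1; ring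
      rw [h5]; linarith
    have hA := integral_lsA (X := 2 ^ j) hF (by linarith) hN hK S hS
    have hA2 : ∫ β in (0:ℝ)..1, lsA (2 ^ j) (lsK L j) β * ‖gs S β‖ ^ 2 ≤ T ^ 2 * W := by
      refine hA.trans ?_
      have h6 : 4 / (lsK L j : ℝ) ≤ 48 * 2 ^ j / L := by
        calc _ ≤ 4 / (L / (12 * 2 ^ j)) := by gcongr
          _ = _ := by field_simp; ring
      calc _ ≤ 48 * 2 ^ j / L * (T * (2 ^ j * N) + T * N ^ 2) := by
            refine mul_le_mul h6 ?_ (by positivity) (by positivity)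
            push_cast
            have h8 : (2 : ℝ) ^ j * N ≤ T * (2 ^ j * N) := le_mul_of_one_le_left (by positivity) (by linarith)
            linarith
        _ = 48 * T * W := by rw [hW]; field_simp
        _ ≤ T ^ 2 * W := by
            gcongr
            nlinarith
    have h9 := integral_min_lsA (X := 2 ^ j) (K := lsK L j) S h0 h1 huv
    have hA0 : 0 ≤ ∫ β in (0:ℝ)..1, lsA (2 ^ j) (lsK L j) β * ‖gs S β‖ ^ 2 :=
      integral01_nonneg fun _ => mul_nonneg (lsA_nonneg _ _ _) (by positivity)
    calc _ ≤ rho p j * ((T ^ 2 * W) ^ θ * U ^ (1 - θ)) := by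
          refine mul_le_mul_of_nonneg_left (h9.trans ?_) (rho_nonneg _ _)
          exact mul_le_mul_of_nonneg_right (Real.rpow_le_rpow hA0 hA2 h0.le) (by positivity)
      _ = (T ^ 2) ^ θ * ((rho p j * W ^ θ) * U ^ (1 - θ)) := by
          rw [Real.mul_rpow (by positivity) hW0]; ring
      _ ≤ (T ^ 2) ^ (1 : ℝ) * (G * U ^ (1 - θ)) := by
          have h10 := hG (2 ^ j) (one_le_pow₀ (by norm_num)) h2jP
          rw [← one_div_pow] at h10
          have h11 : 0 ≤ rho p j * W ^ θ := mul_nonneg (rho_nonneg _ _) (by positivity)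
          refine mul_le_mul (Real.rpow_le_rpow_of_exponent_le (one_le_pow₀ (by linarith)) h1.le)
            (mul_le_mul_of_nonneg_right h10 (by positivity)) (by positivity) (by positivity)
      _ = _ := by rw [Real.rpow_one]
  have hJT : ((J + 1 : ℕ) : ℝ) ≤ T ^ 2 := by
    have h2 : (2 : ℝ) ^ J ≤ Y := le_trans (by exact_mod_cast hJP) hP
    have h3 : J * Real.log 2 ≤ Real.log Y := by
      rw [← Real.log_pow]; exact Real.log_le_log (by positivity) h2
    have h4 := hF.log_le
    have h5 := Real.log_two_gt_d9
    push_cast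
    have h6 : (0 : ℝ) ≤ J := by positivity
    nlinarith
  have hsum := Finset.sum_le_sum hterm
  rw [Finset.sum_const, Finset.card_range, nsmul_eq_mul] at hsum
  have hG0 : 0 ≤ G := le_trans (by positivity) (hG 1 le_rfl hP0)
  calc _ ≤ 2 * (1 / P : ℝ) ^ ((p : ℝ) / 4) * V + ((J + 1 : ℕ) : ℝ) * (T ^ 2 * (G * U ^ (1 - θ))) := by
        gcongr
    _ ≤ 2 * (1 / P : ℝ) ^ ((p : ℝ) / 4) * V + T ^ 2 * (T ^ 2 * (G * U ^ (1 - θ))) := by gcongr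
    _ = _ := by ring

lemma sum_normSq_fiber {ι κ : Type*} [DecidableEq κ] (S : Finset ι) (f : ι → κ) (a : ι → ℂ) :
    ((∑ c ∈ S.image f, ‖∑ x ∈ S.filter (fun x => f x = c), a x‖ ^ 2 : ℝ) : ℂ) =
      ∑ x ∈ S, ∑ y ∈ S, if f x = f y then a x * (starRingEnd ℂ) (a y) else 0 := by
  rw [Complex.ofReal_sum]
  simp_rw [normSq_eq]
  rw [← Finset.sum_fiberwise_of_maps_to (g := f) (t := S.image f)
    (fun x hx => Finset.mem_image_of_mem f hx)
    (fun x => ∑ y ∈ S, if f x = f y then a x * (starRingEnd ℂ) (a y) else 0)]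
  refine Finset.sum_congr rfl fun c _ => ?_
  rw [map_sum, Finset.sum_mul_sum]
  refine Finset.sum_congr rfl fun x hx => ?_
  rw [Finset.sum_filter]
  refine Finset.sum_congr rfl fun y _ => ?_
  rw [(Finset.mem_filter.1 hx).2]
  simp only [eq_comm]

/-- Correlation of two fourth-power phases against a dilated weight. -/
def fcorr (W : ℝ → ℝ) (n x y : ℕ) : ℂ :=
  ∫ α in (0:ℝ)..1, e ((((x : ℤ) ^ 4 - (y : ℤ) ^ 4 : ℤ) : ℝ) * α) * ((W (n * α) : ℝ) : ℂ)

lemma integral_fiber_normSq {W : ℝ → ℝ} (hW : Continuous W) (S : Finset ℕ) (n : ℕ)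
    {κ : Type*} [DecidableEq κ] (f : ℕ → κ) :
    ((∫ α in (0:ℝ)..1, (∑ c ∈ S.image f, ‖gs (S.filter fun x => f x = c) α‖ ^ 2) * W (n * α) : ℝ) : ℂ)
      = ∑ x ∈ S, ∑ y ∈ S, if f x = f y then fcorr W n x y else 0 := by
  rw [← intervalIntegral.integral_ofReal]
  have h1 : ∀ α : ℝ, (((∑ c ∈ S.image f, ‖gs (S.filter fun x => f x = c) α‖ ^ 2) * W (n * α) : ℝ) : ℂ)
      = ∑ x ∈ S, ∑ y ∈ S, if f x = f y then
          e ((((x : ℤ) ^ 4 - (y : ℤ) ^ 4 : ℤ) : ℝ) * α) * ((W (n * α) : ℝ) : ℂ) else 0 := by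
    intro α
    rw [Complex.ofReal_mul]
    unfold gs
    rw [sum_normSq_fiber, Finset.sum_mul]
    refine Finset.sum_congr rfl fun x _ => ?_
    rw [Finset.sum_mul]
    refine Finset.sum_congr rfl fun y _ => ?_
    split_ifs
    · rw [← e_sub]; congr 2; push_cast; ring
    · simp
  simp_rw [h1]
  have hc : ∀ x y : ℕ, Continuous fun α : ℝ => if f x = f y then
          e ((((x : ℤ) ^ 4 - (y : ℤ) ^ 4 : ℤ) : ℝ) * α) * ((W (n * α) : ℝ) : ℂ) else 0 := by
    intro x y; split_ifs
    · fun_prop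
    · fun_prop
  rw [intervalIntegral.integral_finsetSum]
  · refine Finset.sum_congr rfl fun x _ => ?_
    rw [intervalIntegral.integral_finsetSum]
    · refine Finset.sum_congr rfl fun y _ => ?_
      split_ifs
      · rfl
      · simp
    · intro y _; exact (hc x y).intervalIntegrable _ _
  · intro x _; exact (continuous_finsetSum _ fun y _ => hc x y).intervalIntegrable _ _

lemma fcorr_eq_zero {W : ℝ → ℝ} (hp : ∀ x, W (x + 1) = W x) {n x y : ℕ}
    (hn : ¬ (n : ℤ) ∣ (x : ℤ) ^ 4 - (y : ℤ) ^ 4) : fcorr W n x y = 0 := by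
  unfold fcorr
  exact integral01_e_mul_dil (f := fun x => ((W x : ℝ) : ℂ)) (fun x => by simp only [hp]) n _ hn

lemma integral01_dil_complex {f : ℝ → ℂ} (hc : Continuous f) (hf : ∀ x, f (x + 1) = f x)
    (n : ℕ) (hn : n ≠ 0) :
    ∫ x in (0:ℝ)..1, f (n * x) = ∫ x in (0:ℝ)..1, f x := by
  have h1 := integral01_dil (f := fun x => (f x).re) (by fun_prop) (fun x => by simp only [hf]) n hn
  have h2 := integral01_dil (f := fun x => (f x).im) (by fun_prop) (fun x => by simp only [hf]) n hn
  have key : ∀ g : ℝ → ℂ, Continuous g → (∫ x in (0:ℝ)..1, g x) =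
      ((∫ x in (0:ℝ)..1, (g x).re : ℝ) : ℂ) + ((∫ x in (0:ℝ)..1, (g x).im : ℝ) : ℂ) * Complex.I := by
    intro g hg
    rw [← intervalIntegral.integral_ofReal, ← intervalIntegral.integral_ofReal,
      ← intervalIntegral.integral_mul_const, ← intervalIntegral.integral_add]
    · simp only [Complex.re_add_im]
    · exact Continuous.intervalIntegrable (by fun_prop) _ _
    · exact Continuous.intervalIntegrable (by fun_prop) _ _
  rw [key f hc, key (fun x => f (n * x)) (by fun_prop)]
  rw [h1, h2]

/-- The `j`-th Fourier coefficient of a weight. -/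
def fco (W : ℝ → ℝ) (j : ℤ) : ℂ := ∫ α in (0:ℝ)..1, e ((j : ℝ) * α) * ((W α : ℝ) : ℂ)

lemma fcorr_of_eq {W : ℝ → ℝ} (hW : Continuous W) (hp : ∀ x, W (x + 1) = W x) {n x y : ℕ} {j : ℤ}
    (hn : n ≠ 0) (hj : (x : ℤ) ^ 4 - (y : ℤ) ^ 4 = n * j) : fcorr W n x y = fco W j := by
  unfold fcorr fco
  rw [hj, ← integral01_dil_complex (f := fun α => e ((j : ℝ) * α) * ((W α : ℝ) : ℂ))
    (by fun_prop) _ n hn]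
  · refine intervalIntegral.integral_congr fun α _ => ?_
    congr 2; push_cast; ring_nf
  · intro x
    simp only [hp]
    rw [mul_add, mul_one, e_add_int]

lemma fcorr_conj (W : ℝ → ℝ) (n x y : ℕ) :
    fcorr W n y x = (starRingEnd ℂ) (fcorr W n x y) := by
  unfold fcorr
  rw [intervalIntegral.integral_of_le zero_le_one, intervalIntegral.integral_of_le zero_le_one,
    ← integral_conj]
  refine integral_congr_ae (Eventually.of_forall fun α => ?_)
  simp only [map_mul, conj_e, Complex.conj_ofReal]
  congr 2; push_cast; ring

lemma fcorr_self (W : ℝ → ℝ) (hW : Continuous W) (hp : ∀ x, W (x + 1) = W x) (n x : ℕ) (hn : n ≠ 0) :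
    fcorr W n x x = ((∫ α in (0:ℝ)..1, W α : ℝ) : ℂ) := by
  rw [fcorr_of_eq hW hp (j := 0) hn (by ring)]
  unfold fco
  simp [e_zero, intervalIntegral.integral_ofReal]

lemma normSq_sum_le_card (S : Finset ℕ) (a : ℕ → ℂ) (f : ℕ → ℕ) {B : ℝ}
    (hB : ((S.image f).card : ℝ) ≤ B) :
    ‖∑ x ∈ S, a x‖ ^ 2 ≤ B * ∑ c ∈ S.image f, ‖∑ x ∈ S.filter (fun x => f x = c), a x‖ ^ 2 := by
  rw [← Finset.sum_fiberwise_of_maps_to (g := f) (t := S.image f)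
    (fun x hx => Finset.mem_image_of_mem f hx)]
  have h1 := norm_sum_le (S.image f) fun c => ∑ x ∈ S.filter (fun x => f x = c), a x
  have h2 := sq_sum_le_card_mul_sum_sq (s := S.image f)
    (f := fun c => ‖∑ x ∈ S.filter (fun x => f x = c), a x‖)
  calc _ ≤ (∑ c ∈ S.image f, ‖∑ x ∈ S.filter (fun x => f x = c), a x‖) ^ 2 := by gcongr
    _ ≤ _ := h2
    _ ≤ _ := by gcongr

/-- Splitting into residue classes. -/
lemma integral_le_residue {W : ℝ → ℝ} (hW : Continuous W) (hp : ∀ x, W (x + 1) = W x)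
    (h0 : ∀ x, 0 ≤ W x) (S : Finset ℕ) {n : ℕ} (hn : n ≠ 0) (hS : ∀ x ∈ S, Nat.gcd x n = 1)
    {B : ℝ} (hB : (((2 * n.divisors.card) * (2 * n.divisors.card) : ℕ) : ℝ) ≤ B) :
    ∫ α in (0:ℝ)..1, ‖gs S α‖ ^ 2 * W (n * α) ≤
      B * (∑ x ∈ S, ∑ y ∈ S, if x % n = y % n then fcorr W n x y else 0).re := by
  have hA := integral_fiber_normSq hW S n (fun _ => (0:ℕ))
  have hB1 := integral_fiber_normSq hW S n (fun x => x ^ 4 % n)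
  have hC := integral_fiber_normSq hW S n (fun x => x % n)
  have e1 : (∫ α in (0:ℝ)..1, ‖gs S α‖ ^ 2 * W (n * α)) =
      ∫ α in (0:ℝ)..1, (∑ c ∈ S.image (fun _ => (0:ℕ)), ‖gs (S.filter fun _ => (0:ℕ) = c) α‖ ^ 2) *
        W (n * α) := by
    rcases S.eq_empty_or_nonempty with rfl | hne
    · simp [gs]
    · simp [Finset.image_const hne]
  have e2 : (∑ x ∈ S, ∑ y ∈ S, if (0:ℕ) = 0 then fcorr W n x y else 0) =
      ∑ x ∈ S, ∑ y ∈ S, if x ^ 4 % n = y ^ 4 % n then fcorr W n x y else 0 := by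
    refine Finset.sum_congr rfl fun x _ => Finset.sum_congr rfl fun y _ => ?_
    rw [if_pos rfl]
    split_ifs with hxy
    · rfl
    · apply fcorr_eq_zero hp
      intro hd
      apply hxy
      have : (y ^ 4 : ℕ) ≡ x ^ 4 [MOD n] := by
        rw [Nat.modEq_iff_dvd]; push_cast; exact hd
      exact this.symm
  have e3 : ∫ α in (0:ℝ)..1, ‖gs S α‖ ^ 2 * W (n * α) =
      ∫ α in (0:ℝ)..1, (∑ c ∈ S.image (fun x => x ^ 4 % n),
        ‖gs (S.filter fun x => x ^ 4 % n = c) α‖ ^ 2) * W (n * α) := by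
    rw [e1]
    have := hA.trans (e2.trans hB1.symm)
    exact_mod_cast this
  rw [e3]
  rw [← hC, Complex.ofReal_re, ← intervalIntegral.integral_const_mul]
  apply integral01_mono
  · have : Continuous fun α : ℝ => W (n * α) := by fun_prop
    exact (continuous_finsetSum _ fun c _ => by fun_prop).mul this
  · have : Continuous fun α : ℝ => W (n * α) := by fun_prop
    exact continuous_const.mul ((continuous_finsetSum _ fun c _ => by fun_prop).mul this)
  intro α
  rw [← mul_assoc]
  refine mul_le_mul_of_nonneg_right ?_ (h0 _)
  have hkey : ∀ c ∈ S.image (fun x => x ^ 4 % n), ‖gs (S.filter fun x => x ^ 4 % n = c) α‖ ^ 2 ≤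
      B * ∑ r ∈ S.image (fun x => x % n), if r ^ 4 % n = c then
        ‖gs (S.filter fun x => x % n = r) α‖ ^ 2 else 0 := by
    intro c hc
    set S' := S.filter fun x => x ^ 4 % n = c with hS'
    have hcard : ((S'.image fun x => x % n).card : ℝ) ≤ B := by
      refine le_trans ?_ hB
      exact_mod_cast card_fourth_root_mod_le n hn (c : ℤ) _ (by
        intro r hr
        obtain ⟨x, _, rfl⟩ := Finset.mem_image.1 hr
        exact Nat.mod_lt _ (Nat.pos_of_ne_zero hn)) (by
        intro r hr
        obtain ⟨x, hx, rfl⟩ := Finset.mem_image.1 hr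
        have hx2 := (Finset.mem_filter.1 hx).2
        have : c ≡ (x % n) ^ 4 [MOD n] := by
          rw [← hx2]
          exact (Nat.mod_modEq _ _).trans ((Nat.mod_modEq x n).symm.pow 4)
        have := Nat.modEq_iff_dvd.1 this
        push_cast at this ⊢; exact this) (by
        intro r hr
        obtain ⟨x, hx, rfl⟩ := Finset.mem_image.1 hr
        have := hS x (Finset.mem_filter.1 hx).1
        rw [Nat.gcd_comm] at this
        rw [← Nat.gcd_rec]; exact this)
    refine (normSq_sum_le_card S' _ (fun x => x % n) hcard).trans ?_
    have hB0 : 0 ≤ B := le_trans (by positivity) hB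
    refine mul_le_mul_of_nonneg_left ?_ hB0
    have hmod : ∀ x : ℕ, (x % n) ^ 4 % n = x ^ 4 % n := fun x => (Nat.pow_mod x 4 n).symm
    calc _ = ∑ r ∈ S'.image (fun x => x % n), if r ^ 4 % n = c then
          ‖gs (S.filter fun x => x % n = r) α‖ ^ 2 else 0 := by
          refine Finset.sum_congr rfl fun r hr => ?_
          obtain ⟨x, hx, rfl⟩ := Finset.mem_image.1 hr
          have hx2 := (Finset.mem_filter.1 hx).2
          rw [hmod, if_pos hx2]
          congr 2
          unfold gs
          refine Finset.sum_congr ?_ fun _ _ => rfl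
          ext z
          simp only [hS', Finset.mem_filter]
          constructor
          · rintro ⟨⟨a, b⟩, c⟩; exact ⟨a, c⟩
          · rintro ⟨a, c'⟩
            refine ⟨⟨a, ?_⟩, c'⟩
            rw [← hmod z, c', hmod, hx2]
      _ ≤ _ := by
          refine Finset.sum_le_sum_of_subset_of_nonneg
            (Finset.image_subset_image (Finset.filter_subset _ _)) fun r _ _ => ?_
          split_ifs <;> positivity
  refine (Finset.sum_le_sum hkey).trans ?_
  rw [← Finset.mul_sum, Finset.sum_comm]
  have hB0 : 0 ≤ B := le_trans (by positivity) hB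
  refine mul_le_mul_of_nonneg_left ?_ hB0
  refine Finset.sum_le_sum fun r hr => ?_
  rw [Finset.sum_ite_eq]
  split_ifs
  · exact le_rfl
  · positivity

lemma sum_residue_eq {W : ℝ → ℝ} (hW : Continuous W) (hp : ∀ x, W (x + 1) = W x)
    (S : Finset ℕ) {m H P : ℕ} (hm : 0 < m) (hS : S ⊆ Finset.Icc 1 P) (hH : P ≤ H * m ^ 4) :
    (∑ x ∈ S, ∑ y ∈ S, if x % m ^ 4 = y % m ^ 4 then fcorr W (m ^ 4) x y else 0).re =
      S.card * (∫ α in (0:ℝ)..1, W α) + 2 * (∑ k ∈ Finset.Icc 1 H, ∑ x ∈ S,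
        if x + k * m ^ 4 ∈ S then fco W (Psi k m x : ℕ) else 0).re := by
  set n := m ^ 4 with hn
  have hn0 : 0 < n := by positivity
  have h1 : ∀ x y : ℕ, (if x % n = y % n then fcorr W n x y else 0) =
      (if x = y then fcorr W n x x else 0) +
      ((if x < y ∧ x % n = y % n then (starRingEnd ℂ) (fcorr W n y x) else 0) +
       (if y < x ∧ y % n = x % n then fcorr W n x y else 0)) := by
    intro x y
    rcases lt_trichotomy x y with hxy | rfl | hxy
    · rw [if_neg (show ¬ x = y by omega), if_neg (show ¬ (y < x ∧ y % n = x % n) by omega)]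
      rw [← fcorr_conj]
      simp [hxy]
    · simp
    · rw [if_neg (show ¬ x = y by omega), if_neg (show ¬ (x < y ∧ x % n = y % n) by omega)]
      simp [hxy, eq_comm]
  simp_rw [h1, Finset.sum_add_distrib]
  have h2 : (∑ x ∈ S, ∑ y ∈ S, if x = y then fcorr W n x x else 0) =
      ((S.card * (∫ α in (0:ℝ)..1, W α) : ℝ) : ℂ) := by
    rw [Finset.sum_congr rfl (g := fun _ => ((∫ α in (0:ℝ)..1, W α : ℝ) : ℂ))]
    · simp
    · intro x hx
      rw [Finset.sum_ite_eq, if_pos hx, fcorr_self W hW hp _ _ hn0.ne']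
  have h3 : (∑ x ∈ S, ∑ y ∈ S, if x < y ∧ x % n = y % n then (starRingEnd ℂ) (fcorr W n y x) else 0) =
      (starRingEnd ℂ) (∑ x ∈ S, ∑ y ∈ S, if y < x ∧ y % n = x % n then fcorr W n x y else 0) := by
    rw [Finset.sum_comm, map_sum]
    refine Finset.sum_congr rfl fun x _ => ?_
    rw [map_sum]
    refine Finset.sum_congr rfl fun y _ => ?_
    split_ifs <;> simp
  have h4 : (∑ x ∈ S, ∑ y ∈ S, if y < x ∧ y % n = x % n then fcorr W n x y else 0) =
      ∑ k ∈ Finset.Icc 1 H, ∑ x ∈ S, if x + k * n ∈ S then fco W (Psi k m x : ℕ) else 0 := by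
    rw [Finset.sum_comm, Finset.sum_comm (s := Finset.Icc 1 H)]
    refine Finset.sum_congr rfl fun y hy => ?_
    rw [← Finset.sum_filter, ← Finset.sum_filter]
    symm
    refine Finset.sum_bij (fun k _ => y + k * n) ?_ ?_ ?_ ?_
    · intro k hk
      obtain ⟨hk1, hk2⟩ := Finset.mem_filter.1 hk
      refine Finset.mem_filter.2 ⟨hk2, ?_, by simp⟩
      have := (Finset.mem_Icc.1 hk1).1
      have : 0 < k * n := by positivity
      omega
    · intro k _ k' _ hkk
      simp only [add_right_inj] at hkk
      exact Nat.eq_of_mul_eq_mul_right hn0 hkk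
    · intro x hx
      obtain ⟨hx1, hlt, hmod⟩ := Finset.mem_filter.1 hx
      obtain ⟨k, hk⟩ := (Nat.modEq_iff_dvd' hlt.le).1 hmod
      have hxk : x = y + k * n := by rw [mul_comm]; omega
      refine ⟨k, Finset.mem_filter.2 ⟨Finset.mem_Icc.2 ⟨?_, ?_⟩, hxk ▸ hx1⟩, hxk.symm⟩
      · rcases Nat.eq_zero_or_pos k with rfl | h
        · omega
        · exact h
      · have hxP := (Finset.mem_Icc.1 (hS hx1)).2
        by_contra hcon
        have : H * n < k * n := Nat.mul_lt_mul_of_pos_right (by omega) hn0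
        omega
    · intro k _
      symm
      apply fcorr_of_eq hW hp hn0.ne'
      have := Psi_mul k m y
      rw [hn]
      have h5 : ((y + k * m ^ 4 : ℕ) : ℤ) ^ 4 = ((m ^ 4 : ℕ) : ℤ) * (Psi k m y : ℕ) + (y : ℤ) ^ 4 := by
        exact_mod_cast this.symm
      rw [h5]; ring
  rw [h2, h3, h4, Complex.add_re, Complex.ofReal_re, Complex.add_re, Complex.conj_re]
  ring

/-- The phases occurring in the differenced sum. -/
def diffSet (H M P : ℕ) (A S : Finset ℕ) : Finset (ℕ × ℕ × ℕ) :=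
  (boxI H M P).filter fun i => i.2.1 ∈ A ∧ i.2.2 ∈ S ∧ Nat.gcd i.2.2 i.2.1 = 1 ∧
    i.2.2 + i.1 * i.2.1 ^ 4 ∈ S ∧ Nat.gcd (i.2.2 + i.1 * i.2.1 ^ 4) i.2.1 = 1

def diffSum (H M P : ℕ) (A S : Finset ℕ) (β : ℝ) : ℂ :=
  ∑ i ∈ diffSet H M P A S, e (((Psi i.1 i.2.1 i.2.2 : ℕ) : ℤ) * β)

@[fun_prop] lemma continuous_diffSum (H M P : ℕ) (A S : Finset ℕ) :
    Continuous (diffSum H M P A S) := by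
  unfold diffSum; fun_prop

lemma dom_diffSum (H M P : ℕ) (A S : Finset ℕ) : Dom (diffSum H M P A S) (F1 H M P) := by
  have := Dom.trig_subset (S := diffSet H M P A S) (S' := boxI H M P) (Finset.filter_subset _ _)
    (fun i => ((Psi i.1 i.2.1 i.2.2 : ℕ) : ℤ)) (a := fun _ => 1) (by simp)
  simp only [one_mul] at this
  exact this

lemma averaging {W : ℝ → ℝ} (hW : Continuous W) (hp : ∀ x, W (x + 1) = W x)
    (h0 : ∀ x, 0 ≤ W x) {H M P : ℕ} {A S : Finset ℕ} (hA : A ⊆ Finset.Icc 1 M)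
    (hS : S ⊆ Finset.Icc 1 P) (hH : ∀ m ∈ A, P ≤ H * m ^ 4) {B : ℝ} (hB0 : 0 ≤ B)
    (hB : ∀ m ∈ A, (((2 * (m ^ 4).divisors.card) * (2 * (m ^ 4).divisors.card) : ℕ) : ℝ) ≤ B) :
    ∑ m ∈ A, ∫ α in (0:ℝ)..1, ‖gs (S.filter fun x => Nat.gcd x m = 1) α‖ ^ 2 * W ((m : ℝ) ^ 4 * α) ≤
      B * (A.card * P * (∫ α in (0:ℝ)..1, W α) +
        2 * (∫ α in (0:ℝ)..1, diffSum H M P A S α * ((W α : ℝ) : ℂ)).re) := by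
  have hW0 : 0 ≤ ∫ α in (0:ℝ)..1, W α := integral01_nonneg h0
  have h1 : ∀ m ∈ A, ∫ α in (0:ℝ)..1, ‖gs (S.filter fun x => Nat.gcd x m = 1) α‖ ^ 2 *
      W ((m : ℝ) ^ 4 * α) ≤ B * (P * (∫ α in (0:ℝ)..1, W α) +
        2 * (∑ k ∈ Finset.Icc 1 H, ∑ x ∈ S.filter (fun x => Nat.gcd x m = 1),
        if x + k * m ^ 4 ∈ S.filter (fun x => Nat.gcd x m = 1) then
          fco W (Psi k m x : ℕ) else 0).re) := by
    intro m hm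
    have hm0 : 0 < m := (Finset.mem_Icc.1 (hA hm)).1
    have := integral_le_residue hW hp h0 (S.filter fun x => Nat.gcd x m = 1) (n := m ^ 4)
      (by positivity) (fun x hx => Nat.Coprime.pow_right 4 (Finset.mem_filter.1 hx).2) (hB m hm)
    rw [sum_residue_eq hW hp _ hm0 ((Finset.filter_subset _ _).trans hS) (hH m hm)] at this
    push_cast at this
    refine this.trans ?_
    gcongr
    · have := Finset.card_le_card ((Finset.filter_subset (fun x => Nat.gcd x m = 1) S).trans hS)
      simpa using this
  refine (Finset.sum_le_sum h1).trans (le_of_eq ?_)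
  rw [← Finset.mul_sum, Finset.sum_add_distrib, Finset.sum_const, nsmul_eq_mul, ← Finset.mul_sum,
    ← Complex.re_sum, mul_assoc]
  congr 4
  have h2 : (∫ α in (0:ℝ)..1, diffSum H M P A S α * ((W α : ℝ) : ℂ)) =
      ∑ i ∈ diffSet H M P A S, fco W (Psi i.1 i.2.1 i.2.2 : ℕ) := by
    unfold diffSum
    simp_rw [Finset.sum_mul]
    rw [intervalIntegral.integral_finsetSum]
    · rfl
    · intro i _; exact Continuous.intervalIntegrable (by fun_prop) _ _
  rw [h2]
  unfold diffSet boxI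
  rw [Finset.sum_filter, Finset.sum_product, Finset.sum_comm]
  refine Finset.sum_congr rfl fun k _ => ?_
  rw [Finset.sum_product]
  dsimp only
  rw [← Finset.sum_subset hA]
  · refine Finset.sum_congr rfl fun m hm => ?_
    rw [← Finset.sum_subset hS]
    · rw [Finset.sum_filter]
      refine Finset.sum_congr rfl fun x hx => ?_
      simp only [hm, hx, true_and, Finset.mem_filter]
      split_ifs <;> tauto
    · intro x _ hx
      rw [if_neg]; tauto
  · intro m _ hm
    refine Finset.sum_eq_zero fun x _ => ?_
    rw [if_neg]; tauto

/-- `m > M` with largest prime factor `p` and `m / p ≤ M`. -/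
def Good (M : ℝ) (m p : ℕ) : Prop :=
  p.Prime ∧ p ∣ m ∧ (∀ q, q.Prime → q ∣ m → q ≤ p) ∧ M < m ∧ (m : ℝ) ≤ M * p

/-- All prime factors of `n` are at least `p`. -/
def Rough (p n : ℕ) : Prop := ∀ q, q.Prime → q ∣ n → p ≤ q

lemma exists_good {M : ℝ} (hM : 1 ≤ M) (y : ℕ) (hy : M < y) :
    ∃ m p n, y = m * n ∧ Good M m p ∧ Rough p n := by
  induction y using Nat.strong_induction_on with
  | _ y ih =>
    have hy1 : 1 < y := by exact_mod_cast hM.trans_lt hy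
    have hne : y.primeFactors.Nonempty := Nat.nonempty_primeFactors.2 hy1
    set p := y.primeFactors.max' hne with hp
    have hpm : p ∈ y.primeFactors := Finset.max'_mem _ _
    have hpp : p.Prime := Nat.prime_of_mem_primeFactors hpm
    have hpd : p ∣ y := Nat.dvd_of_mem_primeFactors hpm
    have hmax : ∀ q, q.Prime → q ∣ y → q ≤ p := fun q hq hqd =>
      Finset.le_max' _ _ (Nat.mem_primeFactors.2 ⟨hq, hqd, by omega⟩)
    obtain ⟨z, hz⟩ := hpd
    by_cases hzM : M < z
    · have hzy : z < y := by
        rw [hz]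
        have : 0 < z := by
          rcases Nat.eq_zero_or_pos z with h0 | h0
          · rw [h0, mul_zero] at hz; omega
          · exact h0
        nlinarith [hpp.two_le]
      obtain ⟨m, p', n, h1, h2, h3⟩ := ih z hzy hzM
      refine ⟨m, p', n * p, by rw [hz, h1]; ring, h2, ?_⟩
      intro q hq hqd
      rcases hq.dvd_mul.1 hqd with h | h
      · exact h3 q hq h
      · rw [(Nat.prime_dvd_prime_iff_eq hq hpp).1 h]
        apply hmax p' h2.1
        rw [hz, h1]
        exact ((h2.2.1.mul_right n).mul_left p)
    · refine ⟨y, p, 1, by simp, ⟨hpp, ⟨z, hz⟩, hmax, hy, ?_⟩, ?_⟩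
      · push Not at hzM
        rw [hz]; push_cast; rw [mul_comm]
        gcongr
      · intro q hq hqd
        exact absurd (Nat.dvd_one.1 hqd) hq.one_lt.ne'

lemma Good.dvd_aux {M : ℝ} {m m' p p' n n' : ℕ} (h : Good M m p)
    (hn' : Rough p' n') (hy : m * n = m' * n') (hy0 : m * n ≠ 0)
    (hpp : p ≤ p') (hv : p < p' ∨ m.factorization p ≤ m'.factorization p) : m ∣ m' := by
  have hm : m ≠ 0 := left_ne_zero_of_mul hy0
  have hm' : m' ≠ 0 := left_ne_zero_of_mul (hy ▸ hy0)
  have hn0 : n ≠ 0 := right_ne_zero_of_mul hy0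
  have hn0' : n' ≠ 0 := right_ne_zero_of_mul (hy ▸ hy0)
  rw [← Nat.factorization_le_iff_dvd hm hm']
  intro q
  by_cases hq : q.Prime
  swap
  · simp [Nat.factorization_eq_zero_of_not_prime _ hq]
  by_cases hqm : q ∣ m
  swap
  · rw [Nat.factorization_eq_zero_of_not_dvd hqm]; exact Nat.zero_le _
  have hqp := h.2.2.1 q hq hqm
  have hfac : m.factorization q + n.factorization q = m'.factorization q + n'.factorization q := by
    have := congrArg (fun z => Nat.factorization z q) hy
    simpa [Nat.factorization_mul hm hn0, Nat.factorization_mul hm' hn0'] using this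
  by_cases hqn' : q ∣ n'
  · have := hn' q hq hqn'
    have e1 : p = p' := by omega
    have e2 : q = p := by omega
    rcases hv with hv | hv
    · omega
    · rw [e2]; exact hv
  · rw [Nat.factorization_eq_zero_of_not_dvd hqn'] at hfac
    omega

lemma Good.unique_aux {M : ℝ} {m m' p p' n n' : ℕ} (h : Good M m p) (h' : Good M m' p')
    (hn : Rough p n) (hn' : Rough p' n') (hy : m * n = m' * n') (hy0 : m * n ≠ 0)
    (hpp : p ≤ p') (hv : p < p' ∨ m.factorization p ≤ m'.factorization p) : m = m' := by
  have hd := h.dvd_aux hn' hy hy0 hpp hv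
  have hm : m ≠ 0 := left_ne_zero_of_mul hy0
  have hm' : m' ≠ 0 := left_ne_zero_of_mul (hy ▸ hy0)
  obtain ⟨k, hk⟩ := hd
  by_contra hne
  have hk1 : k ≠ 1 := by rintro rfl; simp at hk; exact hne hk.symm
  have hk0 : k ≠ 0 := by rintro rfl; simp at hk; exact hm' hk
  obtain ⟨r, hr, hrk⟩ := Nat.exists_prime_and_dvd hk1
  -- the prime `p'` divides `k`
  have hpk : p' ∣ k := by
    have hn0 : n ≠ 0 := right_ne_zero_of_mul hy0
    by_contra hpk
    have hrm' : r ∣ m' := hk ▸ hrk.mul_left m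
    have hrp' := h'.2.2.1 r hr hrm'
    have hrn : r ∣ n := by
      have : m * n = m * (k * n') := by rw [hy, hk]; ring
      have := Nat.eq_of_mul_eq_mul_left (Nat.pos_of_ne_zero hm) this
      rw [this]; exact hrk.mul_right n'
    have hpr := hn r hr hrn
    have hp'm : p' ∣ m := by
      have : p' ∣ m * k := hk ▸ h'.2.1
      exact (h'.1.dvd_mul.1 this).resolve_right hpk
    have := h.2.2.1 p' h'.1 hp'm
    have : r = p' := by omega
    exact hpk (this ▸ hrk)
  obtain ⟨j, hj⟩ := hpk
  have hj0 : j ≠ 0 := by rintro rfl; simp at hj; exact hk0 hj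
  have h1 := h'.2.2.2.2
  have h2 := h.2.2.2.1
  have hp0 : (0:ℝ) < p' := by exact_mod_cast h'.1.pos
  have h3 : ((m' : ℕ) : ℝ) = m * j * p' := by rw [hk, hj]; push_cast; ring
  rw [h3] at h1
  have h4 : (m : ℝ) * j ≤ M := le_of_mul_le_mul_right h1 hp0
  have h5 : (1:ℝ) ≤ j := by exact_mod_cast Nat.one_le_iff_ne_zero.2 hj0
  nlinarith

lemma Good.unique {M : ℝ} {m m' p p' n n' : ℕ} (h : Good M m p) (h' : Good M m' p')
    (hn : Rough p n) (hn' : Rough p' n') (hy : m * n = m' * n') (hy0 : m * n ≠ 0) : m = m' := by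
  rcases lt_trichotomy p p' with hpp | rfl | hpp
  · exact h.unique_aux h' hn hn' hy hy0 hpp.le (Or.inl hpp)
  · rcases le_total (m.factorization p) (m'.factorization p) with hv | hv
    · exact h.unique_aux h' hn hn' hy hy0 le_rfl (Or.inr hv)
    · exact (h'.unique_aux h hn' hn hy.symm (hy ▸ hy0) le_rfl (Or.inr hv)).symm
  · exact (h'.unique_aux h hn' hn hy.symm (hy ▸ hy0) hpp.le (Or.inl hpp)).symm

lemma Good.unique_prime {M : ℝ} {m p p' : ℕ} (h : Good M m p) (h' : Good M m p') : p = p' :=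
  le_antisymm (h'.2.2.1 p h.1 h.2.1) (h.2.2.1 p' h'.1 h'.2.1)

open Classical in
/-- The greedy divisor of `y` exceeding `M`. -/
def greedy (M : ℝ) (y : ℕ) : ℕ :=
  if H : ∃ m p n, y = m * n ∧ Good M m p ∧ Rough p n then H.choose else 0

lemma greedy_spec {M : ℝ} (hM : 1 ≤ M) {y : ℕ} (hy : M < y) :
    ∃ p n, y = greedy M y * n ∧ Good M (greedy M y) p ∧ Rough p n := by
  have H := exists_good hM y hy
  unfold greedy
  rw [dif_pos H]
  exact H.choose_spec

lemma greedy_eq {M : ℝ} (hM : 1 ≤ M) {m p n : ℕ} (h : Good M m p) (hn : Rough p n) (hn0 : n ≠ 0) :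
    greedy M (m * n) = m := by
  have h0 : m ≠ 0 := by
    rintro rfl
    have := h.2.2.2.1; simp at this; linarith
  have hlt : M < ((m * n : ℕ) : ℝ) := by
    have := h.2.2.2.1
    have h5 : (1:ℝ) ≤ n := by exact_mod_cast Nat.one_le_iff_ne_zero.2 hn0
    push_cast; nlinarith
  obtain ⟨p', n', h1, h2, h3⟩ := greedy_spec hM hlt
  exact (h.unique h2 hn h3 h1 (mul_ne_zero h0 hn0)).symm

lemma mem_smoothA {P R : ℝ} {n : ℕ} : n ∈ smoothA P R ↔
    0 < n ∧ (n : ℝ) ≤ P ∧ ∀ q, q.Prime → q ∣ n → (q : ℝ) ≤ R := by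
  unfold smoothA
  rw [Finset.mem_filter, Finset.mem_Icc]
  constructor
  · rintro ⟨⟨h1, h2⟩, h3⟩
    refine ⟨h1, ?_, fun q hq hd => h3 q (Nat.mem_primeFactors.2 ⟨hq, hd, by omega⟩)⟩
    exact (Nat.le_floor_iff' (by omega)).1 h2
  · rintro ⟨h1, h2, h3⟩
    exact ⟨⟨h1, Nat.le_floor h2⟩, fun q hq => h3 q (Nat.prime_of_mem_primeFactors hq)
      (Nat.dvd_of_mem_primeFactors hq)⟩

lemma smoothA_subset_Icc (P R : ℝ) : smoothA P R ⊆ Finset.Icc 1 ⌊P⌋₊ := Finset.filter_subset _ _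

lemma mem_smoothA_mul {P R : ℝ} {k n : ℕ} (hk : ∀ q, q.Prime → q ∣ k → (q : ℝ) ≤ R) (hk0 : 0 < k) :
    k * n ∈ smoothA P R ↔ n ∈ smoothA (P / k) R := by
  have hk' : (0:ℝ) < k := by exact_mod_cast hk0
  rw [mem_smoothA, mem_smoothA, le_div_iff₀ hk']
  push_cast
  constructor
  · rintro ⟨h1, h2, h3⟩
    exact ⟨Nat.pos_of_mul_pos_left h1, by linarith [mul_comm (k:ℝ) n],
      fun q hq hd => h3 q hq (hd.mul_left k)⟩
  · rintro ⟨h1, h2, h3⟩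
    refine ⟨by positivity, by linarith [mul_comm (k:ℝ) n], fun q hq hd => ?_⟩
    rcases hq.dvd_mul.1 hd with h | h
    · exact hk q hq h
    · exact h3 q hq h

open Classical in
/-- The greedy divisors that occur. -/
def goodSet (M R : ℝ) : Finset ℕ :=
  (Finset.Icc 1 ⌊M * R⌋₊).filter fun m => (∃ p, Good M m p) ∧ ∀ q, q.Prime → q ∣ m → (q : ℝ) ≤ R

open Classical in
/-- The largest prime factor of a greedy divisor. -/
def topPrime (M : ℝ) (m : ℕ) : ℕ := if H : ∃ p, Good M m p then H.choose else 0

lemma good_topPrime {M R : ℝ} {m : ℕ} (hm : m ∈ goodSet M R) : Good M m (topPrime M m) := by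
  classical
  have H := (Finset.mem_filter.1 hm).2.1
  unfold topPrime
  rw [dif_pos H]; exact H.choose_spec

open Classical in
/-- The cofactors of the greedy divisors with largest prime factor `p`. -/
def roughSet (Q R : ℝ) (p : ℕ) : Finset ℕ := (smoothA Q R).filter (Rough p)

lemma sum_greedy {E : Type*} [AddCommMonoid E] {M P R : ℝ} (hM : 1 ≤ M) (f : ℕ → ℕ → E) :
    ∑ y ∈ (smoothA P R).filter (fun y : ℕ => M < (y : ℝ)), f (greedy M y) y =
      ∑ m ∈ goodSet M R, ∑ n ∈ roughSet (P / m) R (topPrime M m), f m (m * n) := by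
  classical
  rw [← Finset.sum_fiberwise_of_maps_to (g := greedy M) (t := goodSet M R)]
  · refine Finset.sum_congr rfl fun m hm => ?_
    have hg := good_topPrime hm
    obtain ⟨hm1, -, hm3⟩ := Finset.mem_filter.1 hm
    have hm0 : 0 < m := (Finset.mem_Icc.1 hm1).1
    symm
    refine Finset.sum_bij (fun n _ => m * n) ?_ ?_ ?_ ?_
    · intro n hn
      obtain ⟨hn1, hn2⟩ := Finset.mem_filter.1 hn
      have hn0 : 0 < n := (mem_smoothA.1 hn1).1
      refine Finset.mem_filter.2 ⟨Finset.mem_filter.2 ⟨(mem_smoothA_mul hm3 hm0).2 hn1, ?_⟩,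
        greedy_eq hM hg hn2 hn0.ne'⟩
      have h5 : (1:ℝ) ≤ n := by exact_mod_cast hn0
      have := hg.2.2.2.1
      push_cast; nlinarith
    · intro a _ b _ hab
      exact Nat.eq_of_mul_eq_mul_left hm0 hab
    · intro y hy
      obtain ⟨hy1, hy2⟩ := Finset.mem_filter.1 hy
      obtain ⟨hy3, hy4⟩ := Finset.mem_filter.1 hy1
      obtain ⟨p, n, h1, h2, h3⟩ := greedy_spec hM hy4
      rw [hy2] at h1 h2
      rw [← h2.unique_prime hg] 
      refine ⟨n, Finset.mem_filter.2 ⟨(mem_smoothA_mul hm3 hm0).1 (h1 ▸ hy3), h3⟩, h1.symm⟩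
    · intro n hn
      obtain ⟨hn1, hn2⟩ := Finset.mem_filter.1 hn
      rw [greedy_eq hM hg hn2 (mem_smoothA.1 hn1).1.ne']
  · intro y hy
    obtain ⟨hy3, hy4⟩ := Finset.mem_filter.1 hy
    obtain ⟨p, n, h1, h2, h3⟩ := greedy_spec hM hy4
    have hd : greedy M y ∣ y := ⟨n, h1⟩
    have hs := (mem_smoothA.1 hy3).2.2
    refine Finset.mem_filter.2 ⟨Finset.mem_Icc.2 ⟨?_, ?_⟩, ⟨p, h2⟩, fun q hq hqd => hs q hq (hqd.trans hd)⟩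
    · exact Nat.pos_of_dvd_of_pos hd (mem_smoothA.1 hy3).1
    · apply Nat.le_floor
      refine h2.2.2.2.2.trans ?_
      have := hs p h2.1 (h2.2.1.trans hd)
      gcongr

lemma sum_e_range_eq_zero {q : ℕ} (hq : 0 < q) {k : ℤ} (hk : ¬ (q : ℤ) ∣ k) :
    ∑ t ∈ Finset.range q, e (t * (k / q)) = 0 := by
  have hq' : (q : ℝ) ≠ 0 := by positivity
  have h1 : ∀ n : ℕ, (∑ x ∈ Finset.range n, e (x * ((k : ℝ) / q))) * (e ((k : ℝ) / q) - 1) =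
      e (n * ((k : ℝ) / q)) - 1 := by
    intro n
    induction n with
    | zero => simp [e_zero]
    | succ n ih =>
      rw [Finset.sum_range_succ, add_mul, ih]; push_cast; rw [add_mul, one_mul, e_add]; ring
  have h2 := h1 q
  rw [mul_div_cancel₀ _ hq', e_int, sub_self, mul_eq_zero] at h2
  rcases h2 with h2 | h2
  · exact h2
  · exfalso
    rw [sub_eq_zero, e_eq_one_iff] at h2
    obtain ⟨m, hm⟩ := h2
    rw [div_eq_iff hq'] at hm
    exact hk ⟨m, by rw [mul_comm]; exact_mod_cast hm⟩

/-- Discrete Fourier removal of a cut-off. -/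
lemma exists_cutoff_kernel {q : ℕ} (hq : 0 < q) :
    ∃ κ : ℕ → ℝ, (∀ t, 0 ≤ κ t) ∧ ∑ t ∈ Finset.range q, κ t ≤ 6 + 6 * (1 + Real.log q) ∧
      ∀ z ≤ q, ∃ c : ℕ → ℂ, (∀ t, ‖c t‖ ≤ κ t) ∧ ∀ N : Finset ℕ, N ⊆ Finset.range q →
        ∀ a : ℕ → ℂ, ∑ n ∈ N.filter (fun n => n < z), a n =
          ∑ t ∈ Finset.range q, c t * ∑ n ∈ N, e (t * (n / q)) * a n := by
  have hq' : (0 : ℝ) < q := by exact_mod_cast hq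
  set φ : ℕ → ℝ := fun t => if nd (0 + t * (1 / (q : ℝ))) = 0 then q else
    min (q : ℝ) (1 / nd (0 + t * (1 / (q : ℝ)))) with hφ
  have hφ0 : ∀ t, 0 ≤ φ t := by
    intro t; simp only [hφ]; split_ifs
    · positivity
    · have := nd_nonneg (0 + t * (1 / (q : ℝ))); positivity
  have hsum := block_sum (1 / (q : ℝ)) 0 1 q hq isCoprime_one_left (by simp) q φ
    (by
      intro t; simp only [hφ]; split_ifs
      · exact le_rfl
      · exact min_le_left _ _)
    (by
      intro t; simp only [hφ]; split_ifs with h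
      · rw [h]; simp
      · have := lt_of_le_of_ne (nd_nonneg (0 + t * (1 / (q : ℝ)))) (Ne.symm h)
        calc _ ≤ 1 / nd (0 + t * (1 / (q : ℝ))) * nd (0 + t * (1 / (q : ℝ))) := by
              gcongr; exact min_le_right _ _
          _ = 1 := one_div_mul_cancel this.ne')
    hq'.le
  refine ⟨fun t => φ t / q, fun t => div_nonneg (hφ0 t) hq'.le, ?_, ?_⟩
  · rw [← Finset.sum_div, div_le_iff₀ hq']
    linarith
  intro z hz
  refine ⟨fun t => (starRingEnd ℂ) (∑ j ∈ Finset.range z, e (j * (0 + t * (1 / (q:ℝ))))) / q, ?_, ?_⟩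
  · intro t
    rw [norm_div, Complex.norm_natCast, RCLike.norm_conj]
    have h1 := geom_sum_nd (0 + t * (1 / (q : ℝ))) z
    have h2 := norm_sum_e_le (Finset.range z) (fun j : ℕ => j * (0 + t * (1 / (q : ℝ))))
    refine div_le_div_of_nonneg_right ?_ hq'.le
    simp only [hφ]
    have h3 : ‖∑ j ∈ Finset.range z, e (j * (0 + t * (1 / (q : ℝ))))‖ ≤ q := by
      refine h2.trans ?_
      simp only [Finset.card_range]
      exact_mod_cast hz
    split_ifs with h
    · exact h3
    · have := lt_of_le_of_ne (nd_nonneg (0 + t * (1 / (q : ℝ)))) (Ne.symm h)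
      refine le_min h3 ?_
      rwa [le_div_iff₀ this]
  · intro N hN a
    have h1 : ∀ n ∈ N, (∑ t ∈ Finset.range q,
        (starRingEnd ℂ) (∑ j ∈ Finset.range z, e (j * (0 + t * (1 / (q:ℝ))))) / q * e (t * (n / q))) =
        if n < z then 1 else 0 := by
      intro n hn
      have hnq := Finset.mem_range.1 (hN hn)
      have h2 : ∀ t : ℕ, (starRingEnd ℂ) (∑ j ∈ Finset.range z, e (j * (0 + t * (1 / (q:ℝ))))) / q *
          e (t * (n / q)) = (∑ j ∈ Finset.range z, e (t * (((n - j : ℤ) : ℝ) / q))) / q := by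
        intro t
        rw [map_sum, div_mul_eq_mul_div, Finset.sum_mul]
        congr 1
        refine Finset.sum_congr rfl fun j _ => ?_
        rw [conj_e, ← e_add]; congr 1; push_cast; ring
      simp_rw [h2]
      rw [← Finset.sum_div, Finset.sum_comm]
      have h3 : ∀ j ∈ Finset.range z, (∑ t ∈ Finset.range q, e (t * (((n - j : ℤ) : ℝ) / q))) =
          if n = j then (q : ℂ) else 0 := by
        intro j hj
        have hjz := Finset.mem_range.1 hj
        split_ifs with hnj
        · subst hnj; simp [e_zero]
        · apply sum_e_range_eq_zero hq
          intro hd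
          apply hnj
          have h4 : j ≡ n [MOD q] := by rw [Nat.modEq_iff_dvd]; exact hd
          exact (Nat.ModEq.eq_of_lt_of_lt h4 (by omega) hnq).symm
      rw [Finset.sum_congr rfl h3, Finset.sum_ite_eq]
      have : (q : ℂ) ≠ 0 := by exact_mod_cast hq.ne'
      simp only [Finset.mem_range]
      split_ifs <;> simp [this]
    simp_rw [Finset.mul_sum]
    rw [Finset.sum_comm, Finset.sum_filter]
    refine Finset.sum_congr rfl fun n hn => ?_
    simp_rw [← mul_assoc]
    rw [← Finset.sum_mul, h1 n hn]
    split_ifs <;> simp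

lemma weighted_sum_pow_le {ι : Type*} (S : Finset ι) (w x : ι → ℝ) (hw : ∀ i ∈ S, 0 ≤ w i)
    (hx : ∀ i ∈ S, 0 ≤ x i) (v : ℕ) :
    (∑ i ∈ S, w i * x i) ^ (v + 1) ≤ (∑ i ∈ S, w i) ^ v * ∑ i ∈ S, w i * x i ^ (v + 1) := by
  rcases (Finset.sum_nonneg hw).eq_or_lt with h0 | h0
  · have : ∀ i ∈ S, w i = 0 := (Finset.sum_eq_zero_iff_of_nonneg hw).1 h0.symm
    rw [Finset.sum_eq_zero (fun i hi => by rw [this i hi, zero_mul]),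
      Finset.sum_eq_zero (f := fun i => w i * x i ^ (v + 1)) (fun i hi => by rw [this i hi, zero_mul])]
    simp
  set K := ∑ i ∈ S, w i with hK
  have := Real.pow_arith_mean_le_arith_mean_pow S (fun i => w i / K) x
    (fun i hi => div_nonneg (hw i hi) h0.le) (by rw [← Finset.sum_div, div_self h0.ne'])
    hx (v + 1)
  simp_rw [div_mul_eq_mul_div] at this
  rw [← Finset.sum_div, ← Finset.sum_div, div_pow, div_le_div_iff₀ (by positivity) h0] at this
  rw [pow_succ K] at this
  have h2 : (∑ i ∈ S, w i * x i) ^ (v + 1) * K ≤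
      (K ^ v * ∑ i ∈ S, w i * x i ^ (v + 1)) * K := by linarith
  exact le_of_mul_le_mul_right h2 h0

/-- The `s`-th moment of the smooth Weyl sum. -/
def U (s : ℕ) (P R : ℝ) : ℝ := ∫ α in (0:ℝ)..1, ‖h P R α‖ ^ s

@[fun_prop] lemma continuous_h (P R : ℝ) : Continuous (h P R) := by
  rw [funext (h_eq P R)]; fun_prop

lemma gs_add_one (S : Finset ℕ) (x : ℝ) : gs S (x + 1) = gs S x := by
  unfold gs
  refine Finset.sum_congr rfl fun n _ => ?_
  rw [mul_add, mul_one, e_add_int]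

lemma U_nonneg (s : ℕ) (P R : ℝ) : 0 ≤ U s P R := integral01_nonneg fun _ => by positivity

lemma U_dil (s : ℕ) (P R : ℝ) (n : ℕ) (hn : n ≠ 0) :
    ∫ α in (0:ℝ)..1, ‖h P R (n * α)‖ ^ s = U s P R :=
  integral01_dil (f := fun α => ‖h P R α‖ ^ s) (by fun_prop)
    (fun x => by simp only [h_eq, gs_add_one]) n hn

lemma gs_image_mul (S : Finset ℕ) (k : ℕ) (hk : 0 < k) (β : ℝ) :
    gs (S.image (k * ·)) β = gs S (((k ^ 4 : ℕ) : ℝ) * β) := by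
  unfold gs
  rw [Finset.sum_image (fun a _ b _ hab => Nat.eq_of_mul_eq_mul_left hk hab)]
  refine Finset.sum_congr rfl fun n _ => ?_
  congr 1; push_cast; ring

lemma smoothA_filter_gcd {P R : ℝ} {k m : ℕ} (hk0 : 0 < k)
    (hk : ∀ q, q.Prime → q ∣ k → (q : ℝ) ≤ R) :
    (smoothA P R).filter (fun x => Nat.gcd x (k * m) = k) =
      ((smoothA (P / k) R).filter fun x => Nat.gcd x m = 1).image (k * ·) := by
  ext x
  simp only [Finset.mem_filter, Finset.mem_image]
  constructor
  · rintro ⟨h1, h2⟩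
    obtain ⟨y, rfl⟩ : k ∣ x := h2 ▸ Nat.gcd_dvd_left x (k * m)
    rw [Nat.gcd_mul_left] at h2
    exact ⟨y, ⟨(mem_smoothA_mul hk hk0).1 h1, Nat.eq_of_mul_eq_mul_left hk0 (by rw [h2, mul_one])⟩, rfl⟩
  · rintro ⟨y, ⟨h1, h2⟩, rfl⟩
    exact ⟨(mem_smoothA_mul hk hk0).2 h1, by rw [Nat.gcd_mul_left, h2, mul_one]⟩

lemma smoothA_filter_dvd {P R : ℝ} {k : ℕ} (hk0 : 0 < k)
    (hk : ∀ q, q.Prime → q ∣ k → (q : ℝ) ≤ R) :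
    (smoothA P R).filter (fun x => k ∣ x) = (smoothA (P / k) R).image (k * ·) := by
  ext x
  simp only [Finset.mem_filter, Finset.mem_image]
  constructor
  · rintro ⟨h1, ⟨y, rfl⟩⟩
    exact ⟨y, (mem_smoothA_mul hk hk0).1 h1, rfl⟩
  · rintro ⟨y, h1, rfl⟩
    exact ⟨(mem_smoothA_mul hk hk0).2 h1, dvd_mul_right _ _⟩

lemma sum_moebius_gcd (x m : ℕ) (hm : m ≠ 0) :
    ∑ j ∈ m.divisors.filter (fun j => j ∣ x), (ArithmeticFunction.moebius j : ℤ) =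
      if Nat.gcd x m = 1 then 1 else 0 := by
  have h1 : m.divisors.filter (fun j => j ∣ x) = (Nat.gcd x m).divisors := by
    ext j
    simp only [Finset.mem_filter, Nat.mem_divisors]
    rw [Nat.dvd_gcd_iff]
    constructor
    · rintro ⟨⟨a, b⟩, c⟩; exact ⟨⟨c, a⟩, (Nat.gcd_pos_of_pos_right _ (Nat.pos_of_ne_zero hm)).ne'⟩
    · rintro ⟨⟨a, b⟩, c⟩; exact ⟨⟨b, hm⟩, a⟩
  rw [h1, ← ArithmeticFunction.coe_mul_zeta_apply, ArithmeticFunction.moebius_mul_coe_zeta,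
    ArithmeticFunction.one_apply]

lemma gs_coprime_le {P R : ℝ} {m : ℕ} (hm0 : 0 < m) (hm : ∀ q, q.Prime → q ∣ m → (q : ℝ) ≤ R)
    (β : ℝ) : ‖gs ((smoothA P R).filter fun x => Nat.gcd x m = 1) β‖ ≤
      ∑ j ∈ m.divisors, ‖h (P / j) R (((j ^ 4 : ℕ) : ℝ) * β)‖ := by
  have h1 : gs ((smoothA P R).filter fun x => Nat.gcd x m = 1) β =
      ∑ j ∈ m.divisors, ((ArithmeticFunction.moebius j : ℤ) : ℂ) *
        gs ((smoothA P R).filter fun x => j ∣ x) β := by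
    unfold gs
    simp_rw [Finset.mul_sum, Finset.sum_filter]
    rw [Finset.sum_comm]
    refine Finset.sum_congr rfl fun x _ => ?_
    have := congrArg (fun z : ℤ => (z : ℂ)) (sum_moebius_gcd x m hm0.ne')
    simp only [Int.cast_sum] at this
    rw [Finset.sum_filter] at this
    rw [← Finset.sum_filter, ← Finset.sum_mul, Finset.sum_filter, this]
    split_ifs <;> simp
  rw [h1]
  refine (norm_sum_le _ _).trans (Finset.sum_le_sum fun j hj => ?_)
  have hjd := Nat.dvd_of_mem_divisors hj
  have hj0 := Nat.pos_of_mem_divisors hj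
  rw [norm_mul, smoothA_filter_dvd hj0 (fun q hq hqd => hm q hq (hqd.trans hjd)),
    gs_image_mul _ _ hj0, h_eq]
  have : ‖((ArithmeticFunction.moebius j : ℤ) : ℂ)‖ ≤ 1 := by
    rw [Complex.norm_intCast]
    exact_mod_cast ArithmeticFunction.abs_moebius_le_one
  exact mul_le_of_le_one_left (norm_nonneg _) this

/-- The moment of the part of the Weyl sum with prescribed greatest common divisor. -/
lemma integral_gcd_part_le {P R A μ : ℝ} {s k m : ℕ} (hs : s ≠ 0) (hk0 : 0 < k) (hm0 : 0 < m)
    (hsm : ∀ q, q.Prime → q ∣ k * m → (q : ℝ) ≤ R) (hμ : 0 ≤ μ) (hA : 0 ≤ A)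
    (hU : ∀ P', 1 ≤ P' → P' ≤ P → U s P' R ≤ A * P' ^ μ) (hP : 0 ≤ P) :
    ∫ α in (0:ℝ)..1, ‖gs ((smoothA P R).filter fun x => Nat.gcd x (k * m) = k) α‖ ^ s ≤
      (m.divisors.card : ℝ) ^ s * (A * (P / k) ^ μ) := by
  obtain ⟨s, rfl⟩ := Nat.exists_eq_succ_of_ne_zero hs
  have hk' : (1:ℝ) ≤ k := by exact_mod_cast hk0
  rw [smoothA_filter_gcd hk0 (fun q hq hd => hsm q hq (hd.mul_right m))]
  simp_rw [gs_image_mul _ _ hk0]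
  rw [integral01_dil (f := fun α => ‖gs ((smoothA (P / k) R).filter fun x => Nat.gcd x m = 1) α‖ ^ (s+1))
    (by fun_prop) (fun x => by simp only [gs_add_one]) (k ^ 4) (by positivity)]
  have h1 : ∀ β : ℝ, ‖gs ((smoothA (P / k) R).filter fun x => Nat.gcd x m = 1) β‖ ^ (s + 1) ≤
      (m.divisors.card : ℝ) ^ s * ∑ j ∈ m.divisors, ‖h (P / k / j) R (((j ^ 4 : ℕ) : ℝ) * β)‖ ^ (s + 1) := by
    intro β
    have h2 := gs_coprime_le (P := P / k) hm0 (fun q hq hd => hsm q hq (hd.mul_left k)) β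
    refine (pow_le_pow_left₀ (norm_nonneg _) h2 (s + 1)).trans ?_
    have := weighted_sum_pow_le m.divisors (fun _ => 1)
      (fun j => ‖h (P / k / j) R (((j ^ 4 : ℕ) : ℝ) * β)‖) (by simp) (by intros; positivity) s
    simpa using this
  refine (integral01_mono (by fun_prop) ?_ h1).trans ?_
  · exact continuous_const.mul (continuous_finsetSum _ fun j _ => by fun_prop)
  rw [intervalIntegral.integral_const_mul, intervalIntegral.integral_finsetSum]
  swap
  · intro j _; exact Continuous.intervalIntegrable (by fun_prop) _ _
  have h3 : ∀ j ∈ m.divisors, (∫ β in (0:ℝ)..1, ‖h (P / k / j) R (((j ^ 4 : ℕ) : ℝ) * β)‖ ^ (s + 1)) ≤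
      A * (P / k) ^ μ := by
    intro j hj
    have hj0 := Nat.pos_of_mem_divisors hj
    have hj' : (1:ℝ) ≤ j := by exact_mod_cast hj0
    rw [U_dil _ _ _ _ (by positivity)]
    by_cases h1 : 1 ≤ P / k / j
    · refine (hU _ h1 ?_).trans ?_
      · exact (div_le_self (by positivity) hj').trans (div_le_self hP hk')
      · have := div_le_self (show 0 ≤ P / k by positivity) hj'
        gcongr
    · have he : smoothA (P / k / j) R = ∅ := by
        apply Finset.subset_empty.1
        refine (smoothA_subset_Icc _ _).trans ?_
        rw [Nat.floor_eq_zero.2 (not_le.1 h1)]; simp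
      have : U (s + 1) (P / k / j) R = 0 := by
        unfold U; simp [h_eq, he, gs]
      rw [this]; positivity
  refine (mul_le_mul_of_nonneg_left (Finset.sum_le_sum h3) (by positivity)).trans (le_of_eq ?_)
  rw [Finset.sum_const, nsmul_eq_mul, Nat.succ_eq_add_one, pow_succ]; ring

lemma young_three {a b c x L : ℝ} (ha : 0 ≤ a) (hb : 0 ≤ b) (hc : 0 ≤ c) (hx : 0 < x) (hL : 0 < L)
    {v : ℕ} (hv : 2 ≤ v) :
    a ^ v * b * c ≤ x ^ (-(((v : ℝ) - 2) / (v + 2))) * L ^ (v - 1) * (b ^ 2 * c ^ v) +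
      x / L * b ^ (v + 2) + 1 / L * a ^ (v + 2) := by
  have hvR : (2 : ℝ) ≤ v := by exact_mod_cast hv
  have hv0 : (v : ℝ) ≠ 0 := by positivity
  have hv2 : (v : ℝ) + 2 ≠ 0 := by positivity
  set w1 : ℝ := 1 / v with hw1
  set w2 : ℝ := (v - 2) / ((v + 2) * v) with hw2
  set w3 : ℝ := v / (v + 2) with hw3
  have n1 : 0 ≤ w1 := by positivity
  have n2 : 0 ≤ w2 := div_nonneg (by linarith) (by positivity)
  have n3 : 0 ≤ w3 := by positivity
  have hsum : w1 + w2 + w3 = 1 := by rw [hw1, hw2, hw3]; field_simp; ring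
  set p1 := x ^ (-(((v : ℝ) - 2) / (v + 2))) * L ^ (v - 1) * (b ^ 2 * c ^ v) with hp1
  set p2 := x / L * b ^ (v + 2) with hp2
  set p3 := 1 / L * a ^ (v + 2) with hp3
  have q1 : 0 ≤ p1 := by positivity
  have q2 : 0 ≤ p2 := by positivity
  have q3 : 0 ≤ p3 := by positivity
  have key := Real.geom_mean_le_arith_mean3_weighted n1 n2 n3 q1 q2 q3 hsum
  have e1 : p1 ^ w1 = x ^ (-w2) * L ^ (((v : ℝ) - 1) / v) * (b ^ (2 / (v : ℝ)) * c) := by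
    rw [hp1, Real.mul_rpow (by positivity) (by positivity), Real.mul_rpow (by positivity) (by positivity),
      Real.mul_rpow (by positivity) (by positivity), ← Real.rpow_mul hx.le, ← Real.rpow_natCast L,
      ← Real.rpow_mul hL.le, ← Real.rpow_natCast b, ← Real.rpow_mul hb, ← Real.rpow_natCast c,
      ← Real.rpow_mul hc]
    rw [Nat.cast_sub (by omega)]
    congr 3
    · rw [hw1, hw2]; field_simp
    · rw [hw1]; push_cast; field_simp
    · rw [hw1]; push_cast; field_simp
    · rw [hw1, mul_one_div_cancel hv0, Real.rpow_one]
  have e2 : p2 ^ w2 = x ^ w2 * L ^ (-w2) * b ^ (((v : ℝ) - 2) / v) := by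
    rw [hp2, Real.mul_rpow (by positivity) (by positivity), Real.div_rpow hx.le hL.le,
      ← Real.rpow_natCast b, ← Real.rpow_mul hb, Real.rpow_neg hL.le, div_eq_mul_inv]
    congr 2
    rw [hw2]; push_cast; field_simp
  have e3 : p3 ^ w3 = L ^ (-w3) * a ^ v := by
    rw [hp3, Real.mul_rpow (by positivity) (by positivity), one_div, Real.inv_rpow hL.le,
      Real.rpow_neg hL.le, ← Real.rpow_natCast a (v + 2), ← Real.rpow_mul ha]
    congr 1
    rw [hw3, ← Real.rpow_natCast a v]
    congr 1
    push_cast; field_simp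
  rw [e1, e2, e3] at key
  have e4 : x ^ (-w2) * x ^ w2 = 1 := by rw [← Real.rpow_add hx]; simp
  have e5 : L ^ (((v : ℝ) - 1) / v) * L ^ (-w2) * L ^ (-w3) = 1 := by
    rw [← Real.rpow_add hL, ← Real.rpow_add hL]
    have : ((v : ℝ) - 1) / v + -w2 + -w3 = 0 := by rw [hw2, hw3]; field_simp; ring
    rw [this, Real.rpow_zero]
  have e6 : b ^ (2 / (v : ℝ)) * b ^ (((v : ℝ) - 2) / v) = b := by
    rw [← Real.rpow_add_of_nonneg hb (by positivity) (div_nonneg (by linarith) (by positivity))]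
    have : 2 / (v : ℝ) + ((v : ℝ) - 2) / v = 1 := by field_simp; ring
    rw [this, Real.rpow_one]
  have e7 : a ^ v * b * c ≤ w1 * p1 + w2 * p2 + w3 * p3 := by
    refine le_trans (le_of_eq ?_) key
    calc a ^ v * b * c = (x ^ (-w2) * x ^ w2) * (L ^ (((v : ℝ) - 1) / v) * L ^ (-w2) * L ^ (-w3)) *
          (a ^ v * (b ^ (2 / (v : ℝ)) * b ^ (((v : ℝ) - 2) / v)) * c) := by rw [e4, e5, e6]; ring
      _ = _ := by ring
  refine e7.trans ?_
  have m1 : w1 * p1 ≤ p1 := mul_le_of_le_one_left q1 (by linarith)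
  have m2 : w2 * p2 ≤ p2 := mul_le_of_le_one_left q2 (by linarith)
  have m3 : w3 * p3 ≤ p3 := mul_le_of_le_one_left q3 (by linarith)
  linarith

/-- The part of the diagonal-free square with large common divisor. -/
def bigGcd (P R M : ℝ) (K : ℕ) (α : ℝ) : ℂ :=
  ∑ y ∈ (smoothA P R).filter (fun y : ℕ => M < (y : ℝ)),
    ∑ x ∈ (smoothA P R).filter (fun x => K < Nat.gcd x (greedy M y)),
      e (((x ^ 4 : ℕ) : ℤ) * α) * (starRingEnd ℂ) (e (((y ^ 4 : ℕ) : ℤ) * α))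

lemma continuous_bigGcd (P R M : ℝ) (K : ℕ) : Continuous (bigGcd P R M K) := by
  unfold bigGcd
  refine continuous_finsetSum _ fun y _ => continuous_finsetSum _ fun x _ => ?_
  exact (by fun_prop : Continuous fun α : ℝ => e (((x ^ 4 : ℕ) : ℤ) * α)).mul
    (Complex.continuous_conj.comp (by fun_prop))

/-- The part of the Weyl sum with `gcd(x, m) = k`. -/
def gcdPart (P R : ℝ) (k m : ℕ) (α : ℝ) : ℂ := gs ((smoothA P R).filter fun x => Nat.gcd x m = k) α

/-- The cofactor sum of the greedy divisor `m`. -/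
def cofSum (P R M : ℝ) (m : ℕ) (β : ℝ) : ℂ := gs (roughSet (P / m) R (topPrime M m)) β

lemma mem_goodSet {M R : ℝ} {m : ℕ} (hm : m ∈ goodSet M R) :
    0 < m ∧ m ≤ ⌊M * R⌋₊ ∧ ∀ q, q.Prime → q ∣ m → (q : ℝ) ≤ R := by
  classical
  have h1 := Finset.mem_Icc.1 (Finset.mem_filter.1 hm).1
  exact ⟨h1.1, h1.2, (Finset.mem_filter.1 hm).2.2⟩

lemma mul_conj_eq {P R M : ℝ} (hM : 1 ≤ M) (K : ℕ) (α : ℝ) :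
    h P R α * (starRingEnd ℂ) (h P R α) =
      h P R α * (starRingEnd ℂ) (gs ((smoothA P R).filter fun y : ℕ => ¬ M < (y : ℝ)) α) +
      (∑ m ∈ goodSet M R, (∑ k ∈ (Finset.Icc 1 K).filter (· ∣ m), gcdPart P R k m α) *
        (starRingEnd ℂ) (cofSum P R M m (((m ^ 4 : ℕ) : ℝ) * α))) + bigGcd P R M K α := by
  have h1 : h P R α = gs ((smoothA P R).filter fun y : ℕ => M < (y : ℝ)) α +
      gs ((smoothA P R).filter fun y : ℕ => ¬ M < (y : ℝ)) α := by
    rw [h_eq]; unfold gs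
    exact (Finset.sum_filter_add_sum_filter_not _ _ _).symm
  have h2 : h P R α * (starRingEnd ℂ) (gs ((smoothA P R).filter fun y : ℕ => M < (y : ℝ)) α) =
      (∑ m ∈ goodSet M R, (∑ k ∈ (Finset.Icc 1 K).filter (· ∣ m), gcdPart P R k m α) *
        (starRingEnd ℂ) (cofSum P R M m (((m ^ 4 : ℕ) : ℝ) * α))) + bigGcd P R M K α := by
    have h3 := sum_greedy (P := P) (R := R) hM (fun m y =>
      (∑ x ∈ (smoothA P R).filter (fun x => ¬ K < Nat.gcd x m), e (((x ^ 4 : ℕ) : ℤ) * α)) *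
        (starRingEnd ℂ) (e (((y ^ 4 : ℕ) : ℤ) * α)))
    have h4 : ∀ m ∈ goodSet M R, ∑ n ∈ roughSet (P / m) R (topPrime M m),
        ((∑ x ∈ (smoothA P R).filter (fun x => ¬ K < Nat.gcd x m), e (((x ^ 4 : ℕ) : ℤ) * α)) *
        (starRingEnd ℂ) (e ((((m * n) ^ 4 : ℕ) : ℤ) * α))) =
        (∑ k ∈ (Finset.Icc 1 K).filter (· ∣ m), gcdPart P R k m α) *
        (starRingEnd ℂ) (cofSum P R M m (((m ^ 4 : ℕ) : ℝ) * α)) := by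
      intro m hm
      have hm0 : 0 < m := (mem_goodSet hm).1
      rw [← Finset.mul_sum, ← map_sum]
      congr 1
      · unfold gcdPart gs
        rw [← Finset.sum_fiberwise_of_maps_to (g := fun x => Nat.gcd x m)
          (t := (Finset.Icc 1 K).filter (· ∣ m))]
        · refine Finset.sum_congr rfl fun k hk => ?_
          refine Finset.sum_congr ?_ fun _ _ => rfl
          ext x
          simp only [Finset.mem_filter]
          have := (Finset.mem_Icc.1 (Finset.mem_filter.1 hk).1).2
          constructor
          · rintro ⟨⟨a, b⟩, c⟩; exact ⟨a, c⟩
          · rintro ⟨a, c⟩; exact ⟨⟨a, by omega⟩, c⟩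
        · intro x hx
          have := (Finset.mem_filter.1 hx).2
          exact Finset.mem_filter.2 ⟨Finset.mem_Icc.2 ⟨Nat.gcd_pos_of_pos_right _ hm0, by omega⟩,
            Nat.gcd_dvd_right _ _⟩
      · congr 1
        unfold cofSum gs
        refine Finset.sum_congr rfl fun n _ => ?_
        congr 1; push_cast; ring
    rw [Finset.sum_congr rfl h4] at h3
    rw [← h3, h_eq]
    unfold gs bigGcd
    rw [map_sum, Finset.mul_sum, ← Finset.sum_add_distrib]
    refine Finset.sum_congr rfl fun y _ => ?_
    rw [← Finset.sum_filter_add_sum_filter_not (smoothA P R) (fun x => K < Nat.gcd x (greedy M y)),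
      add_mul, add_comm, Finset.sum_mul (Finset.filter (fun x => K < Nat.gcd x (greedy M y)) _)]
  conv_lhs => rw [show (starRingEnd ℂ) (h P R α) = (starRingEnd ℂ) (gs ((smoothA P R).filter fun y : ℕ => M < (y : ℝ)) α) + (starRingEnd ℂ) (gs ((smoothA P R).filter fun y : ℕ => ¬ M < (y : ℝ)) α) by rw [← map_add, ← h1]]
  rw [mul_add, h2]; ring

lemma norm_pow_le_core {P R M : ℝ} (hM : 1 ≤ M) (K v : ℕ) (α : ℝ) :
    ‖h P R α‖ ^ (v + 2) ≤ ‖h P R α‖ ^ (v + 1) * M +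
      (∑ m ∈ goodSet M R, ∑ k ∈ (Finset.Icc 1 K).filter (· ∣ m),
        ‖h P R α‖ ^ v * ‖gcdPart P R k m α‖ * ‖cofSum P R M m (((m ^ 4 : ℕ) : ℝ) * α)‖) +
      (((‖h P R α‖ ^ v : ℝ) : ℂ) * bigGcd P R M K α).re := by
  have h1 := mul_conj_eq (P := P) (R := R) hM K α
  rw [← normSq_eq] at h1
  have h2 := congrArg Complex.re h1
  rw [Complex.ofReal_re, Complex.add_re, Complex.add_re] at h2
  rw [pow_add, h2, mul_add, mul_add, Complex.re_ofReal_mul]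
  refine add_le_add (add_le_add ?_ ?_) le_rfl
  · rw [pow_succ, mul_assoc]
    refine mul_le_mul_of_nonneg_left ?_ (by positivity)
    refine (Complex.re_le_norm _).trans ?_
    rw [norm_mul, RCLike.norm_conj]
    refine mul_le_mul_of_nonneg_left ?_ (norm_nonneg _)
    unfold gs
    refine (norm_sum_e_le _ _).trans ?_
    have : ((smoothA P R).filter fun y : ℕ => ¬ M < (y : ℝ)) ⊆ Finset.Icc 1 ⌊M⌋₊ := by
      intro y hy
      obtain ⟨hy1, hy2⟩ := Finset.mem_filter.1 hy
      exact Finset.mem_Icc.2 ⟨(mem_smoothA.1 hy1).1, Nat.le_floor (not_lt.1 hy2)⟩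
    have h3 := Finset.card_le_card this
    rw [Nat.card_Icc, Nat.add_sub_cancel] at h3
    exact (Nat.cast_le.2 h3).trans (Nat.floor_le (by linarith))
  · refine (mul_le_mul_of_nonneg_left (Complex.re_le_norm _) (by positivity)).trans ?_
    refine (mul_le_mul_of_nonneg_left (norm_sum_le _ _) (by positivity)).trans ?_
    rw [Finset.mul_sum]
    refine Finset.sum_le_sum fun m _ => ?_
    rw [norm_mul, RCLike.norm_conj]
    simp_rw [mul_assoc]
    rw [← Finset.mul_sum, ← Finset.sum_mul]
    gcongr
    exact norm_sum_le _ _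

lemma small_absorb {a M : ℝ} (ha : 0 ≤ a) (hM : 0 ≤ M) (v : ℕ) :
    a ^ (v + 1) * M ≤ 1 / 4 * a ^ (v + 2) + (4 * M) ^ (v + 2) := by
  rcases le_total (4 * M) a with h | h
  · have : a ^ (v + 1) * M ≤ a ^ (v + 1) * (a / 4) := by gcongr; linarith
    have h2 : a ^ (v + 1) * (a / 4) = 1 / 4 * a ^ (v + 2) := by ring
    have : 0 ≤ (4 * M) ^ (v + 2) := by positivity
    linarith
  · have : a ^ (v + 1) * M ≤ (4 * M) ^ (v + 1) * (4 * M) := by gcongr; linarith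
    have h2 : (4 * M) ^ (v + 1) * (4 * M) = (4 * M) ^ (v + 2) := by ring
    have : 0 ≤ a ^ (v + 2) := by positivity
    linarith

/-- A weighted biquadratic exponential sum. -/
def cs (S : Finset ℕ) (c : ℕ → ℂ) (β : ℝ) : ℂ := ∑ n ∈ S, c n * e (((n ^ 4 : ℕ) : ℤ) * β)

@[fun_prop] lemma continuous_cs (S : Finset ℕ) (c : ℕ → ℂ) : Continuous (cs S c) := by
  unfold cs
  exact continuous_finsetSum _ fun n _ => continuous_const.mul (by fun_prop)

lemma cs_add_one (S : Finset ℕ) (c : ℕ → ℂ) (x : ℝ) : cs S c (x + 1) = cs S c x := by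
  unfold cs
  refine Finset.sum_congr rfl fun n _ => ?_
  rw [mul_add, mul_one, e_add_int]

open Classical in
/-- An additive character restricted to rough numbers. -/
def roughTwist (q p t n : ℕ) : ℂ := if Rough p n then e (t * ((n : ℝ) / q)) else 0

lemma norm_roughTwist_le (q p t n : ℕ) : ‖roughTwist q p t n‖ ≤ 1 := by
  unfold roughTwist
  split_ifs
  · rw [norm_e]
  · simp

lemma cofSum_pow_le {P R M : ℝ} (hM : 1 ≤ M) (hP : 0 ≤ P) (v : ℕ) :
    ∃ κ : ℕ → ℝ, (∀ t, 0 ≤ κ t) ∧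
      ∑ t ∈ Finset.range (⌊P / M⌋₊ + 1), κ t ≤ 6 + 6 * (1 + Real.log ((⌊P / M⌋₊ + 1 : ℕ) : ℝ)) ∧
      ∀ m ∈ goodSet M R, ∀ β, ‖cofSum P R M m β‖ ^ (v + 1) ≤
        (∑ t ∈ Finset.range (⌊P / M⌋₊ + 1), κ t) ^ v *
          ∑ p ∈ Finset.range (⌊R⌋₊ + 1), ∑ t ∈ Finset.range (⌊P / M⌋₊ + 1), κ t *
            ‖cs (smoothA (P / M) R) (roughTwist (⌊P / M⌋₊ + 1) p t) β‖ ^ (v + 1) := by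
  classical
  obtain ⟨κ, hκ0, hκ, hc⟩ := exists_cutoff_kernel (q := ⌊P / M⌋₊ + 1) (Nat.succ_pos _)
  refine ⟨κ, hκ0, hκ, fun m hm β => ?_⟩
  set q := ⌊P / M⌋₊ + 1 with hq
  set p := topPrime M m with hp
  have hg := good_topPrime hm
  have hmM : M < m := hg.2.2.2.1
  have hPm : P / m ≤ P / M := by gcongr
  have hz : ⌊P / m⌋₊ + 1 ≤ q := by rw [hq]; exact Nat.succ_le_succ (Nat.floor_le_floor hPm)
  obtain ⟨c, hcκ, hcs⟩ := hc _ hz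
  have hset : roughSet (P / m) R p = (roughSet (P / M) R p).filter (fun n => n < ⌊P / m⌋₊ + 1) := by
    ext n
    unfold roughSet
    simp only [Finset.mem_filter, mem_smoothA]
    have hPm0 : 0 ≤ P / m := by positivity
    constructor
    · rintro ⟨⟨a, b, d⟩, r⟩
      exact ⟨⟨⟨a, b.trans hPm, d⟩, r⟩, Nat.lt_succ_of_le (Nat.le_floor b)⟩
    · rintro ⟨⟨⟨a, b, d⟩, r⟩, l⟩
      exact ⟨⟨a, (Nat.le_floor_iff hPm0).1 (Nat.le_of_lt_succ l), d⟩, r⟩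
  have hsub : roughSet (P / M) R p ⊆ Finset.range q := by
    intro n hn
    have h1 := (mem_smoothA.1 (Finset.mem_filter.1 hn).1).2.1
    exact Finset.mem_range.2 (Nat.lt_succ_of_le (Nat.le_floor h1))
  have h1 : cofSum P R M m β = ∑ t ∈ Finset.range q, c t * cs (smoothA (P / M) R) (roughTwist q p t) β := by
    unfold cofSum gs
    rw [hset, hcs _ hsub]
    refine Finset.sum_congr rfl fun t _ => ?_
    congr 1
    unfold cs roughSet
    rw [Finset.sum_filter]
    refine Finset.sum_congr rfl fun n _ => ?_
    unfold roughTwist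
    split_ifs <;> simp
  have h2 : ‖cofSum P R M m β‖ ≤
      ∑ t ∈ Finset.range q, κ t * ‖cs (smoothA (P / M) R) (roughTwist q p t) β‖ := by
    rw [h1]
    refine (norm_sum_le _ _).trans (Finset.sum_le_sum fun t _ => ?_)
    rw [norm_mul]
    gcongr
    exact hcκ t
  refine (pow_le_pow_left₀ (norm_nonneg _) h2 (v + 1)).trans ?_
  refine (weighted_sum_pow_le _ _ _ (fun t _ => hκ0 t) (fun _ _ => norm_nonneg _) v).trans ?_
  have hs0 : 0 ≤ ∑ t ∈ Finset.range q, κ t := Finset.sum_nonneg fun t _ => hκ0 t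
  refine mul_le_mul_of_nonneg_left ?_ (by positivity)
  have hpR : p ∈ Finset.range (⌊R⌋₊ + 1) :=
    Finset.mem_range.2 (Nat.lt_succ_of_le (Nat.le_floor ((mem_goodSet hm).2.2 p hg.1 hg.2.1)))
  exact Finset.single_le_sum (f := fun p => ∑ t ∈ Finset.range q, κ t *
    ‖cs (smoothA (P / M) R) (roughTwist q p t) β‖ ^ (v + 1))
    (fun p _ => Finset.sum_nonneg fun t _ => mul_nonneg (hκ0 t) (by positivity)) hpR

/-- The coprime mean value bound which feeds the recursion. -/
def CopBound (P R M : ℝ) (v k : ℕ) (B : ℝ) : Prop :=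
  ∀ A : Finset ℕ, (∀ m ∈ A, 0 < m ∧ M < k * m ∧ (k * m : ℝ) ≤ M * R) →
    ∀ c : ℕ → ℂ, (∀ n, ‖c n‖ ≤ 1) →
      ∑ m ∈ A, ∫ α in (0:ℝ)..1, ‖gs ((smoothA (P / k) R).filter fun x => Nat.gcd x m = 1) α‖ ^ 2 *
        ‖cs (smoothA (P / M) R) c (((m : ℝ)) ^ 4 * α)‖ ^ v ≤ B

lemma gcd_layer_le {P R M B T : ℝ} {v k : ℕ} (hM : 1 ≤ M) (hP : 0 ≤ P) (hR : 0 ≤ R) (hk : 0 < k)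
    (hT : 6 + 6 * (1 + Real.log ((⌊P / M⌋₊ + 1 : ℕ) : ℝ)) ≤ T) (hRT : R + 1 ≤ T) (hB0 : 0 ≤ B)
    (hB : CopBound P R M (v + 1) k B) :
    ∑ m ∈ (goodSet M R).filter (k ∣ ·), ∫ α in (0:ℝ)..1, ‖gcdPart P R k m α‖ ^ 2 *
      ‖cofSum P R M m (((m ^ 4 : ℕ) : ℝ) * α)‖ ^ (v + 1) ≤ T ^ (v + 2) * B := by
  classical
  obtain ⟨κ, hκ0, hκ, hc⟩ := cofSum_pow_le (R := R) hM hP v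
  set q := ⌊P / M⌋₊ + 1 with hq
  set κs := ∑ t ∈ Finset.range q, κ t with hκs
  have hκs0 : 0 ≤ κs := Finset.sum_nonneg fun t _ => hκ0 t
  have hκT : κs ≤ T := hκ.trans hT
  have hT0 : 0 ≤ T := hκs0.trans hκT
  set G : ℕ → ℕ → ℝ → ℂ := fun p t => cs (smoothA (P / M) R) (roughTwist q p t) with hG
  have hGc : ∀ p t, Continuous (G p t) := fun p t => continuous_cs _ _
  set S := (goodSet M R).filter (k ∣ ·) with hS
  have h1 : ∀ m ∈ S, (∫ α in (0:ℝ)..1, ‖gcdPart P R k m α‖ ^ 2 *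
      ‖cofSum P R M m (((m ^ 4 : ℕ) : ℝ) * α)‖ ^ (v + 1)) ≤
      κs ^ v * ∑ p ∈ Finset.range (⌊R⌋₊ + 1), ∑ t ∈ Finset.range q, κ t *
        ∫ α in (0:ℝ)..1, ‖gcdPart P R k m α‖ ^ 2 * ‖G p t (((m ^ 4 : ℕ) : ℝ) * α)‖ ^ (v + 1) := by
    intro m hm
    have hmg := (Finset.mem_filter.1 hm).1
    have hc1 : Continuous (gcdPart P R k m) := continuous_gs _
    have hc2 : Continuous (cofSum P R M m) := continuous_gs _
    have hi : ∀ p t, Continuous fun α => ‖gcdPart P R k m α‖ ^ 2 *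
        ‖G p t (((m ^ 4 : ℕ) : ℝ) * α)‖ ^ (v + 1) := fun p t => by have := hGc p t; fun_prop
    have hrew : κs ^ v * ∑ p ∈ Finset.range (⌊R⌋₊ + 1), ∑ t ∈ Finset.range q, κ t *
        ∫ α in (0:ℝ)..1, ‖gcdPart P R k m α‖ ^ 2 * ‖G p t (((m ^ 4 : ℕ) : ℝ) * α)‖ ^ (v + 1) =
        ∫ α in (0:ℝ)..1, κs ^ v * ∑ p ∈ Finset.range (⌊R⌋₊ + 1), ∑ t ∈ Finset.range q, κ t *
          (‖gcdPart P R k m α‖ ^ 2 * ‖G p t (((m ^ 4 : ℕ) : ℝ) * α)‖ ^ (v + 1)) := by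
      rw [intervalIntegral.integral_const_mul, intervalIntegral.integral_finsetSum]
      · congr 1
        refine Finset.sum_congr rfl fun p _ => ?_
        rw [intervalIntegral.integral_finsetSum]
        · refine Finset.sum_congr rfl fun t _ => ?_
          rw [intervalIntegral.integral_const_mul]
        · intro t _; exact ii (continuous_const.mul (hi p t)) _ _
      · intro p _
        exact ii (continuous_finsetSum _ fun t _ => continuous_const.mul (hi p t)) _ _
    rw [hrew]
    refine integral01_mono (by fun_prop) ?_ fun α => ?_
    · exact continuous_const.mul (continuous_finsetSum _ fun p _ =>
        continuous_finsetSum _ fun t _ => continuous_const.mul (hi p t))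
    · refine (mul_le_mul_of_nonneg_left (hc m hmg _) (by positivity)).trans (le_of_eq ?_)
      simp only [Finset.mul_sum]
      refine Finset.sum_congr rfl fun p _ => Finset.sum_congr rfl fun t _ => ?_
      simp only [hG]; ring
  refine (Finset.sum_le_sum h1).trans ?_
  rw [← Finset.mul_sum, Finset.sum_comm]
  have h2 : ∀ p t, ∑ m ∈ S, ∫ α in (0:ℝ)..1, ‖gcdPart P R k m α‖ ^ 2 *
      ‖G p t (((m ^ 4 : ℕ) : ℝ) * α)‖ ^ (v + 1) ≤ B := by
    intro p t
    have h3 := hB (S.image (· / k)) (by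
      intro m hm
      obtain ⟨m', hm', rfl⟩ := Finset.mem_image.1 hm
      obtain ⟨hg, hd⟩ := Finset.mem_filter.1 hm'
      obtain ⟨j, rfl⟩ := hd
      have h4 := mem_goodSet hg
      have h5 := (good_topPrime hg).2.2.2.1
      have h6 : k * j / k = j := Nat.mul_div_cancel_left j hk
      simp only [h6]
      refine ⟨Nat.pos_of_mul_pos_left h4.1, by exact_mod_cast h5, ?_⟩
      have := (Nat.le_floor_iff (by positivity)).1 h4.2.1
      exact_mod_cast this) (roughTwist q p t) (norm_roughTwist_le q p t)
    rw [Finset.sum_image] at h3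
    · refine le_trans (Finset.sum_le_sum fun m hm => le_of_eq ?_) h3
      obtain ⟨hg, hd⟩ := Finset.mem_filter.1 hm
      obtain ⟨j, rfl⟩ := hd
      have h4 := mem_goodSet hg
      have h6 : k * j / k = j := Nat.mul_div_cancel_left j hk
      simp only [h6]
      have h7 := integral01_dil (f := fun α => ‖gs ((smoothA (P / k) R).filter fun x => Nat.gcd x j = 1) α‖ ^ 2 *
        ‖cs (smoothA (P / M) R) (roughTwist q p t) ((j : ℝ) ^ 4 * α)‖ ^ (v + 1)) (by fun_prop)
        (fun x => by
          simp only [gs_add_one]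
          congr 3
          have h8 : Function.Periodic (cs (smoothA (P / M) R) (roughTwist q p t)) 1 := cs_add_one _ _
          have := h8.nat_mul (j ^ 4) ((j : ℝ) ^ 4 * x)
          rw [← this]; congr 1; push_cast; ring) (k ^ 4) (by positivity)
      rw [← h7]
      refine intervalIntegral.integral_congr fun α _ => ?_
      simp only [hG]
      unfold gcdPart
      rw [smoothA_filter_gcd hk (fun q' hq' hd' => h4.2.2 q' hq' (hd'.mul_right j)),
        gs_image_mul _ _ hk]
      congr 4
      push_cast; ring
    · intro a ha b hb hab
      have h8 := (Finset.mem_filter.1 ha).2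
      have h9 := (Finset.mem_filter.1 hb).2
      rw [← Nat.mul_div_cancel' h8, ← Nat.mul_div_cancel' h9]
      simp only at hab
      rw [hab]
  have h3 : ∑ p ∈ Finset.range (⌊R⌋₊ + 1), ∑ m ∈ S, ∑ t ∈ Finset.range q, κ t *
        (∫ α in (0:ℝ)..1, ‖gcdPart P R k m α‖ ^ 2 * ‖G p t (((m ^ 4 : ℕ) : ℝ) * α)‖ ^ (v + 1)) ≤
      ∑ p ∈ Finset.range (⌊R⌋₊ + 1), κs * B := by
    refine Finset.sum_le_sum fun p _ => ?_
    rw [Finset.sum_comm, hκs, Finset.sum_mul]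
    refine Finset.sum_le_sum fun t _ => ?_
    rw [← Finset.mul_sum]
    exact mul_le_mul_of_nonneg_left (h2 p t) (hκ0 t)
  refine (mul_le_mul_of_nonneg_left h3 (by positivity)).trans ?_
  rw [Finset.sum_const, Finset.card_range, nsmul_eq_mul]
  have h4 : ((⌊R⌋₊ + 1 : ℕ) : ℝ) ≤ T := by
    push_cast
    have := Nat.floor_le hR
    linarith
  calc κs ^ v * (((⌊R⌋₊ + 1 : ℕ) : ℝ) * (κs * B)) ≤ T ^ v * (T * (T * B)) := by gcongr
    _ = _ := by ring

lemma integral01_add_three {f g k : ℝ → ℝ} (hf : Continuous f) (hg : Continuous g)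
    (hk : Continuous k) : ∫ x in (0:ℝ)..1, (f x + g x + k x) =
      (∫ x in (0:ℝ)..1, f x) + (∫ x in (0:ℝ)..1, g x) + ∫ x in (0:ℝ)..1, k x := by
  have h1 : Continuous fun x => f x + g x := hf.add hg
  rw [intervalIntegral.integral_add (ii h1 _ _) (ii hk _ _),
    intervalIntegral.integral_add (ii hf _ _) (ii hg _ _)]

lemma integral01_linear_three {f g k : ℝ → ℝ} (hf : Continuous f) (hg : Continuous g)
    (hk : Continuous k) (a b c : ℝ) : ∫ x in (0:ℝ)..1, (a * f x + b * g x + c * k x) =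
      a * (∫ x in (0:ℝ)..1, f x) + b * (∫ x in (0:ℝ)..1, g x) + c * ∫ x in (0:ℝ)..1, k x := by
  rw [integral01_add_three (f := fun x => a * f x) (g := fun x => b * g x) (k := fun x => c * k x)
    (by fun_prop) (by fun_prop) (by fun_prop), intervalIntegral.integral_const_mul,
    intervalIntegral.integral_const_mul, intervalIntegral.integral_const_mul]

/-- One step of the smooth-number iteration. -/
lemma iteration_step {P R M A μ T δ err : ℝ} {K v : ℕ} {B : ℕ → ℝ} (hv : 2 ≤ v) (hP : 0 ≤ P)
    (hM : 1 ≤ M) (hR : 1 ≤ R) (hT : 6 + 6 * (1 + Real.log ((⌊P / M⌋₊ + 1 : ℕ) : ℝ)) ≤ T)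
    (hRT : R + 1 ≤ T) (hd : ∀ m : ℕ, 0 < m → (m : ℝ) ≤ M * R → (m.divisors.card : ℝ) ≤ T)
    (hμ : 0 ≤ μ) (hA : 0 ≤ A) (hU : ∀ P', 1 ≤ P' → P' ≤ P → U (v + 2) P' R ≤ A * P' ^ μ)
    (herr : (∫ α in (0:ℝ)..1, (((‖h P R α‖ ^ v : ℝ) : ℂ) * bigGcd P R M K α)).re ≤ err)
    (hδ : 0 < δ) (hδ1 : δ ≤ 1) (hB0 : ∀ k, 0 ≤ B k)
    (hB : ∀ k ∈ Finset.Icc 1 K, CopBound P R M v k (B k)) :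
    U (v + 2) P R ≤ 2 * ((4 * M) ^ (v + 2) + err + T ^ (v + 2) * (A * δ * P ^ μ) +
      δ⁻¹ * (8 * (M * R * T)) ^ (v - 1) * T ^ (v + 1) *
        ∑ k ∈ Finset.Icc 1 K, (k : ℝ) ^ (-(μ * (((v : ℝ) - 2) / (v + 2)))) * B k) := by
  have hT1 : 1 ≤ T := by linarith
  set L := 8 * (M * R * T) with hL
  have hL0 : 0 < L := by positivity
  set w : ℝ := ((v : ℝ) - 2) / (v + 2) with hw
  have hvR : (2:ℝ) ≤ v := by exact_mod_cast hv
  have hw0 : 0 ≤ w := div_nonneg (by linarith) (by positivity)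
  have hw1 : w ≤ 1 := by rw [hw, div_le_one (by positivity)]; linarith
  set G := goodSet M R with hG
  set D : ℕ → Finset ℕ := fun m => (Finset.Icc 1 K).filter (· ∣ m) with hD
  have hGm : ∀ m ∈ G, 0 < m ∧ (m : ℝ) ≤ M * R := by
    intro m hm
    have := mem_goodSet hm
    exact ⟨this.1, (Nat.le_floor_iff (by positivity)).1 this.2.1⟩
  have hDk : ∀ m, ∀ k ∈ D m, 0 < k ∧ k ∣ m ∧ k ∈ Finset.Icc 1 K := by
    intro m k hk
    obtain ⟨h1, h2⟩ := Finset.mem_filter.1 hk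
    exact ⟨(Finset.mem_Icc.1 h1).1, h2, h1⟩
  have hcard : ∑ m ∈ G, ((D m).card : ℝ) ≤ M * R * T := by
    have h1 : ∀ m ∈ G, ((D m).card : ℝ) ≤ T := by
      intro m hm
      refine le_trans ?_ (hd m (hGm m hm).1 (hGm m hm).2)
      exact_mod_cast Finset.card_le_card fun k hk => Nat.mem_divisors.2 ⟨(hDk m k hk).2.1, (hGm m hm).1.ne'⟩
    refine (Finset.sum_le_sum h1).trans ?_
    rw [Finset.sum_const, nsmul_eq_mul]
    have h2 : ((G.card : ℕ) : ℝ) ≤ M * R := by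
      have h3 : G ⊆ Finset.Icc 1 ⌊M * R⌋₊ := by
        intro m hm
        exact Finset.mem_Icc.2 ⟨(mem_goodSet hm).1, (mem_goodSet hm).2.1⟩
      have h4 := Finset.card_le_card h3
      rw [Nat.card_Icc, Nat.add_sub_cancel] at h4
      exact (Nat.cast_le.2 h4).trans (Nat.floor_le (by positivity))
    gcongr
  have cg : ∀ k m, Continuous (gcdPart P R k m) := fun k m => continuous_gs _
  have cc : ∀ m, Continuous (cofSum P R M m) := fun m => continuous_gs _
  have cb := continuous_bigGcd P R M K
  -- pointwise inequality
  have hpt : ∀ α, ‖h P R α‖ ^ (v + 2) ≤ (1 / 4 * ‖h P R α‖ ^ (v + 2) + (4 * M) ^ (v + 2)) +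
      (∑ m ∈ G, ∑ k ∈ D m, ((δ * (k : ℝ) ^ μ) ^ (-w) * L ^ (v - 1) * (‖gcdPart P R k m α‖ ^ 2 *
        ‖cofSum P R M m (((m ^ 4 : ℕ) : ℝ) * α)‖ ^ v) +
        (δ * (k : ℝ) ^ μ) / L * ‖gcdPart P R k m α‖ ^ (v + 2) + 1 / L * ‖h P R α‖ ^ (v + 2))) +
      (((‖h P R α‖ ^ v : ℝ) : ℂ) * bigGcd P R M K α).re := by
    intro α
    refine (norm_pow_le_core hM K v α).trans ?_
    refine add_le_add (add_le_add (small_absorb (norm_nonneg _) (by linarith) v) ?_) le_rfl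
    refine Finset.sum_le_sum fun m hm => Finset.sum_le_sum fun k hk => ?_
    have hk0 : (0:ℝ) < k := by exact_mod_cast (hDk m k hk).1
    exact young_three (norm_nonneg _) (norm_nonneg _) (norm_nonneg _) (by positivity) hL0 hv
  have hInt := integral01_mono (f := fun α => ‖h P R α‖ ^ (v + 2)) (by fun_prop) (by
    refine Continuous.add (Continuous.add (by fun_prop) ?_) ?_
    · refine continuous_finsetSum _ fun m _ => continuous_finsetSum _ fun k _ => ?_
      have := cg k m; have := cc m
      fun_prop
    · exact Complex.continuous_re.comp ((by fun_prop : Continuous fun α => ((‖h P R α‖ ^ v : ℝ) : ℂ)).mul cb)) hpt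
  have i1 : Continuous fun α => (1 / 4 * ‖h P R α‖ ^ (v + 2) + (4 * M) ^ (v + 2)) := by fun_prop
  have i2 : ∀ m k : ℕ, Continuous fun α => ((δ * (k : ℝ) ^ μ) ^ (-w) * L ^ (v - 1) * (‖gcdPart P R k m α‖ ^ 2 *
        ‖cofSum P R M m (((m ^ 4 : ℕ) : ℝ) * α)‖ ^ v) +
        (δ * (k : ℝ) ^ μ) / L * ‖gcdPart P R k m α‖ ^ (v + 2) + 1 / L * ‖h P R α‖ ^ (v + 2)) := by
    intro m k
    have := cg k m; have := cc m
    fun_prop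
  have i3c : Continuous fun α => (((‖h P R α‖ ^ v : ℝ) : ℂ) * bigGcd P R M K α) :=
    (by fun_prop : Continuous fun α => ((‖h P R α‖ ^ v : ℝ) : ℂ)).mul cb
  have i3 := Complex.continuous_re.comp i3c
  simp only [Function.comp_def] at i3
  have i2' := continuous_finsetSum G fun m _ => continuous_finsetSum (D m) fun k _ => i2 m k
  have hre : (∫ α in (0:ℝ)..1, ((((‖h P R α‖ ^ v : ℝ) : ℂ) * bigGcd P R M K α)).re) =
      (∫ α in (0:ℝ)..1, (((‖h P R α‖ ^ v : ℝ) : ℂ) * bigGcd P R M K α)).re := by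
    have := Complex.reCLM.intervalIntegral_comp_comm (μ := volume) (i3c.intervalIntegrable 0 1)
    simpa using this
  rw [integral01_add_three i1 i2' i3,
    intervalIntegral.integral_add (ii (by fun_prop) _ _) (ii continuous_const _ _), hre,
    intervalIntegral.integral_const_mul, intervalIntegral.integral_const] at hInt
  set UU := U (v + 2) P R with hUU
  have hUdef : ∫ α in (0:ℝ)..1, ‖h P R α‖ ^ (v + 2) = UU := rfl
  rw [hUdef] at hInt
  have hUU0 : 0 ≤ UU := U_nonneg _ _ _
  set X : ℕ → ℕ → ℝ := fun m k => ∫ α in (0:ℝ)..1, ‖gcdPart P R k m α‖ ^ 2 *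
        ‖cofSum P R M m (((m ^ 4 : ℕ) : ℝ) * α)‖ ^ v with hX
  have hX0 : ∀ m k, 0 ≤ X m k := fun m k => integral01_nonneg fun _ => by positivity
  have hterm : (∫ α in (0:ℝ)..1, ∑ m ∈ G, ∑ k ∈ D m, ((δ * (k : ℝ) ^ μ) ^ (-w) * L ^ (v - 1) *
        (‖gcdPart P R k m α‖ ^ 2 * ‖cofSum P R M m (((m ^ 4 : ℕ) : ℝ) * α)‖ ^ v) +
        (δ * (k : ℝ) ^ μ) / L * ‖gcdPart P R k m α‖ ^ (v + 2) + 1 / L * ‖h P R α‖ ^ (v + 2))) ≤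
      ∑ m ∈ G, ∑ k ∈ D m, ((δ⁻¹ * L ^ (v - 1)) * ((k : ℝ) ^ (-(μ * w)) * X m k) +
        (T ^ (v + 2) * (A * δ * P ^ μ) + UU) / L) := by
    rw [intervalIntegral.integral_finsetSum]
    swap
    · intro m _; exact ii (continuous_finsetSum _ fun k _ => i2 m k) _ _
    refine Finset.sum_le_sum fun m hm => ?_
    rw [intervalIntegral.integral_finsetSum]
    swap
    · intro k _; exact ii (i2 m k) _ _
    refine Finset.sum_le_sum fun k hk => ?_
    obtain ⟨hk0, hkm, hkK⟩ := hDk m k hk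
    have hk1 : (1:ℝ) ≤ k := by exact_mod_cast hk0
    have c1 : Continuous fun α => ‖gcdPart P R k m α‖ ^ 2 *
        ‖cofSum P R M m (((m ^ 4 : ℕ) : ℝ) * α)‖ ^ v := by
      have := cg k m; have := cc m; fun_prop
    have c2 : Continuous fun α => ‖gcdPart P R k m α‖ ^ (v + 2) := by
      have := cg k m; fun_prop
    have c3 : Continuous fun α => ‖h P R α‖ ^ (v + 2) := by fun_prop
    rw [integral01_linear_three c1 c2 c3, hUdef]
    have e1 : (δ * (k : ℝ) ^ μ) ^ (-w) ≤ δ⁻¹ * (k : ℝ) ^ (-(μ * w)) := by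
      rw [Real.mul_rpow hδ.le (by positivity), ← Real.rpow_mul (by positivity), ← Real.rpow_neg_one δ, mul_neg]
      exact mul_le_mul_of_nonneg_right (Real.rpow_le_rpow_of_exponent_ge hδ hδ1 (by linarith))
        (by positivity)
    have e2 : (∫ α in (0:ℝ)..1, ‖gcdPart P R k m α‖ ^ (v + 2)) ≤ T ^ (v + 2) * (A * (P / k) ^ μ) := by
      obtain ⟨j, rfl⟩ := hkm
      have hj0 : 0 < j := Nat.pos_of_mul_pos_left (hGm _ hm).1
      have := integral_gcd_part_le (s := v + 2) (by omega) hk0 hj0 (mem_goodSet hm).2.2 hμ hA hU hP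
      refine this.trans ?_
      have hdj : (j.divisors.card : ℝ) ≤ T := by
        refine hd j hj0 (le_trans ?_ (hGm _ hm).2)
        push_cast
        nlinarith [(Nat.cast_nonneg j : (0:ℝ) ≤ j)]
      gcongr
    have e3 : δ * (k : ℝ) ^ μ / L * (∫ α in (0:ℝ)..1, ‖gcdPart P R k m α‖ ^ (v + 2)) ≤
        T ^ (v + 2) * (A * δ * P ^ μ) / L := by
      refine (mul_le_mul_of_nonneg_left e2 (by positivity)).trans (le_of_eq ?_)
      rw [Real.div_rpow hP (by positivity)]
      have : (k : ℝ) ^ μ ≠ 0 := by positivity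
      field_simp
    have e4 : (δ * (k : ℝ) ^ μ) ^ (-w) * L ^ (v - 1) * X m k ≤
        (δ⁻¹ * L ^ (v - 1)) * ((k : ℝ) ^ (-(μ * w)) * X m k) := by
      have := mul_le_mul_of_nonneg_right e1 (mul_nonneg (by positivity : 0 ≤ L ^ (v - 1)) (hX0 m k))
      calc _ = (δ * (k : ℝ) ^ μ) ^ (-w) * (L ^ (v - 1) * X m k) := by ring
        _ ≤ _ := this
        _ = _ := by ring
    have e5 : (T ^ (v + 2) * (A * δ * P ^ μ) + UU) / L = T ^ (v + 2) * (A * δ * P ^ μ) / L + 1 / L * UU := by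
      ring
    rw [e5]
    simp only [hX] at e4 ⊢
    linarith
  have hsum2 : ∑ m ∈ G, ∑ k ∈ D m, ((δ⁻¹ * L ^ (v - 1)) * ((k : ℝ) ^ (-(μ * w)) * X m k) +
        (T ^ (v + 2) * (A * δ * P ^ μ) + UU) / L) ≤
      δ⁻¹ * L ^ (v - 1) * T ^ (v + 1) * ∑ k ∈ Finset.Icc 1 K, (k : ℝ) ^ (-(μ * w)) * B k +
        (T ^ (v + 2) * (A * δ * P ^ μ) + UU) / 8 := by
    simp_rw [Finset.sum_add_distrib]
    refine add_le_add ?_ ?_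
    · simp_rw [← Finset.mul_sum]
      rw [mul_assoc (δ⁻¹ * L ^ (v - 1))]
      refine mul_le_mul_of_nonneg_left ?_ (by positivity)
      rw [Finset.mul_sum]
      have : ∑ m ∈ G, ∑ k ∈ D m, (k : ℝ) ^ (-(μ * w)) * X m k =
          ∑ k ∈ Finset.Icc 1 K, (k : ℝ) ^ (-(μ * w)) * ∑ m ∈ G.filter (k ∣ ·), X m k := by
        simp only [hD, Finset.sum_filter, Finset.mul_sum]
        rw [Finset.sum_comm]
        refine Finset.sum_congr rfl fun k _ => Finset.sum_congr rfl fun m _ => ?_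
        split_ifs <;> simp
      rw [this]
      refine Finset.sum_le_sum fun k hk => ?_
      obtain ⟨u, rfl⟩ : ∃ u, v = u + 1 := ⟨v - 1, by omega⟩
      have h6 := gcd_layer_le hM hP (by linarith : 0 ≤ R) (Finset.mem_Icc.1 hk).1 hT hRT (hB0 k) (hB k hk)
      have h7 : ∑ m ∈ G.filter (k ∣ ·), X m k ≤ T ^ (u + 1 + 1) * B k := h6
      calc _ ≤ (k : ℝ) ^ (-(μ * w)) * (T ^ (u + 1 + 1) * B k) := by gcongr
        _ = _ := by ring
    · simp_rw [Finset.sum_const, nsmul_eq_mul]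
      rw [← Finset.sum_mul]
      have h8 : 0 ≤ T ^ (v + 2) * (A * δ * P ^ μ) + UU := by positivity
      calc (∑ m ∈ G, ((D m).card : ℝ)) * ((T ^ (v + 2) * (A * δ * P ^ μ) + UU) / L)
          ≤ (M * R * T) * ((T ^ (v + 2) * (A * δ * P ^ μ) + UU) / L) := by gcongr
        _ = _ := by rw [hL]; field_simp
  have hYY : 0 ≤ T ^ (v + 2) * (A * δ * P ^ μ) := by positivity
  have h9 : 0 ≤ δ⁻¹ * L ^ (v - 1) * T ^ (v + 1) * ∑ k ∈ Finset.Icc 1 K, (k : ℝ) ^ (-(μ * w)) * B k :=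
    mul_nonneg (by positivity) (Finset.sum_nonneg fun k _ => mul_nonneg (by positivity) (hB0 k))
  have h10 : 0 ≤ (4 * M) ^ (v + 2) := by positivity
  have h11 := hterm.trans hsum2
  simp only [sub_zero, one_smul] at hInt
  have hInt2 := hInt.trans (add_le_add (add_le_add le_rfl h11) herr)
  have key : 5 / 8 * UU ≤ (4 * M) ^ (v + 2) + err + T ^ (v + 2) * (A * δ * P ^ μ) +
      δ⁻¹ * L ^ (v - 1) * T ^ (v + 1) * ∑ k ∈ Finset.Icc 1 K, (k : ℝ) ^ (-(μ * w)) * B k := by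
    linarith
  linarith

/-- Smooth common divisors exceeding `K`. -/
def bigDivisors (M R : ℝ) (K : ℕ) : Finset ℕ :=
  (Finset.Icc (K + 1) ⌊M * R⌋₊).filter fun k => ∀ q ∈ k.primeFactors, (q : ℝ) ≤ R

lemma mem_bigDivisors {M R : ℝ} {K k : ℕ} (hk : k ∈ bigDivisors M R K) :
    K + 1 ≤ k ∧ k ≤ ⌊M * R⌋₊ ∧ ∀ q, q.Prime → q ∣ k → (q : ℝ) ≤ R := by
  obtain ⟨h1, h2⟩ := Finset.mem_filter.1 hk
  obtain ⟨h3, h4⟩ := Finset.mem_Icc.1 h1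
  exact ⟨h3, h4, fun q hq hd => h2 q (Nat.mem_primeFactors.2 ⟨hq, hd, by omega⟩)⟩

lemma dom_bigGcd {P R M : ℝ} (hM : 1 ≤ M) (K : ℕ) :
    Dom (bigGcd P R M K) (fun α => ∑ k ∈ bigDivisors M R K,
      h (P / k) R (((k ^ 4 : ℕ) : ℝ) * α) * (starRingEnd ℂ) (h (P / k) R (((k ^ 4 : ℕ) : ℝ) * α))) := by
  classical
  set S := smoothA P R with hS
  set D := bigDivisors M R K with hD
  have h1 : ∀ α, bigGcd P R M K α = ∑ p ∈ S ×ˢ S,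
      (if M < (p.2 : ℝ) ∧ K < Nat.gcd p.1 (greedy M p.2) then (1:ℂ) else 0) *
        e ((((p.1 ^ 4 : ℕ) : ℤ) - ((p.2 ^ 4 : ℕ) : ℤ) : ℤ) * α) := by
    intro α
    unfold bigGcd
    rw [Finset.sum_product_right, Finset.sum_filter]
    refine Finset.sum_congr rfl fun y _ => ?_
    split_ifs with hy
    · rw [Finset.sum_filter]
      refine Finset.sum_congr rfl fun x _ => ?_
      by_cases hx : K < Nat.gcd x (greedy M y)
      · simp only [hx, hy, and_self, if_true, one_mul]
        rw [← e_sub]; congr 1; push_cast; ring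
      · simp [hx]
    · symm
      refine Finset.sum_eq_zero fun x _ => ?_
      simp [hy]
  have h2 : ∀ α, (∑ k ∈ D,
      h (P / k) R (((k ^ 4 : ℕ) : ℝ) * α) * (starRingEnd ℂ) (h (P / k) R (((k ^ 4 : ℕ) : ℝ) * α))) =
      ∑ p ∈ S ×ˢ S, (((D.filter fun k => k ∣ p.1 ∧ k ∣ p.2).card : ℝ) : ℂ) *
        e ((((p.1 ^ 4 : ℕ) : ℤ) - ((p.2 ^ 4 : ℕ) : ℤ) : ℤ) * α) := by
    intro α
    have h3 : ∀ p ∈ S ×ˢ S, (((D.filter fun k => k ∣ p.1 ∧ k ∣ p.2).card : ℝ) : ℂ) *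
        e ((((p.1 ^ 4 : ℕ) : ℤ) - ((p.2 ^ 4 : ℕ) : ℤ) : ℤ) * α) =
        ∑ k ∈ D, if k ∣ p.1 ∧ k ∣ p.2 then
          e ((((p.1 ^ 4 : ℕ) : ℤ) - ((p.2 ^ 4 : ℕ) : ℤ) : ℤ) * α) else 0 := by
      intro p _
      rw [← Finset.sum_filter, Finset.sum_const, nsmul_eq_mul]
      norm_num
    rw [Finset.sum_congr rfl h3, Finset.sum_comm]
    refine Finset.sum_congr rfl fun k hk => ?_
    have hk' := mem_bigDivisors hk
    have h4 : h (P / k) R (((k ^ 4 : ℕ) : ℝ) * α) = ∑ x ∈ S, if k ∣ x then e (((x ^ 4 : ℕ) : ℤ) * α) else 0 := by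
      rw [h_eq, ← gs_image_mul _ _ (by omega), ← smoothA_filter_dvd (by omega) hk'.2.2]
      unfold gs
      rw [Finset.sum_filter]
    rw [h4, map_sum, Finset.sum_mul_sum, Finset.sum_product]
    refine Finset.sum_congr rfl fun x _ => Finset.sum_congr rfl fun y _ => ?_
    by_cases hx : k ∣ x <;> by_cases hy : k ∣ y <;> simp only [hx, hy, if_true, if_false, and_self, and_true, and_false, zero_mul, mul_zero, map_zero]
    rw [← e_sub]; congr 1; push_cast; ring
  have h3 := Dom.trig (S ×ˢ S) (fun p : ℕ × ℕ => ((p.1 ^ 4 : ℕ) : ℤ) - ((p.2 ^ 4 : ℕ) : ℤ))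
    (a := fun p => if M < (p.2 : ℝ) ∧ K < Nat.gcd p.1 (greedy M p.2) then (1:ℂ) else 0)
    (b := fun p => ((D.filter fun k => k ∣ p.1 ∧ k ∣ p.2).card : ℝ)) (by
      intro p hp
      split_ifs with hc
      · have hp' := Finset.mem_product.1 hp
        obtain ⟨q, n, hyn, hgood, hrough⟩ := greedy_spec hM hc.1
        have hsm := mem_smoothA.1 hp'.2
        have : 1 ≤ (D.filter fun k => k ∣ p.1 ∧ k ∣ p.2).card := by
          refine Finset.card_pos.2 ⟨Nat.gcd p.1 (greedy M p.2), ?_⟩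
          have hd1 : Nat.gcd p.1 (greedy M p.2) ∣ greedy M p.2 := Nat.gcd_dvd_right _ _
          have hd2 : greedy M p.2 ∣ p.2 := ⟨n, hyn⟩
          have hg0 : 0 < greedy M p.2 := Nat.pos_of_dvd_of_pos hd2 hsm.1
          refine Finset.mem_filter.2 ⟨Finset.mem_filter.2 ⟨Finset.mem_Icc.2 ⟨hc.2, ?_⟩, ?_⟩,
            Nat.gcd_dvd_left _ _, hd1.trans hd2⟩
          · refine (Nat.le_of_dvd hg0 hd1).trans (Nat.le_floor ?_)
            have hqR : (q : ℝ) ≤ R := hsm.2.2 q hgood.1 (hgood.2.1.trans hd2)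
            exact hgood.2.2.2.2.trans (by gcongr)
          · intro r hr
            obtain ⟨hr1, hr2, -⟩ := Nat.mem_primeFactors.1 hr
            exact hsm.2.2 r hr1 ((hr2.trans hd1).trans hd2)
        simpa using this
      · simp)
  rw [funext h1, funext h2]
  exact h3

lemma dom_h (P R : ℝ) : Dom (h P R) (h P R) := by
  have := Dom.trig_one (smoothA P R) (fun n => ((n ^ 4 : ℕ) : ℤ)) (a := fun _ => 1) (by simp)
  rw [funext (h_eq P R)]
  simp only [one_mul] at this
  exact this

lemma U_eq_zero {s : ℕ} (hs : s ≠ 0) {P R : ℝ} (hP : P < 1) : U s P R = 0 := by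
  have he : smoothA P R = ∅ := by
    apply Finset.subset_empty.1
    refine (smoothA_subset_Icc _ _).trans ?_
    rw [Nat.floor_eq_zero.2 hP]; simp
  unfold U; simp [h_eq, he, gs, hs]

lemma bigGcd_moment_le {P R M A μ T : ℝ} {K u : ℕ} (hP : 0 ≤ P) (hM : 1 ≤ M) (hR : 1 ≤ R) (hK : 1 ≤ K)
    (hT : 1 + Real.log (M * R) ≤ T) (hμ : ((2 * u : ℕ) : ℝ) + 2 ≤ 2 * μ) (hA : 0 ≤ A)
    (hU : ∀ P', 1 ≤ P' → P' ≤ P → U (2 * u + 2) P' R ≤ A * P' ^ μ) :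
    (∫ α in (0:ℝ)..1, (((‖h P R α‖ ^ (2 * u) : ℝ) : ℂ) * bigGcd P R M K α)).re ≤
      A * P ^ μ * ((K : ℝ) ^ (1 - 2 * μ / (2 * u + 2)) * T) := by
  set s : ℝ := 2 * u + 2 with hs
  have hs0 : 0 < s := by positivity
  push_cast at hμ
  have hμ0 : 0 < μ := by have : (0:ℝ) ≤ u := by positivity
                         linarith
  set σ := 2 * μ / s with hσ
  have hσ1 : 1 ≤ σ := by rw [hσ, le_div_iff₀ hs0]; linarith
  have hU' : ∀ P', 0 ≤ P' → P' ≤ P → U (2 * u + 2) P' R ≤ A * P' ^ μ := by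
    intro P' h0 h1
    by_cases h2 : 1 ≤ P'
    · exact hU _ h2 h1
    · rw [U_eq_zero (by omega) (not_le.1 h2)]; positivity
  have h1 := (dom_bigGcd (P := P) (R := R) hM K).mul_pow (dom_h P R) u
  refine (Complex.re_le_norm _).trans ?_
  simp_rw [mul_comm (((‖h P R _‖ ^ (2 * u) : ℝ)) : ℂ)]
  refine h1.trans ?_
  have h2 : ∀ α, (∑ k ∈ bigDivisors M R K, h (P / k) R (((k ^ 4 : ℕ) : ℝ) * α) *
      (starRingEnd ℂ) (h (P / k) R (((k ^ 4 : ℕ) : ℝ) * α))) * ((‖h P R α‖ ^ (2 * u) : ℝ) : ℂ) =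
      ((∑ k ∈ bigDivisors M R K, ‖h (P / k) R (((k ^ 4 : ℕ) : ℝ) * α)‖ ^ 2 * ‖h P R α‖ ^ (2 * u) : ℝ) : ℂ) := by
    intro α
    rw [← Finset.sum_mul]
    push_cast
    congr 1
    refine Finset.sum_congr rfl fun k _ => ?_
    rw [← normSq_eq]; push_cast; rfl
  simp_rw [h2]
  rw [intervalIntegral.integral_ofReal, Complex.ofReal_re, intervalIntegral.integral_finsetSum]
  swap
  · intro k _; exact ii (by fun_prop) _ _
  have h3 : ∀ k ∈ bigDivisors M R K, (∫ α in (0:ℝ)..1, ‖h (P / k) R (((k ^ 4 : ℕ) : ℝ) * α)‖ ^ 2 *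
      ‖h P R α‖ ^ (2 * u)) ≤ A * P ^ μ * ((K : ℝ) ^ (1 - σ) * (k : ℝ)⁻¹) := by
    intro k hk
    obtain ⟨hk1, -, -⟩ := mem_bigDivisors hk
    have hk0 : 0 < k := by omega
    have hkR : (1:ℝ) ≤ k := by exact_mod_cast hk0
    have h4 := holder01 (f := fun α => ‖h (P / k) R (((k ^ 4 : ℕ) : ℝ) * α)‖ ^ (2 * u + 2))
      (g := fun α => ‖h P R α‖ ^ (2 * u + 2)) (by fun_prop) (by fun_prop) (fun _ => by positivity)
      (fun _ => by positivity) (a := 2 / s) (b := 2 * u / s) (by positivity) (by positivity)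
      (by rw [hs]; field_simp; ring)
    have h5 : ∀ α, (‖h (P / k) R (((k ^ 4 : ℕ) : ℝ) * α)‖ ^ (2 * u + 2)) ^ (2 / s) *
        (‖h P R α‖ ^ (2 * u + 2)) ^ (2 * u / s) =
        ‖h (P / k) R (((k ^ 4 : ℕ) : ℝ) * α)‖ ^ 2 * ‖h P R α‖ ^ (2 * u) := by
      intro α
      have e1 : ((2 * u + 2 : ℕ) : ℝ) = s := by rw [hs]; push_cast; ring
      rw [← Real.rpow_natCast _ (2 * u + 2), ← Real.rpow_natCast _ (2 * u + 2),
        ← Real.rpow_mul (norm_nonneg _), ← Real.rpow_mul (norm_nonneg _), e1,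
        mul_div_cancel₀ _ hs0.ne', mul_div_cancel₀ _ hs0.ne', ← Real.rpow_natCast, ← Real.rpow_natCast]
      push_cast; rfl
    simp_rw [h5] at h4
    refine h4.trans ?_
    rw [U_dil _ _ _ _ (by positivity)]
    have hUP := hU' P hP le_rfl
    have hUk := hU' (P / k) (by positivity) (div_le_self hP hkR)
    change _ * (U (2 * u + 2) P R) ^ _ ≤ _
    have hk3 : (k : ℝ) ^ (-σ) ≤ (K : ℝ) ^ (1 - σ) * (k : ℝ)⁻¹ := by
      have : (k : ℝ) ^ (-σ) = (k : ℝ) ^ (1 - σ) * (k : ℝ)⁻¹ := by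
        rw [← Real.rpow_neg_one, ← Real.rpow_add (by linarith)]; congr 1; ring
      rw [this]
      have hK0 : (0:ℝ) < K := by exact_mod_cast hK
      have : (K : ℝ) ≤ k := by exact_mod_cast (by omega : K ≤ k)
      refine mul_le_mul_of_nonneg_right ?_ (by positivity)
      exact Real.rpow_le_rpow_of_nonpos hK0 this (by linarith)
    calc (U (2 * u + 2) (P / k) R) ^ (2 / s) * (U (2 * u + 2) P R) ^ (2 * u / s)
        ≤ (A * (P / k) ^ μ) ^ (2 / s) * (A * P ^ μ) ^ (2 * u / s) := by
          have := U_nonneg (2 * u + 2) (P / k) R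
          have := U_nonneg (2 * u + 2) P R
          gcongr
      _ = A * P ^ μ * (k : ℝ) ^ (-σ) := by
          have e1 : A * (P / k) ^ μ = (A * P ^ μ) * (k : ℝ) ^ (-μ) := by
            rw [Real.div_rpow hP (by positivity), Real.rpow_neg (by positivity)]; ring
          rw [e1, Real.mul_rpow (by positivity) (by positivity), ← Real.rpow_mul (by positivity),
            mul_right_comm, ← Real.rpow_add_of_nonneg (by positivity) (by positivity) (by positivity)]
          have e2 : 2 / s + 2 * u / s = 1 := by rw [hs]; field_simp; ring
          rw [e2, Real.rpow_one]
          congr 2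
          rw [hσ]; ring
      _ ≤ _ := by gcongr
  refine (Finset.sum_le_sum h3).trans ?_
  rw [← Finset.mul_sum, ← Finset.mul_sum]
  have h6 : ∑ k ∈ bigDivisors M R K, (k : ℝ)⁻¹ ≤ T := by
    refine le_trans ?_ hT
    have h7 : ∑ k ∈ bigDivisors M R K, (k : ℝ)⁻¹ ≤ ∑ k ∈ Finset.Icc 1 ⌊M * R⌋₊, (k : ℝ)⁻¹ := by
      refine Finset.sum_le_sum_of_subset_of_nonneg ?_ (fun _ _ _ => by positivity)
      intro k hk
      obtain ⟨a, b, -⟩ := mem_bigDivisors hk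
      exact Finset.mem_Icc.2 ⟨by omega, b⟩
    have h8 := harmonic_le_one_add_log ⌊M * R⌋₊
    rw [harmonic_eq_sum_Icc] at h8
    push_cast at h8
    refine h7.trans (h8.trans ?_)
    have : 1 ≤ M * R := one_le_mul_of_one_le_of_one_le hM hR
    have h9 : (0:ℝ) < ⌊M * R⌋₊ := by exact_mod_cast Nat.floor_pos.2 this
    gcongr
    exact Nat.floor_le (by linarith)
  gcongr

lemma dom_cs (Q R : ℝ) {c : ℕ → ℂ} (hc : ∀ n, ‖c n‖ ≤ 1) : Dom (cs (smoothA Q R) c) (h Q R) := by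
  have := Dom.trig_one (smoothA Q R) (fun n => ((n ^ 4 : ℕ) : ℤ)) (a := c) (fun n _ => hc n)
  rw [funext (h_eq Q R)]
  exact this

lemma cop_of_offdiagonal {P R M T V X : ℝ} {v k H : ℕ} (hM : 0 < M) (hP : 0 ≤ P)
    (hk : 0 < k)
    (hd : ∀ m : ℕ, 0 < m → (m : ℝ) ≤ M * R → 2 * ((m ^ 4).divisors.card : ℝ) ≤ T)
    (hH : P * k ^ 3 ≤ H * M ^ 4)
    (hV : ∀ c : ℕ → ℂ, (∀ n, ‖c n‖ ≤ 1) → ∫ α in (0:ℝ)..1, ‖cs (smoothA (P / M) R) c α‖ ^ v ≤ V)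
    (_ : 0 ≤ X) (hT : 0 ≤ T)
    (hX : ∀ c : ℕ → ℂ, (∀ n, ‖c n‖ ≤ 1) → ∀ A S : Finset ℕ,
      (∫ α in (0:ℝ)..1, diffSum H ⌊M * R / k⌋₊ ⌊P / k⌋₊ A S α *
        ((‖cs (smoothA (P / M) R) c α‖ ^ v : ℝ) : ℂ)).re ≤ X) :
    CopBound P R M v k (T ^ 2 * ((⌊M * R / k⌋₊ : ℝ) * ⌊P / k⌋₊ * V + 2 * X)) := by
  intro A hA c hc
  have hk' : (0:ℝ) < k := by exact_mod_cast hk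
  set W : ℝ → ℝ := fun α => ‖cs (smoothA (P / M) R) c α‖ ^ v with hW
  have hAle : ∀ m ∈ A, (m : ℝ) ≤ M * R := by
    intro m hm
    obtain ⟨h1, h2, h3⟩ := hA m hm
    refine le_trans ?_ h3
    have : (1:ℝ) ≤ k := by exact_mod_cast hk
    nlinarith [(Nat.cast_nonneg m : (0:ℝ) ≤ m)]
  have hAI : A ⊆ Finset.Icc 1 ⌊M * R / k⌋₊ := by
    intro m hm
    obtain ⟨h1, h2, h3⟩ := hA m hm
    refine Finset.mem_Icc.2 ⟨h1, Nat.le_floor ?_⟩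
    rw [le_div_iff₀ hk']; linarith
  have h1 := averaging (W := W) (H := H) (M := ⌊M * R / k⌋₊) (P := ⌊P / k⌋₊) (A := A)
    (S := smoothA (P / k) R) (B := T ^ 2) (by simp only [hW]; fun_prop)
    (fun x => by simp only [hW, cs_add_one]) (fun x => by simp only [hW]; positivity) hAI
    (smoothA_subset_Icc _ _) (fun m hm => ?_) (by positivity) (fun m hm => ?_)
  · refine h1.trans ?_
    have hW0 : 0 ≤ ∫ α in (0:ℝ)..1, W α := integral01_nonneg fun _ => by simp only [hW]; positivity
    have hc1 : (A.card : ℝ) ≤ ⌊M * R / k⌋₊ := by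
      have := Finset.card_le_card hAI
      rw [Nat.card_Icc, Nat.add_sub_cancel] at this
      exact_mod_cast this
    have hV' := hV c hc
    have hX' := hX c hc A (smoothA (P / k) R)
    have h2 : (A.card : ℝ) * ⌊P / k⌋₊ * ∫ α in (0:ℝ)..1, W α ≤ (⌊M * R / k⌋₊ : ℝ) * ⌊P / k⌋₊ * V := by
      gcongr
    refine mul_le_mul_of_nonneg_left ?_ (by positivity)
    exact add_le_add h2 (mul_le_mul_of_nonneg_left hX' (by norm_num))
  · obtain ⟨h1, h2, h3⟩ := hA m hm
    have h4 : (⌊P / k⌋₊ : ℝ) ≤ H * (m : ℝ) ^ 4 := by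
      refine (Nat.floor_le (by positivity)).trans ?_
      rw [div_le_iff₀ hk']
      have h5 : M ^ 4 ≤ (k * m : ℝ) ^ 4 := by gcongr
      have h6 : P * k ^ 3 ≤ (H * (m : ℝ) ^ 4 * k) * k ^ 3 := by
        refine hH.trans ((mul_le_mul_of_nonneg_left h5 (Nat.cast_nonneg H)).trans (le_of_eq ?_))
        ring
      exact le_of_mul_le_mul_right h6 (by positivity)
    exact_mod_cast h4
  · have := hd m (hA m hm).1 (hAle m hm)
    push_cast
    rw [sq]
    gcongr

lemma cop_even {P R M T : ℝ} {k H : ℕ} (n : ℕ) (hM : 0 < M) (hP : 0 ≤ P) (hk : 0 < k) (hT : 0 ≤ T)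
    (hd : ∀ m : ℕ, 0 < m → (m : ℝ) ≤ M * R → 2 * ((m ^ 4).divisors.card : ℝ) ≤ T)
    (hH : P * k ^ 3 ≤ H * M ^ 4) :
    CopBound P R M (2 * n) k (T ^ 2 * ((⌊M * R / k⌋₊ : ℝ) * ⌊P / k⌋₊ * U (2 * n) (P / M) R +
      2 * ∫ α in (0:ℝ)..1, ‖F1 H ⌊M * R / k⌋₊ ⌊P / k⌋₊ α‖ * ‖h (P / M) R α‖ ^ (2 * n))) := by
  refine cop_of_offdiagonal hM hP hk hd hH (fun c hc => (dom_cs _ _ hc).pow_even n)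
    (integral01_nonneg fun _ => by positivity) hT (fun c hc A S => ?_)
  have h1 := (dom_diffSum H ⌊M * R / k⌋₊ ⌊P / k⌋₊ A S).mul_pow (dom_cs (P / M) R hc) n
  refine (Complex.re_le_norm _).trans (h1.trans ((Complex.re_le_norm _).trans ?_))
  refine (intervalIntegral.norm_integral_le_integral_norm (by norm_num)).trans (le_of_eq ?_)
  refine intervalIntegral.integral_congr fun α _ => ?_
  rw [norm_mul, Complex.norm_real, Real.norm_of_nonneg (by positivity)]

lemma cop_nine {P R M T : ℝ} {k H : ℕ} (hM : 0 < M) (hP : 0 ≤ P) (hk : 0 < k) (hT : 0 ≤ T)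
    (hd : ∀ m : ℕ, 0 < m → (m : ℝ) ≤ M * R → 2 * ((m ^ 4).divisors.card : ℝ) ≤ T)
    (hH : P * k ^ 3 ≤ H * M ^ 4) :
    CopBound P R M 9 k (T ^ 2 * ((⌊M * R / k⌋₊ : ℝ) * ⌊P / k⌋₊ *
        (U 8 (P / M) R ^ (1 / 2 : ℝ) * U 10 (P / M) R ^ (1 / 2 : ℝ)) +
      2 * ((∫ α in (0:ℝ)..1, ‖F1 H ⌊M * R / k⌋₊ ⌊P / k⌋₊ α‖ ^ 2 * ‖h (P / M) R α‖ ^ 8) ^ (1 / 2 : ℝ) *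
        U 10 (P / M) R ^ (1 / 2 : ℝ)))) := by
  have h10 : ∀ c : ℕ → ℂ, (∀ n, ‖c n‖ ≤ 1) →
      ∫ α in (0:ℝ)..1, (‖cs (smoothA (P / M) R) c α‖ ^ 5) ^ 2 ≤ U 10 (P / M) R := by
    intro c hc
    have := (dom_cs (P / M) R hc).pow_even 5
    simp_rw [← pow_mul]
    exact this
  have hI0 : 0 ≤ ∫ α in (0:ℝ)..1, ‖F1 H ⌊M * R / k⌋₊ ⌊P / k⌋₊ α‖ ^ 2 * ‖h (P / M) R α‖ ^ 8 :=
    integral01_nonneg fun _ => by positivity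
  have hU10 := U_nonneg 10 (P / M) R
  refine cop_of_offdiagonal hM hP hk hd hH (fun c hc => ?_) (by positivity) hT (fun c hc A S => ?_)
  · have h1 := cauchy01 (f := fun α => ‖cs (smoothA (P / M) R) c α‖ ^ 4)
      (g := fun α => ‖cs (smoothA (P / M) R) c α‖ ^ 5) (by fun_prop) (by fun_prop)
      (fun _ => by positivity) (fun _ => by positivity)
    simp_rw [← pow_add] at h1
    refine h1.trans ?_
    have h8 : ∫ α in (0:ℝ)..1, (‖cs (smoothA (P / M) R) c α‖ ^ 4) ^ 2 ≤ U 8 (P / M) R := by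
      have := (dom_cs (P / M) R hc).pow_even 4
      simp_rw [← pow_mul]
      exact this
    have n8 : 0 ≤ ∫ α in (0:ℝ)..1, (‖cs (smoothA (P / M) R) c α‖ ^ 4) ^ 2 :=
      integral01_nonneg fun _ => by positivity
    have n10 : 0 ≤ ∫ α in (0:ℝ)..1, (‖cs (smoothA (P / M) R) c α‖ ^ 5) ^ 2 :=
      integral01_nonneg fun _ => by positivity
    have := h10 c hc
    have hU8 := U_nonneg 8 (P / M) R
    gcongr
  · refine (Complex.re_le_norm _).trans ?_
    refine (intervalIntegral.norm_integral_le_integral_norm (by norm_num)).trans ?_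
    have h1 := cauchy01 (f := fun α => ‖diffSum H ⌊M * R / k⌋₊ ⌊P / k⌋₊ A S α‖ *
        ‖cs (smoothA (P / M) R) c α‖ ^ 4)
      (g := fun α => ‖cs (smoothA (P / M) R) c α‖ ^ 5) (by fun_prop) (by fun_prop)
      (fun _ => by positivity) (fun _ => by positivity)
    refine le_trans (le_of_eq ?_) (h1.trans ?_)
    · refine intervalIntegral.integral_congr fun α _ => ?_
      rw [norm_mul, Complex.norm_real, Real.norm_of_nonneg (by positivity)]; ring
    · have h2 : ∫ α in (0:ℝ)..1, (‖diffSum H ⌊M * R / k⌋₊ ⌊P / k⌋₊ A S α‖ *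
          ‖cs (smoothA (P / M) R) c α‖ ^ 4) ^ 2 ≤
          ∫ α in (0:ℝ)..1, ‖F1 H ⌊M * R / k⌋₊ ⌊P / k⌋₊ α‖ ^ 2 * ‖h (P / M) R α‖ ^ 8 := by
        have := (dom_diffSum H ⌊M * R / k⌋₊ ⌊P / k⌋₊ A S).sq_mul_pow (dom_cs (P / M) R hc) 4
        simp_rw [_root_.mul_pow, ← pow_mul]
        exact this
      have n2 : 0 ≤ ∫ α in (0:ℝ)..1, (‖diffSum H ⌊M * R / k⌋₊ ⌊P / k⌋₊ A S α‖ *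
          ‖cs (smoothA (P / M) R) c α‖ ^ 4) ^ 2 := integral01_nonneg fun _ => by positivity
      have n10 : 0 ≤ ∫ α in (0:ℝ)..1, (‖cs (smoothA (P / M) R) c α‖ ^ 5) ^ 2 :=
        integral01_nonneg fun _ => by positivity
      have := h10 c hc
      gcongr

lemma bigGcd_eq_zero {P R M : ℝ} {K : ℕ} (hK : P < K + 1) (α : ℝ) : bigGcd P R M K α = 0 := by
  unfold bigGcd
  refine Finset.sum_eq_zero fun y _ => ?_
  refine Finset.sum_eq_zero fun x hx => ?_
  exfalso
  obtain ⟨h1, h2⟩ := Finset.mem_filter.1 hx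
  have h3 := mem_smoothA.1 h1
  have h4 : Nat.gcd x (greedy M y) ≤ x := Nat.le_of_dvd h3.1 (Nat.gcd_dvd_left _ _)
  have : (x : ℝ) < K + 1 := h3.2.1.trans_lt hK
  have : x < K + 1 := by exact_mod_cast this
  omega

/-- `s` is admissible with exponent `μ`: mean values of smooth Weyl sums of lengths `P' ≤ P`
are `≪ P ^ ε * P' ^ μ`, for smoothness parameters at most a small power of `P`. -/
def Adm (s : ℕ) (μ : ℝ) : Prop :=
  0 ≤ μ ∧ ∀ ε : ℝ, 0 < ε → ∃ τ : ℝ, 0 < τ ∧ ∃ P₀ : ℝ, 1 ≤ P₀ ∧ ∀ P ≥ P₀, ∀ R, 2 ≤ R → R ≤ P ^ τ →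
    ∀ P', 1 ≤ P' → P' ≤ P → U s P' R ≤ P ^ ε * P' ^ μ

lemma norm_h_le {P : ℝ} (hP : 0 ≤ P) (R α : ℝ) : ‖h P R α‖ ≤ P := by
  unfold h
  refine (norm_sum_le _ _).trans ?_
  simp only [norm_e, Finset.sum_const, nsmul_eq_mul, mul_one]
  calc ((smoothA P R).card : ℝ) ≤ ((Finset.Icc 1 ⌊P⌋₊).card : ℝ) := by
        exact_mod_cast Finset.card_le_card (smoothA_subset_Icc P R)
    _ = (⌊P⌋₊ : ℝ) := by simp
    _ ≤ P := Nat.floor_le hP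

lemma U_add_le {P : ℝ} (hP : 0 ≤ P) (s j : ℕ) (R : ℝ) : U (s + j) P R ≤ P ^ j * U s P R := by
  unfold U
  rw [← intervalIntegral.integral_const_mul]
  refine integral01_mono (by fun_prop) (by fun_prop) fun α => ?_
  rw [pow_add, mul_comm]
  have := norm_h_le hP R α
  gcongr

lemma U_le_pow {P : ℝ} (hP : 0 ≤ P) (s : ℕ) (R : ℝ) : U s P R ≤ P ^ s := by
  have := U_add_le hP 0 s R
  simpa [U] using this

lemma Adm.of_weak {s : ℕ} {μ : ℝ} (hμ : 0 ≤ μ)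
    (H : ∀ ε : ℝ, 0 < ε → ∃ τ : ℝ, 0 < τ ∧ ∃ P₀ : ℝ, 1 ≤ P₀ ∧ ∀ P ≥ P₀, ∀ R, 2 ≤ R → R ≤ P ^ τ →
      U s P R ≤ P ^ (μ + ε)) : Adm s μ := by
  refine ⟨hμ, fun ε hε => ?_⟩
  obtain ⟨τ, hτ, P₀, hP₀, hU⟩ := H ε hε
  set c : ℝ := ε / (s + 1) with hc
  have hc0 : 0 < c := by positivity
  refine ⟨c * τ, by positivity, P₀ ^ (1 / c), Real.one_le_rpow hP₀ (by positivity), ?_⟩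
  intro P hP R hR hRP P' hP' hPP
  have hP0 : 0 < P := by linarith
  have hP'0 : 0 < P' := by linarith
  have hP1 : 1 ≤ P := by linarith
  by_cases hc' : P ^ c ≤ P'
  · have h1 : P₀ ≤ P' := by
      refine le_trans ?_ hc'
      have := Real.rpow_le_rpow (by positivity) hP hc0.le
      rwa [← Real.rpow_mul (by linarith), one_div, inv_mul_cancel₀ hc0.ne', Real.rpow_one] at this
    have h2 : R ≤ P' ^ τ := by
      refine hRP.trans ?_
      rw [Real.rpow_mul hP0.le]
      exact Real.rpow_le_rpow (by positivity) hc' hτ.le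
    refine (hU P' h1 R hR h2).trans ?_
    rw [Real.rpow_add hP'0, mul_comm]
    gcongr
  · push Not at hc'
    refine (U_le_pow hP'0.le s R).trans ?_
    calc P' ^ s ≤ (P ^ c) ^ s := by gcongr
      _ = P ^ (c * s) := by rw [Real.rpow_mul hP0.le, Real.rpow_natCast]
      _ ≤ P ^ ε := by
        refine Real.rpow_le_rpow_of_exponent_le hP1 ?_
        rw [hc, div_mul_eq_mul_div, div_le_iff₀ (by positivity)]
        nlinarith
      _ ≤ P ^ ε * P' ^ μ := le_mul_of_one_le_right (by positivity) (Real.one_le_rpow hP' hμ)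

lemma Adm.mono {s : ℕ} {μ ν : ℝ} (H : Adm s μ) (hμν : μ ≤ ν) : Adm s ν := by
  refine ⟨H.1.trans hμν, fun ε hε => ?_⟩
  obtain ⟨τ, hτ, P₀, hP₀, hU⟩ := H.2 ε hε
  refine ⟨τ, hτ, P₀, hP₀, fun P hP R hR hRP P' hP' hPP => (hU P hP R hR hRP P' hP' hPP).trans ?_⟩
  have := Real.rpow_le_rpow_of_exponent_le hP' hμν
  have h0 : 0 ≤ P := by linarith
  gcongr

lemma Adm.of_forall_lt {s : ℕ} {μ : ℝ} (hμ : 0 ≤ μ) (H : ∀ ν, μ < ν → Adm s ν) : Adm s μ := by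
  refine ⟨hμ, fun ε hε => ?_⟩
  obtain ⟨-, h1⟩ := H (μ + ε / 2) (by linarith)
  obtain ⟨τ, hτ, P₀, hP₀, hU⟩ := h1 (ε / 2) (by positivity)
  refine ⟨τ, hτ, P₀, hP₀, fun P hP R hR hRP P' hP' hPP => (hU P hP R hR hRP P' hP' hPP).trans ?_⟩
  have h0 : 0 < P := by linarith
  have h1 : 0 < P' := by linarith
  rw [Real.rpow_add h1, show ε = ε / 2 + ε / 2 by ring, Real.rpow_add h0]
  have : P' ^ (ε / 2) ≤ P ^ (ε / 2) := Real.rpow_le_rpow h1.le hPP (by positivity)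
  rw [add_halves]
  calc P ^ (ε / 2) * (P' ^ μ * P' ^ (ε / 2))
      = P ^ (ε / 2) * P' ^ (ε / 2) * P' ^ μ := by ring
    _ ≤ _ := by gcongr

lemma Adm.add {s : ℕ} {μ : ℝ} (H : Adm s μ) (j : ℕ) : Adm (s + j) (μ + j) := by
  refine ⟨by have := H.1; positivity, fun ε hε => ?_⟩
  obtain ⟨τ, hτ, P₀, hP₀, hU⟩ := H.2 ε hε
  refine ⟨τ, hτ, P₀, hP₀, fun P hP R hR hRP P' hP' hPP => ?_⟩
  have h1 : 0 < P' := by linarith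
  refine (U_add_le h1.le s j R).trans ?_
  have := hU P hP R hR hRP P' hP' hPP
  rw [Real.rpow_add h1, Real.rpow_natCast]
  calc P' ^ j * U s P' R ≤ P' ^ j * (P ^ ε * P' ^ μ) := by gcongr
    _ = _ := by ring

lemma exists_least_adm {s : ℕ} (H : ∃ μ, Adm s μ) : ∃ μ, Adm s μ ∧ ∀ ν, Adm s ν → μ ≤ ν := by
  set S : Set ℝ := {μ | Adm s μ} with hS
  have hb : BddBelow S := ⟨0, fun μ hμ => hμ.1⟩
  refine ⟨sInf S, Adm.of_forall_lt (le_csInf H fun μ hμ => hμ.1) fun ν hν => ?_,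
    fun ν hν => csInf_le hb hν⟩
  obtain ⟨μ, hμ, hlt⟩ := exists_lt_of_csInf_lt H hν
  exact Adm.mono hμ hlt.le

lemma card_sub_fourth_le {n : ℤ} (hn : n ≠ 0) (S : Finset (ℕ × ℕ))
    (hS : ∀ p ∈ S, (p.1 : ℤ) ^ 4 - (p.2 : ℤ) ^ 4 = n) : S.card ≤ n.natAbs.divisors.card := by
  have fac : ∀ p : ℕ × ℕ, (p.1 : ℤ) ^ 4 - (p.2 : ℤ) ^ 4 =
      ((p.1 : ℤ) - p.2) * (((p.1 : ℤ) + p.2) * ((p.1 : ℤ) ^ 2 + (p.2 : ℤ) ^ 2)) := fun p => by ring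
  refine Finset.card_le_card_of_injOn (fun p => ((p.1 : ℤ) - p.2).natAbs) ?_ ?_
  · intro p hp
    have := hS p hp
    simp only [Finset.mem_coe, Nat.mem_divisors]
    refine ⟨Int.natAbs_dvd_natAbs.2 ⟨_, by rw [← this, fac]⟩, by simpa using hn⟩
  · rintro p hp q hq hpq
    have h1 := hS p hp
    have h2 := hS q hq
    simp only at hpq
    have pos : ∀ r ∈ S, 0 < ((r.1 : ℤ) + r.2) * ((r.1 : ℤ) ^ 2 + (r.2 : ℤ) ^ 2) := by
      intro r hr
      have h3 := hS r hr
      rw [fac] at h3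
      refine lt_of_le_of_ne (by positivity) fun h0 => hn ?_
      rw [← h3, ← h0, mul_zero]
    have p1 := pos p hp
    have p2 := pos q hq
    have hd : (p.1 : ℤ) - p.2 = q.1 - q.2 := by
      rcases Int.natAbs_eq_natAbs_iff.1 hpq with hd | hd
      · exact hd
      · exfalso
        rw [fac] at h1 h2
        rw [hd] at h1
        have h3 : (q.1 : ℤ) - q.2 ≠ 0 := by
          intro h0; rw [h0] at h2; simp at h2; exact hn h2.symm
        have h4 : ((q.1 : ℤ) - q.2) * (((q.1 : ℤ) + q.2) * ((q.1 : ℤ) ^ 2 + (q.2 : ℤ) ^ 2) +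
          ((p.1 : ℤ) + p.2) * ((p.1 : ℤ) ^ 2 + (p.2 : ℤ) ^ 2)) = 0 := by linarith
        rcases mul_eq_zero.1 h4 with h5 | h5
        · exact h3 h5
        · linarith
    rw [fac] at h1 h2
    have h3 : (p.1 : ℤ) - p.2 ≠ 0 := by
      intro h0; rw [h0] at h1; simp at h1; exact hn h1.symm
    have h4 : ((p.1 : ℤ) + p.2) * ((p.1 : ℤ) ^ 2 + (p.2 : ℤ) ^ 2) =
        ((q.1 : ℤ) + q.2) * ((q.1 : ℤ) ^ 2 + (q.2 : ℤ) ^ 2) := by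
      refine mul_left_cancel₀ h3 ?_
      rw [h1, hd, h2]
    have h5 : ((p.1 : ℤ) + p.2 - (q.1 + q.2)) * (((p.1 : ℤ) + p.2) ^ 2 +
        ((p.1 : ℤ) + p.2) * (q.1 + q.2) + ((q.1 : ℤ) + q.2) ^ 2 + ((p.1 : ℤ) - p.2) ^ 2) = 0 := by
      have e1 : 2 * (((p.1 : ℤ) + p.2) * ((p.1 : ℤ) ^ 2 + (p.2 : ℤ) ^ 2)) =
        ((p.1 : ℤ) + p.2) ^ 3 + ((p.1 : ℤ) + p.2) * ((p.1 : ℤ) - p.2) ^ 2 := by ring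
      have e2 : 2 * (((q.1 : ℤ) + q.2) * ((q.1 : ℤ) ^ 2 + (q.2 : ℤ) ^ 2)) =
        ((q.1 : ℤ) + q.2) ^ 3 + ((q.1 : ℤ) + q.2) * ((p.1 : ℤ) - p.2) ^ 2 := by rw [hd]; ring
      linear_combination e2 - e1 + 2 * h4
    rcases mul_eq_zero.1 h5 with h6 | h6
    · ext <;> omega
    · exfalso
      have : 0 < ((p.1 : ℤ) - p.2) ^ 2 := by positivity
      have : 0 ≤ ((p.1 : ℤ) + p.2) ^ 2 + ((p.1 : ℤ) + p.2) * (q.1 + q.2) + ((q.1 : ℤ) + q.2) ^ 2 := by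
        positivity
      linarith

lemma U_four_le {P T : ℝ} (hP : 1 ≤ P) (hF : Fud P T) (R : ℝ) : U 4 P R ≤ 4 * P ^ 2 * T := by
  classical
  set A := smoothA P R with hA
  have hT := hF.hundred_le
  have hcard : (A.card : ℝ) ≤ P := by
    calc (A.card : ℝ) ≤ ((Finset.Icc 1 ⌊P⌋₊).card : ℝ) := by
          exact_mod_cast Finset.card_le_card (smoothA_subset_Icc P R)
      _ = (⌊P⌋₊ : ℝ) := by simp
      _ ≤ P := Nat.floor_le (by linarith)
  set g : ℝ → ℂ := fun α => ∑ i ∈ A.offDiag, e ((((i.1 : ℤ) ^ 4 - (i.2 : ℤ) ^ 4 : ℤ) : ℝ) * α) with hg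
  have hgc : Continuous g := by unfold g; fun_prop
  have hsplit : ∀ α, ((‖h P R α‖ ^ 2 : ℝ) : ℂ) = A.card + g α := by
    intro α
    rw [normSq_eq, h, map_sum, Finset.sum_mul_sum, ← Finset.sum_product', ← Finset.diag_union_offDiag,
      Finset.sum_union (Finset.disjoint_diag_offDiag A)]
    congr 1
    · rw [Finset.sum_diag]
      simp only [conj_e, ← e_add, add_neg_cancel, e_zero]; simp [hA]
    · refine Finset.sum_congr rfl fun i _ => ?_
      rw [conj_e, ← e_add]; push_cast; congr 1; ring
  have hgb : ∫ α in (0:ℝ)..1, ‖g α‖ ^ 2 ≤ A.offDiag.card * T := by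
    refine integral_normSq_le _ (fun i : ℕ × ℕ => ((i.1 : ℤ) ^ 4 - (i.2 : ℤ) ^ 4)) T fun i hi => ?_
    rw [Finset.mem_offDiag] at hi
    have m1 := mem_smoothA.1 hi.1
    have m2 := mem_smoothA.1 hi.2.1
    have hn : (i.1 : ℤ) ^ 4 - (i.2 : ℤ) ^ 4 ≠ 0 := by
      intro h0
      have h1 : i.1 ^ 4 = i.2 ^ 4 := by exact_mod_cast sub_eq_zero.1 h0
      exact hi.2.2 (Nat.pow_left_injective (by norm_num : (4:ℕ) ≠ 0) h1)
    have h1 := card_sub_fourth_le hn (A.offDiag.filter fun j =>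
      (i.1 : ℤ) ^ 4 - (i.2 : ℤ) ^ 4 = (j.1 : ℤ) ^ 4 - (j.2 : ℤ) ^ 4)
      (fun p hp => ((Finset.mem_filter.1 hp).2).symm)
    refine le_trans (by exact_mod_cast h1) (hF.div_le _ (Int.natAbs_ne_zero.2 hn) ?_)
    have hb : ((((i.1 : ℤ) ^ 4 - (i.2 : ℤ) ^ 4).natAbs : ℕ) : ℝ) ≤ P ^ 4 := by
      rw [Nat.cast_natAbs]; push_cast
      have a1 : (i.1 : ℝ) ^ 4 ≤ P ^ 4 := pow_le_pow_left₀ (by positivity) m1.2.1 4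
      have a2 : (i.2 : ℝ) ^ 4 ≤ P ^ 4 := pow_le_pow_left₀ (by positivity) m2.2.1 4
      have a3 : 0 ≤ (i.1 : ℝ) ^ 4 := by positivity
      have a4 : 0 ≤ (i.2 : ℝ) ^ 4 := by positivity
      rw [abs_le]; constructor <;> linarith
    exact hb.trans (pow_le_pow_right₀ hP (by norm_num : 4 ≤ 50))
  have hpt : ∀ α, ‖h P R α‖ ^ 4 ≤ 2 * (A.card : ℝ) ^ 2 + 2 * ‖g α‖ ^ 2 := by
    intro α
    have h1 : ‖h P R α‖ ^ 2 ≤ A.card + ‖g α‖ := by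
      have := congrArg norm (hsplit α)
      rw [Complex.norm_real, Real.norm_of_nonneg (by positivity)] at this
      rw [this]
      refine (norm_add_le _ _).trans (by simp)
    calc ‖h P R α‖ ^ 4 = (‖h P R α‖ ^ 2) ^ 2 := by ring
      _ ≤ (A.card + ‖g α‖) ^ 2 := by gcongr
      _ ≤ _ := by nlinarith [sq_nonneg ((A.card : ℝ) - ‖g α‖)]
  have h1 : U 4 P R ≤ ∫ α in (0:ℝ)..1, (2 * (A.card : ℝ) ^ 2 + 2 * ‖g α‖ ^ 2) :=
    integral01_mono (by fun_prop) (by fun_prop) hpt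
  rw [intervalIntegral.integral_add (ii (by fun_prop) _ _) (ii (by fun_prop) _ _),
    intervalIntegral.integral_const_mul, intervalIntegral.integral_const] at h1
  have h2 : (A.offDiag.card : ℝ) ≤ P ^ 2 := by
    have : A.offDiag.card ≤ A.card ^ 2 := by rw [Finset.offDiag_card, sq]; exact Nat.sub_le _ _
    calc (A.offDiag.card : ℝ) ≤ (A.card : ℝ) ^ 2 := by exact_mod_cast this
      _ ≤ P ^ 2 := by gcongr
  have h3 : (A.card : ℝ) ^ 2 ≤ P ^ 2 := by gcongr
  have h4 : (A.offDiag.card : ℝ) * T ≤ P ^ 2 * T := by gcongr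
  have h5 : P ^ 2 * 100 ≤ P ^ 2 * T := by gcongr
  simp at h1
  nlinarith

lemma adm_four : Adm 4 2 := by
  refine Adm.of_weak (by norm_num) fun ε hε => ?_
  obtain ⟨P₀, hP₀, hF⟩ := eventually_fud (ε / 2) (by positivity)
  refine ⟨1, one_pos, P₀, hP₀, fun P hP R _ _ => ?_⟩
  have hP1 : 1 ≤ P := hP₀.trans hP
  have hP0 : 0 < P := one_pos.trans_le hP1
  have hT := (hF P hP).hundred_le
  refine (U_four_le hP1 (hF P hP) R).trans ?_
  rw [Real.rpow_add hP0, Real.rpow_two, show ε = ε / 2 + ε / 2 by ring,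
    Real.rpow_add hP0, add_halves]
  have h0 : 0 < P ^ 2 := by positivity
  have : 4 * P ^ (ε / 2) ≤ P ^ (ε / 2) * P ^ (ε / 2) := by gcongr; linarith
  nlinarith

/-- `X` is nonnegative and at most `P ^ x`. -/
def Bd (P x X : ℝ) : Prop := 0 ≤ X ∧ X ≤ P ^ x

lemma Bd.mono {P x y X : ℝ} (H : Bd P x X) (hP : 1 ≤ P) (h : x ≤ y) : Bd P y X :=
  ⟨H.1, H.2.trans (Real.rpow_le_rpow_of_exponent_le hP h)⟩

lemma Bd.of_le {P x X Y : ℝ} (H : Bd P x X) (h0 : 0 ≤ Y) (h : Y ≤ X) : Bd P x Y := ⟨h0, h.trans H.2⟩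

lemma Bd.self {P : ℝ} (hP : 0 ≤ P) (x : ℝ) : Bd P x (P ^ x) := ⟨by positivity, le_rfl⟩

lemma Bd.mul {P x y X Y : ℝ} (hP : 0 < P) (H : Bd P x X) (K : Bd P y Y) : Bd P (x + y) (X * Y) := by
  refine ⟨mul_nonneg H.1 K.1, ?_⟩
  rw [Real.rpow_add hP]
  exact mul_le_mul H.2 K.2 K.1 (by positivity)

lemma Bd.rpow {P x X r : ℝ} (hP : 0 < P) (H : Bd P x X) (hr : 0 ≤ r) : Bd P (x * r) (X ^ r) := by
  refine ⟨Real.rpow_nonneg H.1 _, ?_⟩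
  rw [Real.rpow_mul hP.le]
  exact Real.rpow_le_rpow H.1 H.2 hr

lemma Bd.pow {P x X : ℝ} (hP : 0 < P) (H : Bd P x X) (n : ℕ) : Bd P (x * n) (X ^ n) := by
  have := H.rpow hP (Nat.cast_nonneg n)
  rwa [Real.rpow_natCast] at this

lemma Bd.add {P x y z τ X Y : ℝ} (hP : 1 ≤ P) (hT : 2 ≤ P ^ τ) (H : Bd P x X) (K : Bd P y Y)
    (h1 : x + τ ≤ z) (h2 : y + τ ≤ z) : Bd P z (X + Y) := by
  have hP0 : 0 < P := by linarith
  refine ⟨add_nonneg H.1 K.1, ?_⟩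
  have a1 := (H.mono hP (show x ≤ z - τ by linarith)).2
  have a2 := (K.mono hP (show y ≤ z - τ by linarith)).2
  have h0 : 0 ≤ P ^ (z - τ) := by positivity
  calc X + Y ≤ 2 * P ^ (z - τ) := by linarith
    _ ≤ P ^ τ * P ^ (z - τ) := by gcongr
    _ = P ^ z := by rw [← Real.rpow_add hP0]; congr 1; ring

/-- The parameters of one step of the iterative method. -/
structure Env (P R τ θ : ℝ) : Prop where
  one_lt : 1 < P
  tau_pos : 0 < τ
  tau_le : τ ≤ 1 / 100
  le_theta : 1 / 100 ≤ θ
  theta_le : θ ≤ 1 / 4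
  fud : Fud (P ^ 4) (P ^ τ)
  two_le : 2 ≤ R
  le_rpow : R ≤ P ^ τ

namespace Env

variable {P R τ θ : ℝ}

lemma pos (E : Env P R τ θ) : 0 < P := by linarith [E.one_lt]

lemma hundred (E : Env P R τ θ) : 100 ≤ P ^ τ := E.fud.hundred_le

lemma two (E : Env P R τ θ) : 2 ≤ P ^ τ := by linarith [E.hundred]

lemma const (E : Env P R τ θ) {c : ℝ} (h0 : 0 ≤ c) (h1 : c ≤ 100) : Bd P τ c :=
  ⟨h0, h1.trans E.hundred⟩

/-- The exponent of `k` as a power of `P`. -/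
def lg (P : ℝ) (k : ℕ) : ℝ := Real.log k / Real.log P

lemma rpow_lg (E : Env P R τ θ) {k : ℕ} (hk : 0 < k) : P ^ lg P k = k := by
  have hk' : (0:ℝ) < k := by exact_mod_cast hk
  rw [Real.rpow_def_of_pos E.pos, lg, mul_div_cancel₀ _ (Real.log_pos E.one_lt).ne', Real.exp_log hk']

lemma lg_nonneg (E : Env P R τ θ) {k : ℕ} (hk : 0 < k) : 0 ≤ lg P k := by
  have hk' : (1:ℝ) ≤ k := by exact_mod_cast hk
  exact div_nonneg (Real.log_nonneg hk') (Real.log_pos E.one_lt).le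

lemma lg_le (E : Env P R τ θ) {k : ℕ} (hk : 0 < k) (hkP : (k : ℝ) ≤ P) : lg P k ≤ 1 := by
  have hk' : (0:ℝ) < k := by exact_mod_cast hk
  rw [lg, div_le_one (Real.log_pos E.one_lt)]
  exact Real.log_le_log hk' hkP

lemma div_theta (E : Env P R τ θ) : P / P ^ θ = P ^ (1 - θ) := by
  rw [Real.rpow_sub E.pos, Real.rpow_one]

/-- The length of the differencing parameter. -/
def len (P θ : ℝ) (k : ℕ) : ℕ := ⌈P * k ^ 3 / (P ^ θ) ^ 4⌉₊

lemma len_arg (E : Env P R τ θ) {k : ℕ} (hk : 0 < k) :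
    P * k ^ 3 / (P ^ θ) ^ 4 = P ^ (1 + 3 * lg P k - 4 * θ) := by
  rw [← E.rpow_lg hk, ← Real.rpow_natCast, ← Real.rpow_natCast, ← Real.rpow_mul E.pos.le,
    ← Real.rpow_mul E.pos.le, Real.rpow_sub E.pos, Real.rpow_add E.pos, Real.rpow_one]
  push_cast
  ring_nf

lemma bd_len (E : Env P R τ θ) {k : ℕ} (hk : 0 < k) :
    Bd P (1 + 3 * lg P k - 4 * θ + τ) (len P θ k) := by
  refine ⟨by positivity, ?_⟩
  have h1 : 1 ≤ P ^ (1 + 3 * lg P k - 4 * θ) :=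
    Real.one_le_rpow E.one_lt.le (by linarith [E.lg_nonneg hk, E.theta_le])
  rw [Real.rpow_add E.pos, len, E.len_arg hk]
  have h2 := Nat.ceil_lt_add_one (zero_le_one.trans h1)
  have := E.two
  nlinarith

lemma len_mul_le {k : ℕ} (hP : 0 < P) : P * k ^ 3 ≤ len P θ k * (P ^ θ) ^ 4 := by
  rw [← div_le_iff₀ (by positivity)]
  exact Nat.le_ceil _

lemma bd_floor_M (E : Env P R τ θ) {k : ℕ} (hk : 0 < k) :
    Bd P (θ + τ - lg P k) (⌊P ^ θ * R / k⌋₊ : ℝ) := by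
  have h1 := E.pos
  have h2 := E.two_le
  refine ⟨by positivity, (Nat.floor_le (by positivity)).trans ?_⟩
  rw [Real.rpow_sub E.pos, Real.rpow_add E.pos, E.rpow_lg hk]
  have := E.le_rpow
  gcongr

lemma bd_floor_P (E : Env P R τ θ) {k : ℕ} (hk : 0 < k) :
    Bd P (1 - lg P k) (⌊P / k⌋₊ : ℝ) := by
  have h1 := E.pos
  refine ⟨by positivity, (Nat.floor_le (by positivity)).trans ?_⟩
  rw [Real.rpow_sub E.pos, E.rpow_lg hk, Real.rpow_one]

lemma one_le_floor {k : ℕ} (hk : 0 < k) (hkP : (k : ℝ) ≤ P) : 1 ≤ ⌊P / k⌋₊ := by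
  have hk' : (0:ℝ) < k := by exact_mod_cast hk
  rw [Nat.one_le_floor_iff, le_div_iff₀ hk']; linarith

lemma half_le_floor {k : ℕ} (hk : 0 < k) (hkP : (k : ℝ) ≤ P) :
    P / (2 * k) ≤ ⌊P / k⌋₊ := by
  have hk' : (0:ℝ) < k := by exact_mod_cast hk
  have h1 : (1:ℝ) ≤ ⌊P / k⌋₊ := by exact_mod_cast one_le_floor hk hkP
  have h2 := Nat.lt_floor_add_one (P / k)
  have : P / (2 * k) = P / k / 2 := by field_simp
  rw [this]; linarith

lemma bd_inv_floor (E : Env P R τ θ) {k : ℕ} (hk : 0 < k) (hkP : (k : ℝ) ≤ P) :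
    Bd P (lg P k - 1 + τ) (1 / ⌊P / k⌋₊ : ℝ) := by
  have hk' : (0:ℝ) < k := by exact_mod_cast hk
  have hP := E.pos
  refine ⟨by positivity, ?_⟩
  have h1 : (1 / ⌊P / k⌋₊ : ℝ) ≤ 1 / (P / (2 * k)) :=
    one_div_le_one_div_of_le (by positivity) (half_le_floor hk hkP)
  refine h1.trans ?_
  rw [Real.rpow_add E.pos, Real.rpow_sub E.pos, E.rpow_lg hk, Real.rpow_one]
  have := E.two
  calc 1 / (P / (2 * k)) = k / P * 2 := by field_simp
    _ ≤ _ := by gcongr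

lemma le_Y (E : Env P R τ θ) {x X : ℝ} (H : Bd P x X) (hx : x ≤ 4) : X ≤ P ^ 4 := by
  have := (H.mono E.one_lt.le hx).2
  rwa [show (4:ℝ) = ((4:ℕ):ℝ) by norm_num, Real.rpow_natCast] at this

lemma hundred_le_P (E : Env P R τ θ) : 100 ≤ P := by
  refine E.hundred.trans ?_
  calc P ^ τ ≤ P ^ (1:ℝ) := Real.rpow_le_rpow_of_exponent_le E.one_lt.le (by linarith [E.tau_le])
    _ = P := Real.rpow_one P

lemma hundred_le_Y (E : Env P R τ θ) : 100 ≤ P ^ 4 := by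
  have h1 := E.hundred_le_P
  have h2 : P ≤ P ^ 4 := le_self_pow₀ (by linarith) (by norm_num)
  linarith

lemma divisors (E : Env P R τ θ) {m : ℕ} (hm : 0 < m) (hmR : (m : ℝ) ≤ P ^ θ * R) :
    2 * ((m ^ 4).divisors.card : ℝ) ≤ P ^ (2 * τ) := by
  have hP := E.pos
  have h1 : P ^ θ * R ≤ P := by
    calc P ^ θ * R ≤ P ^ θ * P ^ τ := by gcongr; exact E.le_rpow
      _ = P ^ (θ + τ) := (Real.rpow_add E.pos _ _).symm
      _ ≤ P ^ (1:ℝ) := Real.rpow_le_rpow_of_exponent_le E.one_lt.le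
          (by linarith [E.tau_le, E.theta_le])
      _ = P := Real.rpow_one P
  have h2 := E.fud.div_le (m ^ 4) (by positivity) (by
    push_cast
    calc (m : ℝ) ^ 4 ≤ P ^ 4 := by gcongr; linarith
      _ ≤ (P ^ 4) ^ 50 := le_self_pow₀ (by linarith [E.hundred_le_Y]) (by norm_num))
  rw [two_mul τ, Real.rpow_add E.pos]
  have := E.two
  gcongr

end Env

lemma CopBound.mono {P R M B B' : ℝ} {v k : ℕ} (H : CopBound P R M v k B) (h : B ≤ B') :
    CopBound P R M v k B' := fun A hA c hc => (H A hA c hc).trans h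

namespace Env

variable {P R τ θ : ℝ}

lemma cop_even (E : Env P R τ θ) {k n : ℕ} (hk : 0 < k) {u x z : ℝ}
    (hu : Bd P u (U (2 * n) (P ^ (1 - θ)) R))
    (hx : Bd P x (∫ α in (0:ℝ)..1, ‖F1 (len P θ k) ⌊P ^ θ * R / k⌋₊ ⌊P / k⌋₊ α‖ *
      ‖h (P ^ (1 - θ)) R α‖ ^ (2 * n)))
    (h1 : 6 * τ + θ + 1 - 2 * lg P k + u ≤ z) (h2 : 6 * τ + x ≤ z) :
    CopBound P R (P ^ θ) (2 * n) k (P ^ z) := by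
  have hP := E.pos
  have hP1 := E.one_lt.le
  have h3 := _root_.cop_even (P := P) (R := R) (M := P ^ θ) (T := P ^ (2 * τ)) n (by positivity) hP.le hk
    (by positivity) (fun m hm hmR => E.divisors hm hmR) (len_mul_le hP)
  refine h3.mono ?_
  rw [E.div_theta]
  have e1 := ((E.bd_floor_M hk).mul hP (E.bd_floor_P hk)).mul hP hu
  have e2 := (E.const (c := 2) (by norm_num) (by norm_num)).mul hP hx
  have e3 := e1.add (z := z - 4 * τ) hP1 E.two e2 (by linarith) (by linarith)
  have e4 := ((Bd.self hP.le (2 * τ)).pow hP 2).mul hP e3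
  exact (e4.mono hP1 (by push_cast; linarith)).2

lemma cop_nine (E : Env P R τ θ) {k : ℕ} (hk : 0 < k) {u₈ u₁₀ x z : ℝ}
    (h8 : Bd P u₈ (U 8 (P ^ (1 - θ)) R)) (h10 : Bd P u₁₀ (U 10 (P ^ (1 - θ)) R))
    (hx : Bd P x (∫ α in (0:ℝ)..1, ‖F1 (len P θ k) ⌊P ^ θ * R / k⌋₊ ⌊P / k⌋₊ α‖ ^ 2 *
      ‖h (P ^ (1 - θ)) R α‖ ^ 8))
    (h1 : 6 * τ + θ + 1 - 2 * lg P k + (u₈ + u₁₀) / 2 ≤ z) (h2 : 6 * τ + (x + u₁₀) / 2 ≤ z) :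
    CopBound P R (P ^ θ) 9 k (P ^ z) := by
  have hP := E.pos
  have hP1 := E.one_lt.le
  have h3 := _root_.cop_nine (P := P) (R := R) (M := P ^ θ) (T := P ^ (2 * τ)) (by positivity) hP.le hk
    (by positivity) (fun m hm hmR => E.divisors hm hmR) (len_mul_le hP)
  refine h3.mono ?_
  rw [E.div_theta]
  have hh : (0:ℝ) ≤ 1 / 2 := by norm_num
  have e1 := ((E.bd_floor_M hk).mul hP (E.bd_floor_P hk)).mul hP ((h8.rpow hP hh).mul hP (h10.rpow hP hh))
  have e2 := (E.const (c := 2) (by norm_num) (by norm_num)).mul hP ((hx.rpow hP hh).mul hP (h10.rpow hP hh))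
  have e3 := e1.add (z := z - 4 * τ) hP1 E.two e2 (by linarith) (by linarith)
  have e4 := ((Bd.self hP.le (2 * τ)).pow hP 2).mul hP e3
  exact (e4.mono hP1 (by push_cast; linarith)).2

lemma F1_sq (E : Env P R τ θ) {k : ℕ} (hk : 0 < k) (hkP : (k : ℝ) ≤ P) :
    Bd P (2 + lg P k - 3 * θ + 4 * τ)
      (∫ α in (0:ℝ)..1, ‖F1 (len P θ k) ⌊P ^ θ * R / k⌋₊ ⌊P / k⌋₊ α‖ ^ 2) := by
  have hP := E.pos
  have l0 := E.lg_nonneg hk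
  have l1 := E.lg_le hk hkP
  have t0 := E.tau_pos
  have t1 := E.tau_le
  have q0 := E.le_theta
  have q1 := E.theta_le
  have h1 := _root_.F1_sq E.fud (by linarith [E.hundred_le_Y]) (E.le_Y (E.bd_len hk) (by linarith))
    (E.le_Y (E.bd_floor_M hk) (by linarith)) (E.le_Y (E.bd_floor_P hk) (by linarith))
  have e1 := ((E.bd_len hk).mul hP ((E.bd_floor_M hk).mul hP (E.bd_floor_P hk))).mul hP
    ((Bd.self hP.le τ).pow hP 2)
  refine (e1.of_le (integral01_nonneg fun _ => by positivity) h1).mono E.one_lt.le ?_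
  push_cast; linarith

lemma F1_sq_four (E : Env P R τ θ) {k : ℕ} (hk : 0 < k) (hkP : (k : ℝ) ≤ P) {u₄ u₈ y : ℝ}
    (h4 : Bd P u₄ (U 4 (P ^ (1 - θ)) R)) (h8 : Bd P u₈ (U 8 (P ^ (1 - θ)) R))
    (hy1 : 3 + 3 * lg P k - 6 * θ + u₄ + 12 * τ ≤ y)
    (hy2 : (1 + 2 * lg P k - 3 * θ) + (3 - 3 * θ) / 2 + u₈ / 2 + 12 * τ ≤ y) :
    Bd P y (∫ α in (0:ℝ)..1, ‖F1 (len P θ k) ⌊P ^ θ * R / k⌋₊ ⌊P / k⌋₊ α‖ ^ 2 *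
      ‖h (P ^ (1 - θ)) R α‖ ^ 4) := by
  have hP := E.pos
  have l0 := E.lg_nonneg hk
  have l1 := E.lg_le hk hkP
  have t0 := E.tau_pos
  have t1 := E.tau_le
  have q0 := E.le_theta
  have q1 := E.theta_le
  have hh : (0:ℝ) ≤ 1 / 2 := by norm_num
  have h1 := F1_sq_mul (H := len P θ k) (M := ⌊P ^ θ * R / k⌋₊) (P := ⌊P / k⌋₊)
    (w := fun α => ‖h (P ^ (1 - θ)) R α‖ ^ 4) (by fun_prop) (fun _ => by positivity)
  simp_rw [← pow_mul] at h1
  have e0 := F2_sq E.fud (by linarith [E.hundred_le_Y]) (E.le_Y (E.bd_len hk) (by linarith))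
    (E.le_Y (E.bd_floor_M hk) (by linarith)) (E.le_Y (E.bd_floor_P hk) (by linarith))
  have bH := E.bd_len hk
  have bM := E.bd_floor_M hk
  have bP := E.bd_floor_P hk
  have e1 := (((bH.mul hP bM).mul hP (bP.mul hP bP)).mul hP ((Bd.self hP.le τ).pow hP 5)).of_le
    (integral01_nonneg fun _ => by positivity) e0
  have e2 := (E.const (c := 2) (by norm_num) (by norm_num)).mul hP
    ((e1.rpow hP hh).mul hP (h8.rpow hP hh))
  have e3 := ((bH.mul hP bM).mul hP bP).mul hP h4
  have e4 := (e3.add (z := y - (1 + 2 * lg P k - 3 * θ + 2 * τ)) E.one_lt.le E.two e2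
    (by linarith) (by push_cast; linarith))
  have e5 := (bH.mul hP bM).mul hP e4
  refine (e5.of_le (integral01_nonneg fun _ => by positivity) h1).mono E.one_lt.le ?_
  linarith

end Env

namespace Env

variable {P R τ θ : ℝ}

lemma F1_moment (E : Env P R τ θ) {k : ℕ} (hk : 0 < k) (hkP : (k : ℝ) ≤ P) {p u v : ℕ} (hp : p ≤ 2)
    {η : ℝ} (h0 : 0 < η) (h1 : η < 1) (hηp : η ≤ p / 4) (hpη : p / 8 ≤ η) (huv : (v : ℝ) = 2 * η + u * (1 - η))
    {uu uv y : ℝ} (hu : Bd P uu (U u (P ^ (1 - θ)) R)) (hv : Bd P uv (U v (P ^ (1 - θ)) R))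
    (hy1 : p * (2 + lg P k - 3 * θ) + p / 4 * (lg P k - 1) + uv + 20 * τ ≤ y)
    (hy2 : p * (2 + lg P k - 3 * θ) + η * (2 * θ - 2) + uu * (1 - η) + 20 * τ ≤ y)
    (hy3 : p * (2 + lg P k - 3 * θ) + (2 * η - p / 4) + η * (3 * θ - 3) + uu * (1 - η) + 20 * τ ≤ y) :
    Bd P y (∫ α in (0:ℝ)..1, ‖F1 (len P θ k) ⌊P ^ θ * R / k⌋₊ ⌊P / k⌋₊ α‖ ^ p *
      ‖h (P ^ (1 - θ)) R α‖ ^ v) := by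
  have hP := E.pos
  have hP1 := E.one_lt.le
  have l0 := E.lg_nonneg hk
  have l1 := E.lg_le hk hkP
  have t0 := E.tau_pos
  have t1 := E.tau_le
  have q0 := E.le_theta
  have q1 := E.theta_le
  have hk' : (0:ℝ) < k := by exact_mod_cast hk
  have hp' : (p : ℝ) ≤ 2 := by exact_mod_cast hp
  have hpτ : (p : ℝ) * τ ≤ 2 * τ := by gcongr
  have hpτ0 : 0 ≤ (p : ℝ) * τ := by positivity
  have bH := E.bd_len hk
  have bM := E.bd_floor_M hk
  have bP := E.bd_floor_P hk
  have bN : Bd P (1 - θ) (⌊P ^ (1 - θ)⌋₊ : ℝ) := ⟨by positivity, Nat.floor_le (by positivity)⟩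
  have hL : P ^ (4 * (1 - θ)) ≤ P ^ τ * (len P θ k * (⌊P / k⌋₊ : ℝ) ^ 3) := by
    have a1 : P * k ^ 3 / (P ^ θ) ^ 4 ≤ len P θ k := Nat.le_ceil _
    have a2 := half_le_floor hk hkP
    have a3 : P ^ (4 * (1 - θ)) = P ^ 4 / (P ^ θ) ^ 4 := by
      rw [mul_comm, Real.rpow_mul hP.le, ← E.div_theta, ← div_pow]
      exact_mod_cast Real.rpow_natCast _ 4
    have a4 := E.hundred
    rw [a3]
    calc P ^ 4 / (P ^ θ) ^ 4 = 8 * (P * k ^ 3 / (P ^ θ) ^ 4 * (P / (2 * k)) ^ 3) := by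
          field_simp; norm_num
      _ ≤ P ^ τ * (len P θ k * (⌊P / k⌋₊ : ℝ) ^ 3) := by gcongr; linarith
  have hPL : 6 * (⌊P / k⌋₊ : ℝ) ≤ P ^ (4 * (1 - θ)) := by
    have a1 := ((E.const (c := 6) (by norm_num) (by norm_num)).mul hP bP)
    exact (a1.mono hP1 (by linarith)).2
  obtain ⟨z, hz⟩ : ∃ z, z = max (η * (2 * θ - 2)) ((2 * η - p / 4) + η * (3 * θ - 3)) := ⟨_, rfl⟩
  have z1 : η * (2 * θ - 2) ≤ z := hz ▸ le_max_left _ _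
  have z2 : (2 * η - p / 4) + η * (3 * θ - 3) ≤ z := hz ▸ le_max_right _ _
  have hyz : p * (2 + lg P k - 3 * θ) + z + uu * (1 - η) + 20 * τ ≤ y := by
    rcases max_choice (η * (2 * θ - 2)) ((2 * η - p / 4) + η * (3 * θ - 3)) with h | h <;>
      rw [hz, h] <;> linarith
  have hητ : η * τ ≤ 1 * τ := by gcongr
  have hG : ∀ X : ℝ, 1 ≤ X → X ≤ (⌊P / k⌋₊ : ℝ) → (1 / X) ^ ((p : ℝ) / 4) *
      (X * (X * (⌊P ^ (1 - θ)⌋₊ : ℝ) + (⌊P ^ (1 - θ)⌋₊ : ℝ) ^ 2) / P ^ (4 * (1 - θ))) ^ η ≤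
        P ^ (z + τ) := by
    intro X hX hXP
    have hX0 : 0 < X := by linarith
    have hXP' : X ≤ P := (hXP.trans bP.2).trans (by
      calc P ^ (1 - lg P k) ≤ P ^ (1:ℝ) := Real.rpow_le_rpow_of_exponent_le hP1 (by linarith)
        _ = P := Real.rpow_one P)
    obtain ⟨ξ, hξ⟩ : ∃ ξ, ξ = Real.log X / Real.log P := ⟨_, rfl⟩
    have hlP := Real.log_pos E.one_lt
    have x0 : 0 ≤ ξ := hξ ▸ div_nonneg (Real.log_nonneg hX) hlP.le
    have x1 : ξ ≤ 1 := by
      rw [hξ, div_le_one hlP]; exact Real.log_le_log hX0 hXP'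
    have hXξ : X = P ^ ξ := by
      rw [Real.rpow_def_of_pos hP, hξ, mul_div_cancel₀ _ hlP.ne', Real.exp_log hX0]
    have bX : Bd P ξ X := ⟨hX0.le, hXξ.le⟩
    obtain ⟨w, hw⟩ : ∃ w, w = max (ξ + (1 - θ)) (2 * (1 - θ)) := ⟨_, rfl⟩
    have w1 : ξ + (1 - θ) ≤ w := hw ▸ le_max_left _ _
    have w2 : 2 * (1 - θ) ≤ w := hw ▸ le_max_right _ _
    have e3 := (bX.mul hP bN).add (z := w + τ) hP1 E.two (bN.pow hP 2) (by linarith)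
      (by push_cast; linarith)
    have e4 := ((bX.mul hP e3).mul hP (Bd.self hP.le (-(4 * (1 - θ))))).rpow hP h0.le
    have e5 : Bd P (-ξ * (p / 4)) ((1 / X) ^ ((p : ℝ) / 4)) := by
      refine Bd.rpow hP ⟨by positivity, ?_⟩ (by positivity)
      rw [Real.rpow_neg hP.le, ← hXξ, one_div]
    rw [Real.rpow_neg hP.le, ← div_eq_mul_inv] at e4
    refine ((e5.mul hP e4).mono hP1 ?_).2
    have y1 : 0 ≤ (p / 4 - η) * ξ := mul_nonneg (by linarith) x0
    have y2 : 0 ≤ (2 * η - p / 4) * (1 - ξ) := mul_nonneg (by linarith) (by linarith)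
    rcases max_choice (ξ + (1 - θ)) (2 * (1 - θ)) with h | h <;> rw [h] at hw <;> rw [hw] <;>
      linarith
  have main := _root_.F1_moment E.fud (by linarith [E.hundred_le_Y]) (H := len P θ k)
    (M := ⌊P ^ θ * R / k⌋₊) (P := ⌊P / k⌋₊) (N := ⌊P ^ (1 - θ)⌋₊)
    (E.le_Y bH (by linarith)) (E.le_Y bP (by linarith)) (one_le_floor hk hkP)
    (E.le_Y (Bd.self hP.le (4 * (1 - θ))) (by linarith)) hL hPL (E.le_Y bN (by linarith))
    (smoothA (P ^ (1 - θ)) R) (smoothA_subset_Icc _ _) (p := p) (u := u) (v := v)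
    (by omega) h0 h1 huv hG
  simp_rw [← h_eq] at main
  have e1 := ((((Bd.self hP.le τ).pow hP 2).mul hP ((bH.mul hP bM).mul hP bP)).pow hP p)
  have e2 := ((E.const (c := 2) (by norm_num) (by norm_num)).mul hP
    ((E.bd_inv_floor hk hkP).rpow hP (by positivity : (0:ℝ) ≤ p / 4))).mul hP hv
  have e5 := (((Bd.self hP.le τ).pow hP 4).mul hP (Bd.self hP.le (z + τ))).mul hP
    (hu.rpow hP (by linarith : 0 ≤ 1 - η))
  have e6 := e2.add (z := y - p * (2 + lg P k - 3 * θ + 4 * τ)) hP1 E.two e5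
    (by linarith) (by push_cast; linarith)
  have e7 := (e1.mul hP e6)
  refine (e7.of_le (integral01_nonneg fun _ => by positivity) main).mono hP1 ?_
  push_cast
  linarith

end Env

/-- A property that holds for large `P` and small smoothness parameters. -/
def Ev (p : ℝ → ℝ → Prop) : Prop :=
  ∃ τ : ℝ, 0 < τ ∧ ∃ P₀ : ℝ, 1 ≤ P₀ ∧ ∀ P ≥ P₀, ∀ R, 2 ≤ R → R ≤ P ^ τ → p P R

lemma Ev.and {p q : ℝ → ℝ → Prop} (hp : Ev p) (hq : Ev q) : Ev fun P R => p P R ∧ q P R := by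
  obtain ⟨τ, hτ, P₀, hP₀, h1⟩ := hp
  obtain ⟨σ, hσ, Q₀, hQ₀, h2⟩ := hq
  refine ⟨min τ σ, by positivity, max P₀ Q₀, by simp [hP₀], fun P hP R hR hRP => ?_⟩
  have hP1 : P₀ ≤ P := (le_max_left _ _).trans hP
  have hP2 : Q₀ ≤ P := (le_max_right _ _).trans hP
  have : 1 ≤ P := hP₀.trans hP1
  exact ⟨h1 P hP1 R hR (hRP.trans (Real.rpow_le_rpow_of_exponent_le this (min_le_left _ _))),
    h2 P hP2 R hR (hRP.trans (Real.rpow_le_rpow_of_exponent_le this (min_le_right _ _)))⟩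

lemma Ev.mono {p q : ℝ → ℝ → Prop} (hp : Ev p) (h : ∀ P R, p P R → q P R) : Ev q := by
  obtain ⟨τ, hτ, P₀, hP₀, h1⟩ := hp
  exact ⟨τ, hτ, P₀, hP₀, fun P hP R hR hRP => h P R (h1 P hP R hR hRP)⟩

lemma ev_env {τ θ : ℝ} (hτ : 0 < τ) (hτ1 : τ ≤ 1 / 100) (h1 : 1 / 100 ≤ θ) (h2 : θ ≤ 1 / 4) :
    Ev fun P R => Env P R τ θ := by
  obtain ⟨P₀, hP₀, hF⟩ := eventually_fud (τ / 4) (by positivity)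
  refine ⟨τ, hτ, max 2 P₀, by simp, fun P hP R hR hRP => ?_⟩
  have hP2 : 2 ≤ P := (le_max_left _ _).trans hP
  have hPP : P₀ ≤ P := (le_max_right _ _).trans hP
  refine ⟨by linarith, hτ, hτ1, h1, h2, ?_, hR, hRP⟩
  have h3 : P ≤ P ^ 4 := le_self_pow₀ (by linarith) (by norm_num)
  have := hF (P ^ 4) (hPP.trans h3)
  rwa [← Real.rpow_natCast, ← Real.rpow_mul (by linarith),
    show ((4:ℕ):ℝ) * (τ / 4) = τ by push_cast; ring, Real.rpow_natCast] at this

lemma Adm.ev {s : ℕ} {μ : ℝ} (H : Adm s μ) {τ : ℝ} (hτ : 0 < τ) :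
    Ev fun P R => ∀ σ, 0 ≤ σ → σ ≤ 1 → Bd P (τ + σ * μ) (U s (P ^ σ) R) := by
  obtain ⟨τ', hτ', P₀, hP₀, hU⟩ := H.2 τ hτ
  refine ⟨τ', hτ', P₀, hP₀, fun P hP R hR hRP σ h0 h1 => ⟨U_nonneg _ _ _, ?_⟩⟩
  have hP1 : 1 ≤ P := hP₀.trans hP
  have hP0 : 0 < P := by linarith
  have := hU P hP R hR hRP (P ^ σ) (Real.one_le_rpow hP1 h0) (by
    calc P ^ σ ≤ P ^ (1:ℝ) := Real.rpow_le_rpow_of_exponent_le hP1 h1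
      _ = P := Real.rpow_one P)
  rwa [← Real.rpow_mul hP0.le, ← Real.rpow_add hP0] at this

/-- The bound for the contribution of the common factor `k` that the iteration requires. -/
def GcdBound (s : ℕ) (θ f : ℝ) : Prop :=
  ∀ ε : ℝ, 0 < ε → Ev fun P R => ∀ k : ℕ, 0 < k → (k : ℝ) ≤ P →
    CopBound P R (P ^ θ) (s - 2) k ((k : ℝ) ^ (3 / 2 : ℝ) * P ^ (f - (s - 3) * θ + ε))

lemma gcdBound_of_ev {s : ℕ} {θ f : ℝ} (h1 : 1 / 100 ≤ θ) (h2 : θ ≤ 1 / 4)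
    (H : ∀ τ : ℝ, 0 < τ → τ ≤ 1 / 100 → Ev fun P R => Env P R τ θ → ∀ k : ℕ, 0 < k → (k : ℝ) ≤ P →
      CopBound P R (P ^ θ) (s - 2) k
        (P ^ (f - (s - 3) * θ + 3 / 2 * Env.lg P k + 100 * τ))) : GcdBound s θ f := by
  intro ε hε
  set τ := min (1 / 100) (ε / 100) with hτ
  have hτ0 : 0 < τ := by positivity
  have hτε : 100 * τ ≤ ε := by
    have : τ ≤ ε / 100 := min_le_right _ _
    linarith
  refine ((H τ hτ0 (min_le_left _ _)).and (ev_env hτ0 (min_le_left _ _) h1 h2)).mono ?_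
  rintro P R ⟨h3, h4⟩ k hk hkP
  refine (h3 h4 k hk hkP).mono ?_
  rw [← h4.rpow_lg hk, ← Real.rpow_mul h4.pos.le, ← Real.rpow_add h4.pos]
  exact Real.rpow_le_rpow_of_exponent_le h4.one_lt.le (by linarith)

lemma integral_one_mul_le {f w w' : ℝ → ℝ} (hf : Continuous f) (hw : Continuous w) (hw' : Continuous w')
    (hf0 : ∀ x, 0 ≤ f x) (h0 : ∀ x, 0 ≤ w x) (h0' : ∀ x, 0 ≤ w' x) :
    ∫ α in (0:ℝ)..1, f α * (w α * w' α) ≤ (∫ α in (0:ℝ)..1, f α ^ 2 * w α ^ 2) ^ (1 / 2 : ℝ) *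
      (∫ α in (0:ℝ)..1, w' α ^ 2) ^ (1 / 2 : ℝ) := by
  have := cauchy01 (f := fun α => f α * w α) (g := w') (by fun_prop) hw'
    (fun x => mul_nonneg (hf0 x) (h0 x)) h0'
  simp_rw [_root_.mul_pow] at this
  simpa only [mul_assoc] using this

lemma gcdBound_six {θ μ₆ μ₈ f : ℝ} (h1 : 1 / 100 ≤ θ) (h2 : θ ≤ 1 / 4) (h6 : Adm 6 μ₆) (h8 : Adm 8 μ₈)
    (hf1 : 3 * θ + (θ + 1 + (1 - θ) * 2) ≤ f)
    (hf2 : 3 * θ + ((2 - 3 * θ) / 4 + (3 - 6 * θ + (1 - θ) * 2) / 4 + (1 - θ) * μ₆ / 2) ≤ f)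
    (hf3 : 3 * θ + ((2 - 3 * θ) / 4 + ((1 - 3 * θ) + (3 - 3 * θ) / 2 + (1 - θ) * μ₈ / 2) / 4 +
      (1 - θ) * μ₆ / 2) ≤ f) : GcdBound 6 θ f := by
  refine gcdBound_of_ev h1 h2 fun τ hτ _ => ?_
  refine (((adm_four.ev hτ).and (h6.ev hτ)).and (h8.ev hτ)).mono ?_
  rintro P R ⟨⟨a4, a6⟩, a8⟩ E k hk hkP
  have hP := E.pos
  have s0 : 0 ≤ 1 - θ := by linarith
  have s1 : 1 - θ ≤ 1 := by linarith
  have b4 := a4 _ s0 s1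
  have b6 := a6 _ s0 s1
  have b8 := a8 _ s0 s1
  have l0 := E.lg_nonneg hk
  have hh : (0:ℝ) ≤ 1 / 2 := by norm_num
  set l := Env.lg P k with hl
  obtain ⟨y, hy⟩ : ∃ y, y = max (3 - 6 * θ + (1 - θ) * 2)
    ((1 - 3 * θ) + (3 - 3 * θ) / 2 + (1 - θ) * μ₈ / 2) + 3 * l + 13 * τ := ⟨_, rfl⟩
  have m1 := le_max_left (3 - 6 * θ + (1 - θ) * 2) ((1 - 3 * θ) + (3 - 3 * θ) / 2 + (1 - θ) * μ₈ / 2)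
  have m2 := le_max_right (3 - 6 * θ + (1 - θ) * 2) ((1 - 3 * θ) + (3 - 3 * θ) / 2 + (1 - θ) * μ₈ / 2)
  have m3 : 3 * θ + ((2 - 3 * θ) / 4 + max (3 - 6 * θ + (1 - θ) * 2)
    ((1 - 3 * θ) + (3 - 3 * θ) / 2 + (1 - θ) * μ₈ / 2) / 4 + (1 - θ) * μ₆ / 2) ≤ f := by
    rcases max_choice (3 - 6 * θ + (1 - θ) * 2) ((1 - 3 * θ) + (3 - 3 * θ) / 2 + (1 - θ) * μ₈ / 2)
      with h | h <;> rw [h] <;> linarith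
  have c4 := E.F1_sq_four hk hkP (y := y) b4 b8 (by linarith) (by linarith)
  have c0 := E.F1_sq hk hkP
  have cF := continuous_F1 (Env.len P θ k) ⌊P ^ θ * R / k⌋₊ ⌊P / k⌋₊
  have i2 := cauchy01 (f := fun α => ‖F1 (Env.len P θ k) ⌊P ^ θ * R / k⌋₊ ⌊P / k⌋₊ α‖)
    (g := fun α => ‖F1 (Env.len P θ k) ⌊P ^ θ * R / k⌋₊ ⌊P / k⌋₊ α‖ * ‖h (P ^ (1 - θ)) R α‖ ^ 2)
    (by fun_prop) (by fun_prop) (fun _ => by positivity) (fun _ => by positivity)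
  simp_rw [_root_.mul_pow, ← pow_mul, ← mul_assoc, ← sq] at i2
  have c2 := ((c0.rpow hP hh).mul hP (c4.rpow hP hh)).of_le
    (integral01_nonneg fun _ => by positivity) i2
  have i1 := integral_one_mul_le (f := fun α => ‖F1 (Env.len P θ k) ⌊P ^ θ * R / k⌋₊ ⌊P / k⌋₊ α‖)
    (w := fun α => ‖h (P ^ (1 - θ)) R α‖) (w' := fun α => ‖h (P ^ (1 - θ)) R α‖ ^ 3) (by fun_prop) (by fun_prop)
    (by fun_prop) (fun _ => by positivity) (fun _ => by positivity) (fun _ => by positivity)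
  simp_rw [← pow_succ', ← pow_mul] at i1
  have c1 := ((c2.rpow hP hh).mul hP (b6.rpow hP hh)).of_le
    (integral01_nonneg fun _ => by positivity) i1
  refine E.cop_even (n := 2) hk b4 c1 ?_ ?_
  · push_cast; linarith
  · rw [hy]; push_cast; linarith

lemma gcdBound_eight {θ μ₆ μ₈ f : ℝ} (h1 : 1 / 100 ≤ θ) (h2 : θ ≤ 1 / 4) (h6 : Adm 6 μ₆) (h8 : Adm 8 μ₈)
    (hf1 : 5 * θ + (θ + 1 + (1 - θ) * μ₆) ≤ f)
    (hf2 : 5 * θ + ((3 - 6 * θ + (1 - θ) * 2) / 2 + (1 - θ) * μ₈ / 2) ≤ f)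
    (hf3 : 5 * θ + (((1 - 3 * θ) + (3 - 3 * θ) / 2 + (1 - θ) * μ₈ / 2) / 2 +
      (1 - θ) * μ₈ / 2) ≤ f) : GcdBound 8 θ f := by
  refine gcdBound_of_ev h1 h2 fun τ hτ _ => ?_
  refine (((adm_four.ev hτ).and (h6.ev hτ)).and (h8.ev hτ)).mono ?_
  rintro P R ⟨⟨a4, a6⟩, a8⟩ E k hk hkP
  have hP := E.pos
  have s0 : 0 ≤ 1 - θ := by linarith
  have s1 : 1 - θ ≤ 1 := by linarith
  have b4 := a4 _ s0 s1
  have b6 := a6 _ s0 s1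
  have b8 := a8 _ s0 s1
  have l0 := E.lg_nonneg hk
  have hh : (0:ℝ) ≤ 1 / 2 := by norm_num
  set l := Env.lg P k with hl
  obtain ⟨y, hy⟩ : ∃ y, y = max (3 - 6 * θ + (1 - θ) * 2)
    ((1 - 3 * θ) + (3 - 3 * θ) / 2 + (1 - θ) * μ₈ / 2) + 3 * l + 13 * τ := ⟨_, rfl⟩
  have m1 := le_max_left (3 - 6 * θ + (1 - θ) * 2) ((1 - 3 * θ) + (3 - 3 * θ) / 2 + (1 - θ) * μ₈ / 2)
  have m2 := le_max_right (3 - 6 * θ + (1 - θ) * 2) ((1 - 3 * θ) + (3 - 3 * θ) / 2 + (1 - θ) * μ₈ / 2)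
  have m3 : 5 * θ + (max (3 - 6 * θ + (1 - θ) * 2)
    ((1 - 3 * θ) + (3 - 3 * θ) / 2 + (1 - θ) * μ₈ / 2) / 2 + (1 - θ) * μ₈ / 2) ≤ f := by
    rcases max_choice (3 - 6 * θ + (1 - θ) * 2) ((1 - 3 * θ) + (3 - 3 * θ) / 2 + (1 - θ) * μ₈ / 2)
      with h | h <;> rw [h] <;> linarith
  have c4 := E.F1_sq_four hk hkP (y := y) b4 b8 (by linarith) (by linarith)
  have cF := continuous_F1 (Env.len P θ k) ⌊P ^ θ * R / k⌋₊ ⌊P / k⌋₊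
  have i1 := integral_one_mul_le (f := fun α => ‖F1 (Env.len P θ k) ⌊P ^ θ * R / k⌋₊ ⌊P / k⌋₊ α‖)
    (w := fun α => ‖h (P ^ (1 - θ)) R α‖ ^ 2) (w' := fun α => ‖h (P ^ (1 - θ)) R α‖ ^ 4) (by fun_prop) (by fun_prop)
    (by fun_prop) (fun _ => by positivity) (fun _ => by positivity) (fun _ => by positivity)
  simp_rw [← pow_add, ← pow_mul] at i1
  have c1 := ((c4.rpow hP hh).mul hP (b8.rpow hP hh)).of_le
    (integral01_nonneg fun _ => by positivity) i1
  refine E.cop_even (n := 3) hk b6 c1 ?_ ?_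
  · push_cast; linarith
  · rw [hy]; push_cast; linarith

lemma gcdBound_even {θ μ μ' f η : ℝ} {n : ℕ} (h1 : 1 / 100 ≤ θ) (h2 : θ ≤ 1 / 4) (h : Adm (2 * n) μ)
    (h' : Adm (2 * n + 2) μ') (h0 : 0 < η) (hη : η ≤ 1 / 4) (hη8 : 1 / 8 ≤ η) (hηn : η * n = 1)
    (hf1 : (2 * n - 1) * θ + (θ + 1 + (1 - θ) * μ) ≤ f)
    (hf2 : (2 * n - 1) * θ + (2 - 3 * θ - 1 / 4 + (1 - θ) * μ) ≤ f)
    (hf3 : (2 * n - 1) * θ + (2 - 3 * θ + η * (2 * θ - 2) + (1 - θ) * μ' * (1 - η)) ≤ f)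
    (hf4 : (2 * n - 1) * θ + (2 - 3 * θ + (2 * η - 1 / 4) + η * (3 * θ - 3) +
      (1 - θ) * μ' * (1 - η)) ≤ f) :
    GcdBound (2 * n + 2) θ f := by
  refine gcdBound_of_ev h1 h2 fun τ hτ _ => ?_
  refine ((h.ev hτ).and (h'.ev hτ)).mono ?_
  rintro P R ⟨a, a'⟩ E k hk hkP
  have s0 : 0 ≤ 1 - θ := by linarith
  have s1 : 1 - θ ≤ 1 := by linarith
  have l0 := E.lg_nonneg hk
  have hητ : 0 ≤ η * τ := by positivity
  have c1 := E.F1_moment hk hkP (p := 1) (by norm_num) h0 (by linarith) (by norm_num; linarith)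
    (by norm_num; linarith) (u := 2 * n + 2) (v := 2 * n) (by push_cast; linarith) (a' _ s0 s1) (a _ s0 s1)
    (y := f - (2 * n - 1) * θ + 3 / 2 * Env.lg P k + 30 * τ) (by push_cast; linarith)
    (by push_cast; linarith) (by push_cast; linarith)
  simp only [pow_one] at c1
  refine E.cop_even hk (a _ s0 s1) c1 ?_ ?_
  · push_cast; linarith
  · push_cast; linarith

lemma gcdBound_eleven {θ μ₈ μ₁₀ μ₁₂ f : ℝ} (h1 : 1 / 100 ≤ θ) (h2 : θ ≤ 1 / 4) (h8 : Adm 8 μ₈)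
    (h10 : Adm 10 μ₁₀) (h12 : Adm 12 μ₁₂)
    (hf1 : 8 * θ + (θ + 1 + (1 - θ) * (μ₈ + μ₁₀) / 2) ≤ f)
    (hf2 : 8 * θ + (2 * (2 - 3 * θ) - 1 / 2 + (1 - θ) * μ₈ + (1 - θ) * μ₁₀) / 2 ≤ f)
    (hf3 : 8 * θ + (2 * (2 - 3 * θ) + 2 / 5 * (2 * θ - 2) + 3 / 5 * ((1 - θ) * μ₁₂) +
      (1 - θ) * μ₁₀) / 2 ≤ f) :
    GcdBound 11 θ f := by
  refine gcdBound_of_ev h1 h2 fun τ hτ _ => ?_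
  refine (((h8.ev hτ).and (h10.ev hτ)).and (h12.ev hτ)).mono ?_
  rintro P R ⟨⟨a8, a10⟩, a12⟩ E k hk hkP
  have s0 : 0 ≤ 1 - θ := by linarith
  have s1 : 1 - θ ≤ 1 := by linarith
  have l0 := E.lg_nonneg hk
  have c1 := E.F1_moment hk hkP (p := 2) (by norm_num) (η := 2 / 5) (by norm_num) (by norm_num) (by norm_num)
    (by norm_num) (u := 12) (v := 8) (by norm_num) (a12 _ s0 s1) (a8 _ s0 s1)
    (y := 2 * (f - 8 * θ + 3 / 2 * Env.lg P k + 30 * τ) - (1 - θ) * μ₁₀)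
    (by push_cast; linarith) (by push_cast; linarith) (by push_cast; linarith)
  refine E.cop_nine hk (a8 _ s0 s1) (a10 _ s0 s1) c1 ?_ ?_
  · push_cast; linarith
  · push_cast; linarith

lemma Env.step {P R τ θ : ℝ} (E : Env P R τ θ) {K v : ℕ} {μ κ x w z err : ℝ} {B : ℕ → ℝ} (hv : 2 ≤ v)
    (hμ : 0 ≤ μ) (hκ : 0 ≤ κ)
    (hU : ∀ P', 1 ≤ P' → P' ≤ P → U (v + 2) P' R ≤ P ^ τ * P' ^ μ)
    (herr : (∫ α in (0:ℝ)..1, (((‖h P R α‖ ^ v : ℝ) : ℂ) * bigGcd P R (P ^ θ) K α)).re ≤ err)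
    (hx : Bd P x err) (hB0 : ∀ k, 0 ≤ B k)
    (hB : ∀ k ∈ Finset.Icc 1 K, CopBound P R (P ^ θ) v k (B k))
    (hw : Bd P w (∑ k ∈ Finset.Icc 1 K, (k : ℝ) ^ (-(μ * (((v : ℝ) - 2) / (v + 2)))) * B k))
    (h1 : θ * (v + 2) + 10 * (v + 2) * τ ≤ z) (h2 : x + 10 * (v + 2) * τ ≤ z)
    (h3 : μ - κ + 10 * (v + 2) * τ ≤ z) (h4 : κ + θ * (v - 1) + w + 10 * (v + 2) * τ ≤ z) :
    U (v + 2) P R ≤ P ^ z := by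
  have hP := E.pos
  have hP1 := E.one_lt.le
  have hM : 1 ≤ P ^ θ := Real.one_le_rpow hP1 (by linarith [E.le_theta])
  have hT := E.hundred
  have hTT : P ^ (2 * τ) = P ^ τ * P ^ τ := by rw [two_mul, Real.rpow_add hP]
  have hR := E.two_le
  have hRP := E.le_rpow
  have hP100 := E.hundred_le_P
  have hv' : (2:ℝ) ≤ v := by exact_mod_cast hv
  have hτ := E.tau_pos
  have hlog : 6 + 6 * (1 + Real.log ((⌊P / P ^ θ⌋₊ + 1 : ℕ) : ℝ)) ≤ P ^ (2 * τ) := by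
    have a1 : ((⌊P / P ^ θ⌋₊ + 1 : ℕ) : ℝ) ≤ P ^ 4 := by
      push_cast
      have b1 : (⌊P / P ^ θ⌋₊ : ℝ) ≤ P := (Nat.floor_le (by positivity)).trans
        (div_le_self hP.le hM)
      have b2 : P * 100 ≤ P * P ^ 3 := by
        gcongr
        exact hP100.trans (le_self_pow₀ hP1 (by norm_num))
      nlinarith
    have a2 := Real.log_le_log (by positivity) a1
    have a3 := E.fud.log_le
    nlinarith
  have main := iteration_step (M := P ^ θ) (T := P ^ (2 * τ)) (A := P ^ τ) (δ := P ^ (-κ)) hv hP.le hM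
    (by linarith) hlog (by nlinarith) (fun m hm hmR => ?_) hμ (by positivity) hU herr (by positivity)
    (Real.rpow_le_one_of_one_le_of_nonpos hP1 (by linarith)) hB0 hB
  · have bR : Bd P τ R := ⟨by linarith, hRP⟩
    have bM := Bd.self hP.le θ
    have bT := Bd.self hP.le (2 * τ)
    have c4 := E.const (c := 4) (by norm_num) (by norm_num)
    have c8 := E.const (c := 8) (by norm_num) (by norm_num)
    have c2 := E.const (c := 2) (by norm_num) (by norm_num)
    have t1 := (c4.mul hP bM).pow hP (v + 2)
    have t2 := (bT.pow hP (v + 2)).mul hP (((Bd.self hP.le τ).mul hP (Bd.self hP.le (-κ))).mul hP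
      (Bd.self hP.le μ))
    have t3 := (((Bd.self hP.le κ).mul hP ((c8.mul hP ((bM.mul hP bR).mul hP bT)).pow hP (v - 1))).mul hP
      (bT.pow hP (v + 1))).mul hP hw
    have hvτ : 0 ≤ (v : ℝ) * τ := by positivity
    have hvτ2 : 2 * τ ≤ (v : ℝ) * τ := by gcongr
    have e1 := t1.add (z := z - 4 * τ) hP1 E.two hx (by push_cast; linarith) (by linarith)
    have e2 := e1.add (z := z - 3 * τ) hP1 E.two t2 (by linarith) (by push_cast; linarith)
    have e3 := e2.add (z := z - 2 * τ) hP1 E.two t3 (by linarith)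
      (by push_cast [Nat.cast_sub (by omega : 1 ≤ v)]; linarith)
    have e4 := c2.mul hP e3
    refine main.trans ?_
    rw [Real.rpow_neg hP.le, inv_inv]
    rw [Real.rpow_neg hP.le] at e4
    exact (e4.mono hP1 (by linarith)).2
  · have a1 := E.divisors hm hmR
    have a2 : m.divisors.card ≤ (m ^ 4).divisors.card :=
      Finset.card_le_card (Nat.divisors_subset_of_dvd (by positivity) (dvd_pow_self m (by norm_num)))
    have a3 : (m.divisors.card : ℝ) ≤ ((m ^ 4).divisors.card : ℝ) := by exact_mod_cast a2
    have a4 : (0:ℝ) ≤ ((m ^ 4).divisors.card : ℝ) := by positivity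
    linarith

lemma Adm.ev' {s : ℕ} {μ : ℝ} (H : Adm s μ) {τ : ℝ} (hτ : 0 < τ) :
    Ev fun P R => ∀ P', 1 ≤ P' → P' ≤ P → U s P' R ≤ P ^ τ * P' ^ μ := H.2 τ hτ

lemma Adm.of_ev {s : ℕ} {μ : ℝ} (hμ : 0 ≤ μ) (H : Ev fun P R => U s P R ≤ P ^ μ) : Adm s μ := by
  refine Adm.of_weak hμ fun ε hε => ?_
  obtain ⟨τ, hτ, P₀, hP₀, hU⟩ := H
  exact ⟨τ, hτ, P₀, hP₀, fun P hP R hR hRP => (hU P hP R hR hRP).trans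
    (Real.rpow_le_rpow_of_exponent_le (hP₀.trans hP) (by linarith))⟩

lemma descend_large {v : ℕ} {θ f μ : ℝ} (hv : 2 ≤ v) (h1 : 1 / 100 ≤ θ) (h2 : θ ≤ 1 / 4)
    (hμ : Adm (v + 2) μ) (hG : GcdBound (v + 2) θ f) (hf : f < μ) (hθ : θ * (v + 2) < μ)
    (hs : 5 / 2 * (v + 2) ≤ μ * (v - 2)) : ∃ μ' < μ, Adm (v + 2) μ' := by
  set g := min (μ - f) (μ - θ * (v + 2)) with hg
  have g1 : g ≤ μ - f := min_le_left _ _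
  have g2 : g ≤ μ - θ * (v + 2) := min_le_right _ _
  have g0 : 0 < g := lt_min (by linarith) (by linarith)
  have hv' : (2:ℝ) ≤ v := by exact_mod_cast hv
  set τ := min (1 / 100) (g / (100 * (v + 2))) with hτ
  have hτ0 : 0 < τ := by positivity
  have hτ1 : τ ≤ 1 / 100 := min_le_left _ _
  have hτg : 100 * (v + 2) * τ ≤ g := by
    have : τ ≤ g / (100 * (v + 2)) := min_le_right _ _
    rwa [le_div_iff₀ (by positivity), mul_comm] at this
  have hvτ : 2 * τ ≤ (v : ℝ) * τ := by gcongr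
  have hθv : 0 ≤ θ * v := by positivity
  refine ⟨μ - g / 4, by linarith, Adm.of_ev (by linarith) ?_⟩
  refine (((hμ.ev' hτ0).and (hG τ hτ0)).and (ev_env hτ0 hτ1 h1 h2)).mono ?_
  rintro P R ⟨⟨hU, hB⟩, E⟩
  have hP := E.pos
  have hP1 := E.one_lt.le
  refine E.step (K := ⌊P⌋₊) (κ := g / 2) (err := 0) (x := 0) (w := f - (v - 1) * θ + 3 * τ)
    (B := fun k => (k : ℝ) ^ (3 / 2 : ℝ) * P ^ (f - (v - 1) * θ + τ)) hv hμ.1 (by linarith) hU ?_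
    ⟨le_rfl, by positivity⟩ (fun k => by positivity) ?_ ?_ (by linarith) (by linarith) (by linarith)
    (by linarith)
  · simp [bigGcd_eq_zero (Nat.lt_floor_add_one P)]
  · intro k hk
    rw [Finset.mem_Icc] at hk
    have := hB k hk.1 ((Nat.le_floor_iff hP.le).1 hk.2)
    refine this.mono (le_of_eq ?_)
    push_cast; congr 3; ring
  · refine ⟨Finset.sum_nonneg fun k _ => by positivity, ?_⟩
    calc ∑ k ∈ Finset.Icc 1 ⌊P⌋₊, (k : ℝ) ^ (-(μ * (((v : ℝ) - 2) / (v + 2)))) *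
          ((k : ℝ) ^ (3 / 2 : ℝ) * P ^ (f - (v - 1) * θ + τ))
        ≤ ∑ k ∈ Finset.Icc 1 ⌊P⌋₊, (k : ℝ)⁻¹ * P ^ (f - (v - 1) * θ + τ) := by
          refine Finset.sum_le_sum fun k hk => ?_
          rw [Finset.mem_Icc] at hk
          have hk' : (1:ℝ) ≤ k := by exact_mod_cast hk.1
          rw [← mul_assoc, ← Real.rpow_add (by linarith), ← Real.rpow_neg_one]
          gcongr ?_ * _
          refine Real.rpow_le_rpow_of_exponent_le hk' ?_
          have : 5 / 2 ≤ μ * (((v : ℝ) - 2) / (v + 2)) := by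
            rw [← mul_div_assoc, le_div_iff₀ (by positivity)]; exact hs
          linarith
      _ = (∑ k ∈ Finset.Icc 1 ⌊P⌋₊, (k : ℝ)⁻¹) * P ^ (f - (v - 1) * θ + τ) := by
          rw [Finset.sum_mul]
      _ ≤ P ^ (2 * τ) * P ^ (f - (v - 1) * θ + τ) := by
          gcongr
          have a1 : ∑ k ∈ Finset.Icc 1 ⌊P⌋₊, (k : ℝ)⁻¹ = ((harmonic ⌊P⌋₊ : ℚ) : ℝ) := by
            rw [harmonic_eq_sum_Icc]; push_cast; rfl
          have a2 := harmonic_floor_le_one_add_log P hP1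
          have a3 := E.fud.log_le
          have a4 : Real.log P ≤ Real.log (P ^ 4) :=
            Real.log_le_log hP (le_self_pow₀ hP1 (by norm_num))
          have a5 : P ^ τ ≤ P ^ (2 * τ) := Real.rpow_le_rpow_of_exponent_le hP1 (by linarith)
          rw [a1]; linarith
      _ = _ := by rw [← Real.rpow_add hP]; congr 1; ring

lemma descend_small {u : ℕ} {θ f μ : ℝ} (hu : 1 ≤ u) (h1 : 1 / 100 ≤ θ) (h2 : θ ≤ 1 / 4)
    (hμ : Adm (2 * u + 2) μ) (hG : GcdBound (2 * u + 2) θ f) (hf : f < μ) (hθ : θ * (2 * u + 2) < μ)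
    (hs : 53 / 50 * (2 * u + 2) ≤ 2 * μ) : ∃ μ' < μ, Adm (2 * u + 2) μ' := by
  have hu' : (1:ℝ) ≤ u := by exact_mod_cast hu
  set g := min 1 (min (μ - f) (μ - θ * (2 * u + 2))) with hg
  have g1 : g ≤ μ - f := (min_le_right _ _).trans (min_le_left _ _)
  have g2 : g ≤ μ - θ * (2 * u + 2) := (min_le_right _ _).trans (min_le_right _ _)
  have g3 : g ≤ 1 := min_le_left _ _
  have g0 : 0 < g := lt_min one_pos (lt_min (by linarith) (by linarith))
  set τ := min (1 / 100) (g / (10000 * (2 * u + 2))) with hτ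
  have hτ0 : 0 < τ := by positivity
  have hτ1 : τ ≤ 1 / 100 := min_le_left _ _
  have hτg : 10000 * (2 * u + 2) * τ ≤ g := by
    have : τ ≤ g / (10000 * (2 * u + 2)) := min_le_right _ _
    rwa [le_div_iff₀ (by positivity), mul_comm] at this
  have hvτ : 1 * τ ≤ (u : ℝ) * τ := by gcongr
  have hθv : 0 ≤ θ * u := by positivity
  refine ⟨μ - g / 400, by linarith, Adm.of_ev (by linarith) ?_⟩
  refine (((hμ.ev' hτ0).and (hG τ hτ0)).and (ev_env hτ0 hτ1 h1 h2)).mono ?_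
  rintro P R ⟨⟨hU, hB⟩, E⟩
  have hP := E.pos
  have hP1 := E.one_lt.le
  have hPa : 1 ≤ P ^ (g / 8) := Real.one_le_rpow hP1 (by positivity)
  set K := ⌈P ^ (g / 8)⌉₊ with hK
  have hK0 : P ^ (g / 8) ≤ K := Nat.le_ceil _
  have hK1 : 1 ≤ K := by exact_mod_cast hPa.trans hK0
  have bK : Bd P (g / 8 + τ) (K : ℝ) := by
    refine ⟨by positivity, ?_⟩
    have := Nat.ceil_lt_add_one (zero_le_one.trans hPa)
    rw [Real.rpow_add hP]
    have := E.two
    nlinarith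
  have hKP : (K : ℝ) ≤ P := by
    have := (bK.mono hP1 (show g / 8 + τ ≤ 1 by linarith)).2
    rwa [Real.rpow_one] at this
  have hM1 : 1 ≤ P ^ θ := Real.one_le_rpow hP1 (by linarith)
  have hR := E.two_le
  have hMR : P ^ θ * R ≤ P ^ 4 := by
    have := (Bd.self hP.le θ).mul hP (show Bd P τ R from ⟨by linarith, E.le_rpow⟩)
    exact E.le_Y this (by linarith)
  have herr := bigGcd_moment_le (P := P) (R := R) (M := P ^ θ) (T := P ^ τ) (K := K) (u := u) (A := P ^ τ) hP.le
    hM1 (by linarith) hK1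
    (by
      have a1 := E.fud.log_le
      have a2 := Real.log_le_log (by positivity) hMR
      linarith) (by push_cast; linarith) (by positivity) hU
  have hp : 2 * μ / (2 * u + 2) ≥ 53 / 50 := by
    rw [ge_iff_le, le_div_iff₀ (by positivity)]; exact hs
  have bE : Bd P (μ - 3 / 400 * g + 2 * τ)
      (P ^ τ * P ^ μ * ((K : ℝ) ^ (1 - 2 * μ / (2 * u + 2)) * P ^ τ)) := by
    have a1 : (K : ℝ) ^ (1 - 2 * μ / (2 * u + 2)) ≤ P ^ (-(3 / 400 * g)) := by
      calc (K : ℝ) ^ (1 - 2 * μ / (2 * u + 2)) ≤ (K : ℝ) ^ (-(3 / 50) : ℝ) :=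
            Real.rpow_le_rpow_of_exponent_le (by exact_mod_cast hK1) (by linarith)
        _ ≤ (P ^ (g / 8)) ^ (-(3 / 50) : ℝ) :=
            Real.rpow_le_rpow_of_nonpos (by positivity) hK0 (by norm_num)
        _ = _ := by rw [← Real.rpow_mul hP.le]; congr 1; ring
    have a2 : Bd P (-(3 / 400 * g)) ((K : ℝ) ^ (1 - 2 * μ / (2 * u + 2))) := ⟨by positivity, a1⟩
    exact (((Bd.self hP.le τ).mul hP (Bd.self hP.le μ)).mul hP (a2.mul hP (Bd.self hP.le τ))).mono hP1
      (by linarith)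
  refine E.step (K := K) (κ := g / 8) (w := 5 / 2 * (g / 8 + τ) + (f - (2 * u - 1) * θ + τ))
    (B := fun k => (k : ℝ) ^ (3 / 2 : ℝ) * P ^ (f - (2 * u - 1) * θ + τ)) (by omega) hμ.1 (by linarith) hU
    herr bE (fun k => by positivity) ?_ ?_ (by push_cast; linarith) (by push_cast; linarith)
    (by push_cast; linarith) (by push_cast; linarith)
  · intro k hk
    rw [Finset.mem_Icc] at hk
    have hkK : (k : ℝ) ≤ K := by exact_mod_cast hk.2
    have := hB k hk.1 (hkK.trans hKP)
    refine this.mono (le_of_eq ?_)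
    push_cast; congr 3; ring
  · refine ⟨Finset.sum_nonneg fun k _ => by positivity, ?_⟩
    have a1 : ∀ k ∈ Finset.Icc 1 K, (k : ℝ) ^ (-(μ * ((((2 * u : ℕ) : ℝ) - 2) / ((2 * u : ℕ) + 2)))) *
          ((k : ℝ) ^ (3 / 2 : ℝ) * P ^ (f - (2 * u - 1) * θ + τ)) ≤
        1 * ((K : ℝ) ^ (3 / 2 : ℝ) * P ^ (f - (2 * u - 1) * θ + τ)) := by
      intro k hk
      rw [Finset.mem_Icc] at hk
      have hk' : (1:ℝ) ≤ k := by exact_mod_cast hk.1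
      have hkK : (k : ℝ) ≤ K := by exact_mod_cast hk.2
      gcongr
      refine Real.rpow_le_one_of_one_le_of_nonpos hk' ?_
      have : 0 ≤ ((((2 * u : ℕ) : ℝ) - 2) / ((2 * u : ℕ) + 2)) :=
        div_nonneg (by push_cast; linarith) (by positivity)
      have := mul_nonneg hμ.1 this
      linarith
    refine (Finset.sum_le_sum a1).trans ?_
    simp only [Finset.sum_const, Nat.card_Icc, Nat.add_sub_cancel, nsmul_eq_mul, one_mul]
    have := bK.mul hP ((bK.rpow hP (by norm_num : (0:ℝ) ≤ 3 / 2)).mul hP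
      (Bd.self hP.le (f - (2 * u - 1) * θ + τ)))
    exact (this.mono hP1 (by linarith)).2

lemma exists_adm (k : ℕ) : ∃ μ, Adm (4 + k) μ := ⟨_, adm_four.add k⟩

/-- A minimal admissible exponent at least `5 / 2 * s / (s - 4)` is at most the iterated one. -/
lemma least_le_large {v : ℕ} {θ f μ : ℝ} (hv : 2 ≤ v) (h1 : 1 / 100 ≤ θ) (h2 : θ ≤ 1 / 4)
    (hμ : Adm (v + 2) μ) (hmin : ∀ ν, Adm (v + 2) ν → μ ≤ ν) (hG : GcdBound (v + 2) θ f)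
    (hθ : θ * (v + 2) < μ) (hs : 5 / 2 * (v + 2) ≤ μ * (v - 2)) : μ ≤ f := by
  by_contra hcon
  obtain ⟨ν, hν, H⟩ := descend_large hv h1 h2 hμ hG (not_le.1 hcon) hθ hs
  linarith [hmin ν H]

lemma least_le_small {u : ℕ} {θ f μ : ℝ} (hu : 1 ≤ u) (h1 : 1 / 100 ≤ θ) (h2 : θ ≤ 1 / 4)
    (hμ : Adm (2 * u + 2) μ) (hmin : ∀ ν, Adm (2 * u + 2) ν → μ ≤ ν) (hG : GcdBound (2 * u + 2) θ f)
    (hθ : θ * (2 * u + 2) < μ) (hs : 53 / 50 * (2 * u + 2) ≤ 2 * μ) : μ ≤ f := by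
  by_contra hcon
  obtain ⟨ν, hν, H⟩ := descend_small hu h1 h2 hμ hG (not_le.1 hcon) hθ hs
  linarith [hmin ν H]

lemma adm_eight : Adm 8 4.6186 := by
  obtain ⟨μ, hμ, hm⟩ := exists_least_adm (exists_adm 2)
  obtain ⟨ν, hν, hn⟩ := exists_least_adm (exists_adm 4)
  refine hν.mono ?_
  norm_num at hμ hm hν hn
  by_contra! hcon
  have ν1 : ν ≤ max (5 * 0.1457 + (0.1457 + 1 + (1 - 0.1457) * μ)) (max
      (5 * 0.1457 + ((3 - 6 * 0.1457 + (1 - 0.1457) * 2) / 2 + (1 - 0.1457) * ν / 2))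
      (5 * 0.1457 + (((1 - 3 * 0.1457) + (3 - 3 * 0.1457) / 2 + (1 - 0.1457) * ν / 2) / 2 +
      (1 - 0.1457) * ν / 2))) :=
    least_le_small (u := 3) (θ := 0.1457) (by norm_num) (by norm_num) (by norm_num) hν hn
      (gcdBound_eight (by norm_num) (by norm_num) hμ hν (le_max_left _ _)
        ((le_max_left _ _).trans (le_max_right _ _)) ((le_max_right _ _).trans (le_max_right _ _)))
      (by push_cast; linarith) (by push_cast; linarith)
  have μ1 : μ < 3.18 ∨ μ ≤ max (3 * 0.1061 + (0.1061 + 1 + (1 - 0.1061) * 2)) (max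
      (3 * 0.1061 + ((2 - 3 * 0.1061) / 4 + (3 - 6 * 0.1061 + (1 - 0.1061) * 2) / 4 +
        (1 - 0.1061) * μ / 2))
      (3 * 0.1061 + ((2 - 3 * 0.1061) / 4 + ((1 - 3 * 0.1061) + (3 - 3 * 0.1061) / 2 +
        (1 - 0.1061) * ν / 2) / 4 + (1 - 0.1061) * μ / 2))) := by
    refine or_iff_not_imp_left.2 fun h3 => ?_
    refine least_le_small (u := 2) (θ := 0.1061) (by norm_num) (by norm_num) (by norm_num) hμ hm
      (gcdBound_six (by norm_num) (by norm_num) hμ hν (le_max_left _ _)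
        ((le_max_left _ _).trans (le_max_right _ _)) ((le_max_right _ _).trans (le_max_right _ _)))
      (by push_cast; linarith) (by push_cast; linarith)
  simp only [le_max_iff] at ν1 μ1
  rcases ν1 with h | h | h <;> rcases μ1 with h' | h' | h' | h' <;> linarith

lemma adm_ten : Adm 10 6.25265 := by
  obtain ⟨μ, hμ, hm⟩ := exists_least_adm (exists_adm 6)
  refine hμ.mono ?_
  norm_num at hμ hm
  by_contra! hcon
  obtain ⟨f, hf⟩ : ∃ f : ℝ, f = max 6.25265 (2.4 + 39 / 64 * μ) := ⟨_, rfl⟩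
  have f1 := hf ▸ le_max_left _ _
  have f2 := hf ▸ le_max_right _ _
  have := least_le_large (v := 8) (θ := 3 / 16) (by norm_num) (by norm_num) (by norm_num) hμ hm
    (gcdBound_even (n := 4) (η := 1 / 4) (f := f) (by norm_num) (by norm_num) adm_eight hμ
      (by norm_num) (by norm_num) (by norm_num) (by norm_num) (by norm_num; linarith)
      (by norm_num; linarith) (by norm_num; linarith) (by norm_num; linarith))
      (by norm_num; linarith) (by norm_num; linarith)
  rw [hf, le_max_iff] at this
  rcases this with h | h <;> linarith

lemma adm_twelve : Adm 12 8 := by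
  obtain ⟨μ, hμ, hm⟩ := exists_least_adm (exists_adm 8)
  refine hμ.mono ?_
  norm_num at hμ hm
  by_contra! hcon
  obtain ⟨f, hf⟩ : ∃ f : ℝ, f = max 8 (2.8 + 0.65 * μ) := ⟨_, rfl⟩
  have f1 := hf ▸ le_max_left _ _
  have f2 := hf ▸ le_max_right _ _
  have := least_le_large (v := 10) (θ := 3 / 16) (by norm_num) (by norm_num) (by norm_num) hμ hm
    (gcdBound_even (n := 5) (η := 1 / 5) (f := f) (by norm_num) (by norm_num) adm_ten hμ
      (by norm_num) (by norm_num) (by norm_num) (by norm_num) (by norm_num; linarith)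
      (by norm_num; linarith) (by norm_num; linarith) (by norm_num; linarith))
      (by norm_num; linarith) (by norm_num; linarith)
  rw [hf, le_max_iff] at this
  rcases this with h | h <;> linarith

lemma adm_eleven : Adm 11 7.104 := by
  obtain ⟨μ, hμ, hm⟩ := exists_least_adm (exists_adm 7)
  refine hμ.mono ?_
  norm_num at hμ hm
  by_contra! hcon
  have := least_le_large (v := 9) (θ := 3 / 16) (f := 7.104) (by norm_num) (by norm_num) (by norm_num)
    hμ hm (gcdBound_eleven (by norm_num) (by norm_num) adm_eight adm_ten adm_twelve
      (by norm_num) (by norm_num) (by norm_num)) (by norm_num; linarith) (by norm_num; linarith)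
  linarith

/-- The integer divisors of `m`, of either sign. -/
def intDivs (m : ℤ) : Finset ℤ :=
  m.natAbs.divisors.image (fun d : ℕ => (d : ℤ)) ∪ m.natAbs.divisors.image (fun d : ℕ => -(d : ℤ))

lemma mem_intDivs {m d : ℤ} (hm : m ≠ 0) (hd : d ∣ m) : d ∈ intDivs m := by
  have h1 : d.natAbs ∈ m.natAbs.divisors :=
    Nat.mem_divisors.2 ⟨Int.natAbs_dvd_natAbs.2 hd, by simpa using hm⟩
  rw [intDivs, Finset.mem_union, Finset.mem_image, Finset.mem_image]
  rcases Int.natAbs_eq d with h | h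
  · exact Or.inl ⟨_, h1, h.symm⟩
  · exact Or.inr ⟨_, h1, h.symm⟩

lemma Fud.card_intDivs {Y T : ℝ} (hF : Fud Y T) {m : ℤ} (hm : m ≠ 0) (hmY : ((|m| : ℤ) : ℝ) ≤ Y ^ 50) :
    ((intDivs m).card : ℝ) ≤ 2 * T := by
  have h1 := hF.div_le m.natAbs (by simpa using hm) (by rwa [Nat.cast_natAbs])
  have h2 : (intDivs m).card ≤ m.natAbs.divisors.card + m.natAbs.divisors.card :=
    (Finset.card_union_le _ _).trans (add_le_add Finset.card_image_le Finset.card_image_le)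
  have h3 : ((intDivs m).card : ℝ) ≤ m.natAbs.divisors.card + m.natAbs.divisors.card := by
    exact_mod_cast h2
  linarith

/-- The second difference of the fourth power. -/
def sdiff4 (w a b : ℤ) : ℤ := (w + a + b) ^ 4 - (w + a) ^ 4 - (w + b) ^ 4 + w ^ 4

lemma sdiff4_eq (w a b : ℤ) :
    sdiff4 w a b = a * b * (3 * (2 * w + a + b) ^ 2 + a ^ 2 + b ^ 2) := by
  unfold sdiff4; ring

lemma sdiff4_sub (w w' a b : ℤ) :
    sdiff4 w a b - sdiff4 w' a b = 12 * (a * b * (w - w') * (w + w' + a + b)) := by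
  unfold sdiff4; ring

/-- The triples `(w, a, b)` spanning a parallelogram in `[1, M]`. -/
def paras (M : ℕ) : Finset (ℤ × ℤ × ℤ) :=
  (Finset.Icc (1:ℤ) M ×ˢ Finset.Icc (-M : ℤ) M ×ˢ Finset.Icc (-M : ℤ) M).filter fun p =>
    p.1 + p.2.1 ∈ Finset.Icc (1:ℤ) M ∧ p.1 + p.2.2 ∈ Finset.Icc (1:ℤ) M ∧
      p.1 + p.2.1 + p.2.2 ∈ Finset.Icc (1:ℤ) M

lemma mem_paras {M : ℕ} {w a b : ℤ} : (w, a, b) ∈ paras M ↔ (1 ≤ w ∧ w ≤ M) ∧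
    (1 ≤ w + a ∧ w + a ≤ M) ∧ (1 ≤ w + b ∧ w + b ≤ M) ∧ (1 ≤ w + a + b ∧ w + a + b ≤ M) := by
  simp only [paras, Finset.mem_filter, Finset.mem_product, Finset.mem_Icc]
  constructor
  · rintro ⟨⟨h1, -, -⟩, h2, h3, h4⟩; exact ⟨h1, h2, h3, h4⟩
  · rintro ⟨h1, h2, h3, h4⟩; exact ⟨⟨h1, ⟨by omega, by omega⟩, ⟨by omega, by omega⟩⟩, h2, h3, h4⟩

lemma abs_sdiff4_le {M : ℕ} {w a b : ℤ} (hp : (w, a, b) ∈ paras M) :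
    |sdiff4 w a b| ≤ 2 * (M : ℤ) ^ 4 := by
  obtain ⟨⟨h1, h2⟩, ⟨h3, h4⟩, ⟨h5, h6⟩, h7, h8⟩ := mem_paras.1 hp
  have k1 := pow_le_pow_left₀ (by omega) h2 4
  have k2 := pow_le_pow_left₀ (by omega) h4 4
  have k3 := pow_le_pow_left₀ (by omega) h6 4
  have k4 := pow_le_pow_left₀ (by omega) h8 4
  have l1 : 0 ≤ w ^ 4 := by positivity
  have l2 : 0 ≤ (w + a) ^ 4 := by positivity
  have l3 : 0 ≤ (w + b) ^ 4 := by positivity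
  have l4 : 0 ≤ (w + a + b) ^ 4 := by positivity
  unfold sdiff4
  rw [abs_le]; constructor <;> linarith

lemma abs_le_pow_fifty {Y : ℝ} (hY : 8 ≤ Y) {M : ℕ} (hM : (M : ℝ) ≤ Y) {m : ℤ}
    (hm : |m| ≤ 4 * (M : ℤ) ^ 4) : ((|m| : ℤ) : ℝ) ≤ Y ^ 50 := by
  have h1 : ((|m| : ℤ) : ℝ) ≤ 4 * (M : ℝ) ^ 4 := by exact_mod_cast hm
  calc ((|m| : ℤ) : ℝ) ≤ 4 * (M : ℝ) ^ 4 := h1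
    _ ≤ Y * Y ^ 4 := by gcongr; linarith
    _ = Y ^ 5 := by ring
    _ ≤ Y ^ 50 := pow_le_pow_right₀ (by linarith) (by norm_num)

lemma card_sdiff4_eq_le {Y T : ℝ} (hF : Fud Y T) (hY : 8 ≤ Y) {M : ℕ} (hM : (M : ℝ) ≤ Y) (m : ℤ) :
    (((paras M).filter fun p => p.2.1 * p.2.2 ≠ 0 ∧ sdiff4 p.1 p.2.1 p.2.2 = m).card : ℝ) ≤
      4 * T ^ 2 := by
  set S := (paras M).filter fun p => p.2.1 * p.2.2 ≠ 0 ∧ sdiff4 p.1 p.2.1 p.2.2 = m with hS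
  have hT := hF.hundred_le
  rcases S.eq_empty_or_nonempty with h0 | ⟨⟨w, a, b⟩, hw⟩
  · rw [h0]; simp; positivity
  have key : ∀ p ∈ S, p.1 + (p.1 + p.2.1 + p.2.2) > 0 ∧ p.2.1 * p.2.2 ≠ 0 ∧
      p.2.1 * p.2.2 * (3 * (2 * p.1 + p.2.1 + p.2.2) ^ 2 + p.2.1 ^ 2 + p.2.2 ^ 2) = m := by
    rintro ⟨w, a, b⟩ hp
    rw [hS, Finset.mem_filter] at hp
    obtain ⟨h1, h2, h3⟩ := hp
    have := mem_paras.1 h1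
    exact ⟨by dsimp only; omega, h2, by rw [← h3, sdiff4_eq]⟩
  have hm0 : m ≠ 0 := by
    obtain ⟨h1, h2, h3⟩ := key _ hw
    rw [← h3]
    refine mul_ne_zero h2 (ne_of_gt ?_)
    dsimp only at h1 ⊢
    have : 0 < (2 * w + a + b) ^ 2 := by apply pow_pos; omega
    positivity
  have hmM : |m| ≤ 4 * (M : ℤ) ^ 4 := by
    rw [hS, Finset.mem_filter] at hw
    rw [← hw.2.2]
    have : (0:ℤ) ≤ (M : ℤ) ^ 4 := by positivity
    linarith [abs_sdiff4_le hw.1]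
  have hd := hF.card_intDivs hm0 (abs_le_pow_fifty hY hM hmM)
  have hle : S.card ≤ (intDivs m ×ˢ intDivs m).card := by
    refine Finset.card_le_card_of_injOn (fun p => p.2) ?_ ?_
    · rintro ⟨w, a, b⟩ hp
      obtain ⟨-, -, h3⟩ := key _ hp
      refine Finset.mem_coe.2 (Finset.mem_product.2 ⟨mem_intDivs hm0 ?_, mem_intDivs hm0 ?_⟩)
      · rw [← h3, mul_assoc]; exact dvd_mul_right _ _
      · rw [← h3, mul_comm a b, mul_assoc]; exact dvd_mul_right _ _
    · rintro ⟨w, a, b⟩ hp ⟨w', a', b'⟩ hp' heq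
      obtain ⟨h1, h2, h3⟩ := key _ hp
      obtain ⟨h1', h2', h3'⟩ := key _ hp'
      simp only [Prod.mk.injEq] at heq
      obtain ⟨rfl, rfl⟩ := heq
      dsimp only at *
      have h4 := mul_left_cancel₀ h2 (h3.trans h3'.symm)
      have h5 : (2 * w + a + b) ^ 2 = (2 * w' + a + b) ^ 2 := by linarith
      have h6 : 2 * w + a + b = 2 * w' + a + b :=
        (pow_left_inj₀ (by omega) (by omega) (by norm_num)).1 h5
      rw [show w = w' by omega]
  rw [Finset.card_product] at hle
  calc (S.card : ℝ) ≤ ((intDivs m).card : ℝ) * (intDivs m).card := by exact_mod_cast hle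
    _ ≤ (2 * T) * (2 * T) := by gcongr
    _ = _ := by ring

/-- The full quartic Weyl sum. -/
def fs (M : ℕ) (α : ℝ) : ℂ := ∑ x ∈ Finset.Icc (1:ℤ) M, e (((x ^ 4 : ℤ) : ℝ) * α)

@[fun_prop] lemma continuous_fs (M : ℕ) : Continuous (fs M) := by unfold fs; fun_prop

/-- Solutions of `a i + x⁴ - y⁴ = a i' + x'⁴ - y'⁴` with `x - y = x' - y'`, up to reordering. -/
def quads {κ : Type*} (S : Finset κ) (a : κ → ℤ) (M : ℕ) : Finset ((κ × κ) × (ℤ × ℤ × ℤ)) :=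
  ((S ×ˢ S) ×ˢ paras M).filter fun q =>
    a q.1.2 - a q.1.1 = sdiff4 q.2.1 q.2.2.1 q.2.2.2

lemma norm_fs_pow_four_le (M : ℕ) (α : ℝ) :
    ‖fs M α‖ ^ 4 ≤ (2 * M + 1) * ∑ k ∈ Finset.Icc (-M : ℤ) M,
      ‖∑ p ∈ (Finset.Icc (1:ℤ) M ×ˢ Finset.Icc (1:ℤ) M).filter (fun p => p.1 - p.2 = k),
        e (((p.1 ^ 4 - p.2 ^ 4 : ℤ) : ℝ) * α)‖ ^ 2 := by
  set I := Finset.Icc (1:ℤ) M with hI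
  have h1 : fs M α * (starRingEnd ℂ) (fs M α) =
      ∑ p ∈ I ×ˢ I, e (((p.1 ^ 4 - p.2 ^ 4 : ℤ) : ℝ) * α) := by
    unfold fs
    rw [map_sum, Finset.sum_mul_sum, Finset.sum_product]
    refine Finset.sum_congr rfl fun x _ => Finset.sum_congr rfl fun y _ => ?_
    rw [Int.cast_sub, sub_mul, e_sub]
  have h2 : ∑ p ∈ I ×ˢ I, e (((p.1 ^ 4 - p.2 ^ 4 : ℤ) : ℝ) * α) = ∑ k ∈ Finset.Icc (-M : ℤ) M,
      ∑ p ∈ (I ×ˢ I).filter (fun p => p.1 - p.2 = k), e (((p.1 ^ 4 - p.2 ^ 4 : ℤ) : ℝ) * α) := by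
    refine (Finset.sum_fiberwise_of_maps_to (fun p hp => ?_) _).symm
    simp only [hI, Finset.mem_product, Finset.mem_Icc] at hp ⊢
    omega
  have h3 : ‖fs M α‖ ^ 4 = ‖fs M α * (starRingEnd ℂ) (fs M α)‖ ^ 2 := by
    rw [norm_mul, RCLike.norm_conj]; ring
  rw [h3, h1, h2]
  refine (pow_le_pow_left₀ (norm_nonneg _) (norm_sum_le _ _) 2).trans ?_
  refine sq_sum_le_card_mul_sum_sq.trans (le_of_eq ?_)
  congr 1
  rw [Int.card_Icc]
  have : ((M : ℤ) + 1 - -(M : ℤ)).toNat = 2 * M + 1 := by omega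
  rw [this]; push_cast; ring

lemma fourth_moment_le {κ : Type*} [DecidableEq κ] (S : Finset κ) (a : κ → ℤ) (M : ℕ) :
    ∫ α in (0:ℝ)..1, ‖∑ i ∈ S, e ((a i : ℝ) * α)‖ ^ 2 * ‖fs M α‖ ^ 4 ≤
      (2 * M + 1) * ((quads S a M).card : ℝ) := by
  set I := Finset.Icc (1:ℤ) M with hI
  set D := Finset.Icc (-M : ℤ) M with hD
  set J : ℤ → Finset (ℤ × ℤ) := fun k => (I ×ˢ I).filter (fun p => p.1 - p.2 = k) with hJ
  set b : κ × (ℤ × ℤ) → ℤ := fun i => a i.1 + (i.2.1 ^ 4 - i.2.2 ^ 4) with hb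
  have h1 : ∀ (k : ℤ) (α : ℝ), ‖∑ i ∈ S, e ((a i : ℝ) * α)‖ ^ 2 *
      ‖∑ p ∈ J k, e (((p.1 ^ 4 - p.2 ^ 4 : ℤ) : ℝ) * α)‖ ^ 2 = ‖∑ i ∈ S ×ˢ J k, e ((b i : ℝ) * α)‖ ^ 2 := by
    intro k α
    rw [← _root_.mul_pow, ← norm_mul, Finset.sum_mul_sum, Finset.sum_product]
    congr 2
    refine Finset.sum_congr rfl fun x _ => Finset.sum_congr rfl fun y _ => ?_
    rw [← e_add, hb]
    congr 1; push_cast; ring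
  have h2 : ∫ α in (0:ℝ)..1, ‖∑ i ∈ S, e ((a i : ℝ) * α)‖ ^ 2 * ‖fs M α‖ ^ 4 ≤ ∫ α in (0:ℝ)..1,
      (2 * M + 1) * ∑ k ∈ D, ‖∑ i ∈ S ×ˢ J k, e ((b i : ℝ) * α)‖ ^ 2 := by
    refine integral01_mono (by fun_prop) (by fun_prop) fun α => ?_
    simp_rw [← h1]
    rw [← Finset.mul_sum, mul_left_comm]
    exact mul_le_mul_of_nonneg_left (norm_fs_pow_four_le M α) (by positivity)
  refine h2.trans ?_
  rw [intervalIntegral.integral_const_mul, intervalIntegral.integral_finsetSum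
    (fun k _ => ii (by fun_prop) _ _)]
  refine mul_le_mul_of_nonneg_left ?_ (by positivity)
  simp_rw [integral_normSq_trig]
  rw [← Nat.cast_sum, ← Finset.card_sigma]
  refine Nat.cast_le.2 ?_
  refine Finset.card_le_card_of_injOn (fun s => ((s.2.1.1, s.2.2.1),
    (s.2.2.2.2, s.2.2.2.1 - s.2.2.2.2, s.2.1.2.2 - s.2.2.2.2))) ?_ ?_
  · rintro ⟨k, ⟨i, x, y⟩, ⟨i', x', y'⟩⟩ hs
    simp only [hJ, hI, hb, Finset.mem_coe, Finset.mem_sigma, Finset.mem_filter, Finset.mem_product,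
      Finset.mem_Icc] at hs
    obtain ⟨-, ⟨⟨hi, ⟨hx, hy⟩, h3⟩, hi', ⟨hx', hy'⟩, h3'⟩, h4⟩ := hs
    simp only [quads, Finset.mem_coe, Finset.mem_filter, Finset.mem_product]
    refine ⟨⟨⟨hi, hi'⟩, mem_paras.2 ⟨hy', by omega, by omega, by omega⟩⟩, ?_⟩
    obtain rfl : x = x' - y' + y := by omega
    unfold sdiff4
    linear_combination -h4
  · rintro ⟨k, ⟨i, x, y⟩, ⟨i', x', y'⟩⟩ hs ⟨k₂, ⟨j, z, w⟩, ⟨j', z', w'⟩⟩ hs₂ heq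
    simp only [hJ, Finset.mem_coe, Finset.mem_sigma, Finset.mem_filter, Finset.mem_product] at hs hs₂
    obtain ⟨-, ⟨⟨-, -, h3⟩, -, -, h3'⟩, -⟩ := hs
    obtain ⟨-, ⟨⟨-, -, k3⟩, -, -, k3'⟩, -⟩ := hs₂
    simp only [Prod.mk.injEq] at heq
    obtain ⟨⟨rfl, rfl⟩, rfl, h5, h6⟩ := heq
    obtain rfl : x' = z' := by omega
    obtain rfl : y = w := by omega
    obtain rfl : k = k₂ := by omega
    obtain rfl : x = z := by omega
    rfl

/-- The solutions with both differences nonzero. -/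
def quadsNe {κ : Type*} (S : Finset κ) (a : κ → ℤ) (M : ℕ) : Finset ((κ × κ) × (ℤ × ℤ × ℤ)) :=
  (quads S a M).filter fun q => q.2.2.1 * q.2.2.2 ≠ 0

lemma card_paras_degenerate (M : ℕ) :
    ((paras M).filter fun p => p.2.1 * p.2.2 = 0).card ≤ 2 * (M * (2 * M + 1)) := by
  have h1 : (paras M).filter (fun p => p.2.1 * p.2.2 = 0) ⊆
      (Finset.Icc (1:ℤ) M ×ˢ Finset.Icc (-M : ℤ) M).image (fun q => (q.1, q.2, (0:ℤ))) ∪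
      (Finset.Icc (1:ℤ) M ×ˢ Finset.Icc (-M : ℤ) M).image (fun q => (q.1, (0:ℤ), q.2)) := by
    rintro ⟨w, a, b⟩ hp
    rw [Finset.mem_filter] at hp
    obtain ⟨h2, h3, h4, h5⟩ := mem_paras.1 hp.1
    have h6 : a = 0 ∨ b = 0 := mul_eq_zero.1 hp.2
    simp only [Finset.mem_union, Finset.mem_image, Finset.mem_product, Finset.mem_Icc, Prod.exists,
      Prod.mk.injEq]
    rcases h6 with rfl | rfl
    · exact Or.inr ⟨w, b, ⟨h2, by omega, by omega⟩, rfl, rfl, rfl⟩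
    · exact Or.inl ⟨w, a, ⟨h2, by omega, by omega⟩, rfl, rfl, rfl⟩
  have h2 : (Finset.Icc (1:ℤ) M ×ˢ Finset.Icc (-M : ℤ) M).card = M * (2 * M + 1) := by
    rw [Finset.card_product, Int.card_Icc, Int.card_Icc]
    congr 1 <;> omega
  refine (Finset.card_le_card h1).trans ((Finset.card_union_le _ _).trans ?_)
  have h3 := Finset.card_image_le (s := Finset.Icc (1:ℤ) M ×ˢ Finset.Icc (-M : ℤ) M)
    (f := fun q => (q.1, q.2, (0:ℤ)))
  have h4 := Finset.card_image_le (s := Finset.Icc (1:ℤ) M ×ˢ Finset.Icc (-M : ℤ) M)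
    (f := fun q => (q.1, (0:ℤ), q.2))
  omega

lemma card_quads_le {κ : Type*} [DecidableEq κ] (S : Finset κ) (a : κ → ℤ) (M : ℕ) :
    (quads S a M).card ≤ ((S ×ˢ S).filter fun p => a p.1 = a p.2).card * (2 * (M * (2 * M + 1))) +
      (quadsNe S a M).card := by
  have h1 := Finset.card_filter_add_card_filter_not (s := quads S a M) (fun q => q.2.2.1 * q.2.2.2 = 0)
  rw [← h1]
  refine add_le_add ?_ (le_of_eq rfl)
  refine le_trans ?_ (Nat.mul_le_mul le_rfl (card_paras_degenerate M))
  rw [← Finset.card_product]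
  refine Finset.card_le_card ?_
  rintro ⟨⟨i, j⟩, ⟨w, b, c⟩⟩ hq
  simp only [quads, Finset.mem_filter, Finset.mem_product] at hq ⊢
  obtain ⟨⟨⟨⟨hi, hj⟩, hp⟩, h2⟩, h3⟩ := hq
  refine ⟨⟨⟨hi, hj⟩, ?_⟩, hp, h3⟩
  rw [sdiff4_eq, h3] at h2
  linarith

lemma card_quadsNe_le {κ : Type*} [DecidableEq κ] (S : Finset κ) (a : κ → ℤ) {Y T : ℝ} (hF : Fud Y T)
    (hY : 8 ≤ Y) {M : ℕ} (hM : (M : ℝ) ≤ Y) :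
    ((quadsNe S a M).card : ℝ) ≤ (S.card : ℝ) ^ 2 * (4 * T ^ 2) := by
  have h1 := card_fiber_le (quadsNe S a M) (S ×ˢ S) (fun q => q.1) (fun q hq => by
    simp only [quadsNe, quads, Finset.mem_filter, Finset.mem_product] at hq ⊢
    exact hq.1.1.1) (4 * T ^ 2) (fun p _ => by
    refine le_trans (Nat.cast_le.2 ?_) (card_sdiff4_eq_le hF hY hM (a p.2 - a p.1))
    refine Finset.card_le_card_of_injOn (fun q => q.2) ?_ ?_
    · rintro ⟨⟨i, j⟩, v⟩ hq
      simp only [quadsNe, quads, Finset.mem_coe, Finset.mem_filter, Finset.mem_product] at hq ⊢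
      obtain ⟨⟨⟨⟨-, hp⟩, h2⟩, h3⟩, rfl⟩ := hq
      exact ⟨hp, h3, h2.symm⟩
    · rintro ⟨v, q⟩ hq ⟨v', q'⟩ hq' heq
      simp only [Finset.mem_coe, Finset.mem_filter] at hq hq' heq
      rw [hq.2, hq'.2, heq])
  rw [Finset.card_product] at h1
  push_cast at h1
  rw [sq]; exact h1

lemma sq_card_le_card_mul_pairs {α β : Type*} [DecidableEq β] (S : Finset α) (D : Finset β)
    (f : α → β) (hf : ∀ x ∈ S, f x ∈ D) :
    S.card ^ 2 ≤ D.card * ((S ×ˢ S).filter fun p => f p.1 = f p.2).card := by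
  classical
  have h1 : ((S ×ˢ S).filter fun p => f p.1 = f p.2).card =
      ∑ b ∈ D, (S.filter fun a => f a = b).card ^ 2 := by
    rw [Finset.card_eq_sum_card_fiberwise (f := fun p : α × α => f p.1) (t := D) (fun p hp => by
      have hp := Finset.mem_filter.1 (Finset.mem_coe.1 hp)
      exact hf _ (Finset.mem_product.1 hp.1).1)]
    refine Finset.sum_congr rfl fun b _ => ?_
    rw [sq, ← Finset.card_product]
    congr 1
    ext ⟨x, y⟩
    simp only [Finset.mem_filter, Finset.mem_product]
    constructor
    · rintro ⟨⟨⟨h1, h2⟩, h3⟩, h4⟩; exact ⟨⟨h1, h4⟩, h2, h3 ▸ h4⟩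
    · rintro ⟨⟨h1, h4⟩, h2, h3⟩; exact ⟨⟨⟨h1, h2⟩, h4.trans h3.symm⟩, h4⟩
  rw [h1, Finset.card_eq_sum_card_fiberwise hf]
  exact sq_sum_le_card_mul_sum_sq

lemma sq_card_quadsNe_le (S : Finset ℤ) {Y T : ℝ} (hF : Fud Y T) (hY : 8 ≤ Y) {M : ℕ}
    (hM : (M : ℝ) ≤ Y) :
    ((quadsNe S id M).card : ℝ) ^ 2 ≤ S.card * (2 * M + 1) ^ 2 *
      ((quadsNe S id M).card + 16 * T ^ 4 * (S.card : ℝ) ^ 2) := by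
  classical
  set V := quadsNe S id M with hV
  have hT := hF.hundred_le
  have hT16 : 0 ≤ 16 * T ^ 4 := by positivity
  have mem : ∀ {n n' w a b : ℤ}, ((n, n'), (w, a, b)) ∈ V → (n ∈ S ∧ n' ∈ S) ∧
      (w, a, b) ∈ paras M ∧ n' - n = sdiff4 w a b ∧ a * b ≠ 0 := by
    intro n n' w a b hq
    simp only [hV, quadsNe, quads, Finset.mem_filter, Finset.mem_product, id] at hq
    exact ⟨hq.1.1.1, hq.1.1.2, hq.1.2, hq.2⟩
  have h1 := sq_card_le_card_mul_pairs V (S ×ˢ Finset.Icc (-M : ℤ) M ×ˢ Finset.Icc (-M : ℤ) M)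
    (fun q => (q.1.1, q.2.2.1, q.2.2.2)) (by
      rintro ⟨⟨n, n'⟩, ⟨w, a, b⟩⟩ hq
      obtain ⟨⟨h1, -⟩, h2, -⟩ := mem hq
      have := mem_paras.1 h2
      simp only [Finset.mem_product, Finset.mem_Icc]
      exact ⟨h1, by omega, by omega⟩)
  set W := (V ×ˢ V).filter fun p => ((fun q : (ℤ × ℤ) × ℤ × ℤ × ℤ => (q.1.1, q.2.2.1, q.2.2.2)) p.1 : ℤ × ℤ × ℤ) =
    (fun q : (ℤ × ℤ) × ℤ × ℤ × ℤ => (q.1.1, q.2.2.1, q.2.2.2)) p.2 with hW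
  have mem_pairs : ∀ {n n' w a b m m' v c d : ℤ}, (((n, n'), (w, a, b)), ((m, m'), (v, c, d))) ∈ W →
      (((n, n'), (w, a, b)) ∈ V ∧ ((m, m'), (v, c, d)) ∈ V) ∧ n = m ∧ a = c ∧ b = d := by
    intro n n' w a b m m' v c d hp
    obtain ⟨hp1, hp2⟩ := Finset.mem_filter.1 hp
    obtain ⟨e1, e2⟩ : n = m ∧ (a, b) = (c, d) := Prod.mk.inj hp2
    exact ⟨Finset.mem_product.1 hp1, e1, Prod.mk.inj e2⟩
  have h2 := Finset.card_filter_add_card_filter_not (s := W) (fun p => p.1.2.1 = p.2.2.1)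
  have h3 : (W.filter (fun p => p.1.2.1 = p.2.2.1)).card ≤ V.card := by
    refine Finset.card_le_card_of_injOn (fun p => p.1) ?_ ?_
    · intro p hp
      exact (Finset.mem_product.1 (Finset.mem_filter.1 (Finset.mem_filter.1 hp).1).1).1
    · rintro ⟨⟨⟨n, n'⟩, ⟨w, a, b⟩⟩, ⟨⟨m, m'⟩, ⟨v, c, d⟩⟩⟩ hp ⟨⟨⟨i, i'⟩, ⟨u, f, g⟩⟩, ⟨⟨j, j'⟩, ⟨t, k, l⟩⟩⟩ hp' heq
      obtain ⟨hp1, hp2⟩ := Finset.mem_filter.1 hp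
      obtain ⟨hp1', hp2'⟩ := Finset.mem_filter.1 hp'
      obtain ⟨⟨k1, k2⟩, rfl, rfl, rfl⟩ := mem_pairs hp1
      obtain ⟨⟨l1, l2⟩, rfl, rfl, rfl⟩ := mem_pairs hp1'
      obtain rfl : w = v := hp2
      obtain rfl : u = t := hp2'
      obtain ⟨heq1, heq2⟩ := Prod.mk.inj heq
      obtain ⟨rfl, rfl⟩ := Prod.mk.inj heq1
      obtain ⟨rfl, heq3⟩ := Prod.mk.inj heq2
      obtain ⟨rfl, rfl⟩ := Prod.mk.inj heq3
      have e1 := (mem k2).2.2.1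
      have e2 := (mem l2).2.2.1
      obtain rfl : m' = j' := by linarith
      rfl
  have h4 : ((W.filter (fun p => ¬ p.1.2.1 = p.2.2.1)).card : ℝ) ≤
      (S.card : ℝ) ^ 2 * (16 * T ^ 4) := by
    have key : ∀ n n' w a b m m' v c d : ℤ, (((n, n'), (w, a, b)), ((m, m'), (v, c, d))) ∈
        W.filter (fun p => ¬ p.1.2.1 = p.2.2.1) → (n' ∈ S ∧ m' ∈ S) ∧ m = n ∧ c = a ∧ d = b ∧
        n' - m' = 12 * (a * b * (w - v) * (w + v + a + b)) ∧ n' - m' ≠ 0 ∧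
        |n' - m'| ≤ 4 * (M:ℤ) ^ 4 ∧ n' - n = sdiff4 w a b := by
      intro n n' w a b m m' v c d hp
      obtain ⟨hp1, hne⟩ := Finset.mem_filter.1 hp
      replace hne : ¬ w = v := hne
      obtain ⟨⟨k1, k2⟩, rfl, rfl, rfl⟩ := mem_pairs hp1
      obtain ⟨⟨a1, a2⟩, a3, a4, a5⟩ := mem k1
      obtain ⟨⟨b1, b2⟩, b3, b4, b5⟩ := mem k2
      have c1 : n' - m' = sdiff4 w a b - sdiff4 v a b := by linarith
      have c2 : n' - m' = 12 * (a * b * (w - v) * (w + v + a + b)) := by rw [c1, sdiff4_sub]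
      refine ⟨⟨a2, b2⟩, rfl, rfl, rfl, c2, ?_, ?_, a4⟩
      · rw [c2]
        have := mem_paras.1 a3
        have := mem_paras.1 b3
        exact mul_ne_zero (by norm_num) (mul_ne_zero (mul_ne_zero a5 (sub_ne_zero.2 hne)) (by omega))
      · rw [c1]
        linarith [abs_sub (sdiff4 w a b) (sdiff4 v a b), abs_sdiff4_le a3, abs_sdiff4_le b3]
    have := card_fiber_le (W.filter (fun p => ¬ p.1.2.1 = p.2.2.1)) (S ×ˢ S)
      (fun p => (p.1.1.2, p.2.1.2)) (by
        rintro ⟨⟨⟨n, n'⟩, ⟨w, a, b⟩⟩, ⟨⟨m, m'⟩, ⟨v, c, d⟩⟩⟩ hp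
        exact Finset.mem_product.2 (key _ _ _ _ _ _ _ _ _ _ hp).1) (16 * T ^ 4) (by
        rintro ⟨i, j⟩ -
        set Q := (W.filter (fun p => ¬ p.1.2.1 = p.2.2.1)).filter
          (fun p => (p.1.1.2, p.2.1.2) = (i, j)) with hQ
        rcases Q.eq_empty_or_nonempty with h0 | ⟨⟨⟨⟨n, n'⟩, ⟨w, a, b⟩⟩, ⟨⟨m, m'⟩, ⟨v, c, d⟩⟩⟩, hq⟩
        · rw [h0, Finset.card_empty, Nat.cast_zero]; exact hT16
        have h5 : i - j ≠ 0 ∧ |i - j| ≤ 4 * (M : ℤ) ^ 4 := by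
          rw [hQ, Finset.mem_filter] at hq
          obtain ⟨hq1, hq2⟩ := hq
          obtain ⟨rfl, rfl⟩ : n' = i ∧ m' = j := Prod.mk.inj hq2
          obtain ⟨-, -, -, -, -, h6, h7, -⟩ := key _ _ _ _ _ _ _ _ _ _ hq1
          exact ⟨h6, h7⟩
        have hd := hF.card_intDivs h5.1 (abs_le_pow_fifty hY hM h5.2)
        have hle : Q.card ≤ ((intDivs (i - j) ×ˢ intDivs (i - j)) ×ˢ
            (intDivs (i - j) ×ˢ intDivs (i - j))).card := by
          refine Finset.card_le_card_of_injOn (fun p => ((p.1.2.2.1, p.1.2.2.2),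
            (p.1.2.1 - p.2.2.1, p.1.2.1 + p.2.2.1 + p.1.2.2.1 + p.1.2.2.2))) ?_ ?_
          · rintro ⟨⟨⟨n, n'⟩, ⟨w, a, b⟩⟩, ⟨⟨m, m'⟩, ⟨v, c, d⟩⟩⟩ hq
            rw [Finset.mem_coe, hQ, Finset.mem_filter] at hq
            obtain ⟨hq1, hq2⟩ := hq
            obtain ⟨rfl, rfl⟩ : n' = i ∧ m' = j := Prod.mk.inj hq2
            obtain ⟨-, -, -, -, h6, -⟩ := key _ _ _ _ _ _ _ _ _ _ hq1
            simp only [Finset.coe_product, Set.mem_prod, Finset.mem_coe]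
            refine ⟨⟨mem_intDivs h5.1 ?_, mem_intDivs h5.1 ?_⟩, mem_intDivs h5.1 ?_,
              mem_intDivs h5.1 ?_⟩
            · exact ⟨12 * (b * (w - v) * (w + v + a + b)), by rw [h6]; ring⟩
            · exact ⟨12 * (a * (w - v) * (w + v + a + b)), by rw [h6]; ring⟩
            · exact ⟨12 * (a * b * (w + v + a + b)), by rw [h6]; ring⟩
            · exact ⟨12 * (a * b * (w - v)), by rw [h6]; ring⟩
          · rintro ⟨⟨⟨n, n'⟩, ⟨w, a, b⟩⟩, ⟨⟨m, m'⟩, ⟨v, c, d⟩⟩⟩ hq ⟨⟨⟨n₂, n₂'⟩, ⟨w₂, a₂, b₂⟩⟩, ⟨⟨m₂, m₂'⟩, ⟨v₂, c₂, d₂⟩⟩⟩ hq₂ heq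
            rw [Finset.mem_coe, hQ, Finset.mem_filter] at hq hq₂
            obtain ⟨hq1, hq2⟩ := hq
            obtain ⟨hq1', hq2'⟩ := hq₂
            obtain ⟨rfl, rfl⟩ : n' = i ∧ m' = j := Prod.mk.inj hq2
            obtain ⟨rfl, rfl⟩ : n₂' = n' ∧ m₂' = m' := Prod.mk.inj hq2'
            obtain ⟨-, rfl, rfl, rfl, -, -, -, h6⟩ := key _ _ _ _ _ _ _ _ _ _ hq1
            obtain ⟨-, rfl, rfl, rfl, -, -, -, h7⟩ := key _ _ _ _ _ _ _ _ _ _ hq1'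
            obtain ⟨heq1, heq2⟩ := Prod.mk.inj heq
            obtain ⟨rfl, rfl⟩ : c = c₂ ∧ d = d₂ := Prod.mk.inj heq1
            obtain ⟨h8, h9⟩ : w - v = w₂ - v₂ ∧ w + v + c + d = w₂ + v₂ + c + d := Prod.mk.inj heq2
            obtain rfl : w = w₂ := by omega
            obtain rfl : v = v₂ := by omega
            obtain rfl : m = m₂ := by linarith
            rfl
        rw [Finset.card_product, Finset.card_product] at hle
        calc (Q.card : ℝ) ≤ ((intDivs (i - j)).card * (intDivs (i - j)).card : ℝ) *
              ((intDivs (i - j)).card * (intDivs (i - j)).card) :=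
              (Nat.cast_le.2 hle).trans_eq (by rw [Nat.cast_mul, Nat.cast_mul])
          _ ≤ ((2 * T) * (2 * T)) * ((2 * T) * (2 * T)) :=
            mul_self_le_mul_self (mul_self_nonneg _) (mul_self_le_mul_self (Nat.cast_nonneg _) hd)
          _ = _ := by ring)
    rw [Finset.card_product] at this
    rw [Nat.cast_mul] at this
    rw [sq]; exact this
  have h5 : (W.card : ℝ) ≤ V.card + 16 * T ^ 4 * (S.card : ℝ) ^ 2 := by
    have h3' : ((W.filter (fun p => p.1.2.1 = p.2.2.1)).card : ℝ) ≤ V.card := Nat.cast_le.2 h3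
    have h2' : ((W.filter (fun p => p.1.2.1 = p.2.2.1)).card : ℝ) +
      (W.filter (fun p => ¬ p.1.2.1 = p.2.2.1)).card = W.card := by
      rw [← Nat.cast_add, h2]
    linarith
  have h6 : ((S ×ˢ Finset.Icc (-M : ℤ) M ×ˢ Finset.Icc (-M : ℤ) M).card : ℝ) =
      S.card * (2 * M + 1) ^ 2 := by
    rw [Finset.card_product, Finset.card_product, Int.card_Icc]
    have : ((M : ℤ) + 1 - -(M : ℤ)).toNat = 2 * M + 1 := by omega
    rw [this]; push_cast; ring
  rw [← h6]
  refine le_trans (b := ((S ×ˢ Finset.Icc (-M : ℤ) M ×ˢ Finset.Icc (-M : ℤ) M).card : ℝ) * W.card) ?_ ?_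
  · rw [← Nat.cast_pow, ← Nat.cast_mul]
    exact Nat.cast_le.2 h1
  · exact mul_le_mul_of_nonneg_left h5 (Nat.cast_nonneg _)

lemma le_add_of_sq_le {V A B s : ℝ} (hs : 0 ≤ s) (hA : 0 ≤ A) (h1 : V ^ 2 ≤ A * (V + B))
    (h2 : A * B ≤ s ^ 2) : V ≤ A + s := by
  by_contra! h3
  nlinarith [mul_pos (show 0 < V - A - s by linarith) (show 0 < V by linarith),
    mul_nonneg hs (show 0 ≤ V - s by linarith)]

lemma integral_sq_mul_fs_pow_four_le (S : Finset ℤ) {Y T : ℝ} (hF : Fud Y T) (hY : 8 ≤ Y) {M : ℕ}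
    (hM1 : 1 ≤ M) (hM : (M : ℝ) ≤ Y) :
    ∫ α in (0:ℝ)..1, ‖∑ n ∈ S, e ((n : ℝ) * α)‖ ^ 2 * ‖fs M α‖ ^ 4 ≤
      45 * (M : ℝ) ^ 3 * S.card + 36 * (M : ℝ) ^ 2 * T ^ 2 * (S.card * √S.card) := by
  have hT := hF.hundred_le
  have h1 := fourth_moment_le S id M
  have h2 : ((quads S id M).card : ℝ) ≤ S.card * (2 * (M * (2 * M + 1))) + (quadsNe S id M).card := by
    have h3 := card_quads_le S id M
    have h4 : ((S ×ˢ S).filter fun p => id p.1 = id p.2).card ≤ S.card := by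
      refine Finset.card_le_card_of_injOn (fun p => p.1) ?_ ?_
      · intro p hp
        exact (Finset.mem_product.1 (Finset.mem_filter.1 hp).1).1
      · rintro ⟨x, y⟩ hp ⟨x', y'⟩ hp' heq
        have a1 : x = y := (Finset.mem_filter.1 hp).2
        have a2 : x' = y' := (Finset.mem_filter.1 hp').2
        have a3 : x = x' := heq
        rw [← a1, ← a2, a3]
    have h5 := h3.trans (Nat.add_le_add_right (Nat.mul_le_mul_right _ h4) _)
    exact_mod_cast h5
  have hM1' : (1:ℝ) ≤ M := by exact_mod_cast hM1
  have hZ : (0:ℝ) ≤ S.card := by positivity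
  have h3 : ((quadsNe S id M).card : ℝ) ≤ 9 * M ^ 2 * S.card + 12 * M * T ^ 2 * (S.card * √S.card) := by
    refine le_add_of_sq_le (B := 16 * T ^ 4 * (S.card : ℝ) ^ 2) (by positivity) (by positivity) ?_ ?_
    · refine (sq_card_quadsNe_le S hF hY hM).trans ?_
      refine mul_le_mul_of_nonneg_right ?_ (by positivity)
      have : ((2:ℝ) * M + 1) ^ 2 ≤ 9 * M ^ 2 := by nlinarith
      nlinarith
    · have := Real.sq_sqrt hZ
      refine le_of_eq ?_
      calc (9 * (M:ℝ) ^ 2 * S.card) * (16 * T ^ 4 * (S.card : ℝ) ^ 2)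
          = 144 * M ^ 2 * T ^ 4 * (S.card ^ 2 * S.card) := by ring
        _ = 144 * M ^ 2 * T ^ 4 * (S.card ^ 2 * √S.card ^ 2) := by rw [this]
        _ = _ := by ring
  refine h1.trans ?_
  calc (2 * (M:ℝ) + 1) * ((quads S id M).card : ℝ)
      ≤ (3 * M) * (S.card * (2 * (M * (3 * M))) +
        (9 * M ^ 2 * S.card + 12 * M * T ^ 2 * (S.card * √S.card))) := by
        refine mul_le_mul (by linarith) (h2.trans (add_le_add ?_ h3)) (by positivity) (by positivity)
        gcongr; linarith
    _ = _ := by ring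

lemma card_add_fourth_eq_le (S : Finset ℤ) {Y T : ℝ} (hF : Fud Y T) (hY : 8 ≤ Y) {M : ℕ}
    (hM : (M : ℝ) ≤ Y) :
    ((((S ×ˢ Finset.Icc (1:ℤ) M) ×ˢ (S ×ˢ Finset.Icc (1:ℤ) M)).filter fun p =>
      p.1.1 + p.1.2 ^ 4 = p.2.1 + p.2.2 ^ 4).card : ℝ) ≤ S.card * M + (S.card : ℝ) ^ 2 * (4 * T ^ 2) := by
  classical
  set W := ((S ×ˢ Finset.Icc (1:ℤ) M) ×ˢ (S ×ˢ Finset.Icc (1:ℤ) M)).filter fun p =>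
      p.1.1 + p.1.2 ^ 4 = p.2.1 + p.2.2 ^ 4 with hW
  have hT := hF.hundred_le
  have hT4 : 0 ≤ 4 * T ^ 2 := by positivity
  have mem : ∀ n y n' y' : ℤ, ((n, y), (n', y')) ∈ W → (n ∈ S ∧ 1 ≤ y ∧ y ≤ M) ∧
      (n' ∈ S ∧ 1 ≤ y' ∧ y' ≤ M) ∧ n + y ^ 4 = n' + y' ^ 4 := by
    intro n y n' y' hp
    simp only [hW, Finset.mem_filter, Finset.mem_product, Finset.mem_Icc] at hp
    exact ⟨hp.1.1, hp.1.2, hp.2⟩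
  have h2 := Finset.card_filter_add_card_filter_not (s := W) (fun p => p.1.1 = p.2.1)
  have h3 : (W.filter (fun p => p.1.1 = p.2.1)).card ≤ S.card * M := by
    have : S.card * M = (S ×ˢ Finset.Icc (1:ℤ) M).card := by
      rw [Finset.card_product, Int.card_Icc]; congr 1; omega
    rw [this]
    refine Finset.card_le_card_of_injOn (fun p => p.1) ?_ ?_
    · intro p hp
      exact (Finset.mem_product.1 (Finset.mem_filter.1 (Finset.mem_filter.1 hp).1).1).1
    · rintro ⟨⟨n, y⟩, ⟨n', y'⟩⟩ hp ⟨⟨m, z⟩, ⟨m', z'⟩⟩ hp' heq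
      obtain ⟨hp1, hp2⟩ := Finset.mem_filter.1 hp
      obtain ⟨hp1', hp2'⟩ := Finset.mem_filter.1 hp'
      simp only [Prod.mk.injEq] at hp2 hp2' heq
      obtain ⟨rfl, rfl⟩ := heq
      subst hp2 hp2'
      obtain ⟨a1, a2, a3⟩ := mem _ _ _ _ hp1
      obtain ⟨b1, b2, b3⟩ := mem _ _ _ _ hp1'
      have : y' ^ 4 = z' ^ 4 := by linarith
      rw [(pow_left_inj₀ (by omega) (by omega) (by norm_num)).1 this]
  have h4 : ((W.filter (fun p => ¬ p.1.1 = p.2.1)).card : ℝ) ≤ (S.card : ℝ) ^ 2 * (4 * T ^ 2) := by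
    have := card_fiber_le (W.filter (fun p => ¬ p.1.1 = p.2.1)) (S ×ˢ S)
      (fun p => (p.1.1, p.2.1)) (by
        rintro ⟨⟨n, y⟩, ⟨n', y'⟩⟩ hp
        obtain ⟨hp1, hp2⟩ := Finset.mem_filter.1 hp
        obtain ⟨a1, a2, a3⟩ := mem _ _ _ _ hp1
        exact Finset.mem_product.2 ⟨a1.1, a2.1⟩) (4 * T ^ 2) (by
        rintro ⟨i, j⟩ -
        set Q := (W.filter (fun p => ¬ p.1.1 = p.2.1)).filter
          (fun p => (p.1.1, p.2.1) = (i, j)) with hQ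
        have key : ∀ n y n' y' : ℤ, ((n, y), (n', y')) ∈ Q → n = i ∧ n' = j ∧ (1 ≤ y ∧ y ≤ M) ∧
            (1 ≤ y' ∧ y' ≤ M) ∧ j - i = (y - y') * ((y + y') * (y ^ 2 + y' ^ 2)) ∧ j - i ≠ 0 ∧
            |j - i| ≤ 4 * (M:ℤ) ^ 4 := by
          intro n y n' y' hq
          obtain ⟨hq1, hq2⟩ := Finset.mem_filter.1 hq
          obtain ⟨hp1, hp2⟩ := Finset.mem_filter.1 hq1
          obtain ⟨a1, a2, a3⟩ := mem _ _ _ _ hp1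
          simp only [Prod.mk.injEq] at hq2
          obtain ⟨rfl, rfl⟩ := hq2
          refine ⟨rfl, rfl, a1.2, a2.2, by linear_combination -a3, fun h => hp2 ?_, ?_⟩
          · dsimp only; omega
          · have k1 := pow_le_pow_left₀ (by omega) a1.2.2 4
            have k2 := pow_le_pow_left₀ (by omega) a2.2.2 4
            have l1 : 0 ≤ y ^ 4 := by positivity
            have l2 : 0 ≤ y' ^ 4 := by positivity
            rw [abs_le]; constructor <;> linarith
        rcases Q.eq_empty_or_nonempty with h0 | ⟨⟨⟨n, y⟩, ⟨n', y'⟩⟩, hq⟩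
        · rw [h0, Finset.card_empty, Nat.cast_zero]; exact hT4
        obtain ⟨-, -, -, -, -, k1, k2⟩ := key _ _ _ _ hq
        have hd := hF.card_intDivs k1 (abs_le_pow_fifty hY hM k2)
        have hle : Q.card ≤ (intDivs (j - i) ×ˢ intDivs (j - i)).card := by
          refine Finset.card_le_card_of_injOn (fun p => (p.1.2 - p.2.2, p.1.2 + p.2.2)) ?_ ?_
          · rintro ⟨⟨n, y⟩, ⟨n', y'⟩⟩ hq
            obtain ⟨-, -, -, -, h6, -⟩ := key _ _ _ _ hq
            simp only [Finset.coe_product, Set.mem_prod, Finset.mem_coe]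
            refine ⟨mem_intDivs k1 (Dvd.intro _ h6.symm), mem_intDivs k1 ?_⟩
            exact ⟨(y - y') * (y ^ 2 + y' ^ 2), by rw [h6]; ring⟩
          · rintro ⟨⟨n, y⟩, ⟨n', y'⟩⟩ hq ⟨⟨m, z⟩, ⟨m', z'⟩⟩ hq' heq
            obtain ⟨rfl, rfl, -⟩ := key _ _ _ _ hq
            obtain ⟨rfl, rfl, -⟩ := key _ _ _ _ hq'
            simp only [Prod.mk.injEq] at heq ⊢
            exact ⟨⟨trivial, by omega⟩, trivial, by omega⟩
        rw [Finset.card_product] at hle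
        calc (Q.card : ℝ) ≤ ((intDivs (j - i)).card : ℝ) * (intDivs (j - i)).card :=
              (Nat.cast_le.2 hle).trans_eq (Nat.cast_mul _ _)
          _ ≤ (2 * T) * (2 * T) := mul_self_le_mul_self (Nat.cast_nonneg _) hd
          _ = _ := by ring)
    rw [Finset.card_product] at this
    rw [Nat.cast_mul] at this
    rw [sq]; exact this
  have h3' : ((W.filter (fun p => p.1.1 = p.2.1)).card : ℝ) ≤ S.card * M := by
    rw [← Nat.cast_mul]; exact Nat.cast_le.2 h3
  have h2' : ((W.filter (fun p => p.1.1 = p.2.1)).card : ℝ) +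
    (W.filter (fun p => ¬ p.1.1 = p.2.1)).card = W.card := by
      rw [← Nat.cast_add, h2]
  linarith

lemma integral_sq_mul_fs_pow_six_le (S : Finset ℤ) {Y T : ℝ} (hF : Fud Y T) (hY : 8 ≤ Y) {M : ℕ}
    (hM1 : 1 ≤ M) (hM : (M : ℝ) ≤ Y) :
    ∫ α in (0:ℝ)..1, ‖∑ n ∈ S, e ((n : ℝ) * α)‖ ^ 2 * ‖fs M α‖ ^ 6 ≤
      18 * (M : ℝ) ^ 4 * S.card + 84 * (M : ℝ) ^ 3 * T ^ 2 * (S.card : ℝ) ^ 2 := by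
  have hT := hF.hundred_le
  have hM1' : (1:ℝ) ≤ M := by exact_mod_cast hM1
  set I := S ×ˢ Finset.Icc (1:ℤ) M with hI
  set a : ℤ × ℤ → ℤ := fun p => p.1 + p.2 ^ 4 with ha
  have h0 : ∀ α, ‖∑ n ∈ S, e ((n : ℝ) * α)‖ ^ 2 * ‖fs M α‖ ^ 6 =
      ‖∑ i ∈ I, e ((a i : ℝ) * α)‖ ^ 2 * ‖fs M α‖ ^ 4 := by
    intro α
    have : ∑ i ∈ I, e ((a i : ℝ) * α) = (∑ n ∈ S, e ((n : ℝ) * α)) * fs M α := by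
      rw [fs, Finset.sum_mul_sum, hI, Finset.sum_product]
      refine Finset.sum_congr rfl fun x _ => Finset.sum_congr rfl fun y _ => ?_
      rw [← e_add, ha]; congr 1; push_cast; ring
    rw [this, norm_mul]; ring
  simp_rw [h0]
  have hIc : (I.card : ℝ) = S.card * M := by
    have : I.card = S.card * M := by
      rw [hI, Finset.card_product, Int.card_Icc]; congr 1; omega
    rw [this]; push_cast; ring
  have h2 : ((quads I a M).card : ℝ) ≤
      (S.card * M + (S.card : ℝ) ^ 2 * (4 * T ^ 2)) * (2 * (M * (2 * M + 1))) +
      (S.card * M) ^ 2 * (4 * T ^ 2) := by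
    have h3 : ((quads I a M).card : ℝ) ≤ (((I ×ˢ I).filter fun p => a p.1 = a p.2).card : ℝ) *
      (2 * (M * (2 * M + 1))) + (quadsNe I a M).card := by exact_mod_cast card_quads_le I a M
    refine h3.trans (add_le_add (mul_le_mul_of_nonneg_right (card_add_fourth_eq_le S hF hY hM)
      (by positivity)) ?_)
    rw [← hIc]
    exact card_quadsNe_le I a hF hY hM
  refine (fourth_moment_le I a M).trans ?_
  calc (2 * (M:ℝ) + 1) * ((quads I a M).card : ℝ)
      ≤ (3 * M) * ((S.card * M + (S.card : ℝ) ^ 2 * (4 * T ^ 2)) * (2 * (M * (3 * M))) +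
      (S.card * M) ^ 2 * (4 * T ^ 2)) := by
        refine mul_le_mul (by linarith) (h2.trans ?_) (by positivity) (by positivity)
        gcongr; linarith
    _ = _ := by ring

/-- The trigonometric polynomial with frequencies in `S` and coefficients `c`. -/
def ks (S : Finset ℤ) (c : ℤ → ℂ) (α : ℝ) : ℂ := ∑ n ∈ S, c n * e ((n : ℝ) * α)

@[fun_prop] lemma continuous_ks (S : Finset ℤ) (c : ℤ → ℂ) : Continuous (ks S c) := by
  unfold ks; fun_prop

lemma integral_normSq_ks (S : Finset ℤ) (c : ℤ → ℂ) :
    ∫ α in (0:ℝ)..1, ‖ks S c α‖ ^ 2 = ∑ n ∈ S, ‖c n‖ ^ 2 := by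
  have h1 : ∀ α : ℝ, ((‖ks S c α‖ ^ 2 : ℝ) : ℂ) =
      ∑ i ∈ S, ∑ j ∈ S, (c i * (starRingEnd ℂ) (c j)) * e (((i - j : ℤ) : ℝ) * α) := by
    intro α
    rw [normSq_eq, ks, map_sum, Finset.sum_mul_sum]
    refine Finset.sum_congr rfl fun i _ => Finset.sum_congr rfl fun j _ => ?_
    rw [Int.cast_sub, sub_mul, e_sub, map_mul]; ring
  have h2 : ((∫ α in (0:ℝ)..1, ‖ks S c α‖ ^ 2 : ℝ) : ℂ) = ((∑ n ∈ S, ‖c n‖ ^ 2 : ℝ) : ℂ) := by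
    rw [← intervalIntegral.integral_ofReal]
    simp_rw [h1]
    rw [intervalIntegral.integral_finsetSum
      (fun i _ => Continuous.intervalIntegrable (by fun_prop) _ _)]
    rw [Complex.ofReal_sum]
    refine Finset.sum_congr rfl fun i hi => ?_
    rw [intervalIntegral.integral_finsetSum
      (fun i _ => Continuous.intervalIntegrable (by fun_prop) _ _)]
    simp_rw [intervalIntegral.integral_const_mul, integral_e, sub_eq_zero]
    rw [Finset.sum_eq_single i (fun j _ hj => by rw [if_neg (Ne.symm hj), mul_zero])
      (fun hi' => absurd hi hi')]
    rw [if_pos rfl, mul_one, normSq_eq]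
  exact_mod_cast h2

/-- The Fourier coefficients of `|h|⁷`. -/
def psi (P R : ℝ) (n : ℤ) : ℂ :=
  ∫ α in (0:ℝ)..1, ((‖h P R α‖ ^ 7 : ℝ) : ℂ) * e ((n : ℝ) * α)

lemma norm_sum_mul_psi_le (P R : ℝ) (S : Finset ℤ) (c : ℤ → ℂ) :
    ‖∑ n ∈ S, c n * psi P R n‖ ≤ ∫ α in (0:ℝ)..1, ‖h P R α‖ ^ 7 * ‖ks S c α‖ := by
  have h1 : ∑ n ∈ S, c n * psi P R n =
      ∫ α in (0:ℝ)..1, ((‖h P R α‖ ^ 7 : ℝ) : ℂ) * ks S c α := by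
    unfold psi ks
    simp_rw [← intervalIntegral.integral_const_mul]
    rw [← intervalIntegral.integral_finsetSum
      (fun i _ => Continuous.intervalIntegrable (by fun_prop) _ _)]
    refine intervalIntegral.integral_congr fun α _ => ?_
    rw [Finset.mul_sum]
    exact Finset.sum_congr rfl fun i _ => by ring
  rw [h1]
  refine (intervalIntegral.norm_integral_le_integral_norm zero_le_one).trans (le_of_eq ?_)
  refine intervalIntegral.integral_congr fun α _ => ?_
  rw [norm_mul, Complex.norm_real, Real.norm_of_nonneg (by positivity)]

lemma integral_mul_ks_sq_le (P R : ℝ) (S : Finset ℤ) (c : ℤ → ℂ) {s r : ℕ} (hsr : s + r = 14) :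
    (∫ α in (0:ℝ)..1, ‖h P R α‖ ^ 7 * ‖ks S c α‖) ^ 2 ≤
      U s P R * ∫ α in (0:ℝ)..1, ‖ks S c α‖ ^ 2 * ‖h P R α‖ ^ r := by
  have h1 := cauchy01_sq (f := fun α => √(‖h P R α‖ ^ s)) (g := fun α => ‖ks S c α‖ * √(‖h P R α‖ ^ r))
    (by fun_prop) (by fun_prop) (fun _ => Real.sqrt_nonneg _) (fun _ => by positivity)
  have h2 : ∀ α, √(‖h P R α‖ ^ s) * (‖ks S c α‖ * √(‖h P R α‖ ^ r)) =
      ‖h P R α‖ ^ 7 * ‖ks S c α‖ := by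
    intro α
    have : √(‖h P R α‖ ^ s) * √(‖h P R α‖ ^ r) = ‖h P R α‖ ^ 7 := by
      rw [← Real.sqrt_mul (by positivity), ← pow_add, hsr, show 14 = 7 * 2 by norm_num, pow_mul,
        Real.sqrt_sq (by positivity)]
    rw [← this]; ring
  simp_rw [h2, mul_pow] at h1
  have h3 : ∀ (α : ℝ) (k : ℕ), √(‖h P R α‖ ^ k) ^ 2 = ‖h P R α‖ ^ k :=
    fun α k => Real.sq_sqrt (by positivity)
  simp_rw [h3] at h1
  exact h1

lemma sum_norm_psi_sq_le (P R : ℝ) (S : Finset ℤ) : ∑ n ∈ S, ‖psi P R n‖ ^ 2 ≤ U 14 P R := by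
  set X := ∑ n ∈ S, ‖psi P R n‖ ^ 2 with hX
  have h0 : 0 ≤ X := Finset.sum_nonneg fun _ _ => by positivity
  have h1 := norm_sum_mul_psi_le P R S (fun n => (starRingEnd ℂ) (psi P R n))
  have h2 : ∑ n ∈ S, (starRingEnd ℂ) (psi P R n) * psi P R n = (X : ℂ) := by
    rw [hX, Complex.ofReal_sum]
    exact Finset.sum_congr rfl fun n _ => by rw [normSq_eq, mul_comm]
  rw [h2, Complex.norm_real, Real.norm_of_nonneg h0] at h1
  have h3 := integral_mul_ks_sq_le P R S (fun n => (starRingEnd ℂ) (psi P R n)) (s := 14) (r := 0) rfl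
  simp_rw [pow_zero, mul_one] at h3
  rw [integral_normSq_ks] at h3
  simp_rw [RCLike.norm_conj] at h3
  have h4 : X ^ 2 ≤ U 14 P R * X := (pow_le_pow_left₀ h0 h1 2).trans h3
  rcases h0.eq_or_lt with h5 | h5
  · rw [← h5]; exact U_nonneg _ _ _
  · rw [sq] at h4; exact le_of_mul_le_mul_right h4 h5

/-- unimodular coefficients turning `psi` into its absolute value -/
def phase (P R : ℝ) (n : ℤ) : ℂ := (starRingEnd ℂ) (psi P R n) / (‖psi P R n‖ : ℂ)

lemma norm_phase_le (P R : ℝ) (n : ℤ) : ‖phase P R n‖ ≤ 1 := by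
  rw [phase, norm_div, RCLike.norm_conj, Complex.norm_real, Real.norm_of_nonneg (norm_nonneg _)]
  exact div_self_le_one _

lemma phase_mul_psi (P R : ℝ) (n : ℤ) : phase P R n * psi P R n = (‖psi P R n‖ : ℂ) := by
  by_cases h : psi P R n = 0
  · simp [h]
  have h1 : (‖psi P R n‖ : ℂ) ≠ 0 := by simpa using h
  rw [phase, div_mul_eq_mul_div, mul_comm, ← normSq_eq]
  field_simp
  push_cast; ring

lemma mul_card_sq_le (P R : ℝ) (S : Finset ℤ) {L : ℝ} (hL0 : 0 ≤ L) (hL : ∀ n ∈ S, L ≤ ‖psi P R n‖)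
    {s r : ℕ} (hsr : s + r = 14) :
    (L * S.card) ^ 2 ≤ U s P R * ∫ α in (0:ℝ)..1, ‖ks S (phase P R) α‖ ^ 2 * ‖h P R α‖ ^ r := by
  refine le_trans (pow_le_pow_left₀ (by positivity) ?_ 2) (integral_mul_ks_sq_le P R S _ hsr)
  refine le_trans ?_ (norm_sum_mul_psi_le P R S _)
  simp_rw [phase_mul_psi]
  rw [← Complex.ofReal_sum, Complex.norm_real,
    Real.norm_of_nonneg (Finset.sum_nonneg fun _ _ => norm_nonneg _), mul_comm, ← nsmul_eq_mul]
  exact Finset.card_nsmul_le_sum _ _ _ hL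

lemma dom_h_fs (P R : ℝ) : Dom (h P R) (fs ⌊P⌋₊) := by
  have := Dom.trig_subset (smoothA_subset_Icc P R) (fun n => ((n ^ 4 : ℕ) : ℤ)) (a := fun _ => 1)
    (by simp)
  simp only [one_mul] at this
  rw [funext (h_eq P R)]
  have h1 : fs ⌊P⌋₊ = fun α => ∑ x ∈ Finset.Icc 1 ⌊P⌋₊, e ((((x ^ 4 : ℕ) : ℤ) : ℝ) * α) := by
    funext α
    unfold fs
    refine (Finset.sum_nbij (fun x : ℕ => (x : ℤ)) ?_ ?_ ?_ ?_).symm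
    · intro x hx
      simp only [Finset.mem_Icc] at hx ⊢
      omega
    · intro x _ y _ h
      exact Int.ofNat_inj.1 h
    · intro y hy
      simp only [Finset.coe_Icc, Set.mem_Icc, Set.mem_image] at hy ⊢
      exact ⟨y.toNat, by omega, by omega⟩
    · intro x _
      congr 1
  rw [h1]
  exact this

lemma dom_ks {S : Finset ℤ} {c : ℤ → ℂ} (hc : ∀ n ∈ S, ‖c n‖ ≤ 1) :
    Dom (ks S c) (fun α => ∑ n ∈ S, e ((n : ℝ) * α)) := Dom.trig_one S (fun n => n) hc

/-- The mixed moments of `h` against a trigonometric polynomial with bounded coefficients. -/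
lemma ks_moments {P T : ℝ} (hF : Fud P T) (hP : 8 ≤ P) (R : ℝ) {S : Finset ℤ} {c : ℤ → ℂ}
    (hc : ∀ n ∈ S, ‖c n‖ ≤ 1) :
    (∫ α in (0:ℝ)..1, ‖ks S c α‖ ^ 2 * ‖h P R α‖ ^ 6 ≤
      18 * P ^ 4 * S.card + 84 * P ^ 3 * T ^ 2 * (S.card : ℝ) ^ 2) ∧
    (∫ α in (0:ℝ)..1, ‖ks S c α‖ ^ 2 * ‖h P R α‖ ^ 4 ≤
      45 * P ^ 3 * S.card + 36 * P ^ 2 * T ^ 2 * (S.card * √S.card)) ∧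
    (∫ α in (0:ℝ)..1, ‖ks S c α‖ ^ 2 * ‖h P R α‖ ^ 2) ^ 2 ≤
      S.card * (∫ α in (0:ℝ)..1, ‖ks S c α‖ ^ 2 * ‖h P R α‖ ^ 4) ∧
    (∫ α in (0:ℝ)..1, ‖ks S c α‖ ^ 2 * ‖h P R α‖ ^ 3) ^ 2 ≤
      (∫ α in (0:ℝ)..1, ‖ks S c α‖ ^ 2 * ‖h P R α‖ ^ 2) *
      (∫ α in (0:ℝ)..1, ‖ks S c α‖ ^ 2 * ‖h P R α‖ ^ 4) := by
  have hM : ((⌊P⌋₊ : ℕ) : ℝ) ≤ P := Nat.floor_le (by linarith)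
  have hM1 : 1 ≤ ⌊P⌋₊ := Nat.one_le_floor_iff _ |>.2 (by linarith)
  refine ⟨?_, ?_, ?_, ?_⟩
  · refine ((dom_ks hc).sq_mul_pow (dom_h_fs P R) 3).trans
      ((integral_sq_mul_fs_pow_six_le S hF hP hM1 hM).trans ?_)
    gcongr
  · refine ((dom_ks hc).sq_mul_pow (dom_h_fs P R) 2).trans
      ((integral_sq_mul_fs_pow_four_le S hF hP hM1 hM).trans ?_)
    gcongr
  · have h1 := cauchy01_sq (f := fun α => ‖ks S c α‖) (g := fun α => ‖ks S c α‖ * ‖h P R α‖ ^ 2)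
      (by fun_prop) (by fun_prop) (fun _ => by positivity) (fun _ => by positivity)
    have e1 : ∀ α, ‖ks S c α‖ * (‖ks S c α‖ * ‖h P R α‖ ^ 2) = ‖ks S c α‖ ^ 2 * ‖h P R α‖ ^ 2 :=
      fun α => by ring
    have e2 : ∀ α, (‖ks S c α‖ * ‖h P R α‖ ^ 2) ^ 2 = ‖ks S c α‖ ^ 2 * ‖h P R α‖ ^ 4 :=
      fun α => by ring
    simp_rw [e1, e2] at h1
    refine h1.trans (mul_le_mul_of_nonneg_right ?_ (integral01_nonneg fun _ => by positivity))
    rw [integral_normSq_ks]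
    calc ∑ n ∈ S, ‖c n‖ ^ 2 ≤ ∑ n ∈ S, (1:ℝ) :=
          Finset.sum_le_sum fun n hn => pow_le_one₀ (norm_nonneg _) (hc n hn)
      _ = S.card := by simp
  · have h1 := cauchy01_sq (f := fun α => ‖ks S c α‖ * ‖h P R α‖) (g := fun α => ‖ks S c α‖ * ‖h P R α‖ ^ 2)
      (by fun_prop) (by fun_prop) (fun _ => by positivity) (fun _ => by positivity)
    have e1 : ∀ α, ‖ks S c α‖ * ‖h P R α‖ * (‖ks S c α‖ * ‖h P R α‖ ^ 2) = ‖ks S c α‖ ^ 2 * ‖h P R α‖ ^ 3 :=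
      fun α => by ring
    have e2 : ∀ α, (‖ks S c α‖ * ‖h P R α‖ ^ 2) ^ 2 = ‖ks S c α‖ ^ 2 * ‖h P R α‖ ^ 4 :=
      fun α => by ring
    have e3 : ∀ α, (‖ks S c α‖ * ‖h P R α‖) ^ 2 = ‖ks S c α‖ ^ 2 * ‖h P R α‖ ^ 2 :=
      fun α => by ring
    simp_rw [e1, e2, e3] at h1
    exact h1

lemma le_rpow_half_of_sq_le {P X a : ℝ} (hP : 0 < P) (h : X ^ 2 ≤ P ^ a) : X ≤ P ^ (a / 2) := by
  refine le_of_sq_le_sq (h.trans (le_of_eq ?_)) (by positivity)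
  rw [← Real.rpow_natCast, ← Real.rpow_mul hP.le]; congr 1; push_cast; ring

/-- The large values estimate for the Fourier coefficients of `|h|⁷`. -/
lemma card_large_psi_le {P R : ℝ} (hF : Fud P (P ^ (0.0001 : ℝ))) (hP : 8 ≤ P)
    (h8 : U 8 P R ≤ P ^ (0.0001 + 4.6186 : ℝ)) (h10 : U 10 P R ≤ P ^ (0.0001 + 6.25265 : ℝ))
    (h11 : U 11 P R ≤ P ^ (0.0001 + 7.104 : ℝ)) (h12 : U 12 P R ≤ P ^ (0.0001 + 8 : ℝ))
    {S : Finset ℤ} {t : ℝ} (hS : ∀ n ∈ S, P ^ (3 + t) ≤ ‖psi P R n‖) :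
    (S.card : ℝ) ≤ P ^ (4.1066 - 3 * t) := by
  have hP0 : 0 < P := by linarith
  have hP1 : 1 < P := by linarith
  rcases S.eq_empty_or_nonempty with h0 | hne
  · rw [h0, Finset.card_empty, Nat.cast_zero]; positivity
  have hZ1 : (1:ℝ) ≤ S.card := by exact_mod_cast hne.card_pos
  set z := Real.logb P S.card with hz
  have hZ : (S.card : ℝ) = P ^ z := (Real.rpow_logb hP0 hP1.ne' (by linarith)).symm
  have hz0 : 0 ≤ z := Real.logb_nonneg hP1 hZ1
  obtain ⟨m6, m4, m2, m3⟩ := ks_moments hF hP R (S := S) (fun n _ => norm_phase_le P R n)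
  set Y6 := ∫ α in (0:ℝ)..1, ‖ks S (phase P R) α‖ ^ 2 * ‖h P R α‖ ^ 6
  set Y4 := ∫ α in (0:ℝ)..1, ‖ks S (phase P R) α‖ ^ 2 * ‖h P R α‖ ^ 4
  set Y3 := ∫ α in (0:ℝ)..1, ‖ks S (phase P R) α‖ ^ 2 * ‖h P R α‖ ^ 3
  set Y2 := ∫ α in (0:ℝ)..1, ‖ks S (phase P R) α‖ ^ 2 * ‖h P R α‖ ^ 2
  have hY4 : 0 ≤ Y4 := integral01_nonneg fun _ => by positivity
  set T : ℝ := P ^ (0.0001 : ℝ) with hT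
  have hT100 := hF.hundred_le
  have hT3 : P ^ (0.0003 : ℝ) = T ^ 3 := by
    rw [hT, ← Real.rpow_natCast, ← Real.rpow_mul hP0.le]; norm_num
  have hsq : √(S.card : ℝ) = P ^ (z / 2) := by
    rw [hZ, Real.sqrt_eq_rpow, ← Real.rpow_mul hP0.le]; congr 1; ring
  have two : ∀ {x y w A B : ℝ}, x ≤ w → y ≤ w → 0 ≤ A → 0 ≤ B → A + B * T ^ 2 ≤ T ^ 3 →
      A * P ^ x + B * T ^ 2 * P ^ y ≤ P ^ (0.0003 + w) := by
    intro x y w A B hx hy hA hB hAB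
    rw [Real.rpow_add hP0, hT3]
    calc A * P ^ x + B * T ^ 2 * P ^ y ≤ A * P ^ w + B * T ^ 2 * P ^ w := by
          gcongr <;> linarith
      _ = (A + B * T ^ 2) * P ^ w := by ring
      _ ≤ _ := by gcongr
  have y4 : ∀ w, 3 + z ≤ w → 2 + 3 / 2 * z ≤ w → Y4 ≤ P ^ (0.0003 + w) := by
    intro w h1 h2
    refine m4.trans (le_trans (le_of_eq ?_) (two h1 h2 (A := 45) (B := 36) (by norm_num)
      (by norm_num) (by nlinarith)))
    rw [hsq, hZ, ← Real.rpow_add hP0 z, Real.rpow_add hP0 3, Real.rpow_add hP0 2,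
      show (3:ℝ) / 2 * z = z + z / 2 by ring, show ((3:ℝ)) = ((3:ℕ):ℝ) by norm_num,
      show ((2:ℝ)) = ((2:ℕ):ℝ) by norm_num, Real.rpow_natCast, Real.rpow_natCast]
    push_cast; ring
  have y6 : ∀ w, 4 + z ≤ w → 3 + 2 * z ≤ w → Y6 ≤ P ^ (0.0003 + w) := by
    intro w h1 h2
    refine m6.trans (le_trans (le_of_eq ?_) (two h1 h2 (A := 18) (B := 84) (by norm_num)
      (by norm_num) (by nlinarith)))
    have : (P ^ z) ^ 2 = P ^ (2 * z) := by
      rw [← Real.rpow_natCast, ← Real.rpow_mul hP0.le]; congr 1; push_cast; ring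
    rw [hZ, this, Real.rpow_add hP0 4, Real.rpow_add hP0 3, show ((4:ℝ)) = ((4:ℕ):ℝ) by norm_num,
      show ((3:ℝ)) = ((3:ℕ):ℝ) by norm_num, Real.rpow_natCast, Real.rpow_natCast]
    ring
  have y2 : ∀ w, Y4 ≤ P ^ w → Y2 ≤ P ^ ((z + w) / 2) := by
    intro w hw
    refine le_rpow_half_of_sq_le hP0 (m2.trans ?_)
    rw [Real.rpow_add hP0, hZ]
    gcongr
  have y3 : ∀ w, Y4 ≤ P ^ w → Y3 ≤ P ^ (((z + w) / 2 + w) / 2) := by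
    intro w hw
    refine le_rpow_half_of_sq_le hP0 (m3.trans ?_)
    rw [Real.rpow_add hP0]
    exact mul_le_mul (y2 w hw) hw hY4 (by positivity)
  have fin : ∀ {s r : ℕ} {u w : ℝ}, s + r = 14 → U s P R ≤ P ^ (0.0001 + u : ℝ) →
      (∫ α in (0:ℝ)..1, ‖ks S (phase P R) α‖ ^ 2 * ‖h P R α‖ ^ r) ≤ P ^ w →
      2 * (3 + t + z) ≤ 0.0001 + u + w := by
    intro s r u w hsr hu hw
    have h1 := mul_card_sq_le P R S (by positivity) hS hsr
    rw [hZ, ← Real.rpow_add hP0, ← Real.rpow_natCast, ← Real.rpow_mul hP0.le] at h1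
    have h2 := h1.trans (mul_le_mul hu hw (integral01_nonneg fun _ => by positivity) (by positivity))
    rw [← Real.rpow_add hP0] at h2
    have := (Real.rpow_le_rpow_left_iff hP1).1 h2
    push_cast at this
    linarith
  rw [hZ]
  refine Real.rpow_le_rpow_of_exponent_le hP1.le ?_
  rcases le_total z 2 with hz2 | hz2
  · have k4 := y4 (3 + z) le_rfl (by linarith)
    have f10 := fin rfl h10 k4
    have f11 := fin rfl h11 (y3 _ k4)
    have f12 := fin rfl h12 (y2 _ k4)
    rcases le_total z 1 with hz1 | hz1
    · have f8 := fin rfl h8 (y6 (4 + z) le_rfl (by linarith))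
      by_contra! hcon
      linarith
    · have f8 := fin rfl h8 (y6 (3 + 2 * z) (by linarith) le_rfl)
      by_contra! hcon
      linarith
  · have k4 := y4 (2 + 3 / 2 * z) (by linarith) le_rfl
    have f11 := fin rfl h11 (y3 _ k4)
    have f12 := fin rfl h12 (y2 _ k4)
    by_contra! hcon
    linarith

lemma norm_psi_le {P : ℝ} (hP : 0 ≤ P) (R : ℝ) (n : ℤ) : ‖psi P R n‖ ≤ P ^ 7 := by
  have := intervalIntegral.norm_integral_le_of_norm_le_const (a := 0) (b := 1) (C := P ^ 7)
    (f := fun α => ((‖h P R α‖ ^ 7 : ℝ) : ℂ) * e ((n : ℝ) * α)) (fun α _ => by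
      rw [norm_mul, norm_e, mul_one, Complex.norm_real, Real.norm_of_nonneg (by positivity)]
      exact pow_le_pow_left₀ (norm_nonneg _) (norm_h_le hP R α) 7)
  simpa [psi] using this

lemma sum_norm_psi_cube_le_of_moments {P R : ℝ} (hF : Fud P (P ^ (0.0001 : ℝ))) (hP : 8 ≤ P)
    (hJ : (400001 : ℝ) ≤ P ^ (0.00001 : ℝ))
    (h8 : U 8 P R ≤ P ^ (0.0001 + 4.6186 : ℝ)) (h10 : U 10 P R ≤ P ^ (0.0001 + 6.25265 : ℝ))
    (h11 : U 11 P R ≤ P ^ (0.0001 + 7.104 : ℝ)) (h12 : U 12 P R ≤ P ^ (0.0001 + 8 : ℝ))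
    (S : Finset ℤ) : ∑ n ∈ S, ‖psi P R n‖ ^ 3 ≤ P ^ (13.1067 : ℝ) := by
  have hP0 : 0 < P := by linarith
  have hP1 : 1 < P := by linarith
  set t : ℕ → ℝ := fun j => 0.1 + j * 0.00001 with ht
  set A : ℕ → Finset ℤ := fun j => S.filter fun n => P ^ (3 + t j) ≤ ‖psi P R n‖ with hA
  have point : ∀ n ∈ S, ‖psi P R n‖ ^ 3 ≤ P ^ (3.1 : ℝ) * ‖psi P R n‖ ^ 2 +
      ∑ j ∈ Finset.range 400000, if P ^ (3 + t j) ≤ ‖psi P R n‖ then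
        P ^ (3 * (3 + t j) + 0.00003) else 0 := by
    intro n _
    set x := ‖psi P R n‖ with hx
    have hx0 : 0 ≤ x := norm_nonneg _
    have hnn : ∀ j ∈ Finset.range 400000, (0:ℝ) ≤ if P ^ (3 + t j) ≤ x then
        P ^ (3 * (3 + t j) + 0.00003) else 0 := by
      intro j _; split_ifs <;> positivity
    rcases le_or_gt x (P ^ (3.1 : ℝ)) with h1 | h1
    · have h2 : x ^ 3 ≤ P ^ (3.1 : ℝ) * x ^ 2 := by
        rw [pow_succ, mul_comm]; gcongr
      linarith [Finset.sum_nonneg hnn]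
    · have hxpos : 0 < x := lt_trans (by positivity) h1
      set l := Real.logb P x with hl
      have hxl : x = P ^ l := (Real.rpow_logb hP0 hP1.ne' hxpos).symm
      have hl1 : 3.1 < l := by
        rw [hxl] at h1; exact (Real.rpow_lt_rpow_left_iff hP1).1 h1
      have hl2 : l ≤ 7 := by
        have := norm_psi_le hP0.le R n
        rw [← hx, hxl, ← Real.rpow_natCast] at this
        exact_mod_cast (Real.rpow_le_rpow_left_iff hP1).1 this
      set j := ⌊(l - 3.1) / 0.00001⌋₊ with hj
      have hj1 : (j : ℝ) ≤ (l - 3.1) / 0.00001 := Nat.floor_le (div_nonneg (by linarith) (by norm_num))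
      have hj2 : (l - 3.1) / 0.00001 < j + 1 := Nat.lt_floor_add_one _
      rw [le_div_iff₀ (by norm_num)] at hj1
      rw [div_lt_iff₀ (by norm_num)] at hj2
      have hjJ : j ∈ Finset.range 400000 := by
        rw [Finset.mem_range]
        have : (j : ℝ) < 400000 := by linarith
        exact_mod_cast this
      have h2 := Finset.single_le_sum hnn hjJ
      have h3 : P ^ (3 + t j) ≤ x := by
        rw [hxl]; refine Real.rpow_le_rpow_of_exponent_le hP1.le ?_
        rw [ht]; dsimp only; linarith
      rw [if_pos h3] at h2
      have h4 : x ^ 3 ≤ P ^ (3 * (3 + t j) + 0.00003) := by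
        rw [hxl, ← Real.rpow_natCast, ← Real.rpow_mul hP0.le]
        refine Real.rpow_le_rpow_of_exponent_le hP1.le ?_
        rw [ht]; push_cast; linarith
      have h5 : 0 ≤ P ^ (3.1 : ℝ) * x ^ 2 := by positivity
      linarith
  have h14 : U 14 P R ≤ P ^ (10.0001 : ℝ) := by
    refine (U_add_le hP0.le 12 2 R).trans ?_
    calc P ^ 2 * U 12 P R ≤ P ^ (2:ℝ) * P ^ (0.0001 + 8 : ℝ) := by
          rw [show ((2:ℝ)) = ((2:ℕ):ℝ) by norm_num, Real.rpow_natCast]; gcongr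
      _ = P ^ (10.0001 : ℝ) := by rw [← Real.rpow_add hP0]; norm_num
  have lev : ∀ j ∈ Finset.range 400000, ∑ n ∈ S, (if P ^ (3 + t j) ≤ ‖psi P R n‖ then
        P ^ (3 * (3 + t j) + 0.00003) else 0) ≤ P ^ (13.10663 : ℝ) := by
    intro j _
    rw [← Finset.sum_filter, Finset.sum_const, nsmul_eq_mul]
    have h1 := card_large_psi_le hF hP h8 h10 h11 h12 (S := A j) (t := t j)
      (fun n hn => (Finset.mem_filter.1 hn).2)
    calc ((A j).card : ℝ) * P ^ (3 * (3 + t j) + 0.00003)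
        ≤ P ^ (4.1066 - 3 * t j) * P ^ (3 * (3 + t j) + 0.00003) := by gcongr
      _ = P ^ (13.10663 : ℝ) := by rw [← Real.rpow_add hP0]; congr 1; ring
  calc ∑ n ∈ S, ‖psi P R n‖ ^ 3
      ≤ P ^ (3.1 : ℝ) * ∑ n ∈ S, ‖psi P R n‖ ^ 2 + ∑ j ∈ Finset.range 400000, ∑ n ∈ S,
        if P ^ (3 + t j) ≤ ‖psi P R n‖ then P ^ (3 * (3 + t j) + 0.00003) else 0 := by
        rw [Finset.sum_comm, Finset.mul_sum, ← Finset.sum_add_distrib]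
        exact Finset.sum_le_sum point
    _ ≤ P ^ (3.1 : ℝ) * P ^ (10.0001 : ℝ) + ∑ j ∈ Finset.range 400000, P ^ (13.10663 : ℝ) := by
        refine add_le_add ?_ (Finset.sum_le_sum lev)
        gcongr
        exact (sum_norm_psi_sq_le P R S).trans h14
    _ = P ^ (13.1001 : ℝ) + 400000 * P ^ (13.10663 : ℝ) := by
        rw [← Real.rpow_add hP0, Finset.sum_const, Finset.card_range, nsmul_eq_mul]; norm_num
    _ ≤ P ^ (13.10663 : ℝ) + 400000 * P ^ (13.10663 : ℝ) := by
        gcongr <;> linarith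
    _ = 400001 * P ^ (13.10663 : ℝ) := by ring
    _ ≤ P ^ (0.00001 : ℝ) * P ^ (13.10663 : ℝ) := by gcongr
    _ = P ^ (13.10664 : ℝ) := by rw [← Real.rpow_add hP0]; norm_num
    _ ≤ P ^ (13.1067 : ℝ) := Real.rpow_le_rpow_of_exponent_le hP1.le (by norm_num)

lemma ev_sum_norm_psi_cube_le :
    Ev fun P R => ∀ S : Finset ℤ, ∑ n ∈ S, ‖psi P R n‖ ^ 3 ≤ P ^ (13.1067 : ℝ) := by
  have hτ : (0:ℝ) < 0.0001 := by norm_num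
  obtain ⟨P₁, hP₁, hfud⟩ := eventually_fud 0.0001 hτ
  have hlim := (tendsto_rpow_atTop (show (0:ℝ) < 0.00001 by norm_num)).eventually_ge_atTop 400001
  obtain ⟨P₂, hP₂⟩ := Filter.eventually_atTop.1 hlim
  obtain ⟨τ, hτ0, P₀, hP₀, H⟩ := ((adm_eight.ev' hτ).and (adm_ten.ev' hτ)).and
    ((adm_eleven.ev' hτ).and (adm_twelve.ev' hτ))
  refine ⟨τ, hτ0, max (max P₀ 8) (max P₁ P₂), hP₀.trans (le_max_of_le_left (le_max_left _ _)), ?_⟩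
  intro P hP R hR hRP
  obtain ⟨⟨g8, g10⟩, g11, g12⟩ := H P ((le_max_left _ _).trans ((le_max_left _ _).trans hP)) R hR hRP
  have hP8 : 8 ≤ P := (le_max_right _ _).trans ((le_max_left _ _).trans hP)
  have hP0 : 0 < P := by linarith
  have hP1 : 1 ≤ P := by linarith
  refine sum_norm_psi_cube_le_of_moments
    (hfud P ((le_max_left _ _).trans ((le_max_right _ _).trans hP))) hP8
    (hP₂ P ((le_max_right _ _).trans ((le_max_right _ _).trans hP))) ?_ ?_ ?_ ?_
  · rw [Real.rpow_add hP0]; exact g8 P hP1 le_rfl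
  · rw [Real.rpow_add hP0]; exact g10 P hP1 le_rfl
  · rw [Real.rpow_add hP0]; exact g11 P hP1 le_rfl
  · rw [Real.rpow_add hP0]; exact g12 P hP1 le_rfl

lemma norm_one_sub_e_nat_mul_le (n : ℕ) (t : ℝ) : ‖1 - e (n * t)‖ ≤ n * ‖1 - e t‖ := by
  induction n with
  | zero => simp [e_zero]
  | succ n ih =>
    have h1 : 1 - e ((n + 1 : ℕ) * t) = (1 - e (n * t)) + e (n * t) * (1 - e t) := by
      have : ((n + 1 : ℕ) : ℝ) * t = n * t + t := by push_cast; ring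
      rw [this, e_add]; ring
    rw [h1]
    refine (norm_add_le _ _).trans ?_
    rw [norm_mul, norm_e, one_mul]
    push_cast
    linarith

/-- The Fejér kernel. -/
def fejer (N : ℕ) (t : ℝ) : ℝ := ‖∑ j ∈ Finset.range N, e (((j : ℤ) : ℝ) * t)‖ ^ 2 / N

@[fun_prop] lemma continuous_fejer (N : ℕ) : Continuous (fejer N) := by unfold fejer; fun_prop

lemma fejer_nonneg (N : ℕ) (t : ℝ) : 0 ≤ fejer N t := by unfold fejer; positivity

lemma integral_fejer {N : ℕ} (hN : N ≠ 0) : ∫ t in (0:ℝ)..1, fejer N t = 1 := by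
  unfold fejer
  rw [intervalIntegral.integral_div, integral_normSq_trig]
  have h1 : ((Finset.range N ×ˢ Finset.range N).filter fun p => (p.1 : ℤ) = p.2).card = N := by
    have : ((Finset.range N ×ˢ Finset.range N).filter fun p => (p.1 : ℤ) = p.2) =
        (Finset.range N).diag := by
      ext ⟨x, y⟩
      simp only [Finset.mem_filter, Finset.mem_product, Finset.mem_diag, Finset.mem_range]
      omega
    rw [this, Finset.diag_card, Finset.card_range]
  rw [h1]
  field_simp

lemma normSq_mul_fejer_le (N : ℕ) (t : ℝ) : ‖1 - e t‖ ^ 2 * fejer N t ≤ 4 / N := by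
  have h1 : ∀ n : ℕ, (1 - e t) * ∑ j ∈ Finset.range n, e (((j : ℤ) : ℝ) * t) = 1 - e (n * t) := by
    intro n
    induction n with
    | zero => simp [e_zero]
    | succ n ih =>
      have : ((n + 1 : ℕ) : ℝ) * t = n * t + t := by push_cast; ring
      rw [Finset.sum_range_succ, mul_add, ih, this, e_add, Int.cast_natCast]; ring
  unfold fejer
  rw [← mul_div_assoc, ← mul_pow, ← norm_mul, h1]
  refine div_le_div_of_nonneg_right ?_ (by positivity)
  have h2 : ‖1 - e (N * t)‖ ≤ 2 := by
    refine (norm_sub_le _ _).trans ?_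
    rw [norm_one, norm_e]; norm_num
  nlinarith [norm_nonneg (1 - e (N * t))]

/-- Approximation of a function by its Fejér means. -/
lemma abs_fejer_mean_sub_le {F : ℝ → ℝ} (hF : Continuous F) {L : ℝ} (hL : 0 ≤ L)
    (hlip : ∀ α t, |F (t + α) - F α| ≤ L * ‖1 - e t‖) {N : ℕ} (hN : N ≠ 0) {δ : ℝ} (hδ : 0 < δ) (α : ℝ) :
    |(∫ t in (0:ℝ)..1, F (t + α) * fejer N t) - F α| ≤ L * (δ + 4 / (N * δ)) := by
  have h1 : (∫ t in (0:ℝ)..1, F (t + α) * fejer N t) - F α =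
      ∫ t in (0:ℝ)..1, (F (t + α) - F α) * fejer N t := by
    have h2 : ∀ t, (F (t + α) - F α) * fejer N t = F (t + α) * fejer N t - F α * fejer N t :=
      fun t => by ring
    simp_rw [h2]
    rw [intervalIntegral.integral_sub (ii (by fun_prop) _ _) (ii (by fun_prop) _ _),
      intervalIntegral.integral_const_mul, integral_fejer hN, mul_one]
  rw [h1]
  refine (intervalIntegral.abs_integral_le_integral_abs zero_le_one).trans ?_
  refine (integral01_mono (g := fun t => L * (δ * fejer N t + 4 / (N * δ))) (by fun_prop)
    (by fun_prop) fun t => ?_).trans (le_of_eq ?_)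
  · rw [abs_mul, abs_of_nonneg (fejer_nonneg N t)]
    have h3 : ‖1 - e t‖ ≤ δ + ‖1 - e t‖ ^ 2 / δ := by
      rw [← sub_nonneg]
      have : δ + ‖1 - e t‖ ^ 2 / δ - ‖1 - e t‖ =
          ((δ - ‖1 - e t‖ / 2) ^ 2 + 3 / 4 * ‖1 - e t‖ ^ 2) / δ := by
        field_simp; ring
      rw [this]; positivity
    calc |F (t + α) - F α| * fejer N t ≤ (L * ‖1 - e t‖) * fejer N t :=
          mul_le_mul_of_nonneg_right (hlip α t) (fejer_nonneg N t)
      _ ≤ (L * (δ + ‖1 - e t‖ ^ 2 / δ)) * fejer N t := by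
          have := fejer_nonneg N t
          gcongr
      _ = L * (δ * fejer N t + (‖1 - e t‖ ^ 2 * fejer N t) / δ) := by ring
      _ ≤ L * (δ * fejer N t + (4 / N) / δ) := by
          gcongr
          exact normSq_mul_fejer_le N t
      _ = _ := by rw [div_div]
  · rw [intervalIntegral.integral_const_mul, intervalIntegral.integral_add (ii (by fun_prop) _ _)
      (ii (by fun_prop) _ _), intervalIntegral.integral_const_mul, integral_fejer hN]
    simp

lemma fejer_sub (N : ℕ) (t α : ℝ) : ((fejer N (t - α) : ℝ) : ℂ) =
    ∑ p ∈ Finset.range N ×ˢ Finset.range N,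
      (1 / (N : ℂ)) * (e (((p.1 - p.2 : ℤ) : ℝ) * t) * e (((p.2 - p.1 : ℤ) : ℝ) * α)) := by
  unfold fejer
  rw [Complex.ofReal_div, normSq_eq, map_sum, Finset.sum_mul_sum, Finset.sum_product, Finset.sum_div]
  refine Finset.sum_congr rfl fun i _ => ?_
  rw [Finset.sum_div]
  refine Finset.sum_congr rfl fun j _ => ?_
  rw [← e_sub, ← e_add, div_eq_mul_one_div, mul_comm, Complex.ofReal_natCast]
  congr 2
  push_cast; ring

/-- Fejér means are trigonometric polynomials with damped Fourier coefficients. -/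
lemma fejer_mean_eq (P R : ℝ) (N : ℕ) : ∃ c : ℤ → ℂ, (∀ n, ‖c n‖ ≤ ‖psi P R (-n)‖) ∧ ∀ α,
    ((∫ t in (0:ℝ)..1, ‖h P R (t + α)‖ ^ 7 * fejer N t : ℝ) : ℂ) =
      ks (Finset.Icc (-N : ℤ) N) c α := by
  classical
  set D := Finset.range N ×ˢ Finset.range N with hD
  set f : ℕ × ℕ → ℤ := fun p => (p.2 : ℤ) - p.1 with hf
  refine ⟨fun n => ((D.filter fun p => f p = n).card / (N : ℂ)) * psi P R (-n), ?_, ?_⟩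
  · intro n
    have h1 : (D.filter fun p => f p = n).card ≤ N := by
      conv_rhs => rw [← Finset.card_range N]
      refine Finset.card_le_card_of_injOn (fun p => p.1) ?_ ?_
      · intro p hp
        exact (Finset.mem_product.1 (Finset.mem_filter.1 hp).1).1
      · rintro ⟨x, y⟩ hp ⟨x', y'⟩ hp' heq
        have a1 := (Finset.mem_filter.1 hp).2
        have a2 := (Finset.mem_filter.1 hp').2
        simp only [hf] at a1 a2 heq
        simp only [Prod.mk.injEq]
        omega
    rw [norm_mul, norm_div, Complex.norm_natCast, Complex.norm_natCast]
    refine mul_le_of_le_one_left (norm_nonneg _) ?_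
    refine div_le_one_of_le₀ (by exact_mod_cast h1) (by positivity)
  · intro α
    have hper : ∀ t, ‖h P R (t + 1)‖ ^ 7 = ‖h P R t‖ ^ 7 := by
      intro t; rw [h_eq, h_eq, gs_add_one]
    have hfp : ∀ t, fejer N (t + 1) = fejer N t := by
      intro t; unfold fejer
      congr 3
      refine Finset.sum_congr rfl fun j _ => ?_
      rw [mul_add, mul_one, e_add_int]
    have h1 : ∫ t in (0:ℝ)..1, ‖h P R (t + α)‖ ^ 7 * fejer N t =
        ∫ t in (0:ℝ)..1, ‖h P R t‖ ^ 7 * fejer N (t - α) := by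
      rw [← integral01_shift (f := fun t => ‖h P R t‖ ^ 7 * fejer N (t - α)) (fun t => by
        rw [hper, show t + 1 - α = t - α + 1 by ring, hfp]) α]
      simp only [add_sub_cancel_right]
    rw [h1, ← intervalIntegral.integral_ofReal]
    have h2 : ∀ t, ((‖h P R t‖ ^ 7 * fejer N (t - α) : ℝ) : ℂ) = ∑ p ∈ D,
        ((1 / (N : ℂ)) * e (((f p : ℤ) : ℝ) * α)) *
          (((‖h P R t‖ ^ 7 : ℝ) : ℂ) * e (((-f p : ℤ) : ℝ) * t)) := by
      intro t
      rw [Complex.ofReal_mul, fejer_sub, Finset.mul_sum]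
      refine Finset.sum_congr rfl fun p _ => ?_
      rw [hf]; dsimp only; rw [neg_sub]; ring
    simp_rw [h2]
    rw [intervalIntegral.integral_finsetSum
      (fun i _ => Continuous.intervalIntegrable (by fun_prop) _ _)]
    simp_rw [intervalIntegral.integral_const_mul]
    have h3 : ∀ p, (∫ t in (0:ℝ)..1, ((‖h P R t‖ ^ 7 : ℝ) : ℂ) * e (((-f p : ℤ) : ℝ) * t)) =
      psi P R (-f p) := fun p => rfl
    simp_rw [h3]
    rw [← Finset.sum_fiberwise_of_maps_to (s := D) (t := Finset.Icc (-N : ℤ) N) (g := f) (fun p hp => by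
      simp only [hD, Finset.mem_product, Finset.mem_range] at hp
      simp only [hf, Finset.mem_Icc]; omega)]
    unfold ks
    refine Finset.sum_congr rfl fun n _ => ?_
    rw [Finset.sum_congr rfl (g := fun _ => 1 / (N : ℂ) * e ((n : ℝ) * α) * psi P R (-n))
      (fun p hp => by rw [(Finset.mem_filter.1 hp).2])]
    rw [Finset.sum_const, nsmul_eq_mul]
    ring

lemma exists_h_lipschitz {P : ℝ} (hP : 0 ≤ P) (R : ℝ) : ∃ L, 0 ≤ L ∧ ∀ α t,
    |‖h P R (t + α)‖ ^ 7 - ‖h P R α‖ ^ 7| ≤ L * ‖1 - e t‖ := by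
  set K : ℝ := ∑ x ∈ smoothA P R, (x : ℝ) ^ 4 with hK
  have hK0 : 0 ≤ K := Finset.sum_nonneg fun _ _ => by positivity
  have h1 : ∀ α t, ‖h P R (t + α) - h P R α‖ ≤ K * ‖1 - e t‖ := by
    intro α t
    unfold h
    rw [← Finset.sum_sub_distrib, hK, Finset.sum_mul]
    refine (norm_sum_le _ _).trans (Finset.sum_le_sum fun x _ => ?_)
    have h2 : e ((t + α) * (x:ℝ) ^ 4) - e (α * (x:ℝ) ^ 4) =
        -(e (α * (x:ℝ) ^ 4) * (1 - e (((x ^ 4 : ℕ) : ℝ) * t))) := by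
      have : (t + α) * (x:ℝ) ^ 4 = α * (x:ℝ) ^ 4 + ((x ^ 4 : ℕ) : ℝ) * t := by push_cast; ring
      rw [this, e_add]; ring
    rw [h2, norm_neg, norm_mul, norm_e, one_mul]
    refine (norm_one_sub_e_nat_mul_le _ _).trans (le_of_eq ?_)
    push_cast; ring
  refine ⟨7 * P ^ 6 * K, by positivity, fun α t => ?_⟩
  set u := ‖h P R (t + α)‖
  set v := ‖h P R α‖
  have hu0 : 0 ≤ u := norm_nonneg _
  have hv0 : 0 ≤ v := norm_nonneg _
  have hu : u ≤ P := norm_h_le hP R _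
  have hv : v ≤ P := norm_h_le hP R _
  have h3 : |u - v| ≤ K * ‖1 - e t‖ := (abs_norm_sub_norm_le _ _).trans (h1 α t)
  have h4 : u ^ 7 - v ^ 7 = (u - v) * (u ^ 6 + u ^ 5 * v + u ^ 4 * v ^ 2 + u ^ 3 * v ^ 3 +
      u ^ 2 * v ^ 4 + u * v ^ 5 + v ^ 6) := by ring
  have h5 : u ^ 6 + u ^ 5 * v + u ^ 4 * v ^ 2 + u ^ 3 * v ^ 3 +
      u ^ 2 * v ^ 4 + u * v ^ 5 + v ^ 6 ≤ P ^ 6 + P ^ 5 * P + P ^ 4 * P ^ 2 + P ^ 3 * P ^ 3 +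
      P ^ 2 * P ^ 4 + P * P ^ 5 + P ^ 6 := by gcongr
  rw [h4, abs_mul, abs_of_nonneg (a := u ^ 6 + u ^ 5 * v + u ^ 4 * v ^ 2 + u ^ 3 * v ^ 3 +
      u ^ 2 * v ^ 4 + u * v ^ 5 + v ^ 6) (by positivity)]
  calc _ ≤ (K * ‖1 - e t‖) * (P ^ 6 + P ^ 5 * P + P ^ 4 * P ^ 2 + P ^ 3 * P ^ 3 +
      P ^ 2 * P ^ 4 + P * P ^ 5 + P ^ 6) := by gcongr
    _ = _ := by ring

/-- The correlation of a trigonometric polynomial is bounded by the cubes of its coefficients. -/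
lemma norm_correlation_ks_le (S : Finset ℤ) (k : ℤ → ℂ) {a b c d : ℤ} (ha : a ≠ 0) (hb : b ≠ 0)
    (hc : c ≠ 0) (hd : d ≠ 0) :
    ‖∫ α in (0:ℝ)..1, ∫ β in (0:ℝ)..1,
      ks S k ((a : ℝ) * α) * ks S k ((b : ℝ) * β) * ks S k ((c : ℝ) * α + (d : ℝ) * β)‖ ≤
      ∑ n ∈ S, ‖k n‖ ^ 3 := by
  set T := (S ×ˢ S ×ˢ S).filter fun p => a * p.1 + c * p.2.2 = 0 ∧ b * p.2.1 + d * p.2.2 = 0 with hT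
  have h1 : ∀ α β : ℝ, ks S k ((a : ℝ) * α) * ks S k ((b : ℝ) * β) *
      ks S k ((c : ℝ) * α + (d : ℝ) * β) = ∑ p ∈ S ×ˢ S ×ˢ S,
        (k p.1 * k p.2.1 * k p.2.2 * e (((a * p.1 + c * p.2.2 : ℤ) : ℝ) * α)) *
          e (((b * p.2.1 + d * p.2.2 : ℤ) : ℝ) * β) := by
    intro α β
    simp only [Finset.sum_product]
    unfold ks
    rw [mul_assoc, Finset.sum_mul]
    refine Finset.sum_congr rfl fun x _ => ?_
    rw [Finset.sum_mul_sum, Finset.mul_sum]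
    refine Finset.sum_congr rfl fun y _ => ?_
    rw [Finset.mul_sum]
    refine Finset.sum_congr rfl fun z _ => ?_
    have h2 : e ((z : ℝ) * ((c : ℝ) * α + (d : ℝ) * β)) = e ((c * z : ℝ) * α) * e ((d * z : ℝ) * β) := by
      rw [← e_add]; congr 1; ring
    have h3 : e (((a * x + c * z : ℤ) : ℝ) * α) = e ((x : ℝ) * (a * α)) * e ((c * z : ℝ) * α) := by
      rw [← e_add]; congr 1; push_cast; ring
    have h4 : e (((b * y + d * z : ℤ) : ℝ) * β) = e ((y : ℝ) * (b * β)) * e ((d * z : ℝ) * β) := by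
      rw [← e_add]; congr 1; push_cast; ring
    rw [h2, h3, h4]; ring
  have h2 : ∫ α in (0:ℝ)..1, ∫ β in (0:ℝ)..1,
      ks S k ((a : ℝ) * α) * ks S k ((b : ℝ) * β) * ks S k ((c : ℝ) * α + (d : ℝ) * β) =
      ∑ p ∈ T, k p.1 * k p.2.1 * k p.2.2 := by
    simp_rw [h1]
    have h3 : ∀ α : ℝ, (∫ β in (0:ℝ)..1, ∑ p ∈ S ×ˢ S ×ˢ S,
        (k p.1 * k p.2.1 * k p.2.2 * e (((a * p.1 + c * p.2.2 : ℤ) : ℝ) * α)) *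
          e (((b * p.2.1 + d * p.2.2 : ℤ) : ℝ) * β)) = ∑ p ∈ S ×ˢ S ×ˢ S,
        (k p.1 * k p.2.1 * k p.2.2 * (if b * p.2.1 + d * p.2.2 = 0 then 1 else 0)) *
          e (((a * p.1 + c * p.2.2 : ℤ) : ℝ) * α) := by
      intro α
      rw [intervalIntegral.integral_finsetSum
        (fun i _ => Continuous.intervalIntegrable (by fun_prop) _ _)]
      refine Finset.sum_congr rfl fun p _ => ?_
      rw [intervalIntegral.integral_const_mul, integral_e]; ring
    simp_rw [h3]
    rw [intervalIntegral.integral_finsetSum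
      (fun i _ => Continuous.intervalIntegrable (by fun_prop) _ _), hT, Finset.sum_filter]
    refine Finset.sum_congr rfl fun p _ => ?_
    rw [intervalIntegral.integral_const_mul, integral_e]
    by_cases g1 : a * p.1 + c * p.2.2 = 0 <;> by_cases g2 : b * p.2.1 + d * p.2.2 = 0 <;>
      simp [g1, g2]
  have hmem : ∀ {x y z : ℤ}, (x, y, z) ∈ T → (x ∈ S ∧ y ∈ S ∧ z ∈ S) ∧ a * x + c * z = 0 ∧
      b * y + d * z = 0 := by
    intro x y z hp
    simp only [hT, Finset.mem_filter, Finset.mem_product] at hp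
    exact hp
  have proj : ∀ g : ℤ × ℤ × ℤ → ℤ, (∀ p ∈ T, g p ∈ S) → Set.InjOn g T →
      ∑ p ∈ T, ‖k (g p)‖ ^ 3 ≤ ∑ n ∈ S, ‖k n‖ ^ 3 := by
    intro g h3 h4
    rw [← Finset.sum_image (f := fun n => ‖k n‖ ^ 3) h4]
    exact Finset.sum_le_sum_of_subset_of_nonneg (Finset.image_subset_iff.2 h3)
      fun _ _ _ => by positivity
  have p1 := proj (fun p => p.1) (fun ⟨x, y, z⟩ hp => (hmem hp).1.1) (by
    rintro ⟨x, y, z⟩ hp ⟨x', y', z'⟩ hp' heq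
    obtain ⟨-, g1, g2⟩ := hmem hp
    obtain ⟨-, g3, g4⟩ := hmem hp'
    obtain rfl : x = x' := heq
    obtain rfl : z = z' := mul_left_cancel₀ hc (by linarith)
    obtain rfl : y = y' := mul_left_cancel₀ hb (by linarith)
    rfl)
  have p2 := proj (fun p => p.2.1) (fun ⟨x, y, z⟩ hp => (hmem hp).1.2.1) (by
    rintro ⟨x, y, z⟩ hp ⟨x', y', z'⟩ hp' heq
    obtain ⟨-, g1, g2⟩ := hmem hp
    obtain ⟨-, g3, g4⟩ := hmem hp'
    obtain rfl : y = y' := heq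
    obtain rfl : z = z' := mul_left_cancel₀ hd (by linarith)
    obtain rfl : x = x' := mul_left_cancel₀ ha (by linarith)
    rfl)
  have p3 := proj (fun p => p.2.2) (fun ⟨x, y, z⟩ hp => (hmem hp).1.2.2) (by
    rintro ⟨x, y, z⟩ hp ⟨x', y', z'⟩ hp' heq
    obtain ⟨-, g1, g2⟩ := hmem hp
    obtain ⟨-, g3, g4⟩ := hmem hp'
    obtain rfl : z = z' := heq
    obtain rfl : y = y' := mul_left_cancel₀ hb (by linarith)
    obtain rfl : x = x' := mul_left_cancel₀ ha (by linarith)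
    rfl)
  rw [h2]
  refine (norm_sum_le _ _).trans ?_
  have h5 : ∑ p ∈ T, ‖k p.1 * k p.2.1 * k p.2.2‖ ≤
      ∑ p ∈ T, (‖k p.1‖ ^ 3 / 3 + ‖k p.2.1‖ ^ 3 / 3 + ‖k p.2.2‖ ^ 3 / 3) := by
    refine Finset.sum_le_sum fun p _ => ?_
    rw [norm_mul, norm_mul]
    have h6 : ∀ x y z : ℝ, 0 ≤ x → 0 ≤ y → 0 ≤ z → x * y * z ≤ x ^ 3 / 3 + y ^ 3 / 3 + z ^ 3 / 3 := by
      intro x y z hx hy hz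
      nlinarith [mul_nonneg (add_nonneg (add_nonneg hx hy) hz)
        (add_nonneg (add_nonneg (sq_nonneg (x - y)) (sq_nonneg (y - z))) (sq_nonneg (x - z)))]
    exact h6 _ _ _ (norm_nonneg _) (norm_nonneg _) (norm_nonneg _)
  refine h5.trans ?_
  rw [Finset.sum_add_distrib, Finset.sum_add_distrib, ← Finset.sum_div, ← Finset.sum_div,
    ← Finset.sum_div]
  linarith

lemma norm_double_integral_sub_le {f g : ℝ → ℝ → ℂ} (hf : Continuous (Function.uncurry f))
    (hg : Continuous (Function.uncurry g)) {ε : ℝ} (h : ∀ α β, ‖f α β - g α β‖ ≤ ε) :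
    ‖(∫ α in (0:ℝ)..1, ∫ β in (0:ℝ)..1, f α β) - ∫ α in (0:ℝ)..1, ∫ β in (0:ℝ)..1, g α β‖ ≤ ε := by
  have cf : Continuous fun α => ∫ β in (0:ℝ)..1, f α β :=
    intervalIntegral.continuous_parametric_intervalIntegral_of_continuous' hf 0 1
  have cg : Continuous fun α => ∫ β in (0:ℝ)..1, g α β :=
    intervalIntegral.continuous_parametric_intervalIntegral_of_continuous' hg 0 1
  rw [← intervalIntegral.integral_sub (cf.intervalIntegrable _ _) (cg.intervalIntegrable _ _)]
  have h1 := intervalIntegral.norm_integral_le_of_norm_le_const (a := 0) (b := 1) (C := ε)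
    (f := fun α => (∫ β in (0:ℝ)..1, f α β) - ∫ β in (0:ℝ)..1, g α β) (fun α _ => by
      have f1 : Continuous (f α) := hf.comp (Continuous.prodMk_right α)
      have g1 : Continuous (g α) := hg.comp (Continuous.prodMk_right α)
      rw [← intervalIntegral.integral_sub (f1.intervalIntegrable _ _) (g1.intervalIntegrable _ _)]
      have := intervalIntegral.norm_integral_le_of_norm_le_const (a := 0) (b := 1) (C := ε)
        (f := fun β => f α β - g α β) (fun β _ => h α β)
      simpa using this)
  simpa using h1

lemma norm_mul_three_sub_le {x y z x' y' z' : ℂ} {M δ : ℝ} (hM : 0 ≤ M) (hδ1 : δ ≤ 1)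
    (hy : ‖y‖ ≤ M) (hz : ‖z‖ ≤ M) (hx : ‖x‖ ≤ M) (dx : ‖x' - x‖ ≤ δ) (dy : ‖y' - y‖ ≤ δ)
    (dz : ‖z' - z‖ ≤ δ) :
    ‖x * y * z - x' * y' * z'‖ ≤ 3 * (M + 1) ^ 2 * δ := by
  have hδ : 0 ≤ δ := (norm_nonneg _).trans dx
  have hx' : ‖x'‖ ≤ M + 1 := by
    calc ‖x'‖ = ‖x + (x' - x)‖ := by congr 1; ring
      _ ≤ ‖x‖ + ‖x' - x‖ := norm_add_le _ _
      _ ≤ _ := by linarith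
  have hy' : ‖y'‖ ≤ M + 1 := by
    calc ‖y'‖ = ‖y + (y' - y)‖ := by congr 1; ring
      _ ≤ ‖y‖ + ‖y' - y‖ := norm_add_le _ _
      _ ≤ _ := by linarith
  have hy1 : ‖y‖ ≤ M + 1 := by linarith
  have hz1 : ‖z‖ ≤ M + 1 := by linarith
  have h1 : x * y * z - x' * y' * z' =
      -((x' - x) * y * z + x' * (y' - y) * z + x' * y' * (z' - z)) := by ring
  rw [h1, norm_neg]
  refine (norm_add_le _ _).trans ((add_le_add (norm_add_le _ _) le_rfl).trans ?_)
  simp only [norm_mul]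
  calc ‖x' - x‖ * ‖y‖ * ‖z‖ + ‖x'‖ * ‖y' - y‖ * ‖z‖ + ‖x'‖ * ‖y'‖ * ‖z' - z‖
      ≤ δ * (M + 1) * (M + 1) + (M + 1) * δ * (M + 1) + (M + 1) * (M + 1) * δ := by gcongr
    _ = _ := by ring

lemma exists_ks_approx {P : ℝ} (hP : 0 ≤ P) (R : ℝ) {δ : ℝ} (hδ : 0 < δ) :
    ∃ (N : ℕ) (c : ℤ → ℂ), (∀ n, ‖c n‖ ≤ ‖psi P R (-n)‖) ∧
      ∀ α, ‖ks (Finset.Icc (-N : ℤ) N) c α - ((‖h P R α‖ ^ 7 : ℝ) : ℂ)‖ ≤ δ := by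
  obtain ⟨L, hL, hlip⟩ := exists_h_lipschitz hP R
  set δ' := δ / (2 * (L + 1)) with hδ'
  have hδ'0 : 0 < δ' := by positivity
  obtain ⟨N, hN⟩ := exists_nat_gt (4 / (δ' * δ'))
  have hN0 : (0:ℝ) < N := lt_of_le_of_lt (by positivity) hN
  have hN1 : N ≠ 0 := by rintro rfl; simp at hN0
  obtain ⟨c, hc, hcα⟩ := fejer_mean_eq P R N
  refine ⟨N, c, hc, fun α => ?_⟩
  rw [← hcα, ← Complex.ofReal_sub, Complex.norm_real, Real.norm_eq_abs]
  refine (abs_fejer_mean_sub_le (F := fun α => ‖h P R α‖ ^ 7) (by fun_prop) hL hlip hN1 hδ'0 α).trans ?_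
  have h1 : 4 / (N * δ') ≤ δ' := by
    rw [div_le_iff₀ (by positivity)]
    rw [div_lt_iff₀ (by positivity)] at hN
    linarith
  calc L * (δ' + 4 / (N * δ')) ≤ (L + 1) * (δ' + δ') := by gcongr; linarith
    _ = δ := by rw [hδ']; field_simp; ring

lemma Icorr_le_of_sum_cube_le {P R B : ℝ} (hP : 1 ≤ P)
    (hB : ∀ S : Finset ℤ, ∑ n ∈ S, ‖psi P R n‖ ^ 3 ≤ B) {a b c d : ℤ} (ha : a ≠ 0) (hb : b ≠ 0)
    (hc : c ≠ 0) (hd : d ≠ 0) : Icorr P R a b c d ≤ B := by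
  have hP0 : 0 ≤ P := by linarith
  have key : ∀ δ : ℝ, 0 < δ → δ ≤ 1 → Icorr P R a b c d ≤ B + 3 * (P ^ 7 + 1) ^ 2 * δ := by
    intro δ hδ hδ1
    obtain ⟨N, k, hk, hkα⟩ := exists_ks_approx hP0 R hδ
    set S := Finset.Icc (-N : ℤ) N with hS
    set F : ℝ → ℂ := fun α => ((‖h P R α‖ ^ 7 : ℝ) : ℂ) with hF
    have hFc : Continuous F := by rw [hF]; fun_prop
    have hFM : ∀ α, ‖F α‖ ≤ P ^ 7 := fun α => by
      rw [hF, Complex.norm_real, Real.norm_of_nonneg (by positivity)]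
      exact pow_le_pow_left₀ (norm_nonneg _) (norm_h_le hP0 R α) 7
    have h1 : ((Icorr P R a b c d : ℝ) : ℂ) = ∫ α in (0:ℝ)..1, ∫ β in (0:ℝ)..1,
        F ((a : ℝ) * α) * F ((b : ℝ) * β) * F ((c : ℝ) * α + (d : ℝ) * β) := by
      unfold Icorr
      rw [← intervalIntegral.integral_ofReal]
      refine intervalIntegral.integral_congr fun α _ => ?_
      rw [← intervalIntegral.integral_ofReal]
      refine intervalIntegral.integral_congr fun β _ => ?_
      simp only [hF]
      rw [norm_mul, norm_mul, mul_pow, mul_pow, Complex.ofReal_mul, Complex.ofReal_mul]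
    have h2 := norm_double_integral_sub_le (ε := 3 * (P ^ 7 + 1) ^ 2 * δ)
      (f := fun α β => F ((a : ℝ) * α) * F ((b : ℝ) * β) * F ((c : ℝ) * α + (d : ℝ) * β))
      (g := fun α β => ks S k ((a : ℝ) * α) * ks S k ((b : ℝ) * β) * ks S k ((c : ℝ) * α + (d : ℝ) * β))
      (by unfold Function.uncurry; fun_prop) (by unfold Function.uncurry; fun_prop)
      (fun α β => norm_mul_three_sub_le (by positivity) hδ1 (hFM _) (hFM _) (hFM _) (hkα _) (hkα _)
        (hkα _))
    have h3 := norm_correlation_ks_le S k ha hb hc hd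
    have h4 : ∑ n ∈ S, ‖k n‖ ^ 3 ≤ B := by
      refine le_trans (Finset.sum_le_sum fun n _ => pow_le_pow_left₀ (norm_nonneg _) (hk n) 3) ?_
      have := hB (S.image fun n => -n)
      rwa [Finset.sum_image (fun _ _ _ _ h => neg_injective h)] at this
    rw [← h1] at h2
    have h5 : ‖((Icorr P R a b c d : ℝ) : ℂ)‖ ≤ B + 3 * (P ^ 7 + 1) ^ 2 * δ :=
      (norm_le_norm_add_norm_sub _ _).trans (add_le_add (h3.trans h4) ((norm_sub_rev _ _).trans_le h2))
    rw [Complex.norm_real] at h5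
    exact (le_abs_self _).trans h5
  refine le_of_forall_pos_le_add fun ε hε => ?_
  have hK : 0 < 3 * (P ^ 7 + 1) ^ 2 := by positivity
  refine (key (min 1 (ε / (3 * (P ^ 7 + 1) ^ 2))) (by positivity) (min_le_left _ _)).trans ?_
  gcongr
  calc _ ≤ 3 * (P ^ 7 + 1) ^ 2 * (ε / (3 * (P ^ 7 + 1) ^ 2)) := by gcongr; exact min_le_right _ _
    _ = ε := by field_simp

lemma Icorr_le_pow {P : ℝ} (hP : 0 ≤ P) (R : ℝ) (a b c d : ℤ) : Icorr P R a b c d ≤ P ^ 21 := by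
  have h1 : ∀ α β : ℝ, ‖h P R ((a : ℝ) * α) * h P R ((b : ℝ) * β) *
      h P R ((c : ℝ) * α + (d : ℝ) * β)‖ ^ 7 ≤ P ^ 21 := by
    intro α β
    rw [norm_mul, norm_mul, show P ^ 21 = (P * P * P) ^ 7 by ring]
    gcongr <;> exact norm_h_le hP R _
  refine (le_abs_self _).trans ?_
  have h2 := intervalIntegral.norm_integral_le_of_norm_le_const (a := 0) (b := 1) (C := P ^ 21)
    (f := fun α => ∫ β in (0:ℝ)..1, ‖h P R ((a : ℝ) * α) * h P R ((b : ℝ) * β) *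
      h P R ((c : ℝ) * α + (d : ℝ) * β)‖ ^ 7) (fun α _ => by
      have := intervalIntegral.norm_integral_le_of_norm_le_const (a := 0) (b := 1) (C := P ^ 21)
        (f := fun β => ‖h P R ((a : ℝ) * α) * h P R ((b : ℝ) * β) *
          h P R ((c : ℝ) * α + (d : ℝ) * β)‖ ^ 7) (fun β _ => by
          rw [Real.norm_of_nonneg (by positivity)]; exact h1 α β)
      simpa using this)
  simpa [Icorr] using h2

/-- the entangled 21st moment bound `I(a,b,c,d) ≪ P^{13 + Δ₁₀/2 + ε}`,
valid for some `η > 0`, all `ε > 0`, all nonzero `a, b, c, d`, all `P ≥ 2` and `2 ≤ R ≤ P^η`. -/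
theorem cubic_moment_correlation_bound :
    ∃ η : ℝ, 0 < η ∧
      ∀ ε : ℝ, 0 < ε → ∀ a b c d : ℤ, a ≠ 0 → b ≠ 0 → c ≠ 0 → d ≠ 0 →
        ∃ C : ℝ, ∀ P R : ℝ, 2 ≤ P → 2 ≤ R → R ≤ P ^ η →
          Icorr P R a b c d ≤ C * P ^ (13 + Δ₁₀ / 2 + ε) := by
  obtain ⟨τ, hτ, P₀, hP₀, H⟩ := ev_sum_norm_psi_cube_le
  refine ⟨τ, hτ, fun ε hε a b c d ha hb hc hd => ⟨P₀ ^ 21, fun P R hP hR hRP => ?_⟩⟩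
  have hP1 : 1 ≤ P := by linarith
  have hC : 1 ≤ P₀ ^ 21 := one_le_pow₀ hP₀
  have hexp : (13.1067 : ℝ) ≤ 13 + Δ₁₀ / 2 + ε := by
    unfold Δ₁₀; linarith
  rcases le_or_gt P₀ P with h1 | h1
  · refine (Icorr_le_of_sum_cube_le hP1 (H P h1 R hR hRP) ha hb hc hd).trans ?_
    refine (Real.rpow_le_rpow_of_exponent_le hP1 hexp).trans ?_
    exact le_mul_of_one_le_left (by positivity) hC
  · refine (Icorr_le_pow (by linarith) R a b c d).trans ?_
    refine (pow_le_pow_left₀ (by linarith) h1.le 21).trans ?_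
    exact le_mul_of_one_le_right (by positivity) (Real.one_le_rpow hP1 (by linarith))
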